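/- There exist absolute constants c > 0, ν ∈ (0,1), L > 0 and, for each admissible test function f, a constant κ(f) > 0 with the following property. Let D > 3 be a prime with D ≡ 3 (mod 4), let 𝒞 be an ideal class of ℚ(√−D), let f : ℝ → ℝ be smooth, nonnegative, supported in [1−ν, 1], with f(u) ≥ 1 for u in the middle third of [1−ν,1], and let x ≥ D^L. If Hypothesis H(c) holds for L(s, χ_D), then S = Σ_p (λ_𝒞(p)/p) f(log p / log x) ≥ κ(f) · ν/h, where the sum is over rational primes p. -/

import Mathlib

open NumberField
open scoped Classical

/-- The ideal class of a nonzero integral ideal (junk value `1` for the zero ideal). -/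
noncomputable def idealClass (K : Type) [Field K] [NumberField K] (I : Ideal (𝓞 K)) :
    ClassGroup (𝓞 K) :=
  if h : I ∈ nonZeroDivisors (Ideal (𝓞 K)) then ClassGroup.mk0 ⟨I, h⟩ else 1

/-- `lambdaC K 𝒞 n` is the number of integral ideals in the class `𝒞` of norm `n`. -/
noncomputable def lambdaC (K : Type) [Field K] [NumberField K]
    (C : ClassGroup (𝓞 K)) (n : ℕ) : ℕ :=
  Nat.card {I : Ideal (𝓞 K) // Ideal.absNorm I = n ∧ I ≠ 0 ∧ idealClass K I = C}

/-- The Kronecker symbol χ_D(n) = (−D/n), as the quadratic Dirichlet character mod `D`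
(for prime `D ≡ 3 (mod 4)` this is the Legendre symbol character mod `D`). -/
noncomputable def chiD (D : ℕ) [Fact (Nat.Prime D)] : DirichletCharacter ℂ D :=
  (quadraticChar (ZMod D)).ringHomComp (Int.castRingHom ℂ)

/-- Hypothesis H(c): every zero ρ of L(s, χ_D) with |Im ρ| ≤ 1 has Re ρ ≤ 1 - c/log D. -/
def HypH (c : ℝ) (D : ℕ) [Fact (Nat.Prime D)] : Prop :=
  ∀ ρ : ℂ, (chiD D).LFunction ρ = 0 → |ρ.im| ≤ 1 → ρ.re ≤ 1 - c / Real.log D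

open ArithmeticFunction in
theorem sum_vonMangoldt_div_le_nat (N : ℕ) (hN : 1 ≤ N) :
    ∑ n ∈ Finset.Ioc 0 N, vonMangoldt n / n ≤ Real.log N + 6 := by
  have h1 := sum_Ioc_mul_zeta_eq_sum (R := ℝ) vonMangoldt N
  rw [vonMangoldt_mul_zeta] at h1
  have h2 : ∑ n ∈ Finset.Ioc 0 N, (log n : ℝ) ≤ N * Real.log N := by
    calc _ ≤ ∑ n ∈ Finset.Ioc 0 N, Real.log N := by
          refine Finset.sum_le_sum fun n hn => ?_
          rw [Finset.mem_Ioc] at hn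
          rw [log_apply]
          exact Real.log_le_log (by exact_mod_cast hn.1) (by exact_mod_cast hn.2)
      _ = _ := by simp
  have h3 := Chebyshev.psi_le_const_mul_self (x := N) (by positivity)
  rw [Chebyshev.psi, Nat.floor_natCast] at h3
  have hl4 : Real.log 4 ≤ 2 := by
    rw [show (4:ℝ) = 2 ^ 2 by norm_num, Real.log_pow]
    have := Real.log_two_lt_d9
    push_cast; linarith
  have hN0 : (0:ℝ) < N := by exact_mod_cast hN
  have h4 : ∑ n ∈ Finset.Ioc 0 N, vonMangoldt n * ((N:ℝ) / n - 1) ≤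
      ∑ n ∈ Finset.Ioc 0 N, vonMangoldt n * ((N / n : ℕ) : ℝ) := by
    refine Finset.sum_le_sum fun n hn => ?_
    rw [Finset.mem_Ioc] at hn
    refine mul_le_mul_of_nonneg_left ?_ vonMangoldt_nonneg
    have := Nat.lt_floor_add_one ((N:ℝ) / n)
    rw [Nat.floor_div_eq_div] at this
    linarith
  have h5 : ∑ n ∈ Finset.Ioc 0 N, vonMangoldt n * ((N:ℝ) / n - 1) =
      N * ∑ n ∈ Finset.Ioc 0 N, vonMangoldt n / n - ∑ n ∈ Finset.Ioc 0 N, vonMangoldt n := by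
    rw [Finset.mul_sum, ← Finset.sum_sub_distrib]
    exact Finset.sum_congr rfl fun n _ => by ring
  have h6 : (N:ℝ) * ∑ n ∈ Finset.Ioc 0 N, vonMangoldt n / n ≤ N * (Real.log N + 6) := by
    nlinarith
  exact le_of_mul_le_mul_left h6 hN0

theorem sum_vonMangoldt_div_le {X : ℝ} (hX : 1 ≤ X) :
    ∑ n ∈ Finset.Ioc 0 ⌊X⌋₊, ArithmeticFunction.vonMangoldt n / n ≤ Real.log X + 6 := by
  have h1 : 1 ≤ ⌊X⌋₊ := by simpa using hX
  refine (sum_vonMangoldt_div_le_nat _ h1).trans ?_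
  gcongr
  exact Nat.floor_le (by linarith)

theorem sum_prime_inv_le {w : ℝ} (hw : 1 < w) :
    ∑ p ∈ (Finset.Ioc ⌊w⌋₊ ⌊w ^ 2⌋₊).filter Nat.Prime, (1:ℝ) / p ≤ 20 := by
  by_cases h2 : w ^ 2 < 2
  · have : (Finset.Ioc ⌊w⌋₊ ⌊w ^ 2⌋₊).filter Nat.Prime = ∅ := by
      rw [Finset.filter_eq_empty_iff]
      intro p hp hpp
      rw [Finset.mem_Ioc] at hp
      have h3 : ⌊w ^ 2⌋₊ < 2 := by
        rw [Nat.floor_lt (by positivity)]; exact_mod_cast h2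
      have := hpp.two_le
      omega
    rw [this]; simp
  push Not at h2
  have hlw : 0.34 ≤ Real.log w := by
    have h3 : Real.log 2 ≤ Real.log (w ^ 2) := Real.log_le_log (by norm_num) h2
    rw [Real.log_pow] at h3
    have := Real.log_two_gt_d9
    push_cast at h3; linarith
  have h4 := sum_vonMangoldt_div_le (X := w ^ 2) (by nlinarith)
  have h5 : ∑ p ∈ (Finset.Ioc ⌊w⌋₊ ⌊w ^ 2⌋₊).filter Nat.Prime, Real.log w * ((1:ℝ) / p) ≤
      ∑ n ∈ Finset.Ioc 0 ⌊w ^ 2⌋₊, ArithmeticFunction.vonMangoldt n / n := by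
    calc _ ≤ ∑ p ∈ (Finset.Ioc ⌊w⌋₊ ⌊w ^ 2⌋₊).filter Nat.Prime,
          ArithmeticFunction.vonMangoldt p / p := by
          refine Finset.sum_le_sum fun p hp => ?_
          rw [Finset.mem_filter, Finset.mem_Ioc] at hp
          rw [ArithmeticFunction.vonMangoldt_apply_prime hp.2, mul_one_div]
          have : w < p := (Nat.floor_lt (by linarith)).1 hp.1.1
          gcongr
      _ ≤ _ := by
          refine Finset.sum_le_sum_of_subset_of_nonneg ?_ fun n _ _ =>
            div_nonneg ArithmeticFunction.vonMangoldt_nonneg (by positivity)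
          intro p hp
          rw [Finset.mem_filter, Finset.mem_Ioc] at hp
          rw [Finset.mem_Ioc]; omega
  rw [← Finset.mul_sum] at h5
  have h6 : Real.log (w ^ 2) = 2 * Real.log w := by rw [Real.log_pow]; norm_num
  rw [h6] at h4
  by_contra hcon
  push Not at hcon
  nlinarith

theorem sum_vonMangoldt_exp_le {l : ℝ} (hl : 1 ≤ l) (N : ℕ) :
    ∑ n ∈ Finset.Ioc 0 N, ArithmeticFunction.vonMangoldt n / n * Real.exp (-(Real.log n / l)) ≤
      60 * l := by
  have hpt : ∀ n ∈ Finset.Ioc 0 N, ArithmeticFunction.vonMangoldt n / n *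
      Real.exp (-(Real.log n / l)) ≤ ∑ j ∈ Finset.range (N + 1),
        (if n ∈ Finset.Ioc 0 ⌊Real.exp ((j + 1) * l)⌋₊ then
          ArithmeticFunction.vonMangoldt n / n * Real.exp (-(j:ℝ)) else 0) := by
    intro n hn
    rw [Finset.mem_Ioc] at hn
    have hn0 : (0:ℝ) < n := by exact_mod_cast hn.1
    have hn1 : (1:ℝ) ≤ n := by exact_mod_cast hn.1
    have hL : 0 ≤ ArithmeticFunction.vonMangoldt n / n :=
      div_nonneg ArithmeticFunction.vonMangoldt_nonneg (by positivity)
    have hlog : 0 ≤ Real.log n := Real.log_nonneg hn1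
    set j := ⌊Real.log n / l⌋₊ with hj
    have hj1 : (j:ℝ) ≤ Real.log n / l := Nat.floor_le (by positivity)
    have hj2 : Real.log n / l < j + 1 := Nat.lt_floor_add_one _
    have hjN : j ∈ Finset.range (N + 1) := by
      rw [Finset.mem_range]
      have h1 : Real.log n / l ≤ N := by
        have h2 : Real.log n ≤ n := (Real.log_le_sub_one_of_pos hn0).trans (by linarith)
        have h3 : (n:ℝ) ≤ N := by exact_mod_cast hn.2
        calc _ ≤ Real.log n := div_le_self hlog hl
          _ ≤ _ := by linarith
      have : (j:ℝ) < N + 1 := by linarith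
      exact_mod_cast this
    have hmem : n ∈ Finset.Ioc 0 ⌊Real.exp ((j + 1) * l)⌋₊ := by
      rw [Finset.mem_Ioc]
      refine ⟨hn.1, Nat.le_floor ?_⟩
      rw [div_lt_iff₀ (by linarith)] at hj2
      rw [← Real.log_le_iff_le_exp hn0]; exact hj2.le
    calc _ ≤ ArithmeticFunction.vonMangoldt n / n * Real.exp (-(j:ℝ)) := by
          refine mul_le_mul_of_nonneg_left (Real.exp_le_exp.2 (by linarith)) hL
      _ = (if n ∈ Finset.Ioc 0 ⌊Real.exp ((j + 1) * l)⌋₊ then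
          ArithmeticFunction.vonMangoldt n / n * Real.exp (-(j:ℝ)) else 0) := by rw [if_pos hmem]
      _ ≤ _ := Finset.single_le_sum (f := fun j : ℕ =>
        (if n ∈ Finset.Ioc 0 ⌊Real.exp ((j + 1) * l)⌋₊ then
          ArithmeticFunction.vonMangoldt n / n * Real.exp (-(j:ℝ)) else 0))
          (fun i _ => by split_ifs <;> positivity) hjN
  refine (Finset.sum_le_sum hpt).trans ?_
  rw [Finset.sum_comm]
  have hj : ∀ j ∈ Finset.range (N + 1), (∑ n ∈ Finset.Ioc 0 N,
      (if n ∈ Finset.Ioc 0 ⌊Real.exp ((j + 1) * l)⌋₊ then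
          ArithmeticFunction.vonMangoldt n / n * Real.exp (-(j:ℝ)) else 0)) ≤
      14 * l * (Real.exp (-(1/2))) ^ j := by
    intro j _
    have hj0 : (0:ℝ) ≤ j := by positivity
    rw [← Finset.sum_filter]
    have h1 : ∑ n ∈ (Finset.Ioc 0 N).filter (fun n => n ∈ Finset.Ioc 0 ⌊Real.exp ((j + 1) * l)⌋₊),
        ArithmeticFunction.vonMangoldt n / n * Real.exp (-(j:ℝ)) ≤
        ∑ n ∈ Finset.Ioc 0 ⌊Real.exp ((j + 1) * l)⌋₊,
        ArithmeticFunction.vonMangoldt n / n * Real.exp (-(j:ℝ)) :=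
      Finset.sum_le_sum_of_subset_of_nonneg (fun n hn => (Finset.mem_filter.1 hn).2)
        fun n _ _ => mul_nonneg (div_nonneg ArithmeticFunction.vonMangoldt_nonneg (by positivity))
          (Real.exp_pos _).le
    refine h1.trans ?_
    rw [← Finset.sum_mul]
    have h2 := sum_vonMangoldt_div_le (X := Real.exp ((j + 1) * l))
      (Real.one_le_exp (by positivity))
    rw [Real.log_exp] at h2
    have h3 : ((j:ℝ) + 1) * l + 6 ≤ 14 * l * Real.exp (j / 2) := by
      have := Real.add_one_le_exp ((j:ℝ) / 2)
      have h4 : ((j:ℝ) + 1) * l + 6 ≤ 14 * l * (j / 2 + 1) := by nlinarith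
      refine h4.trans (by gcongr)
    calc _ ≤ 14 * l * Real.exp (j / 2) * Real.exp (-(j:ℝ)) := by
          gcongr; exact h2.trans h3
      _ = _ := by
          rw [← Real.exp_nat_mul, mul_assoc, ← Real.exp_add]
          congr 2; ring
  refine (Finset.sum_le_sum hj).trans ?_
  rw [← Finset.mul_sum]
  have hr : Real.exp (-(1/2)) ≤ 3 / 4 := by
    rw [Real.exp_neg, inv_le_comm₀ (Real.exp_pos _) (by norm_num)]
    have := Real.add_one_le_exp (1/2 : ℝ)
    have h2 := Real.quadratic_le_exp_of_nonneg (x := 1/2) (by norm_num)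
    norm_num at h2 ⊢; linarith
  have hg : ∑ i ∈ Finset.range (N + 1), Real.exp (-(1/2)) ^ i ≤ 4 := by
    have h1 : ∑ i ∈ Finset.range (N + 1), Real.exp (-(1/2)) ^ i ≤
        ∑ i ∈ Finset.range (N + 1), (3/4 : ℝ) ^ i := by gcongr
    refine h1.trans ?_
    rw [geom_sum_eq (by norm_num)]
    have : 0 ≤ (3/4 : ℝ) ^ (N + 1) := by positivity
    rw [div_le_iff_of_neg (by norm_num)]; linarith
  nlinarith

/-- A system of prime ideals `P` with norms and classes in a finite abelian group `G`, such that
the free commutative monoid on `P` has the counting function of the ideals of a number field. -/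
structure Sys (P G : Type) [AddCommGroup G] [Fintype G] where
  N : P → ℕ
  cl : P → G
  below : P → ℕ
  prime_below : ∀ p, (below p).Prime
  N_eq : ∀ p, N p = below p ∨ N p = below p ^ 2
  fib : ∀ (l : ℕ) (s : Finset P), (∀ p ∈ s, below p = l) → s.card ≤ 2
  c : ℝ
  Q : ℝ
  two_le_Q : 2 ≤ Q
  inv_le_c : Q⁻¹ ≤ c
  count : ∀ (g : G) (X : ℝ), 0 ≤ X →
    |(Nat.card {a : Multiset P // (((a.map N).prod : ℕ) : ℝ) ≤ X ∧ (a.map cl).sum = g} : ℝ) - c * X|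
      ≤ Q * √X

namespace Sys

open scoped Classical

variable {P G : Type} [AddCommGroup G] [Fintype G] (S : Sys P G)

theorem two_le_N (p : P) : 2 ≤ S.N p := by
  have := (S.prime_below p).two_le
  rcases S.N_eq p with h | h <;> rw [h]
  · exact this
  · nlinarith

theorem below_le_N (p : P) : S.below p ≤ S.N p := by
  have := (S.prime_below p).two_le
  rcases S.N_eq p with h | h <;> rw [h]
  nlinarith

theorem N_pos (p : P) : (0:ℝ) < S.N p := by
  have := S.two_le_N p
  exact_mod_cast (by omega : 0 < S.N p)

theorem c_pos : 0 < S.c :=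
  lt_of_lt_of_le (inv_pos.2 (by linarith [S.two_le_Q])) S.inv_le_c

/-- norm of an ideal -/
def norm (a : Multiset P) : ℕ := (a.map S.N).prod

/-- class of an ideal -/
def cls (a : Multiset P) : G := (a.map S.cl).sum

@[simp] theorem norm_zero : S.norm 0 = 1 := by simp [norm]
@[simp] theorem cls_zero : S.cls 0 = 0 := by simp [cls]
theorem norm_add (a b : Multiset P) : S.norm (a + b) = S.norm a * S.norm b := by simp [norm]
theorem cls_add (a b : Multiset P) : S.cls (a + b) = S.cls a + S.cls b := by simp [cls]
theorem norm_cons (p : P) (a : Multiset P) : S.norm (p ::ₘ a) = S.N p * S.norm a := by simp [norm]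

theorem two_pow_card_le (a : Multiset P) : 2 ^ a.card ≤ S.norm a := by
  induction a using Multiset.induction with
  | empty => simp
  | cons p a ih =>
    rw [Multiset.card_cons, pow_succ, norm_cons, mul_comm]
    exact Nat.mul_le_mul (S.two_le_N p) ih

theorem norm_pos (a : Multiset P) : 0 < S.norm a := lt_of_lt_of_le (by positivity) (S.two_pow_card_le a)

theorem norm_pos' (a : Multiset P) : (0:ℝ) < S.norm a := by exact_mod_cast S.norm_pos a

theorem norm_le_of_le {a b : Multiset P} (h : a ≤ b) : S.norm a ≤ S.norm b := by
  obtain ⟨d, rfl⟩ := Multiset.le_iff_exists_add.1 h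
  rw [norm_add]
  exact Nat.le_mul_of_pos_right _ (S.norm_pos d)

theorem N_le_norm {a : Multiset P} {p : P} (h : p ∈ a) : S.N p ≤ S.norm a := by
  have := S.norm_le_of_le (Multiset.singleton_le.2 h)
  simpa [norm] using this

theorem norm_eq_one {a : Multiset P} : S.norm a = 1 ↔ a = 0 := by
  constructor
  · intro h
    by_contra hne
    obtain ⟨p, hp⟩ := Multiset.exists_mem_of_ne_zero hne
    have := S.N_le_norm hp
    have := S.two_le_N p
    omega
  · rintro rfl; simp

theorem finite_primes (n : ℕ) : {p : P | S.N p ≤ n}.Finite := by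
  have h : {p : P | S.N p ≤ n} ⊆ ⋃ l ∈ Finset.Iic n, {p : P | S.below p = l} := by
    intro p hp
    simp only [Set.mem_iUnion]
    exact ⟨S.below p, by simpa using (S.below_le_N p).trans hp, rfl⟩
  refine Set.Finite.subset (Set.Finite.biUnion (Finset.finite_toSet _) fun l _ => ?_) h
  by_contra hinf
  obtain ⟨t, ht, htc⟩ := Set.Infinite.exists_subset_card_eq hinf 3
  have := S.fib l t (fun p hp => ht hp)
  omega

/-- primes of norm at most `n` -/
noncomputable def primes (n : ℕ) : Finset P := (S.finite_primes n).toFinset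

theorem mem_primes {n : ℕ} {p : P} : p ∈ S.primes n ↔ S.N p ≤ n := by simp [primes]

theorem finite_upto (n : ℕ) : {a : Multiset P | S.norm a ≤ n}.Finite := by
  refine Set.Finite.subset (Finset.finite_toSet (n • (S.primes n).val).powerset.toFinset) ?_
  intro a ha
  simp only [Finset.mem_coe, Multiset.mem_toFinset, Multiset.mem_powerset]
  rw [Multiset.le_iff_count]
  intro p
  by_cases hp : p ∈ a
  · have h1 : p ∈ S.primes n := S.mem_primes.2 ((S.N_le_norm hp).trans ha)
    rw [Multiset.count_nsmul, Multiset.count_eq_one_of_mem (S.primes n).nodup h1, mul_one]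
    have h2 := S.two_pow_card_le a
    have h3 := Nat.lt_two_pow_self (n := a.card)
    have h4 := Multiset.count_le_card p a
    have h5 : S.norm a ≤ n := ha
    omega
  · rw [Multiset.count_eq_zero_of_notMem hp]; positivity

/-- ideals of norm at most `n` -/
noncomputable def upto (n : ℕ) : Finset (Multiset P) := (S.finite_upto n).toFinset

theorem mem_upto {n : ℕ} {a : Multiset P} : a ∈ S.upto n ↔ S.norm a ≤ n := by simp [upto]

/-- ideals of norm at most `X` in the class `g` -/
noncomputable def ball (g : G) (X : ℝ) : Finset (Multiset P) :=
  (S.upto ⌊X⌋₊).filter fun a => S.cls a = g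

theorem mem_ball {g : G} {X : ℝ} (hX : 0 ≤ X) {a : Multiset P} :
    a ∈ S.ball g X ↔ (S.norm a : ℝ) ≤ X ∧ S.cls a = g := by
  rw [ball, Finset.mem_filter, mem_upto, Nat.le_floor_iff hX]

theorem card_ball (g : G) {X : ℝ} (hX : 0 ≤ X) : |((S.ball g X).card : ℝ) - S.c * X| ≤ S.Q * √X := by
  have h := S.count g X hX
  have h2 : Nat.card {a : Multiset P // (((a.map S.N).prod : ℕ) : ℝ) ≤ X ∧ (a.map S.cl).sum = g} =
      (S.ball g X).card := by
    rw [← Fintype.card_coe, ← Nat.card_eq_fintype_card]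
    exact Nat.card_congr (Equiv.subtypeEquivRight fun a => (by rw [S.mem_ball hX]; rfl))
  rwa [h2] at h

theorem sum_below_le (T : Finset P) (U : Finset ℕ) (hU : ∀ p ∈ T, S.below p ∈ U) (f : ℕ → ℝ)
    (hf : ∀ n, 0 ≤ f n) : ∑ p ∈ T, f (S.below p) ≤ 2 * ∑ l ∈ U, f l := by
  rw [← Finset.sum_fiberwise_of_maps_to hU, Finset.mul_sum]
  refine Finset.sum_le_sum fun l _ => ?_
  rw [Finset.sum_congr rfl (g := fun _ => f l) (fun p hp => by rw [(Finset.mem_filter.1 hp).2]),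
    Finset.sum_const, nsmul_eq_mul]
  refine mul_le_mul_of_nonneg_right ?_ (hf l)
  exact_mod_cast S.fib l _ fun p hp => (Finset.mem_filter.1 hp).2

theorem sum_inv_le (T : Finset P) {w : ℝ} (hw : 1 < w)
    (hT : ∀ p ∈ T, w < S.N p ∧ (S.N p : ℝ) ≤ w ^ 2) : ∑ p ∈ T, (1:ℝ) / S.N p ≤ 80 := by
  set T1 := T.filter fun p => S.N p = S.below p
  set T2 := T.filter fun p => ¬ S.N p = S.below p
  have hsq : 1 < √w := Real.lt_sqrt (by norm_num) |>.2 (by simpa using hw)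
  have h1 : ∑ p ∈ T1, (1:ℝ) / S.N p ≤ 40 := by
    have := S.sum_below_le T1 ((Finset.Ioc ⌊w⌋₊ ⌊w ^ 2⌋₊).filter Nat.Prime) (fun p hp => by
      obtain ⟨hp1, hp2⟩ := Finset.mem_filter.1 hp
      have := hT p hp1
      rw [hp2] at this
      rw [Finset.mem_filter, Finset.mem_Ioc, Nat.floor_lt (by linarith), Nat.le_floor_iff (by positivity)]
      exact ⟨this, S.prime_below p⟩) (fun n => (1:ℝ) / n) (fun n => by positivity)
    have h2 := sum_prime_inv_le hw
    calc _ = ∑ p ∈ T1, (1:ℝ) / S.below p :=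
          Finset.sum_congr rfl fun p hp => by rw [(Finset.mem_filter.1 hp).2]
      _ ≤ _ := by linarith
  have h2 : ∑ p ∈ T2, (1:ℝ) / S.N p ≤ 40 := by
    have := S.sum_below_le T2 ((Finset.Ioc ⌊√w⌋₊ ⌊√w ^ 2⌋₊).filter Nat.Prime) (fun p hp => by
      obtain ⟨hp1, hp2⟩ := Finset.mem_filter.1 hp
      have hN : S.N p = S.below p ^ 2 := (S.N_eq p).resolve_left hp2
      have := hT p hp1
      rw [hN] at this
      push_cast at this
      rw [Finset.mem_filter, Finset.mem_Ioc, Nat.floor_lt (by positivity),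
        Nat.le_floor_iff (by positivity), Real.sq_sqrt (by linarith)]
      refine ⟨⟨?_, ?_⟩, S.prime_below p⟩
      · rw [Real.sqrt_lt' (by exact_mod_cast (S.prime_below p).pos)]; exact this.1
      · exact le_of_sq_le_sq this.2 (by linarith)) (fun n => (1:ℝ) / n) (fun n => by positivity)
    have h2 := sum_prime_inv_le hsq
    calc _ ≤ ∑ p ∈ T2, (1:ℝ) / S.below p :=
          Finset.sum_le_sum fun p hp => by
            have : (S.below p : ℝ) ≤ S.N p := by exact_mod_cast S.below_le_N p
            have : (0:ℝ) < S.below p := by exact_mod_cast (S.prime_below p).pos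
            gcongr
      _ ≤ _ := by linarith
  rw [← Finset.sum_filter_add_sum_filter_not T (fun p => S.N p = S.below p)]
  linarith

end Sys

section Bonferroni

open scoped Classical

variable {P : Type}

/-- elementary symmetric function -/
noncomputable def esym (T : Finset P) (x : P → ℝ) (k : ℕ) : ℝ :=
  ∑ d ∈ T.powersetCard k, ∏ p ∈ d, x p

/-- truncated inclusion-exclusion sum -/
noncomputable def bonf (T : Finset P) (x : P → ℝ) (m : ℕ) : ℝ :=
  ∑ i ∈ Finset.range (m + 1), (-1) ^ i * esym T x i

theorem esym_zero (T : Finset P) (x : P → ℝ) : esym T x 0 = 1 := by simp [esym]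

theorem esym_insert {T : Finset P} {p : P} (hp : p ∉ T) (x : P → ℝ) (k : ℕ) :
    esym (insert p T) x (k + 1) = esym T x (k + 1) + x p * esym T x k := by
  unfold esym
  rw [Finset.powersetCard_succ_insert hp, Finset.sum_union, Finset.sum_image, Finset.mul_sum]
  · congr 1
    refine Finset.sum_congr rfl fun d hd => ?_
    rw [Finset.prod_insert]
    exact fun h => hp ((Finset.mem_powersetCard.1 hd).1 h)
  · intro d hd e he hde
    have h1 : p ∉ d := fun h => hp ((Finset.mem_powersetCard.1 hd).1 h)
    have h2 : p ∉ e := fun h => hp ((Finset.mem_powersetCard.1 he).1 h)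
    rw [← Finset.erase_insert h1, ← Finset.erase_insert h2, hde]
  · rw [Finset.disjoint_left]
    intro d hd hd'
    obtain ⟨e, _, rfl⟩ := Finset.mem_image.1 hd'
    exact hp ((Finset.mem_powersetCard.1 hd).1 (Finset.mem_insert_self _ _))

theorem bonf_zero (T : Finset P) (x : P → ℝ) : bonf T x 0 = 1 := by simp [bonf, esym_zero]

theorem bonf_succ (T : Finset P) (x : P → ℝ) (m : ℕ) :
    bonf T x (m + 1) = bonf T x m + (-1) ^ (m + 1) * esym T x (m + 1) := by
  rw [bonf, Finset.sum_range_succ, ← bonf]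

theorem bonf_insert {T : Finset P} {p : P} (hp : p ∉ T) (x : P → ℝ) (m : ℕ) :
    bonf (insert p T) x (m + 1) = bonf T x (m + 1) - x p * bonf T x m := by
  induction m with
  | zero => simp [bonf_succ, bonf_zero, esym_insert hp, esym_zero]; ring
  | succ m ih =>
    rw [bonf_succ, ih, esym_insert hp, bonf_succ T x (m + 1), bonf_succ T x m]
    ring

theorem bonf_sign (T : Finset P) (x : P → ℝ) (h0 : ∀ p, 0 ≤ x p) (h1 : ∀ p, x p ≤ 1) (m : ℕ) :
    0 ≤ (-1) ^ m * (bonf T x m - ∏ p ∈ T, (1 - x p)) := by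
  induction T using Finset.induction generalizing m with
  | empty =>
    have : bonf (∅ : Finset P) x m = 1 := by
      induction m with
      | zero => exact bonf_zero _ _
      | succ m ih => rw [bonf_succ, ih, esym, Finset.powersetCard_eq_empty.2 (by simp)]; simp
    simp [this]
  | insert p T hp ih =>
    rw [Finset.prod_insert hp]
    cases m with
    | zero =>
      have h2 : ∏ p ∈ T, (1 - x p) ≤ 1 :=
        Finset.prod_le_one (fun p _ => by linarith [h1 p]) fun p _ => by linarith [h0 p]
      have h3 : 0 ≤ ∏ p ∈ T, (1 - x p) := Finset.prod_nonneg fun p _ => by linarith [h1 p]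
      rw [bonf_zero]
      nlinarith [h0 p, h1 p]
    | succ m =>
      rw [bonf_insert hp]
      have h2 := ih (m + 1)
      have h3 := mul_nonneg (h0 p) (ih m)
      calc (0:ℝ) ≤ _ := add_nonneg h2 h3
        _ = _ := by ring

theorem bonf_even (T : Finset P) (x : P → ℝ) (h0 : ∀ p, 0 ≤ x p) (h1 : ∀ p, x p ≤ 1) (b : ℕ) :
    0 ≤ bonf T x (2 * b) - ∏ p ∈ T, (1 - x p) ∧
    bonf T x (2 * b) - ∏ p ∈ T, (1 - x p) ≤ esym T x (2 * b + 1) := by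
  have h2 := bonf_sign T x h0 h1 (2 * b)
  have h3 := bonf_sign T x h0 h1 (2 * b + 1)
  have hs : (-1 : ℝ) ^ (2 * b) = 1 := by simp
  rw [bonf_succ, pow_succ, hs] at h3
  rw [hs] at h2
  constructor <;> linarith

theorem esym_le (T : Finset P) (x : P → ℝ) (h0 : ∀ p, 0 ≤ x p) {t : ℝ} (ht : 0 < t) (k : ℕ) :
    t ^ k * esym T x k ≤ Real.exp (t * ∑ p ∈ T, x p) := by
  have h1 : ∏ p ∈ T, (1 + t * x p) ≤ Real.exp (t * ∑ p ∈ T, x p) := by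
    rw [Finset.mul_sum, Real.exp_sum]
    refine Finset.prod_le_prod (fun p _ => ?_) fun p _ => ?_
    · have := mul_nonneg ht.le (h0 p); linarith
    · rw [add_comm]; exact Real.add_one_le_exp _
  refine le_trans ?_ h1
  rw [Finset.prod_one_add, esym, Finset.mul_sum]
  calc _ = ∑ d ∈ T.powersetCard k, ∏ p ∈ d, t * x p := by
        refine Finset.sum_congr rfl fun d hd => ?_
        rw [Finset.prod_mul_distrib, Finset.prod_const, (Finset.mem_powersetCard.1 hd).2]
    _ ≤ _ := Finset.sum_le_sum_of_subset_of_nonneg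
        (fun d hd => Finset.mem_powerset.2 (Finset.mem_powersetCard.1 hd).1)
        fun d _ _ => Finset.prod_nonneg fun p _ => mul_nonneg ht.le (h0 p)

theorem sum_choose_le (n m : ℕ) : ∑ i ∈ Finset.range (m + 1), n.choose i ≤ (n + 1) ^ m := by
  induction m with
  | zero => simp
  | succ m ih =>
    rw [Finset.sum_range_succ]
    have h1 : n.choose (m + 1) ≤ n ^ (m + 1) := Nat.choose_le_pow _ _
    have h2 : n ^ m ≤ (n + 1) ^ m := Nat.pow_le_pow_left (by omega) _
    calc _ ≤ (n + 1) ^ m + n ^ (m + 1) := add_le_add ih h1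
      _ ≤ _ := by rw [pow_succ, pow_succ]; nlinarith

end Bonferroni

namespace Sys

open scoped Classical

variable {P G : Type} [AddCommGroup G] [Fintype G] (S : Sys P G)

/-- `θ` is a finite combination of indicators of divisibility by squarefree products of primes of
`T`, with mean `M` and total weight at most `W`. -/
def Rep (T : Finset P) (θ : Multiset P → ℝ) (M W : ℝ) : Prop :=
  ∃ (ι : Type) (_ : Fintype ι) (lam : ι → ℝ) (d : ι → Finset P), (∀ i, d i ⊆ T) ∧
    (∀ a, θ a = ∑ i, lam i * (if (d i).val ≤ a then 1 else 0)) ∧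
    M = ∑ i, lam i / S.norm (d i).val ∧ ∑ i, |lam i| ≤ W

variable {S}

theorem Rep.one (T : Finset P) : S.Rep T (fun _ => 1) 1 1 :=
  ⟨Unit, inferInstance, fun _ => 1, fun _ => ∅, by simp, by simp, by simp, by simp⟩

theorem Rep.W_nonneg {T θ M W} (h : S.Rep T θ M W) : 0 ≤ W := by
  obtain ⟨ι, _, lam, d, _, _, _, h⟩ := h
  exact (Finset.sum_nonneg fun i _ => abs_nonneg _).trans h

theorem Rep.mono {T T' θ M W W'} (h : S.Rep T θ M W) (hT : T ⊆ T') (hW : W ≤ W') :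
    S.Rep T' θ M W' := by
  obtain ⟨ι, hι, lam, d, h1, h2, h3, h4⟩ := h
  exact ⟨ι, hι, lam, d, fun i => (h1 i).trans hT, h2, h3, h4.trans hW⟩

theorem Rep.smul {T θ M W} (h : S.Rep T θ M W) (r : ℝ) :
    S.Rep T (fun a => r * θ a) (r * M) (|r| * W) := by
  obtain ⟨ι, hι, lam, d, h1, h2, h3, h4⟩ := h
  refine ⟨ι, hι, fun i => r * lam i, d, h1, fun a => ?_, ?_, ?_⟩
  · dsimp only; rw [h2, Finset.mul_sum]; simp only [mul_assoc]
  · rw [h3, Finset.mul_sum]; simp only [mul_div_assoc]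
  · simp only [abs_mul]; rw [← Finset.mul_sum]; gcongr

theorem Rep.add {T θ M W θ' M' W'} (h : S.Rep T θ M W) (h' : S.Rep T θ' M' W') :
    S.Rep T (fun a => θ a + θ' a) (M + M') (W + W') := by
  obtain ⟨ι, hι, lam, d, h1, h2, h3, h4⟩ := h
  obtain ⟨ι', _, lam', d', h1', h2', h3', h4'⟩ := h'
  refine ⟨ι ⊕ ι', inferInstance, Sum.elim lam lam', Sum.elim d d', ?_, fun a => ?_, ?_, ?_⟩
  · rintro (i | i); exacts [h1 i, h1' i]
  · dsimp only; rw [h2, h2', Fintype.sum_sum_type]; rfl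
  · rw [h3, h3', Fintype.sum_sum_type]; rfl
  · rw [Fintype.sum_sum_type]; simp only [Sum.elim_inl, Sum.elim_inr]; exact add_le_add h4 h4'

theorem Rep.mul {T T' θ M W θ' M' W'} (h : S.Rep T θ M W) (h' : S.Rep T' θ' M' W')
    (hd : Disjoint T T') : S.Rep (T ∪ T') (fun a => θ a * θ' a) (M * M') (W * W') := by
  have hW := h.W_nonneg
  obtain ⟨ι, hι, lam, d, h1, h2, h3, h4⟩ := h
  obtain ⟨ι', _, lam', d', h1', h2', h3', h4'⟩ := h'
  refine ⟨ι × ι', inferInstance, fun i => lam i.1 * lam' i.2, fun i => d i.1 ∪ d' i.2,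
    fun i => Finset.union_subset_union (h1 _) (h1' _), fun a => ?_, ?_, ?_⟩
  · dsimp only; rw [h2, h2', Fintype.sum_prod_type, Finset.sum_mul_sum]
    refine Finset.sum_congr rfl fun i _ => Finset.sum_congr rfl fun j _ => ?_
    have : (d i ∪ d' j).val ≤ a ↔ (d i).val ≤ a ∧ (d' j).val ≤ a := by
      rw [Multiset.le_iff_subset (d i).nodup, Multiset.le_iff_subset (d' j).nodup,
        Multiset.le_iff_subset (d i ∪ d' j).nodup]
      simp only [Multiset.subset_iff, Finset.mem_val, Finset.mem_union]
      exact ⟨fun h => ⟨fun x hx => h (Or.inl hx), fun x hx => h (Or.inr hx)⟩,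
        fun h x hx => hx.elim (h.1 ·) (h.2 ·)⟩
    by_cases c1 : (d i).val ≤ a <;> by_cases c2 : (d' j).val ≤ a <;> simp [c1, c2]
  · rw [h3, h3', Fintype.sum_prod_type, Finset.sum_mul_sum]
    refine Finset.sum_congr rfl fun i _ => Finset.sum_congr rfl fun j _ => ?_
    have hdij : Disjoint (d i) (d' j) := Finset.disjoint_of_subset_left (h1 i)
      (Finset.disjoint_of_subset_right (h1' j) hd)
    have : S.norm (d i ∪ d' j).val = S.norm (d i).val * S.norm (d' j).val := by
      rw [← Finset.disjUnion_eq_union _ _ hdij, Finset.disjUnion_val, norm_add]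
    dsimp only
    rw [this]; push_cast
    rw [div_mul_div_comm]
  · simp only [abs_mul]
    rw [Fintype.sum_prod_type]; dsimp only; rw [← Finset.sum_mul_sum]
    exact mul_le_mul h4 h4' (Finset.sum_nonneg fun i _ => abs_nonneg _) hW

theorem prod_ind (d : Finset P) (a : Multiset P) :
    ∏ p ∈ d, (if p ∈ a then (1:ℝ) else 0) = if d.val ≤ a then 1 else 0 := by
  rw [Finset.prod_ite_zero]
  simp only [Multiset.le_iff_subset d.nodup, Multiset.subset_iff, Finset.mem_val]
  simp

theorem norm_val (S : Sys P G) (d : Finset P) : (S.norm d.val : ℝ) = ∏ p ∈ d, (S.N p : ℝ) := by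
  rw [norm, Finset.prod_map_val, Nat.cast_prod]

theorem rep_esym (S : Sys P G) (T : Finset P) (k : ℕ) :
    S.Rep T (fun a => esym T (fun p => if p ∈ a then 1 else 0) k)
      (esym T (fun p => 1 / (S.N p : ℝ)) k) (T.card.choose k) := by
  refine ⟨T.powersetCard k, inferInstance, fun _ => 1, fun d => d.1, fun d =>
    (Finset.mem_powersetCard.1 d.2).1, fun a => ?_, ?_, ?_⟩
  · simp only [esym, prod_ind, one_mul]
    rw [← Finset.sum_coe_sort]
  · simp only [esym, norm_val]
    rw [← Finset.sum_coe_sort]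
    simp
  · simp

theorem rep_bonf (S : Sys P G) (T : Finset P) (m : ℕ) :
    S.Rep T (fun a => bonf T (fun p => if p ∈ a then 1 else 0) m)
      (bonf T (fun p => 1 / (S.N p : ℝ)) m) ((∑ i ∈ Finset.range (m + 1), T.card.choose i : ℕ)) := by
  induction m with
  | zero => simpa [bonf_zero] using Rep.one T
  | succ m ih =>
    simp only [bonf_succ]
    rw [Finset.sum_range_succ, Nat.cast_add]
    have := ih.add ((rep_esym S T (m + 1)).smul ((-1) ^ (m + 1)))
    simpa using this

theorem Rep.count {T θ M W} (h : S.Rep T θ M W) (g : G) {X : ℝ} (hX : 0 ≤ X) :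
    |∑ a ∈ S.ball g X, θ a - M * (S.c * X)| ≤ W * (S.Q * √X) := by
  obtain ⟨ι, hι, lam, d, h1, h2, h3, h4⟩ := h
  have hcard : ∀ i, ∑ a ∈ S.ball g X, (if (d i).val ≤ a then (1:ℝ) else 0) =
      (S.ball (g - S.cls (d i).val) (X / S.norm (d i).val)).card := by
    intro i
    rw [← Finset.sum_filter, Finset.sum_const, nsmul_eq_mul, mul_one]
    congr 1
    symm
    have hn := S.norm_pos' (d i).val
    refine Finset.card_bij (fun a _ => (d i).val + a) (fun a ha => ?_) (fun a _ b _ hab => ?_) ?_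
    · rw [S.mem_ball (by positivity), le_div_iff₀ hn] at ha
      rw [Finset.mem_filter, S.mem_ball hX, norm_add, cls_add, ha.2]
      refine ⟨⟨?_, by abel⟩, by simp⟩
      push_cast; linarith [ha.1]
    · simpa using hab
    · intro a ha
      rw [Finset.mem_filter, S.mem_ball hX] at ha
      obtain ⟨⟨ha1, ha2⟩, ha3⟩ := ha
      obtain ⟨e, rfl⟩ := Multiset.le_iff_exists_add.1 ha3
      refine ⟨e, ?_, rfl⟩
      rw [S.mem_ball (by positivity), le_div_iff₀ hn, ← ha2, cls_add]
      rw [norm_add] at ha1; push_cast at ha1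
      exact ⟨by linarith, by abel⟩
  have hsum : ∑ a ∈ S.ball g X, θ a - M * (S.c * X) = ∑ i, lam i *
      (((S.ball (g - S.cls (d i).val) (X / S.norm (d i).val)).card : ℝ) -
        S.c * (X / S.norm (d i).val)) := by
    simp only [h2]
    rw [Finset.sum_comm, h3, Finset.sum_mul, ← Finset.sum_sub_distrib]
    refine Finset.sum_congr rfl fun i _ => ?_
    rw [← Finset.mul_sum, hcard]; ring
  rw [hsum]
  have hQ := S.two_le_Q
  calc _ ≤ ∑ i, |lam i| * (S.Q * √X) := by
        refine (Finset.abs_sum_le_sum_abs _ _).trans (Finset.sum_le_sum fun i _ => ?_)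
        rw [abs_mul]
        have hn := S.norm_pos' (d i).val
        have hn1 : (1:ℝ) ≤ S.norm (d i).val := by exact_mod_cast S.norm_pos (d i).val
        refine mul_le_mul_of_nonneg_left ?_ (abs_nonneg _)
        refine (S.card_ball _ (by positivity)).trans ?_
        gcongr
        exact div_le_self hX hn1
    _ ≤ _ := by rw [← Finset.sum_mul]; gcongr

end Sys

namespace Sys

open scoped Classical

variable {P G : Type} [AddCommGroup G] [Fintype G]

theorem one_le_prod_real {ι : Type*} (s : Finset ι) (f : ι → ℝ) (h : ∀ i ∈ s, 1 ≤ f i) :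
    1 ≤ ∏ i ∈ s, f i := by
  simpa using Finset.prod_le_prod (f := fun _ => (1:ℝ)) (fun _ _ => zero_le_one) h

/-- indicator that no prime of `T` divides -/
noncomputable def rough (T : Finset P) (a : Multiset P) : ℝ :=
  ∏ p ∈ T, (1 - if p ∈ a then (1:ℝ) else 0)

theorem rough_nonneg (T : Finset P) (a : Multiset P) : 0 ≤ rough T a :=
  Finset.prod_nonneg fun p _ => by split_ifs <;> norm_num

theorem rough_eq (T : Finset P) (a : Multiset P) :
    rough T a = if ∀ p ∈ a, p ∉ T then 1 else 0 := by
  rw [rough]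
  split_ifs with h
  · refine Finset.prod_eq_one fun p hp => ?_
    rw [if_neg fun ha => h p ha hp]; simp
  · push Not at h
    obtain ⟨p, ha, hT⟩ := h
    exact Finset.prod_eq_zero hT (by simp [ha])

theorem rough_union {T T' : Finset P} (h : Disjoint T T') (a : Multiset P) :
    rough (T ∪ T') a = rough T a * rough T' a := Finset.prod_union h

/-- density of integers free of primes of `T` -/
noncomputable def dens (S : Sys P G) (T : Finset P) : ℝ := ∏ p ∈ T, (1 - 1 / (S.N p : ℝ))

theorem N_inv_le (S : Sys P G) (p : P) : 1 / (S.N p : ℝ) ≤ 1 / 2 :=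
  one_div_le_one_div_of_le (by norm_num) (by exact_mod_cast S.two_le_N p)

theorem N_inv_nonneg (S : Sys P G) (p : P) : 0 ≤ 1 / (S.N p : ℝ) := by positivity

theorem dens_pos (S : Sys P G) (T : Finset P) : 0 < S.dens T :=
  Finset.prod_pos fun p _ => by linarith [S.N_inv_le p]

theorem dens_union (S : Sys P G) {T T' : Finset P} (h : Disjoint T T') :
    S.dens (T ∪ T') = S.dens T * S.dens T' := Finset.prod_union h

theorem dens_ge (S : Sys P G) (T : Finset P) {w : ℝ} (hw : 1 < w)
    (hT : ∀ p ∈ T, w < S.N p ∧ (S.N p : ℝ) ≤ w ^ 2) : Real.exp (-160) ≤ S.dens T := by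
  have h1 := S.sum_inv_le T hw hT
  have h2 : ∀ x : ℝ, 0 ≤ x → x ≤ 1 / 2 → Real.exp (-2 * x) ≤ 1 - x := by
    intro x h0 h1
    have : Real.exp (2 * x) * (1 - x) ≥ 1 := by
      have := Real.quadratic_le_exp_of_nonneg (x := 2 * x) (by linarith)
      nlinarith
    rw [neg_mul, Real.exp_neg]
    rw [inv_le_iff_one_le_mul₀ (Real.exp_pos _)]; linarith
  calc Real.exp (-160) ≤ Real.exp (-2 * ∑ p ∈ T, 1 / (S.N p : ℝ)) := Real.exp_le_exp.2 (by linarith)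
    _ = ∏ p ∈ T, Real.exp (-2 * (1 / (S.N p : ℝ))) := by rw [Finset.mul_sum, Real.exp_sum]
    _ ≤ _ := Finset.prod_le_prod (fun _ _ => (Real.exp_pos _).le) fun p _ =>
      h2 _ (S.N_inv_nonneg p) (S.N_inv_le p)

theorem block (S : Sys P G) (T : ℕ → Finset P) (b : ℕ → ℕ) (ε w : ℕ → ℝ) (hε0 : ∀ j, 0 ≤ ε j)
    (J : ℕ) (hd : ∀ i < J, ∀ j < i, Disjoint (T j) (T i))
    (hw : ∀ j < J, ((T j).card + 1 : ℝ) ^ (2 * b j + 1) ≤ w j)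
    (hε : ∀ j < J, esym (T j) (fun p => 1 / (S.N p : ℝ)) (2 * b j + 1) ≤ ε j * S.dens (T j)) :
    ∃ (U E : Multiset P → ℝ) (M M' W W' : ℝ),
      S.Rep ((Finset.range J).biUnion T) U M W ∧ S.Rep ((Finset.range J).biUnion T) E M' W' ∧
      (∀ a, 0 ≤ U a - rough ((Finset.range J).biUnion T) a ∧
        U a - rough ((Finset.range J).biUnion T) a ≤ E a) ∧
      S.dens ((Finset.range J).biUnion T) ≤ M ∧
      M ≤ S.dens ((Finset.range J).biUnion T) * ∏ j ∈ Finset.range J, (1 + 2 * ε j) ∧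
      M' ≤ S.dens ((Finset.range J).biUnion T) * (∏ j ∈ Finset.range J, (1 + 2 * ε j) - 1) ∧
      0 ≤ M' ∧
      W + W' ≤ ∏ j ∈ Finset.range J, (2 * w j) := by
  induction J with
  | zero =>
    refine ⟨fun _ => 1, fun _ => 0 * 1, 1, 0 * 1, 1, |0| * 1, Rep.one _, (Rep.one _).smul 0, ?_, ?_,
      ?_, ?_, ?_, ?_⟩ <;> simp [rough, dens]
  | succ J ih =>
    obtain ⟨U, E, M, M', W, W', hU, hE, hUE, hM1, hM2, hM', hM'0, hW⟩ :=
      ih (fun i hi => hd i (hi.trans (Nat.lt_succ_self _)))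
        (fun j hj => hw j (hj.trans (Nat.lt_succ_self _)))
        (fun j hj => hε j (hj.trans (Nat.lt_succ_self _)))
    set B := (Finset.range J).biUnion T
    have hB : (Finset.range (J + 1)).biUnion T = B ∪ T J := by
      rw [Finset.range_add_one, Finset.biUnion_insert, Finset.union_comm]
    have hdis : Disjoint B (T J) := by
      rw [Finset.disjoint_biUnion_left]
      exact fun j hj => hd J (Nat.lt_succ_self _) j (Finset.mem_range.1 hj)
    set y : Multiset P → ℝ := fun a => bonf (T J) (fun p => if p ∈ a then 1 else 0) (2 * b J)
    set e : Multiset P → ℝ := fun a => esym (T J) (fun p => if p ∈ a then 1 else 0) (2 * b J + 1)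
    set my := bonf (T J) (fun p => 1 / (S.N p : ℝ)) (2 * b J)
    set me := esym (T J) (fun p => 1 / (S.N p : ℝ)) (2 * b J + 1)
    have hye : ∀ a, 0 ≤ y a - rough (T J) a ∧ y a - rough (T J) a ≤ e a := fun a =>
      bonf_even (T J) _ (fun p => by split_ifs <;> norm_num) (fun p => by split_ifs <;> norm_num) _
    have hm := bonf_even (T J) (fun p => 1 / (S.N p : ℝ)) S.N_inv_nonneg
      (fun p => by linarith [S.N_inv_le p]) (b J)
    change 0 ≤ my - S.dens (T J) ∧ my - S.dens (T J) ≤ me at hm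
    have hmε := hε J (Nat.lt_succ_self _)
    have hw0 : (0:ℝ) ≤ ((T J).card + 1 : ℝ) ^ (2 * b J + 1) := by positivity
    have hwJ := hw J (Nat.lt_succ_self _)
    have hy : S.Rep (T J) y my (w J) := by
      refine (rep_bonf S (T J) (2 * b J)).mono subset_rfl (le_trans ?_ hwJ)
      have h1 : ((∑ i ∈ Finset.range (2 * b J + 1), (T J).card.choose i : ℕ) : ℝ) ≤
          ((T J).card + 1 : ℝ) ^ (2 * b J) := by exact_mod_cast sum_choose_le _ _
      refine h1.trans (pow_le_pow_right₀ ?_ (Nat.le_succ _))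
      have : (0:ℝ) ≤ (T J).card := by positivity
      linarith
    have he : S.Rep (T J) e me (w J) := by
      refine (rep_esym S (T J) (2 * b J + 1)).mono subset_rfl (le_trans ?_ hwJ)
      have h1 : ((T J).card.choose (2 * b J + 1) : ℝ) ≤ ((T J).card + 1 : ℝ) ^ (2 * b J + 1) := by
        have := Nat.choose_le_pow (T J).card (2 * b J + 1)
        have h2 : ((T J).card.choose (2 * b J + 1) : ℝ) ≤ ((T J).card : ℝ) ^ (2 * b J + 1) := by
          exact_mod_cast this
        refine h2.trans ?_
        gcongr; linarith
      exact h1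
    have hme0 : 0 ≤ me := by linarith
    have hdB := S.dens_pos B
    have hdT := S.dens_pos (T J)
    have hPr1 : (1:ℝ) ≤ ∏ j ∈ Finset.range J, (1 + 2 * ε j) :=
      one_le_prod_real _ _ fun j _ => by linarith [hε0 j]
    set Pr := ∏ j ∈ Finset.range J, (1 + 2 * ε j)
    rw [hB, Finset.prod_range_succ, Finset.prod_range_succ, S.dens_union hdis]
    have hey := hε0 J
    have hmy : my ≤ S.dens (T J) * (1 + ε J) := by linarith
    refine ⟨fun a => U a * y a, fun a => E a * y a + U a * e a, M * my, M' * my + M * me, W * w J,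
      W' * w J + W * w J, hU.mul hy hdis, (hE.mul hy hdis).add (hU.mul he hdis), fun a => ?_, ?_, ?_,
      ?_, ?_, ?_⟩
    · rw [rough_union hdis]
      obtain ⟨h1, h2⟩ := hUE a
      obtain ⟨h3, h4⟩ := hye a
      have h5 := rough_nonneg B a
      have h6 := rough_nonneg (T J) a
      have h8 : 0 ≤ y a := by linarith
      have h7 : U a * y a - rough B a * rough (T J) a =
        (U a - rough B a) * y a + rough B a * (y a - rough (T J) a) := by ring
      dsimp only
      rw [h7]
      constructor
      · exact add_nonneg (mul_nonneg h1 h8) (mul_nonneg h5 h3)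
      · refine add_le_add (mul_le_mul_of_nonneg_right h2 h8) ?_
        exact mul_le_mul (by linarith) h4 h3 (by linarith)
    · exact mul_le_mul hM1 (by linarith) hdT.le (by linarith)
    · calc M * my ≤ (S.dens B * Pr) * (S.dens (T J) * (1 + 2 * ε J)) := by
            refine mul_le_mul hM2 (hmy.trans ?_) (by linarith) (by positivity)
            gcongr; linarith
        _ = _ := by ring
    · calc M' * my + M * me ≤ (S.dens B * (Pr - 1)) * (S.dens (T J) * (1 + ε J)) +
            (S.dens B * Pr) * (ε J * S.dens (T J)) := by
            refine add_le_add ?_ ?_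
            · exact mul_le_mul hM' hmy (by linarith) (mul_nonneg hdB.le (by linarith))
            · exact mul_le_mul hM2 hmε hme0 (by positivity)
        _ = S.dens B * S.dens (T J) * (Pr * (1 + 2 * ε J) - 1 - ε J) := by ring
        _ ≤ _ := by
            refine mul_le_mul_of_nonneg_left ?_ (by positivity)
            linarith
    · have h1 : 0 ≤ my := by linarith
      have h2 : 0 ≤ M := by linarith
      positivity
    · have hwp : 0 ≤ w J := hw0.trans hwJ
      have hW0 := hU.W_nonneg
      have hW0' := hE.W_nonneg
      calc W * w J + (W' * w J + W * w J) ≤ (W + W') * (2 * w J) := by nlinarith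
        _ ≤ _ := by gcongr

/-- number of ideals of norm at most `X` and class `g` without prime factors in `T` -/
noncomputable def cnt (S : Sys P G) (T : Finset P) (g : G) (X : ℝ) : ℝ := ∑ a ∈ S.ball g X, rough T a

theorem cnt_sub (S : Sys P G) (T : ℕ → Finset P) (b : ℕ → ℕ) (ε w : ℕ → ℝ) (hε0 : ∀ j, 0 ≤ ε j)
    (J : ℕ) (hd : ∀ i < J, ∀ j < i, Disjoint (T j) (T i))
    (hw : ∀ j < J, ((T j).card + 1 : ℝ) ^ (2 * b j + 1) ≤ w j)
    (hε : ∀ j < J, esym (T j) (fun p => 1 / (S.N p : ℝ)) (2 * b j + 1) ≤ ε j * S.dens (T j))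
    (g : G) {X : ℝ} (hX : 0 ≤ X) :
    |S.cnt ((Finset.range J).biUnion T) g X - S.dens ((Finset.range J).biUnion T) * (S.c * X)| ≤
      2 * (S.dens ((Finset.range J).biUnion T) * (S.c * X) * (∏ j ∈ Finset.range J, (1 + 2 * ε j) - 1))
      + (∏ j ∈ Finset.range J, (2 * w j)) * (S.Q * √X) := by
  obtain ⟨U, E, M, M', W, W', hU, hE, hUE, hM1, hM2, hM', hM'0, hW⟩ := S.block T b ε w hε0 J hd hw hε
  set B := (Finset.range J).biUnion T
  have h1 := hU.count g hX
  have h2 := hE.count g hX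
  have h3 : 0 ≤ ∑ a ∈ S.ball g X, U a - S.cnt B g X ∧
      ∑ a ∈ S.ball g X, U a - S.cnt B g X ≤ ∑ a ∈ S.ball g X, E a := by
    rw [cnt, ← Finset.sum_sub_distrib]
    exact ⟨Finset.sum_nonneg fun a _ => (hUE a).1, Finset.sum_le_sum fun a _ => (hUE a).2⟩
  have hcX : 0 ≤ S.c * X := mul_nonneg S.c_pos.le hX
  have hQX : 0 ≤ S.Q * √X := mul_nonneg (by linarith [S.two_le_Q]) (Real.sqrt_nonneg _)
  have h4 : (W + W') * (S.Q * √X) ≤ (∏ j ∈ Finset.range J, (2 * w j)) * (S.Q * √X) := by gcongr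
  set Pr := ∏ j ∈ Finset.range J, (1 + 2 * ε j)
  have h5 : M * (S.c * X) ≤ S.dens B * Pr * (S.c * X) := by gcongr
  have h6 : M' * (S.c * X) ≤ S.dens B * (Pr - 1) * (S.c * X) := by gcongr
  have h7 : S.dens B * (S.c * X) ≤ M * (S.c * X) := by gcongr
  have h8 : 0 ≤ M' * (S.c * X) := by positivity
  rw [abs_le] at h1 h2 ⊢
  constructor <;> nlinarith

end Sys

namespace Sys

open scoped Classical

variable {P G : Type} [AddCommGroup G] [Fintype G]

/-- primes with norm in `(exp(L/2^(j+1)), exp(L/2^j)]` -/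
noncomputable def dyad (S : Sys P G) (L : ℝ) (j : ℕ) : Finset P :=
  (S.primes ⌊Real.exp (L / 2 ^ j)⌋₊).filter fun p => Real.exp (L / 2 ^ (j + 1)) < S.N p

theorem mem_dyad (S : Sys P G) {L : ℝ} {j : ℕ} {p : P} : p ∈ S.dyad L j ↔
    Real.exp (L / 2 ^ (j + 1)) < S.N p ∧ (S.N p : ℝ) ≤ Real.exp (L / 2 ^ j) := by
  rw [dyad, Finset.mem_filter, mem_primes, Nat.le_floor_iff (Real.exp_pos _).le, and_comm]

theorem exp_half_sq (L : ℝ) (j : ℕ) : Real.exp (L / 2 ^ (j + 1)) ^ 2 = Real.exp (L / 2 ^ j) := by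
  rw [← Real.exp_nat_mul]; congr 1; rw [pow_succ]; push_cast; field_simp

theorem exp_half_mono {L : ℝ} (hL : 0 ≤ L) {i j : ℕ} (h : i ≤ j) :
    Real.exp (L / 2 ^ j) ≤ Real.exp (L / 2 ^ i) := by
  refine Real.exp_le_exp.2 (div_le_div_of_nonneg_left hL (by positivity) ?_)
  exact pow_le_pow_right₀ (by norm_num) h

theorem dyad_disjoint (S : Sys P G) {L : ℝ} (hL : 0 ≤ L) {i j : ℕ} (h : j < i) :
    Disjoint (S.dyad L j) (S.dyad L i) := by
  rw [Finset.disjoint_left]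
  intro p h1 h2
  rw [mem_dyad] at h1 h2
  have := exp_half_mono hL (Nat.succ_le_of_lt h)
  linarith [h1.1, h2.2]

theorem biUnion_dyad (S : Sys P G) {L : ℝ} (hL : 0 ≤ L) (J : ℕ) :
    (Finset.range J).biUnion (S.dyad L) =
      (S.primes ⌊Real.exp L⌋₊).filter fun p => Real.exp (L / 2 ^ J) < S.N p := by
  induction J with
  | zero =>
    ext p
    simp only [Finset.range_zero, Finset.biUnion_empty, Finset.notMem_empty, false_iff,
      Finset.mem_filter, mem_primes, Nat.le_floor_iff (Real.exp_pos _).le]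
    simp
  | succ J ih =>
    ext p
    rw [Finset.range_add_one, Finset.biUnion_insert, ih]
    simp only [Finset.mem_union, Finset.mem_filter, mem_primes, mem_dyad,
      Nat.le_floor_iff (Real.exp_pos _).le]
    have h1 := exp_half_mono hL (Nat.zero_le J)
    have h2 := exp_half_mono hL (Nat.le_succ J)
    rw [pow_zero, div_one] at h1
    constructor
    · rintro (h | h)
      · exact ⟨h.2.trans h1, h.1⟩
      · exact ⟨h.1, h2.trans_lt h.2⟩
    · rintro ⟨h3, h4⟩
      rcases le_or_gt (S.N p : ℝ) (Real.exp (L / 2 ^ J)) with h | h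
      · exact Or.inl ⟨h4, h⟩
      · exact Or.inr ⟨h3, h⟩

theorem sum_dyad (S : Sys P G) {L : ℝ} (hL : 0 < L) (j : ℕ) :
    ∑ p ∈ S.dyad L j, (1:ℝ) / S.N p ≤ 80 := by
  refine S.sum_inv_le _ (w := Real.exp (L / 2 ^ (j + 1))) (Real.one_lt_exp_iff.2 (by positivity)) ?_
  intro p hp
  rw [exp_half_sq]
  exact S.mem_dyad.1 hp

theorem dens_dyad (S : Sys P G) {L : ℝ} (hL : 0 < L) (j : ℕ) :
    Real.exp (-160) ≤ S.dens (S.dyad L j) := by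
  refine S.dens_ge _ (w := Real.exp (L / 2 ^ (j + 1))) (Real.one_lt_exp_iff.2 (by positivity)) ?_
  intro p hp
  rw [exp_half_sq]
  exact S.mem_dyad.1 hp

theorem dens_biUnion_dyad (S : Sys P G) {L : ℝ} (hL : 0 < L) (J : ℕ) :
    Real.exp (-160 * J) ≤ S.dens ((Finset.range J).biUnion (S.dyad L)) := by
  induction J with
  | zero => simp [dens]
  | succ J ih =>
    rw [Finset.range_add_one, Finset.biUnion_insert, dens_union]
    · have h := S.dens_dyad hL J
      calc Real.exp (-160 * (J + 1 : ℕ)) = Real.exp (-160) * Real.exp (-160 * J) := by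
            rw [← Real.exp_add]; congr 1; push_cast; ring
        _ ≤ _ := mul_le_mul h ih (Real.exp_pos _).le ((Real.exp_pos _).le.trans h)
    · rw [Finset.disjoint_biUnion_right]
      exact fun j hj => (S.dyad_disjoint hL.le (Finset.mem_range.1 hj)).symm

theorem card_dyad (S : Sys P G) (L : ℝ) (j : ℕ) (h2 : 2 ≤ Real.exp (L / 2 ^ j)) :
    ((S.dyad L j).card : ℝ) + 1 ≤ 2 * Real.exp (L / 2 ^ j) := by
  have h := S.sum_below_le (S.dyad L j) (Finset.Icc 2 ⌊Real.exp (L / 2 ^ j)⌋₊) (fun p hp => by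
    rw [Finset.mem_Icc]
    refine ⟨(S.prime_below p).two_le, (S.below_le_N p).trans ?_⟩
    exact Nat.le_floor (S.mem_dyad.1 hp).2) (fun _ => 1) (fun _ => zero_le_one)
  have h3 := Nat.floor_le (Real.exp_pos (L / 2 ^ j)).le
  have h4 : 2 ≤ ⌊Real.exp (L / 2 ^ j)⌋₊ := Nat.le_floor (by exact_mod_cast h2)
  simp only [Finset.sum_const, Nat.card_Icc, nsmul_eq_mul, mul_one] at h
  rw [Nat.cast_sub (by omega)] at h
  push_cast at h
  linarith

theorem exists_J {L : ℝ} (hL : 1 ≤ L) : ∃ J : ℕ, Real.exp (L / 2 ^ J) < 2 ∧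
    (∀ j < J, 2 ≤ Real.exp (L / 2 ^ j)) ∧ 160 * (J : ℝ) ≤ L + 1600 := by
  have hex : ∃ J : ℕ, Real.exp (L / 2 ^ J) < 2 := by
    obtain ⟨n, hn⟩ := pow_unbounded_of_one_lt (2 * L) (one_lt_two)
    refine ⟨n, ?_⟩
    rw [← Real.lt_log_iff_exp_lt (by norm_num), div_lt_iff₀ (by positivity)]
    have := Real.log_two_gt_d9
    nlinarith [pow_pos (two_pos : (0:ℝ) < 2) n]
  refine ⟨Nat.find hex, Nat.find_spec hex, fun j hj => not_lt.1 (Nat.find_min hex hj), ?_⟩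
  set J := Nat.find hex with hJ
  rcases Nat.lt_or_ge J 11 with h | h
  · have : (J:ℝ) ≤ 10 := by exact_mod_cast (by omega : J ≤ 10)
    linarith
  · obtain ⟨n, hn⟩ : ∃ n, J = n + 1 := ⟨J - 1, by omega⟩
    have h1 : 2 ≤ Real.exp (L / 2 ^ n) := not_lt.1 (Nat.find_min hex (by omega))
    rw [← Real.log_le_iff_le_exp (by norm_num), le_div_iff₀ (by positivity)] at h1
    have h2 : ∀ m : ℕ, 1024 * (m + 1) ≤ 2 ^ (m + 10) := by
      intro m
      have := Nat.lt_two_pow_self (n := m)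
      rw [pow_add]; norm_num; omega
    have h3 := h2 (n - 10)
    rw [Nat.sub_add_cancel (by omega)] at h3
    have h4 : 1024 * ((n:ℝ) - 9) ≤ 2 ^ n := by
      have : ((1024 * (n - 10 + 1) : ℕ) : ℝ) ≤ (2 ^ n : ℕ) := by exact_mod_cast h3
      push_cast [Nat.cast_sub (by omega : 10 ≤ n)] at this
      linarith
    rw [hn]; push_cast
    have h5 : (10:ℝ) ≤ n := by exact_mod_cast (by omega : 10 ≤ n)
    have := Real.log_two_gt_d9
    nlinarith

theorem primes_eq (S : Sys P G) {L : ℝ} (hL : 0 ≤ L) {J : ℕ} (hJ : Real.exp (L / 2 ^ J) < 2) :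
    S.primes ⌊Real.exp L⌋₊ = (Finset.range J).biUnion (S.dyad L) := by
  rw [S.biUnion_dyad hL, Finset.filter_true_of_mem]
  intro p _
  have : (2:ℝ) ≤ S.N p := by exact_mod_cast S.two_le_N p
  linarith

theorem sum_k (b J : ℕ) : ∑ j ∈ Finset.range J, (2 * (b + j : ℕ) + 1 : ℝ) / 2 ^ j ≤ 4 * b + 6 := by
  have : ∑ j ∈ Finset.range J, (2 * (b + j : ℕ) + 1 : ℝ) / 2 ^ j =
      4 * b + 6 - (4 * b + 6 + 4 * J) / 2 ^ J := by
    induction J with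
    | zero => simp
    | succ J ih => rw [Finset.sum_range_succ, ih]; push_cast; field_simp; ring
  rw [this]
  have : (0:ℝ) ≤ (4 * b + 6 + 4 * J) / 2 ^ J := by positivity
  linarith

/-- a large absolute constant -/
noncomputable def KB : ℝ := Real.exp (80 * Real.exp 200 + 160)

theorem KB_pos : 0 < KB := Real.exp_pos _

theorem dens_primes_ge (S : Sys P G) {L : ℝ} (hL : 1 ≤ L) :
    Real.exp (-L - 1600) ≤ S.dens (S.primes ⌊Real.exp L⌋₊) := by
  obtain ⟨J, h1, _, h3⟩ := exists_J hL
  rw [S.primes_eq (by linarith) h1]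
  refine le_trans (Real.exp_le_exp.2 ?_) (S.dens_biUnion_dyad (by linarith) J)
  linarith

theorem fund_aux (S : Sys P G) {L : ℝ} (hL : 1 ≤ L) (b : ℕ) (g : G) {X : ℝ} (hX : 0 ≤ X) :
    |S.cnt (S.primes ⌊Real.exp L⌋₊) g X - S.dens (S.primes ⌊Real.exp L⌋₊) * (S.c * X)| ≤
      2 * (S.dens (S.primes ⌊Real.exp L⌋₊) * (S.c * X) *
        (Real.exp (4 * KB * Real.exp (-200 * (2 * b + 1))) - 1)) +
      Real.exp (L * (12 * b + 18)) * (S.Q * √X) := by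
  obtain ⟨J, h1, h2, -⟩ := exists_J hL
  rw [S.primes_eq (by linarith) h1]
  have hL0 : 0 < L := by linarith
  have hlog2 := Real.log_two_gt_d9
  have h := S.cnt_sub (S.dyad L) (fun j => b + j)
    (fun j => KB * Real.exp (-200 * (2 * (b + j : ℕ) + 1)))
    (fun j => (2 * Real.exp (L / 2 ^ j)) ^ (2 * (b + j) + 1))
    (fun j => mul_nonneg KB_pos.le (Real.exp_pos _).le) J (fun i _ j hj => S.dyad_disjoint hL0.le hj)
    (fun j hj => ?_) (fun j hj => ?_) g hX
  · refine h.trans ?_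
    have hcX : 0 ≤ S.c * X := mul_nonneg S.c_pos.le hX
    have hQX : 0 ≤ S.Q * √X := mul_nonneg (by linarith [S.two_le_Q]) (Real.sqrt_nonneg _)
    have hd := (S.dens_pos ((Finset.range J).biUnion (S.dyad L))).le
    refine add_le_add ?_ (mul_le_mul_of_nonneg_right ?_ hQX)
    · gcongr
      have e1 : ∀ J : ℕ, ∑ j ∈ Finset.range J, Real.exp (-200 * (2 * (b + j : ℕ) + 1)) ≤
          2 * Real.exp (-200 * (2 * b + 1)) := by
        intro J
        calc _ ≤ ∑ j ∈ Finset.range J, Real.exp (-200 * (2 * b + 1)) * (1 / 2) ^ j := by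
              refine Finset.sum_le_sum fun j _ => ?_
              have : Real.exp (-200 * (2 * (b + j : ℕ) + 1)) =
                  Real.exp (-200 * (2 * b + 1)) * (Real.exp (-400)) ^ j := by
                rw [← Real.exp_nat_mul, ← Real.exp_add]; congr 1; push_cast; ring
              rw [this]
              gcongr
              have := Real.add_one_le_exp (400:ℝ)
              rw [Real.exp_neg, one_div]
              exact inv_anti₀ (by norm_num) (by linarith)
          _ = Real.exp (-200 * (2 * b + 1)) * ∑ j ∈ Finset.range J, (1 / 2 : ℝ) ^ j := by
              rw [Finset.mul_sum]
          _ ≤ Real.exp (-200 * (2 * b + 1)) * 2 := by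
              gcongr
              have := sum_geometric_two_le J
              simpa using this
          _ = _ := by ring
      calc ∏ j ∈ Finset.range J, (1 + 2 * (KB * Real.exp (-200 * (2 * (b + j : ℕ) + 1)))) ≤
          ∏ j ∈ Finset.range J, Real.exp (2 * (KB * Real.exp (-200 * (2 * (b + j : ℕ) + 1)))) := by
            refine Finset.prod_le_prod (fun j _ => ?_) fun j _ => ?_
            · have := mul_pos KB_pos (Real.exp_pos (-200 * (2 * (b + j : ℕ) + 1)))
              linarith
            · rw [add_comm]; exact Real.add_one_le_exp _
        _ = Real.exp (2 * (KB * ∑ j ∈ Finset.range J, Real.exp (-200 * (2 * (b + j : ℕ) + 1)))) := by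
            rw [Finset.mul_sum, Finset.mul_sum, Real.exp_sum]
        _ ≤ _ := by
            refine Real.exp_le_exp.2 ?_
            have := mul_le_mul_of_nonneg_left (e1 J) KB_pos.le
            linarith
    · calc ∏ j ∈ Finset.range J, 2 * (2 * Real.exp (L / 2 ^ j)) ^ (2 * (b + j) + 1) ≤
          ∏ j ∈ Finset.range J, Real.exp (3 * L * ((2 * (b + j : ℕ) + 1 : ℝ) / 2 ^ j)) := by
            refine Finset.prod_le_prod (fun j _ => by positivity) fun j hj => ?_
            have hz := h2 j (Finset.mem_range.1 hj)
            set z := Real.exp (L / 2 ^ j) with hz'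
            have e2 : Real.exp (3 * L * ((2 * (b + j : ℕ) + 1 : ℝ) / 2 ^ j)) =
                (z ^ 3) ^ (2 * (b + j) + 1) := by
              rw [hz', ← Real.exp_nat_mul, ← Real.exp_nat_mul]; congr 1; push_cast; ring
            rw [e2]
            calc 2 * (2 * z) ^ (2 * (b + j) + 1) ≤ 2 ^ (2 * (b + j) + 1) * (2 * z) ^ (2 * (b + j) + 1) := by
                  gcongr
                  exact le_self_pow₀ (by norm_num) (by omega)
              _ = (4 * z) ^ (2 * (b + j) + 1) := by rw [← mul_pow]; congr 1; ring
              _ ≤ _ := by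
                  gcongr
                  nlinarith [mul_self_nonneg (z - 2), mul_nonneg (sub_nonneg.2 hz) (sub_nonneg.2 hz)]
        _ = Real.exp (3 * L * ∑ j ∈ Finset.range J, ((2 * (b + j : ℕ) + 1 : ℝ) / 2 ^ j)) := by
            rw [Finset.mul_sum, Real.exp_sum]
        _ ≤ _ := by
            refine Real.exp_le_exp.2 ?_
            have := mul_le_mul_of_nonneg_left (sum_k b J) (by linarith : 0 ≤ 3 * L)
            linarith
  · exact pow_le_pow_left₀ (by positivity) (S.card_dyad L j (h2 j hj)) _
  · have e1 := esym_le (S.dyad L j) (fun p => 1 / (S.N p : ℝ)) S.N_inv_nonneg (Real.exp_pos 200)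
      (2 * (b + j) + 1)
    have e2 := S.sum_dyad hL0 j
    have e3 := S.dens_dyad hL0 j
    have e4 : Real.exp (Real.exp 200 * ∑ p ∈ S.dyad L j, 1 / (S.N p : ℝ)) ≤
        Real.exp (80 * Real.exp 200) := by
      refine Real.exp_le_exp.2 ?_
      rw [mul_comm]; gcongr
    have e5 : Real.exp 200 ^ (2 * (b + j) + 1) = Real.exp (200 * (2 * (b + j : ℕ) + 1)) := by
      rw [← Real.exp_nat_mul]; congr 1; push_cast; ring
    rw [e5] at e1
    have e6 := e1.trans e4
    calc _ = Real.exp (-200 * (2 * (b + j : ℕ) + 1)) * (Real.exp (200 * (2 * (b + j : ℕ) + 1)) *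
          esym (S.dyad L j) (fun p => 1 / (S.N p : ℝ)) (2 * (b + j) + 1)) := by
          rw [← mul_assoc, ← Real.exp_add]; simp
      _ ≤ Real.exp (-200 * (2 * (b + j : ℕ) + 1)) * Real.exp (80 * Real.exp 200) := by gcongr
      _ = KB * Real.exp (-200 * (2 * (b + j : ℕ) + 1)) * Real.exp (-160) := by
          rw [KB, Real.exp_add]
          have : Real.exp 160 * Real.exp (-160) = 1 := by rw [← Real.exp_add]; simp
          linear_combination (-Real.exp (-200 * (2 * (b + j : ℕ) + 1)) * Real.exp (80 * Real.exp 200)) * this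
      _ ≤ _ := mul_le_mul_of_nonneg_left e3 (mul_nonneg KB_pos.le (Real.exp_pos _).le)

end Sys

namespace Sys

open scoped Classical

variable {P G : Type} [AddCommGroup G] [Fintype G]

/-- density of `exp L`-rough ideals in a class -/
noncomputable def rho (S : Sys P G) (L : ℝ) : ℝ := S.dens (S.primes ⌊Real.exp L⌋₊) * S.c

theorem rho_pos (S : Sys P G) (L : ℝ) : 0 < S.rho L := mul_pos (S.dens_pos _) S.c_pos

/-- number of `exp L`-rough ideals in class `g` of norm at most `X` -/
noncomputable def R (S : Sys P G) (L : ℝ) (g : G) (X : ℝ) : ℝ := S.cnt (S.primes ⌊Real.exp L⌋₊) g X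

theorem fund_large (S : Sys P G) {L u : ℝ} (hL : 1600 ≤ L) (hq : Real.log S.Q ≤ L) (hu : 100 ≤ u)
    (g : G) :
    |S.R L g (Real.exp (u * L)) - S.rho L * Real.exp (u * L)| ≤
      (8 * KB * Real.exp 200 * Real.exp (4 * KB * Real.exp 200) + 1) * Real.exp (-2 * u) *
        (S.rho L * Real.exp (u * L)) := by
  have h := S.fund_aux (by linarith : 1 ≤ L) ⌊u / 100⌋₊ g (Real.exp_pos (u * L)).le
  set b := ⌊u / 100⌋₊
  have hb1 : (b:ℝ) ≤ u / 100 := Nat.floor_le (by positivity)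
  have hb2 : u / 100 < b + 1 := Nat.lt_floor_add_one _
  have hd := S.dens_primes_ge (by linarith : 1 ≤ L)
  rw [R, rho]
  set d := S.dens (S.primes ⌊Real.exp L⌋₊)
  have hd0 : 0 < d := S.dens_pos _
  have hc := S.c_pos
  have hQ : 0 < S.Q := by linarith [S.two_le_Q]
  rw [mul_assoc d]
  refine h.trans ?_
  have hX := Real.exp_pos (u * L)
  have hsplit : ∀ A E Y : ℝ, (A + 1) * E * Y = A * E * Y + E * Y := by intros; ring
  rw [hsplit]
  refine add_le_add ?_ ?_
  · have hK := KB_pos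
    set y := 4 * KB * Real.exp (-200 * (2 * b + 1))
    have hy0 : 0 ≤ y := by positivity
    have hy1 : y ≤ 4 * KB * Real.exp 200 * Real.exp (-2 * u) := by
      rw [mul_assoc (4 * KB), ← Real.exp_add]
      refine mul_le_mul_of_nonneg_left (Real.exp_le_exp.2 ?_) (by positivity)
      linarith
    have hy2 : y ≤ 4 * KB * Real.exp 200 := by
      refine hy1.trans (mul_le_of_le_one_right (by positivity) (Real.exp_le_one_iff.2 (by linarith)))
    have hy3 : Real.exp y - 1 ≤ y * Real.exp y := by
      have := Real.add_one_le_exp (-y)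
      have h2 : Real.exp (-y) * Real.exp y = 1 := by rw [← Real.exp_add]; simp
      nlinarith [Real.exp_pos y]
    have hy4 : Real.exp y - 1 ≤ 4 * KB * Real.exp 200 * Real.exp (-2 * u) *
        Real.exp (4 * KB * Real.exp 200) := by
      refine hy3.trans (mul_le_mul hy1 (Real.exp_le_exp.2 hy2) (Real.exp_pos _).le (by positivity))
    calc _ ≤ 2 * (d * (S.c * Real.exp (u * L)) * (4 * KB * Real.exp 200 * Real.exp (-2 * u) *
        Real.exp (4 * KB * Real.exp 200))) := by gcongr
      _ = _ := by ring
  · have hs : √(Real.exp (u * L)) = Real.exp (u * L / 2) := by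
      rw [Real.sqrt_eq_iff_mul_self_eq (by positivity) (by positivity), ← Real.exp_add]; congr 1; ring
    have hQe : S.Q = Real.exp (Real.log S.Q) := (Real.exp_log hQ).symm
    have hce : Real.exp (-Real.log S.Q) ≤ S.c := by
      rw [Real.exp_neg, Real.exp_log hQ]; exact S.inv_le_c
    calc _ = Real.exp (L * (12 * b + 18) + (Real.log S.Q + u * L / 2)) := by
          rw [hs, Real.exp_add, Real.exp_add, Real.exp_log hQ]
      _ ≤ Real.exp (-2 * u + ((-L - 1600) + (-Real.log S.Q + u * L))) := by
          refine Real.exp_le_exp.2 ?_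
          nlinarith [mul_nonneg (by linarith : 0 ≤ L - 1600) (by linarith : 0 ≤ u - 100),
            mul_nonneg (by linarith : (0:ℝ) ≤ L) (by linarith : 0 ≤ u / 100 - b)]
      _ = Real.exp (-2 * u) * (Real.exp (-L - 1600) * (Real.exp (-Real.log S.Q) * Real.exp (u * L))) := by
          rw [← Real.exp_add, ← Real.exp_add, ← Real.exp_add]
      _ ≤ _ := by gcongr

theorem rough_anti {T T' : Finset P} (h : T ⊆ T') (a : Multiset P) : rough T' a ≤ rough T a := by
  rw [rough_eq, rough_eq]
  split_ifs with h1 h2 h2 <;> norm_num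
  exact h2 fun p hp hT => h1 p hp (h hT)

theorem cnt_anti (S : Sys P G) {T T' : Finset P} (h : T ⊆ T') (g : G) (X : ℝ) :
    S.cnt T' g X ≤ S.cnt T g X := Finset.sum_le_sum fun a _ => rough_anti h a

theorem cnt_nonneg (S : Sys P G) (T : Finset P) (g : G) (X : ℝ) : 0 ≤ S.cnt T g X :=
  Finset.sum_nonneg fun a _ => rough_nonneg T a

theorem primes_mono (S : Sys P G) {m n : ℕ} (h : m ≤ n) : S.primes m ⊆ S.primes n := by
  intro p; rw [mem_primes, mem_primes]; exact fun hp => hp.trans h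

theorem rho_half (S : Sys P G) {L : ℝ} (hL : 0 < L) :
    S.rho (L / 2) ≤ Real.exp 160 * S.rho L := by
  have h1 : S.primes ⌊Real.exp L⌋₊ = S.primes ⌊Real.exp (L / 2)⌋₊ ∪ S.dyad L 0 := by
    ext p
    simp only [Finset.mem_union, mem_primes, mem_dyad, Nat.le_floor_iff (Real.exp_pos _).le]
    have : Real.exp (L / 2) ≤ Real.exp L := Real.exp_le_exp.2 (by linarith)
    simp only [zero_add, pow_one, pow_zero, div_one]
    constructor
    · intro h
      rcases le_or_gt (S.N p : ℝ) (Real.exp (L / 2)) with h' | h'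
      exacts [Or.inl h', Or.inr ⟨h', h⟩]
    · rintro (h | h)
      exacts [h.trans this, h.2]
  have h2 : Disjoint (S.primes ⌊Real.exp (L / 2)⌋₊) (S.dyad L 0) := by
    rw [Finset.disjoint_left]
    intro p hp hp'
    rw [mem_dyad] at hp'
    rw [mem_primes, Nat.le_floor_iff (Real.exp_pos _).le] at hp
    simp only [zero_add, pow_one] at hp'
    linarith [hp'.1]
  rw [rho, rho, h1, S.dens_union h2]
  have h3 := S.dens_dyad hL 0
  have h4 : Real.exp 160 * Real.exp (-160) = 1 := by rw [← Real.exp_add]; simp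
  have h5 := S.dens_pos (S.primes ⌊Real.exp (L / 2)⌋₊)
  have hc := S.c_pos
  calc _ = Real.exp 160 * (S.dens (S.primes ⌊Real.exp (L / 2)⌋₊) * Real.exp (-160) * S.c) := by
        linear_combination (-S.dens (S.primes ⌊Real.exp (L / 2)⌋₊) * S.c) * h4
    _ ≤ _ := by gcongr

theorem rho_div (S : Sys P G) {L : ℝ} (hL : 0 < L) (n : ℕ) :
    S.rho (L / 2 ^ n) ≤ Real.exp (160 * n) * S.rho L := by
  induction n with
  | zero => simp
  | succ n ih =>
    have h := S.rho_half (L := L / 2 ^ n) (by positivity)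
    rw [pow_succ, ← div_div]
    refine h.trans ?_
    calc _ ≤ Real.exp 160 * (Real.exp (160 * n) * S.rho L) := by gcongr
      _ = _ := by rw [← mul_assoc, ← Real.exp_add]; congr 2; push_cast; ring

/-- error in the fundamental lemma for large `u` -/
noncomputable def CF0 : ℝ := 8 * KB * Real.exp 200 * Real.exp (4 * KB * Real.exp 200) + 1

/-- constant in the fundamental lemma -/
noncomputable def CF : ℝ := ((1 + CF0) * Real.exp (160 * 7) + 1) * Real.exp 200

theorem CF0_pos : 0 < CF0 := by have := KB_pos; unfold CF0; positivity

theorem CF_ge : CF0 ≤ CF := by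
  have h := CF0_pos
  have h1 : 1 ≤ Real.exp (160 * 7) := Real.one_le_exp (by norm_num)
  have h2 : (1:ℝ) ≤ Real.exp 200 := Real.one_le_exp (by norm_num)
  unfold CF
  have h3 : CF0 ≤ ((1 + CF0) * Real.exp (160 * 7) + 1) := by nlinarith
  nlinarith

theorem CF_pos : 0 < CF := CF0_pos.trans_le CF_ge

/-- fundamental lemma of the sieve -/
theorem fund (S : Sys P G) {L u : ℝ} (hL : 300000 ≤ L) (hq : 128 * Real.log S.Q ≤ L) (hu : 1 ≤ u)
    (g : G) :
    |S.R L g (Real.exp (u * L)) - S.rho L * Real.exp (u * L)| ≤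
      CF * Real.exp (-2 * u) * (S.rho L * Real.exp (u * L)) := by
  have hQ : 0 < Real.log S.Q := Real.log_pos (by linarith [S.two_le_Q])
  have hρ := S.rho_pos L
  have hX := Real.exp_pos (u * L)
  rcases le_or_gt 100 u with h | h
  · refine (S.fund_large (by linarith) (by linarith) h g).trans ?_
    have := CF_ge
    unfold CF0 at this
    gcongr
  · have h1 := S.fund_large (L := L / 2 ^ 7) (u := 128 * u) (by norm_num; linarith)
      (by norm_num; linarith) (by linarith) g
    have h2 : 128 * u * (L / 2 ^ 7) = u * L := by ring
    rw [h2] at h1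
    have h3 : S.R L g (Real.exp (u * L)) ≤ S.R (L / 2 ^ 7) g (Real.exp (u * L)) := by
      refine S.cnt_anti (S.primes_mono (Nat.floor_le_floor (Real.exp_le_exp.2 ?_))) _ _
      exact div_le_self (by linarith) (by norm_num)
    have h4 := S.rho_div (L := L) (by linarith) 7
    have h0 : 0 ≤ S.R L g (Real.exp (u * L)) := S.cnt_nonneg _ _ _
    have h5 : Real.exp (-2 * (128 * u)) ≤ 1 := Real.exp_le_one_iff.2 (by linarith)
    have hρ' := S.rho_pos (L / 2 ^ 7)
    have hC := CF0_pos
    have h6 : S.R L g (Real.exp (u * L)) ≤ (1 + CF0) * Real.exp (160 * 7) * (S.rho L * Real.exp (u * L)) := by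
      have h7 := (abs_le.1 h1).2
      rw [← CF0] at h7
      have h8 : CF0 * Real.exp (-2 * (128 * u)) * (S.rho (L / 2 ^ 7) * Real.exp (u * L)) ≤
          CF0 * 1 * (S.rho (L / 2 ^ 7) * Real.exp (u * L)) := by gcongr
      calc _ ≤ (1 + CF0) * (S.rho (L / 2 ^ 7) * Real.exp (u * L)) := by linarith
        _ ≤ (1 + CF0) * ((Real.exp (160 * (7:ℕ)) * S.rho L) * Real.exp (u * L)) := by gcongr
        _ = _ := by push_cast; ring
    have h9 : 1 ≤ Real.exp 200 * Real.exp (-2 * u) := by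
      rw [← Real.exp_add]; exact Real.one_le_exp (by linarith)
    have hm : 0 < S.rho L * Real.exp (u * L) := by positivity
    have h10 : ((1 + CF0) * Real.exp (160 * 7) + 1) * (S.rho L * Real.exp (u * L)) ≤
        CF * Real.exp (-2 * u) * (S.rho L * Real.exp (u * L)) := by
      have e : CF * Real.exp (-2 * u) * (S.rho L * Real.exp (u * L)) =
        (((1 + CF0) * Real.exp (160 * 7) + 1) * (S.rho L * Real.exp (u * L))) *
          (Real.exp 200 * Real.exp (-2 * u)) := by unfold CF; ring
      rw [e]
      exact le_mul_of_one_le_right (by positivity) h9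
    refine le_trans ?_ h10
    have : 0 ≤ (1 + CF0) * Real.exp (160 * 7) * (S.rho L * Real.exp (u * L)) := by positivity
    rw [abs_le]; constructor <;> linarith

end Sys

namespace Sys

open scoped Classical

variable {P G : Type} [AddCommGroup G] [Fintype G]

theorem sum_inv_norm_le (S : Sys P G) (T : Finset P) : ∀ F : Finset (Multiset P),
    (∀ a ∈ F, ∀ p ∈ a, p ∈ T) → ∑ a ∈ F, 1 / (S.norm a : ℝ) ≤ (S.dens T)⁻¹ := by
  induction T using Finset.induction with
  | empty =>
    intro F hF
    have : F ⊆ {0} := by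
      intro a ha
      rw [Finset.mem_singleton]
      exact Multiset.eq_zero_of_forall_notMem fun p hp => by simpa using hF a ha p hp
    refine (Finset.sum_le_sum_of_subset_of_nonneg this fun _ _ _ => by positivity).trans ?_
    simp [dens]
  | insert p T hp ih =>
    intro F hF
    set F' := F.image fun a => a.filter (· ≠ p)
    set K := F.sup (fun a => a.count p) + 1
    have hN := S.N_pos p
    have hN2 : 1 / (S.N p : ℝ) ≤ 1 / 2 := S.N_inv_le p
    have hN0 : 0 ≤ 1 / (S.N p : ℝ) := S.N_inv_nonneg p
    have hdec : ∀ a : Multiset P, a = Multiset.replicate (a.count p) p + a.filter (· ≠ p) := by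
      intro a
      ext q
      rw [Multiset.count_add, Multiset.count_replicate, Multiset.count_filter]
      by_cases h : q = p
      · simp [h]
      · simp [h, Ne.symm h]
    have hnorm : ∀ a : Multiset P, 1 / (S.norm a : ℝ) =
        (1 / (S.N p : ℝ)) ^ (a.count p) * (1 / (S.norm (a.filter (· ≠ p)) : ℝ)) := by
      intro a
      conv_lhs => rw [hdec a]
      rw [norm_add]
      simp [norm, mul_comm]
    have hF' := ih F' (by
      intro a ha q hq
      obtain ⟨b, hb, rfl⟩ := Finset.mem_image.1 ha
      rw [Multiset.mem_filter] at hq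
      exact (Finset.mem_insert.1 (hF b hb q hq.1)).resolve_left hq.2)
    have h1 : ∑ a ∈ F, 1 / (S.norm a : ℝ) ≤
        ∑ x ∈ Finset.range K ×ˢ F', (1 / (S.N p : ℝ)) ^ x.1 * (1 / (S.norm x.2 : ℝ)) := by
      have hinj : Set.InjOn (fun a : Multiset P => (a.count p, a.filter (· ≠ p))) F := by
        intro a _ b _ hab
        simp only [Prod.mk.injEq] at hab
        rw [hdec a, hdec b, hab.1, hab.2]
      calc _ = ∑ x ∈ F.image (fun a : Multiset P => (a.count p, a.filter (· ≠ p))),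
            (1 / (S.N p : ℝ)) ^ x.1 * (1 / (S.norm x.2 : ℝ)) := by
            rw [Finset.sum_image hinj]
            exact Finset.sum_congr rfl fun a _ => hnorm a
        _ ≤ _ := by
            refine Finset.sum_le_sum_of_subset_of_nonneg ?_ fun _ _ _ => by positivity
            intro x hx
            obtain ⟨a, ha, rfl⟩ := Finset.mem_image.1 hx
            rw [Finset.mem_product, Finset.mem_range]
            exact ⟨Nat.lt_succ_of_le (Finset.le_sup (f := fun a => a.count p) ha),
              Finset.mem_image_of_mem _ ha⟩
    refine h1.trans ?_
    rw [Finset.sum_product, dens, Finset.prod_insert hp, mul_inv]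
    simp_rw [← Finset.mul_sum]
    rw [← Finset.sum_mul]
    refine mul_le_mul ?_ hF' (Finset.sum_nonneg fun _ _ => by positivity)
      (inv_nonneg.2 (by linarith))
    have hg := geom_sum_eq (x := 1 / (S.N p : ℝ)) (by linarith) K
    rw [hg, ← neg_div_neg_eq, neg_sub, neg_sub, ← one_div]
    have : 0 ≤ (1 / (S.N p : ℝ)) ^ K := by positivity
    exact div_le_div_of_nonneg_right (by linarith) (by linarith)

theorem sum_inv_ball_ge (S : Sys P G) {L : ℝ} (hL : 100 ≤ L) (hq : 100 * Real.log S.Q ≤ L) (g : G) :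
    S.c * L / 12 ≤ ∑ a ∈ S.ball g (Real.exp L), 1 / (S.norm a : ℝ) := by
  have hQ : 0 < S.Q := by linarith [S.two_le_Q]
  have hc := S.c_pos
  have hX := Real.exp_pos L
  set J := Finset.Ico ⌈L / 2⌉₊ ⌊L⌋₊
  have hfl1 := Nat.ceil_lt_add_one (by linarith : 0 ≤ L / 2)
  have hfl2 := Nat.lt_floor_add_one L
  have hJ : L / 4 ≤ (J.card : ℝ) := by
    rw [Nat.card_Ico, Nat.cast_sub]
    · linarith
    · have : ((⌈L / 2⌉₊ : ℕ) : ℝ) < ⌊L⌋₊ := by linarith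
      exact_mod_cast this.le
  have he1 := Real.exp_one_gt_d9
  have he2 := Real.exp_one_lt_d9
  have hshell : ∀ j ∈ J, S.c / 3 ≤
      ∑ a ∈ S.ball g (Real.exp L) with ⌈Real.log (S.norm a)⌉₊ = j + 1, 1 / (S.norm a : ℝ) := by
    intro j hj
    rw [Finset.mem_Ico] at hj
    have hj1 : L / 2 ≤ j := Nat.ceil_le.1 hj.1
    have hj2 : (j:ℝ) + 1 ≤ L := by
      have := (Nat.le_floor_iff (by linarith : 0 ≤ L)).1 (Nat.succ_le_of_lt hj.2)
      push_cast at this; exact this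
    have hsub : S.ball g (Real.exp (j + 1)) \ S.ball g (Real.exp j) ⊆
        (S.ball g (Real.exp L)).filter fun a => ⌈Real.log (S.norm a)⌉₊ = j + 1 := by
      intro a ha
      rw [Finset.mem_sdiff, S.mem_ball (Real.exp_pos _).le, S.mem_ball (Real.exp_pos _).le] at ha
      obtain ⟨⟨h1, h2⟩, h3⟩ := ha
      have h3' : Real.exp j < S.norm a := by
        by_contra h; exact h3 ⟨not_lt.1 h, h2⟩
      rw [Finset.mem_filter, S.mem_ball hX.le]
      refine ⟨⟨h1.trans (Real.exp_le_exp.2 hj2), h2⟩, ?_⟩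
      rw [Nat.ceil_eq_iff (Nat.succ_ne_zero _)]
      push_cast
      have hn := S.norm_pos' a
      exact ⟨by simpa using (Real.lt_log_iff_exp_lt hn).2 h3',
        (Real.log_le_iff_le_exp hn).2 h1⟩
    have hcard : S.c * Real.exp j ≤
        ((S.ball g (Real.exp (j + 1)) \ S.ball g (Real.exp j)).card : ℝ) := by
      have hss : S.ball g (Real.exp j) ⊆ S.ball g (Real.exp (j + 1)) := by
        intro a
        rw [S.mem_ball (Real.exp_pos _).le, S.mem_ball (Real.exp_pos _).le]
        rintro ⟨h1, h2⟩
        exact ⟨h1.trans (Real.exp_le_exp.2 (by linarith)), h2⟩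
      rw [Finset.card_sdiff_of_subset hss, Nat.cast_sub (Finset.card_le_card hss)]
      have h1 := (abs_le.1 (S.card_ball g (Real.exp_pos ((j:ℝ) + 1)).le)).1
      have h2 := (abs_le.1 (S.card_ball g (Real.exp_pos (j:ℝ)).le)).2
      have hs : √(Real.exp j) = Real.exp (j / 2) := by
        rw [Real.sqrt_eq_iff_mul_self_eq (by positivity) (by positivity), ← Real.exp_add]
        congr 1; ring
      have hs' : √(Real.exp (j + 1)) ≤ 2 * Real.exp (j / 2) := by
        rw [Real.sqrt_le_left (by positivity), mul_pow, ← hs, Real.sq_sqrt (Real.exp_pos _).le,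
          Real.exp_add]
        nlinarith [Real.exp_pos (j:ℝ)]
      rw [hs] at h2
      have hbig : 5 * S.Q * Real.exp (j / 2) ≤ S.c * Real.exp j := by
        have hce : Real.exp (-Real.log S.Q) ≤ S.c := by
          rw [Real.exp_neg, Real.exp_log hQ]; exact S.inv_le_c
        have h5 : (5:ℝ) ≤ Real.exp 4 := by linarith [Real.add_one_le_exp (4:ℝ)]
        calc 5 * S.Q * Real.exp (j / 2) ≤ Real.exp 4 * Real.exp (Real.log S.Q) * Real.exp (j / 2) := by
              rw [Real.exp_log hQ]; gcongr
          _ = Real.exp (4 + Real.log S.Q + j / 2) := by rw [← Real.exp_add, ← Real.exp_add]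
          _ ≤ Real.exp (-Real.log S.Q + j) := Real.exp_le_exp.2 (by linarith)
          _ = Real.exp (-Real.log S.Q) * Real.exp j := Real.exp_add _ _
          _ ≤ _ := by gcongr
      have h3 : S.Q * √(Real.exp (j + 1)) ≤ S.Q * (2 * Real.exp (j / 2)) := by gcongr
      have h4 : S.c * Real.exp (j + 1) ≥ S.c * Real.exp j * 2.7 := by
        rw [Real.exp_add, ← mul_assoc]; gcongr; linarith
      linarith
    have hej := Real.exp_pos (j:ℝ)
    calc S.c / 3 ≤ (S.c * Real.exp j) * (1 / Real.exp (j + 1)) := by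
          rw [Real.exp_add, div_eq_mul_one_div, mul_assoc]
          refine mul_le_mul_of_nonneg_left ?_ hc.le
          rw [mul_one_div, ← div_div, div_self hej.ne']
          exact one_div_le_one_div_of_le (by linarith) (by linarith)
      _ ≤ (S.ball g (Real.exp (j + 1)) \ S.ball g (Real.exp j)).card * (1 / Real.exp (j + 1)) := by
          gcongr
      _ = ∑ a ∈ S.ball g (Real.exp (j + 1)) \ S.ball g (Real.exp j), 1 / Real.exp (j + 1) := by
          rw [Finset.sum_const, nsmul_eq_mul]
      _ ≤ ∑ a ∈ S.ball g (Real.exp (j + 1)) \ S.ball g (Real.exp j), 1 / (S.norm a : ℝ) := by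
          refine Finset.sum_le_sum fun a ha => ?_
          rw [Finset.mem_sdiff, S.mem_ball (Real.exp_pos _).le] at ha
          exact one_div_le_one_div_of_le (S.norm_pos' a) ha.1.1
      _ ≤ _ := Finset.sum_le_sum_of_subset_of_nonneg hsub fun _ _ _ => by positivity
  calc S.c * L / 12 ≤ J.card * (S.c / 3) := by nlinarith
    _ = ∑ j ∈ J, S.c / 3 := by rw [Finset.sum_const, nsmul_eq_mul]
    _ ≤ ∑ j ∈ J, ∑ a ∈ S.ball g (Real.exp L) with ⌈Real.log (S.norm a)⌉₊ = j + 1,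
          1 / (S.norm a : ℝ) := Finset.sum_le_sum hshell
    _ = ∑ j ∈ J.image (· + 1), ∑ a ∈ S.ball g (Real.exp L) with ⌈Real.log (S.norm a)⌉₊ = j,
          1 / (S.norm a : ℝ) := by
        rw [Finset.sum_image (fun a _ b _ h => Nat.succ_injective h)]
    _ ≤ _ := by
        rw [Finset.sum_fiberwise_eq_sum_filter]
        exact Finset.sum_le_sum_of_subset_of_nonneg (Finset.filter_subset _ _)
          fun _ _ _ => by positivity

/-- upper bound for the density of rough ideals -/
theorem rho_le (S : Sys P G) {L : ℝ} (hL : 100 ≤ L) (hq : 100 * Real.log S.Q ≤ L) :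
    (Fintype.card G : ℝ) * S.rho L * L ≤ 12 := by
  have h1 := S.sum_inv_norm_le (S.primes ⌊Real.exp L⌋₊) (S.upto ⌊Real.exp L⌋₊) (by
    intro a ha p hp
    rw [mem_upto] at ha
    rw [mem_primes]
    exact (S.N_le_norm hp).trans ha)
  have h2 : ∑ a ∈ S.upto ⌊Real.exp L⌋₊, 1 / (S.norm a : ℝ) =
      ∑ g, ∑ a ∈ S.ball g (Real.exp L), 1 / (S.norm a : ℝ) := by
    rw [← Finset.sum_fiberwise _ S.cls]; rfl
  have h3 : (Fintype.card G : ℝ) * (S.c * L / 12) ≤ (S.dens (S.primes ⌊Real.exp L⌋₊))⁻¹ := by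
    refine le_trans ?_ (h2 ▸ h1)
    rw [← nsmul_eq_mul, ← Finset.card_univ, ← Finset.sum_const]
    exact Finset.sum_le_sum fun g _ => S.sum_inv_ball_ge hL hq g
  rw [rho]
  have hd := S.dens_pos (S.primes ⌊Real.exp L⌋₊)
  rw [← one_div, le_div_iff₀ hd] at h3
  linarith

theorem card_le (S : Sys P G) : (Fintype.card G : ℝ) ≤ Real.exp (10000 * Real.log S.Q) := by
  have hQ : 0 < S.Q := by linarith [S.two_le_Q]
  have hq : Real.log 2 ≤ Real.log S.Q := Real.log_le_log (by norm_num) S.two_le_Q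
  have h2 := Real.log_two_gt_d9
  have h := S.rho_le (L := 1000 * Real.log S.Q) (by linarith) (by linarith)
  have h3 := S.dens_primes_ge (L := 1000 * Real.log S.Q) (by linarith)
  have hce : Real.exp (-Real.log S.Q) ≤ S.c := by
    rw [Real.exp_neg, Real.exp_log hQ]; exact S.inv_le_c
  have h4 : Real.exp (-(1001 * Real.log S.Q + 1600)) ≤ S.rho (1000 * Real.log S.Q) := by
    rw [rho]
    calc _ = Real.exp (-(1000 * Real.log S.Q) - 1600) * Real.exp (-Real.log S.Q) := by
          rw [← Real.exp_add]; congr 1; ring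
      _ ≤ _ := mul_le_mul h3 hce (Real.exp_pos _).le (S.dens_pos _).le
  have h5 : (Fintype.card G : ℝ) * Real.exp (-(1001 * Real.log S.Q + 1600)) ≤ 1 := by
    have : (Fintype.card G : ℝ) * Real.exp (-(1001 * Real.log S.Q + 1600)) ≤
      (Fintype.card G : ℝ) * S.rho (1000 * Real.log S.Q) := by gcongr
    have h6 : 0 ≤ (Fintype.card G : ℝ) * S.rho (1000 * Real.log S.Q) :=
      mul_nonneg (by positivity) (S.rho_pos _).le
    nlinarith
  rw [Real.exp_neg, ← div_eq_mul_inv, div_le_one (Real.exp_pos _)] at h5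
  exact h5.trans (Real.exp_le_exp.2 (by linarith))

end Sys

namespace Sys

open scoped Classical

variable {P G : Type} [AddCommGroup G] [Fintype G]

/-- primes removed at level `L` -/
noncomputable def lev (S : Sys P G) (L : ℝ) : Finset P := S.primes ⌊Real.exp L⌋₊

theorem mem_lev (S : Sys P G) {L : ℝ} {p : P} : p ∈ S.lev L ↔ (S.N p : ℝ) ≤ Real.exp L := by
  rw [lev, mem_primes, Nat.le_floor_iff (Real.exp_pos _).le]

/-- rough ideals of given norm and class -/
noncomputable def bset (S : Sys P G) (L : ℝ) (g : G) (n : ℕ) : Finset (Multiset P) :=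
  (S.upto n).filter fun a => S.norm a = n ∧ S.cls a = g ∧ ∀ p ∈ a, p ∉ S.lev L

theorem mem_bset (S : Sys P G) {L : ℝ} {g : G} {n : ℕ} {a : Multiset P} :
    a ∈ S.bset L g n ↔ S.norm a = n ∧ S.cls a = g ∧ ∀ p ∈ a, p ∉ S.lev L := by
  rw [bset, Finset.mem_filter, mem_upto]
  exact ⟨fun h => h.2, fun h => ⟨h.1.le, h⟩⟩

/-- number of rough ideals of given norm and class -/
noncomputable def bb (S : Sys P G) (L : ℝ) (g : G) (n : ℕ) : ℝ := (S.bset L g n).card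

theorem bb_nonneg (S : Sys P G) (L : ℝ) (g : G) (n : ℕ) : 0 ≤ S.bb L g n := by
  unfold bb; positivity

theorem bb_one (S : Sys P G) (L : ℝ) (g : G) : S.bb L g 1 = if g = 0 then 1 else 0 := by
  have : S.bset L g 1 = if g = 0 then {0} else ∅ := by
    ext a
    rw [mem_bset, norm_eq_one]
    split_ifs with h
    · rw [Finset.mem_singleton]
      exact ⟨fun h => h.1, fun h' => by subst h'; simp [h]⟩
    · simp only [Finset.notMem_empty, iff_false]
      rintro ⟨rfl, h1, -⟩
      exact h (by simpa using h1.symm)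
  rw [bb, this]
  split_ifs <;> simp

theorem bb_zero (S : Sys P G) (L : ℝ) (g : G) : S.bb L g 0 = 0 := by
  have : S.bset L g 0 = ∅ := by
    ext a
    rw [mem_bset]
    simp only [Finset.notMem_empty, iff_false]
    rintro ⟨h, -⟩
    exact (S.norm_pos a).ne' h
  simp [bb, this]

theorem bb_eq_zero (S : Sys P G) {L : ℝ} (g : G) {n : ℕ} (h1 : 1 < n) (h : (n:ℝ) ≤ Real.exp L) :
    S.bb L g n = 0 := by
  have : S.bset L g n = ∅ := by
    ext a
    rw [mem_bset]
    simp only [Finset.notMem_empty, iff_false]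
    rintro ⟨h2, -, h3⟩
    have hne : a ≠ 0 := fun h0 => by rw [h0] at h2; simp at h2; omega
    obtain ⟨p, hp⟩ := Multiset.exists_mem_of_ne_zero hne
    refine h3 p hp (S.mem_lev.2 (le_trans ?_ h))
    exact_mod_cast h2 ▸ S.N_le_norm hp
  simp [bb, this]

theorem R_eq (S : Sys P G) (L : ℝ) (g : G) {X : ℝ} (hX : 0 ≤ X) :
    S.R L g X = ∑ n ∈ Finset.Icc 0 ⌊X⌋₊, S.bb L g n := by
  rw [R, cnt]
  have h1 : ∀ a : Multiset P, rough (S.primes ⌊Real.exp L⌋₊) a =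
      if ∀ p ∈ a, p ∉ S.lev L then 1 else 0 := fun a => rough_eq _ _
  simp only [h1]
  rw [← Finset.sum_filter, Finset.sum_const, nsmul_eq_mul, mul_one]
  unfold bb
  rw [← Nat.cast_sum, ← Finset.card_biUnion]
  · congr 2
    ext a
    rw [Finset.mem_filter, S.mem_ball hX, Finset.mem_biUnion]
    simp only [mem_bset, Finset.mem_Icc]
    constructor
    · rintro ⟨⟨h1, h2⟩, h3⟩
      exact ⟨S.norm a, ⟨Nat.zero_le _, Nat.le_floor h1⟩, rfl, h2, h3⟩
    · rintro ⟨n, ⟨-, h1⟩, h2, h3, h4⟩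
      subst h2
      exact ⟨⟨(Nat.le_floor_iff hX).1 h1, h3⟩, h4⟩
  · intro m _ n _ hmn
    rw [Function.onFun, Finset.disjoint_left]
    intro a h1 h2
    rw [mem_bset] at h1 h2
    exact hmn (h1.1.symm.trans h2.1)

/-- von Mangoldt function of rough ideals in a class -/
noncomputable def Lam (S : Sys P G) (L : ℝ) (g : G) (n : ℕ) : ℝ :=
  ∑ p ∈ S.primes n \ S.lev L, ∑ j ∈ Finset.Icc 1 n,
    if S.N p ^ j = n ∧ j • S.cl p = g then Real.log (S.N p) else 0

theorem log_N_nonneg (S : Sys P G) (p : P) : 0 ≤ Real.log (S.N p) :=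
  Real.log_nonneg (by exact_mod_cast (by have := S.two_le_N p; omega : 1 ≤ S.N p))

theorem Lam_nonneg (S : Sys P G) (L : ℝ) (g : G) (n : ℕ) : 0 ≤ S.Lam L g n :=
  Finset.sum_nonneg fun p _ => Finset.sum_nonneg fun j _ => by
    split_ifs; exacts [S.log_N_nonneg p, le_rfl]

theorem Lam_eq_of_le (S : Sys P G) (L : ℝ) (g : G) {m n : ℕ} (hmn : m ≤ n) :
    S.Lam L g m = ∑ p ∈ S.primes n \ S.lev L, ∑ j ∈ Finset.Icc 1 n,
      if S.N p ^ j = m ∧ j • S.cl p = g then Real.log (S.N p) else 0 := by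
  rw [Lam]
  have hj : ∀ p : P, ∀ j, S.N p ^ j = m → j ≤ m := fun p j h => by
    rw [← h]; exact (Nat.lt_pow_self (S.two_le_N p)).le
  calc _ = ∑ p ∈ S.primes m \ S.lev L, ∑ j ∈ Finset.Icc 1 n,
      if S.N p ^ j = m ∧ j • S.cl p = g then Real.log (S.N p) else 0 := by
        refine Finset.sum_congr rfl fun p _ => ?_
        refine Finset.sum_subset (Finset.Icc_subset_Icc_right hmn) fun j hj1 hj2 => ?_
        rw [if_neg]
        rintro ⟨h, -⟩
        rw [Finset.mem_Icc] at hj1 hj2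
        exact hj2 ⟨hj1.1, hj p j h⟩
    _ = _ := by
        refine Finset.sum_subset (Finset.sdiff_subset_sdiff (S.primes_mono hmn) subset_rfl) ?_
        intro p hp1 hp2
        refine Finset.sum_eq_zero fun j hj1 => ?_
        rw [if_neg]
        rintro ⟨h, -⟩
        rw [Finset.mem_sdiff] at hp1 hp2
        refine hp2 ⟨S.mem_primes.2 ?_, hp1.2⟩
        rw [← h]
        exact Nat.le_self_pow (by rw [Finset.mem_Icc] at hj1; omega) _

theorem log_norm (S : Sys P G) (a : Multiset P) (T : Finset P) (hT : ∀ p ∈ a, p ∈ T) (n : ℕ)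
    (hn : ∀ p ∈ a, a.count p ≤ n) :
    Real.log (S.norm a) = ∑ p ∈ T, ∑ j ∈ Finset.Icc 1 n,
      if Multiset.replicate j p ≤ a then Real.log (S.N p) else 0 := by
  have h1 : ∀ p ∈ T, ∑ j ∈ Finset.Icc 1 n,
      (if Multiset.replicate j p ≤ a then Real.log (S.N p) else 0) =
      a.count p * Real.log (S.N p) := by
    intro p _
    simp only [← Multiset.le_count_iff_replicate_le]
    rw [← Finset.sum_filter, Finset.sum_const, nsmul_eq_mul]
    congr 2
    have : (Finset.Icc 1 n).filter (fun j => j ≤ a.count p) = Finset.Icc 1 (a.count p) := by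
      ext j
      rw [Finset.mem_filter, Finset.mem_Icc, Finset.mem_Icc]
      constructor
      · rintro ⟨⟨h1, h2⟩, h3⟩; exact ⟨h1, h3⟩
      · rintro ⟨h1, h2⟩
        have hp : p ∈ a := Multiset.count_pos.1 (by omega)
        exact ⟨⟨h1, h2.trans (hn p hp)⟩, h2⟩
    rw [this]; simp
  rw [Finset.sum_congr rfl h1, norm, Finset.prod_multiset_map_count, Nat.cast_prod, Real.log_prod]
  · calc _ = ∑ p ∈ a.toFinset, (a.count p : ℝ) * Real.log (S.N p) := by
          refine Finset.sum_congr rfl fun p _ => ?_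
          rw [Nat.cast_pow, Real.log_pow]
      _ = _ := by
          refine Finset.sum_subset (fun p hp => hT p (Multiset.mem_toFinset.1 hp)) fun p _ hp => ?_
          rw [Multiset.mem_toFinset] at hp
          rw [Multiset.count_eq_zero.2 hp]; simp
  · intro p _
    have := S.N_pos p
    push_cast
    positivity

theorem conv (S : Sys P G) (L : ℝ) (g : G) {n : ℕ} (hn : n ≠ 0) :
    Real.log n * S.bb L g n =
      ∑ x ∈ n.divisorsAntidiagonal, ∑ g', S.Lam L g' x.1 * S.bb L (g - g') x.2 := by
  set T := S.primes n \ S.lev L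
  have hA : ∀ p ∈ T, ∀ j ∈ Finset.Icc 1 n,
      ∑ x ∈ n.divisorsAntidiagonal, (if S.N p ^ j = x.1 then
        Real.log (S.N p) * S.bb L (g - j • S.cl p) x.2 else 0) =
      ∑ a ∈ S.bset L g n, if Multiset.replicate j p ≤ a then Real.log (S.N p) else 0 := by
    intro p hp j hj
    rw [Finset.mem_sdiff] at hp
    have hrep : ∀ a, Multiset.replicate j p ≤ a → S.N p ^ j ∣ S.norm a := by
      intro a ha
      obtain ⟨d, rfl⟩ := Multiset.le_iff_exists_add.1 ha
      rw [norm_add]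
      exact ⟨S.norm d, by simp [norm]⟩
    by_cases hd : S.N p ^ j ∣ n
    · obtain ⟨e, he⟩ := hd
      rw [Finset.sum_eq_single (S.N p ^ j, e)]
      · rw [if_pos rfl, ← Finset.sum_filter, Finset.sum_const, nsmul_eq_mul, mul_comm]
        congr 1
        rw [bb, Nat.cast_inj]
        refine Finset.card_bij (fun a _ => Multiset.replicate j p + a) ?_ ?_ ?_
        · intro a ha
          rw [mem_bset] at ha
          rw [Finset.mem_filter, mem_bset, norm_add, cls_add, ha.1, ha.2.1]
          refine ⟨⟨by simp [norm, he], by simp [cls], ?_⟩, Multiset.le_add_right _ _⟩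
          intro q hq
          rcases Multiset.mem_add.1 hq with h | h
          · rw [Multiset.eq_of_mem_replicate h]; exact hp.2
          · exact ha.2.2 q h
        · intro a _ b _ h
          exact add_left_cancel h
        · intro b hb
          rw [Finset.mem_filter, mem_bset] at hb
          obtain ⟨⟨h1, h2, h3⟩, h4⟩ := hb
          obtain ⟨a, rfl⟩ := Multiset.le_iff_exists_add.1 h4
          refine ⟨a, ?_, rfl⟩
          rw [mem_bset]
          refine ⟨?_, ?_, fun q hq => h3 q (Multiset.mem_add.2 (Or.inr hq))⟩
          · rw [norm_add, he] at h1
            have : S.norm (Multiset.replicate j p) = S.N p ^ j := by simp [norm]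
            rw [this] at h1
            exact Nat.eq_of_mul_eq_mul_left (pow_pos (by have := S.two_le_N p; omega) j) h1
          · rw [← h2, cls_add]; simp [cls]
      · intro x hx hne
        rw [if_neg]
        intro h
        apply hne
        rw [Nat.mem_divisorsAntidiagonal] at hx
        ext
        · exact h.symm
        · have : S.N p ^ j * x.2 = S.N p ^ j * e := by rw [← he, ← hx.1, h]
          exact Nat.eq_of_mul_eq_mul_left (pow_pos (by have := S.two_le_N p; omega) j) this
      · intro h
        exact absurd (Nat.mem_divisorsAntidiagonal.2 ⟨he.symm, hn⟩) h
    · rw [Finset.sum_eq_zero, Finset.sum_eq_zero]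
      · intro a ha
        rw [mem_bset] at ha
        rw [if_neg]
        exact fun h => hd (ha.1 ▸ hrep a h)
      · intro x hx
        rw [if_neg]
        intro h
        rw [Nat.mem_divisorsAntidiagonal] at hx
        exact hd (h ▸ Dvd.intro _ hx.1)
  have hL : Real.log n * S.bb L g n = ∑ p ∈ T, ∑ j ∈ Finset.Icc 1 n, ∑ a ∈ S.bset L g n,
      if Multiset.replicate j p ≤ a then Real.log (S.N p) else 0 := by
    calc _ = ∑ a ∈ S.bset L g n, Real.log (S.norm a) := by
          rw [bb, mul_comm, ← nsmul_eq_mul, ← Finset.sum_const]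
          refine Finset.sum_congr rfl fun a ha => ?_
          rw [(S.mem_bset.1 ha).1]
      _ = ∑ a ∈ S.bset L g n, ∑ p ∈ T, ∑ j ∈ Finset.Icc 1 n,
          if Multiset.replicate j p ≤ a then Real.log (S.N p) else 0 := by
          refine Finset.sum_congr rfl fun a ha => ?_
          rw [mem_bset] at ha
          refine S.log_norm a T (fun p hp => ?_) n fun p _ => ?_
          · rw [Finset.mem_sdiff, mem_primes]
            exact ⟨ha.1 ▸ S.N_le_norm hp, ha.2.2 p hp⟩
          · have h1 := S.two_pow_card_le a
            have h2 := Multiset.count_le_card p a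
            have h3 := Nat.lt_two_pow_self (n := a.card)
            rw [ha.1] at h1
            omega
      _ = _ := by
          rw [Finset.sum_comm]
          exact Finset.sum_congr rfl fun p _ => Finset.sum_comm
  rw [hL]
  have hR : ∀ x ∈ n.divisorsAntidiagonal, ∑ g', S.Lam L g' x.1 * S.bb L (g - g') x.2 =
      ∑ p ∈ T, ∑ j ∈ Finset.Icc 1 n, if S.N p ^ j = x.1 then
        Real.log (S.N p) * S.bb L (g - j • S.cl p) x.2 else 0 := by
    intro x hx
    rw [Nat.mem_divisorsAntidiagonal] at hx
    have hx2 : x.1 ≤ n := Nat.le_of_dvd (Nat.pos_of_ne_zero hn) (Dvd.intro _ hx.1)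
    simp only [S.Lam_eq_of_le L _ hx2, Finset.sum_mul]
    rw [Finset.sum_comm]
    refine Finset.sum_congr rfl fun p _ => ?_
    rw [Finset.sum_comm]
    refine Finset.sum_congr rfl fun j _ => ?_
    rw [Finset.sum_eq_single (j • S.cl p)]
    · simp only [and_true, ite_mul, zero_mul]
    · intro g' _ hne
      rw [if_neg (fun h => hne h.2.symm), zero_mul]
    · simp
  rw [Finset.sum_congr rfl hR]
  refine Eq.trans ?_ Finset.sum_comm
  refine Finset.sum_congr rfl fun p hp => ?_
  refine Eq.trans ?_ Finset.sum_comm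
  exact Finset.sum_congr rfl fun j hj => (hA p hp j hj).symm

end Sys

open scoped Classical in
theorem nonprime_sum_aux : ∃ C : ℝ, 0 < C ∧ ∀ N : ℕ,
    ∑ n ∈ Finset.Ioc 0 N, (if n.Prime then 0 else ArithmeticFunction.vonMangoldt n) *
      (n:ℝ) ^ (-(3/4):ℝ) ≤ C := by
  have hs : Summable fun n : ℕ => (n:ℝ) ^ (-(5/4):ℝ) :=
    Real.summable_nat_rpow.2 (by norm_num)
  refine ⟨(∑' n : ℕ, (n:ℝ) ^ (-(5/4):ℝ)) * (4 * (1 - (2:ℝ) ^ (-(3/4):ℝ))⁻¹) + 1, ?_, fun N => ?_⟩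
  · have h2 : (2:ℝ) ^ (-(3/4):ℝ) < 1 := Real.rpow_lt_one_of_one_lt_of_neg (by norm_num) (by norm_num)
    have : 0 ≤ ∑' n : ℕ, (n:ℝ) ^ (-(5/4):ℝ) := tsum_nonneg fun n => by positivity
    have h3 : 0 < 1 - (2:ℝ) ^ (-(3/4):ℝ) := by linarith
    positivity
  have h2 : (2:ℝ) ^ (-(3/4):ℝ) < 1 := Real.rpow_lt_one_of_one_lt_of_neg (by norm_num) (by norm_num)
  have h3 : 0 < 1 - (2:ℝ) ^ (-(3/4):ℝ) := by linarith
  set D := Finset.Icc 2 N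
  have step1 : ∀ n ∈ Finset.Ioc 0 N, (if n.Prime then 0 else ArithmeticFunction.vonMangoldt n) *
      (n:ℝ) ^ (-(3/4):ℝ) ≤ ∑ p ∈ D, ∑ j ∈ D,
        if p ^ j = n then Real.log p * (n:ℝ) ^ (-(3/4):ℝ) else 0 := by
    intro n hn
    have hnn : ∀ p ∈ D, ∀ j ∈ D, 0 ≤ if p ^ j = n then Real.log p * (n:ℝ) ^ (-(3/4):ℝ) else 0 := by
      intro p hp j _
      split_ifs
      · have : 0 ≤ Real.log p := Real.log_natCast_nonneg p
        positivity
      · exact le_rfl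
    split_ifs with h
    · rw [zero_mul]
      exact Finset.sum_nonneg fun p hp => Finset.sum_nonneg fun j hj => hnn p hp j hj
    · by_cases hpp : IsPrimePow n
      · obtain ⟨p, j, hp, hj, rfl⟩ := (isPrimePow_nat_iff n).1 hpp
        rw [Finset.mem_Ioc] at hn
        have hj1 : j ≠ 1 := fun h1 => h (by rw [h1, pow_one]; exact hp)
        have hpN : p ≤ p ^ j := Nat.le_self_pow (by omega) _
        have hjN : j < p ^ j := Nat.lt_pow_self hp.one_lt
        have hpD : p ∈ D := by rw [Finset.mem_Icc]; exact ⟨hp.two_le, by omega⟩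
        have hjD : j ∈ D := by rw [Finset.mem_Icc]; exact ⟨by omega, by omega⟩
        refine le_trans ?_ (Finset.single_le_sum (f := fun q => ∑ i ∈ D,
          if q ^ i = p ^ j then Real.log q * ((p ^ j : ℕ):ℝ) ^ (-(3/4):ℝ) else 0)
          (fun q hq => Finset.sum_nonneg fun i hi => hnn q hq i hi) hpD)
        refine le_trans ?_ (Finset.single_le_sum (f := fun i =>
          if p ^ i = p ^ j then Real.log p * ((p ^ j : ℕ):ℝ) ^ (-(3/4):ℝ) else 0)
          (fun i hi => hnn p hpD i hi) hjD)
        rw [if_pos rfl, ArithmeticFunction.vonMangoldt_apply_pow (by omega),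
          ArithmeticFunction.vonMangoldt_apply_prime hp]
      · rw [ArithmeticFunction.vonMangoldt_eq_zero_iff.2 hpp, zero_mul]
        exact Finset.sum_nonneg fun p hp => Finset.sum_nonneg fun j hj => hnn p hp j hj
  have step2 : ∀ p ∈ D, ∑ j ∈ D, Real.log p * ((p ^ j : ℕ):ℝ) ^ (-(3/4):ℝ) ≤
      (p:ℝ) ^ (-(5/4):ℝ) * (4 * (1 - (2:ℝ) ^ (-(3/4):ℝ))⁻¹) := by
    intro p hp
    rw [Finset.mem_Icc] at hp
    have hp0 : (0:ℝ) < p := by exact_mod_cast (by omega : 0 < p)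
    have hp2 : (2:ℝ) ≤ p := by exact_mod_cast hp.1
    have hlog : Real.log p ≤ 4 * (p:ℝ) ^ (1/4:ℝ) := by
      have := Real.log_le_rpow_div hp0.le (show (0:ℝ) < 1/4 by norm_num)
      linarith
    have hq : (p:ℝ) ^ (-(3/4):ℝ) ≤ (2:ℝ) ^ (-(3/4):ℝ) :=
      Real.rpow_le_rpow_of_nonpos (by norm_num) hp2 (by norm_num)
    set q := (p:ℝ) ^ (-(3/4):ℝ)
    have hq0 : 0 < q := Real.rpow_pos_of_pos hp0 _
    have hpow : ∀ j : ℕ, ((p ^ j : ℕ):ℝ) ^ (-(3/4):ℝ) = q ^ j := by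
      intro j
      rw [Nat.cast_pow, ← Real.rpow_natCast, ← Real.rpow_mul hp0.le, mul_comm, Real.rpow_mul hp0.le,
        Real.rpow_natCast]
    simp only [hpow]
    rw [← Finset.mul_sum]
    have hg : ∑ j ∈ D, q ^ j ≤ q ^ 2 * (1 - (2:ℝ) ^ (-(3/4):ℝ))⁻¹ := by
      have h1 : ∑ j ∈ D, q ^ j = ∑ i ∈ Finset.range (N - 1), q ^ 2 * q ^ i := by
        have hD : D = Finset.Ico 2 (N + 1) := by ext; simp [D]
        rw [hD, Finset.sum_Ico_eq_sum_range]
        refine Finset.sum_congr (by congr 1) fun i _ => by rw [pow_add]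
      rw [h1, ← Finset.mul_sum]
      refine mul_le_mul_of_nonneg_left ?_ (by positivity)
      calc _ ≤ (1 - q)⁻¹ := by
            have hs := summable_geometric_of_lt_one hq0.le (by linarith : q < 1)
            have := hs.sum_le_tsum (Finset.range (N-1)) (fun i _ => by positivity)
            rwa [tsum_geometric_of_lt_one hq0.le (by linarith : q < 1)] at this
        _ ≤ _ := inv_anti₀ h3 (by linarith)
    calc _ ≤ (4 * (p:ℝ) ^ (1/4:ℝ)) * (q ^ 2 * (1 - (2:ℝ) ^ (-(3/4):ℝ))⁻¹) :=
          mul_le_mul hlog hg (Finset.sum_nonneg fun j _ => by positivity) (by positivity)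
      _ = _ := by
          have : (p:ℝ) ^ (-(5/4):ℝ) = (p:ℝ) ^ (1/4:ℝ) * q ^ 2 := by
            rw [sq, ← Real.rpow_add hp0, ← Real.rpow_add hp0]; norm_num
          rw [this]; ring
  calc _ ≤ ∑ n ∈ Finset.Ioc 0 N, ∑ p ∈ D, ∑ j ∈ D,
        (if p ^ j = n then Real.log p * (n:ℝ) ^ (-(3/4):ℝ) else 0) := Finset.sum_le_sum step1
    _ = ∑ p ∈ D, ∑ j ∈ D, ∑ n ∈ Finset.Ioc 0 N,
        (if p ^ j = n then Real.log p * (n:ℝ) ^ (-(3/4):ℝ) else 0) := by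
        rw [Finset.sum_comm]
        exact Finset.sum_congr rfl fun p _ => Finset.sum_comm
    _ ≤ ∑ p ∈ D, ∑ j ∈ D, Real.log p * ((p ^ j : ℕ):ℝ) ^ (-(3/4):ℝ) := by
        refine Finset.sum_le_sum fun p _ => Finset.sum_le_sum fun j _ => ?_
        rw [Finset.sum_ite_eq]
        split_ifs
        · exact le_rfl
        · have : 0 ≤ Real.log p := Real.log_natCast_nonneg p
          positivity
    _ ≤ ∑ p ∈ D, (p:ℝ) ^ (-(5/4):ℝ) * (4 * (1 - (2:ℝ) ^ (-(3/4):ℝ))⁻¹) := Finset.sum_le_sum step2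
    _ ≤ _ := by
        rw [← Finset.sum_mul]
        have := hs.sum_le_tsum D (fun i _ => by positivity)
        have h4 : 0 ≤ 4 * (1 - (2:ℝ) ^ (-(3/4):ℝ))⁻¹ := by positivity
        nlinarith

/-- the von Mangoldt function restricted to proper prime powers -/
noncomputable def properL (n : ℕ) : ℝ :=
  open scoped Classical in if n.Prime then 0 else ArithmeticFunction.vonMangoldt n

theorem properL_nonneg (n : ℕ) : 0 ≤ properL n := by
  unfold properL
  split_ifs
  exacts [le_rfl, ArithmeticFunction.vonMangoldt_nonneg]

theorem exists_properL_sum : ∃ C : ℝ, 0 < C ∧ ∀ (s : Finset ℕ) (Y : ℝ),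
    (∀ n ∈ s, Real.exp Y ≤ n) → ∑ n ∈ s, properL n / n ≤ C * Real.exp (-(Y/4)) := by
  obtain ⟨C, hC, h⟩ := nonprime_sum_aux
  refine ⟨C, hC, fun s Y hs => ?_⟩
  have h1 : ∀ n ∈ s, properL n / n ≤ properL n * (n:ℝ) ^ (-(3/4):ℝ) * Real.exp (-(Y/4)) := by
    intro n hn
    have hn0 : (0:ℝ) < n := lt_of_lt_of_le (Real.exp_pos _) (hs n hn)
    rw [mul_assoc, div_eq_mul_inv]
    refine mul_le_mul_of_nonneg_left ?_ (properL_nonneg n)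
    have h2 : Y ≤ Real.log n := (Real.le_log_iff_exp_le hn0).2 (hs n hn)
    rw [Real.rpow_def_of_pos hn0, ← Real.exp_add]
    nth_rw 1 [← Real.exp_log hn0]
    rw [← Real.exp_neg]
    exact Real.exp_le_exp.2 (by linarith)
  have hsub : s ⊆ Finset.Ioc 0 (s.sup id) := by
    intro n hn
    rw [Finset.mem_Ioc]
    refine ⟨?_, Finset.le_sup (f := id) hn⟩
    have : (0:ℝ) < n := lt_of_lt_of_le (Real.exp_pos _) (hs n hn)
    exact_mod_cast this
  calc _ ≤ ∑ n ∈ s, properL n * (n:ℝ) ^ (-(3/4):ℝ) * Real.exp (-(Y/4)) := Finset.sum_le_sum h1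
    _ = (∑ n ∈ s, properL n * (n:ℝ) ^ (-(3/4):ℝ)) * Real.exp (-(Y/4)) := by rw [Finset.sum_mul]
    _ ≤ _ := by
        refine mul_le_mul_of_nonneg_right ?_ (Real.exp_pos _).le
        refine le_trans (Finset.sum_le_sum_of_subset_of_nonneg hsub fun n _ _ => ?_) (h (s.sup id))
        have := properL_nonneg n
        positivity

namespace Sys

open scoped Classical

variable {P G : Type} [AddCommGroup G] [Fintype G]

theorem sum_Lam_eq (S : Sys P G) (L : ℝ) (n : ℕ) : ∑ g, S.Lam L g n =
    ∑ p ∈ S.primes n \ S.lev L, ∑ j ∈ Finset.Icc 1 n,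
      if S.N p ^ j = n then Real.log (S.N p) else 0 := by
  unfold Lam
  rw [Finset.sum_comm]
  refine Finset.sum_congr rfl fun p _ => ?_
  rw [Finset.sum_comm]
  refine Finset.sum_congr rfl fun j _ => ?_
  rw [Finset.sum_eq_single (j • S.cl p)]
  · simp
  · intro g' _ hne
    rw [if_neg (fun h => hne h.2.symm)]
  · simp

theorem sum_Lam_le (S : Sys P G) (L : ℝ) (n : ℕ) :
    ∑ g, S.Lam L g n ≤ 4 * ArithmeticFunction.vonMangoldt n := by
  rw [sum_Lam_eq]
  have key : ∀ p : P, ∀ j ∈ Finset.Icc 1 n, S.N p ^ j = n → S.below p = n.minFac ∧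
      Real.log (S.N p) ≤ 2 * ArithmeticFunction.vonMangoldt n := by
    intro p j hj h
    rw [Finset.mem_Icc] at hj
    have hp := S.prime_below p
    obtain ⟨i, hi, hi'⟩ : ∃ i, i ≠ 0 ∧ n = S.below p ^ i := by
      rcases S.N_eq p with h1 | h1
      · exact ⟨j, by omega, by rw [← h1, h]⟩
      · exact ⟨2 * j, by omega, by rw [pow_mul, ← h1, h]⟩
    have hb : S.below p = n.minFac := by rw [hi', Nat.Prime.pow_minFac hp hi]
    refine ⟨hb, ?_⟩
    rw [hi', ArithmeticFunction.vonMangoldt_apply_pow hi, ArithmeticFunction.vonMangoldt_apply_prime hp]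
    have h0 : 0 ≤ Real.log (S.below p) := Real.log_natCast_nonneg _
    rcases S.N_eq p with h1 | h1 <;> rw [h1]
    · linarith
    · push_cast
      rw [Real.log_pow]; push_cast; linarith
  have hL : 0 ≤ ArithmeticFunction.vonMangoldt n := ArithmeticFunction.vonMangoldt_nonneg
  have h1 : ∀ p ∈ S.primes n \ S.lev L, (∑ j ∈ Finset.Icc 1 n,
      if S.N p ^ j = n then Real.log (S.N p) else 0) ≤
      if S.below p = n.minFac then 2 * ArithmeticFunction.vonMangoldt n else 0 := by
    intro p _
    by_cases hex : ∃ j ∈ Finset.Icc 1 n, S.N p ^ j = n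
    · obtain ⟨j, hj, h⟩ := hex
      rw [if_pos (key p j hj h).1, Finset.sum_eq_single j]
      · rw [if_pos h]; exact (key p j hj h).2
      · intro i _ hne
        rw [if_neg]
        intro h'
        exact hne (Nat.pow_right_injective (S.two_le_N p) (h'.trans h.symm))
      · exact fun h' => absurd hj h'
    · push Not at hex
      rw [Finset.sum_eq_zero fun j hj => if_neg (hex j hj)]
      split_ifs <;> linarith
  refine (Finset.sum_le_sum h1).trans ?_
  rw [← Finset.sum_filter, Finset.sum_const, nsmul_eq_mul]
  have h2 := S.fib n.minFac ((S.primes n \ S.lev L).filter fun p => S.below p = n.minFac)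
    (fun p hp => (Finset.mem_filter.1 hp).2)
  have h3 : ((((S.primes n \ S.lev L).filter fun p => S.below p = n.minFac).card : ℕ) : ℝ) ≤ 2 := by
    exact_mod_cast h2
  nlinarith

theorem Lam_le (S : Sys P G) (L : ℝ) (g : G) (n : ℕ) :
    S.Lam L g n ≤ 4 * ArithmeticFunction.vonMangoldt n :=
  (Finset.single_le_sum (f := fun g => S.Lam L g n) (fun g _ => S.Lam_nonneg L g n)
    (Finset.mem_univ g)).trans (S.sum_Lam_le L n)

theorem Lam_prime (S : Sys P G) {L : ℝ} (g : G) {n : ℕ} (hn : n.Prime) (hL : Real.exp L < n) :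
    S.Lam L g n = Real.log n * ((S.primes n).filter fun p => S.N p = n ∧ S.cl p = g).card := by
  have h1 : ∀ p : P, ∀ j, S.N p ^ j = n → j = 1 := by
    intro p j h
    rw [← h] at hn
    exact hn.eq_one_of_pow
  have h2 : ∀ p ∈ S.primes n \ S.lev L, (∑ j ∈ Finset.Icc 1 n,
      if S.N p ^ j = n ∧ j • S.cl p = g then Real.log (S.N p) else 0) =
      if S.N p = n ∧ S.cl p = g then Real.log n else 0 := by
    intro p _
    rw [Finset.sum_eq_single 1]
    · rw [pow_one, one_smul]
      split_ifs with h
      · rw [h.1]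
      · rfl
    · intro j _ hj
      rw [if_neg]
      exact fun h => hj (h1 p j h.1)
    · intro h
      exact absurd (Finset.mem_Icc.2 ⟨le_rfl, hn.one_le⟩) h
  rw [Lam, Finset.sum_congr rfl h2, ← Finset.sum_filter, Finset.sum_const, nsmul_eq_mul, mul_comm]
  congr 3
  ext p
  simp only [Finset.mem_filter, Finset.mem_sdiff, mem_lev, and_congr_left_iff, and_iff_left_iff_imp]
  rintro ⟨h, -⟩ -
  rw [h]; linarith

theorem abs_Lam_sub_le (S : Sys P G) {L M : ℝ} (g : G) {n : ℕ} (hL : Real.exp L < n)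
    (hM : Real.exp M < n) : |S.Lam L g n - S.Lam M g n| ≤ 4 * properL n := by
  unfold properL
  split_ifs with h
  · rw [S.Lam_prime g h hL, S.Lam_prime g h hM]; simp
  · rw [abs_le]
    have h1 := S.Lam_le L g n
    have h2 := S.Lam_le M g n
    have h3 := S.Lam_nonneg L g n
    have h4 := S.Lam_nonneg M g n
    constructor <;> linarith

end Sys

namespace Sys

open scoped Classical

variable {P G : Type} [AddCommGroup G] [Fintype G]

theorem abel (S : Sys P G) {L : ℝ} (hL : 300000 ≤ L) (hq : 128 * Real.log S.Q ≤ L) (g : G)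
    {ψ : ℝ → ℝ} (hψ : ContDiff ℝ 1 ψ) {M v0 v1 : ℝ} (h0 : L ≤ v0) (h1 : v0 ≤ v1)
    (hM : 0 ≤ M)
    (hb : ∀ v ∈ Set.Icc v0 v1, |ψ v| ≤ M * Real.exp (v / L))
    (hb' : ∀ v ∈ Set.Icc v0 v1, |deriv ψ v| ≤ M * Real.exp (v / L)) :
    |∑ n ∈ Finset.Ioc ⌊Real.exp v0⌋₊ ⌊Real.exp v1⌋₊, ψ (Real.log n) / n * S.bb L g n -
      S.rho L * ∫ v in v0..v1, ψ v| ≤ 4 * CF * M * Real.exp (-(v0 / L)) * (S.rho L * L) := by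
  have hL0 : 0 < L := by linarith
  have hρ := S.rho_pos L
  have hCF := CF_pos
  set s0 := Real.exp v0 with hs0
  set s1 := Real.exp v1 with hs1
  have hs00 : 0 < s0 := Real.exp_pos _
  have hs01 : s0 ≤ s1 := Real.exp_le_exp.2 h1
  have hlog : ∀ t ∈ Set.Icc s0 s1, 0 < t ∧ Real.log t ∈ Set.Icc v0 v1 := by
    intro t ht
    have h : 0 < t := hs00.trans_le ht.1
    refine ⟨h, (Real.le_log_iff_exp_le h).2 ht.1, (Real.log_le_iff_le_exp h).2 ht.2⟩
  have hψd : Differentiable ℝ ψ := hψ.differentiable one_ne_zero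
  have hψc : Continuous (deriv ψ) := hψ.continuous_deriv le_rfl
  set φ : ℝ → ℝ := fun t => ψ (Real.log t) / t with hφ
  have hφd : ∀ t ∈ Set.Icc s0 s1, HasDerivAt φ
      ((deriv ψ (Real.log t) - ψ (Real.log t)) / t ^ 2) t := by
    intro t ht
    have ht0 := (hlog t ht).1
    have h := (((hψd (Real.log t)).hasDerivAt).comp t (Real.hasDerivAt_log ht0.ne')).div
      (hasDerivAt_id t) ht0.ne'
    refine h.congr_deriv ?_
    simp only [Function.comp, id]
    field_simp
  have hlc : ContinuousOn Real.log (Set.Icc s0 s1) :=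
    Real.continuousOn_log.mono fun t ht => ne_of_gt (hlog t ht).1
  have hcd : ContinuousOn (fun t => (deriv ψ (Real.log t) - ψ (Real.log t)) / t ^ 2)
      (Set.Icc s0 s1) := by
    refine ContinuousOn.div ?_ (by fun_prop) fun t ht => (pow_pos (hlog t ht).1 2).ne'
    exact (hψc.comp_continuousOn hlc).sub (hψd.continuous.comp_continuousOn hlc)
  have hderiv : Set.EqOn (deriv φ) (fun t => (deriv ψ (Real.log t) - ψ (Real.log t)) / t ^ 2)
      (Set.Icc s0 s1) := fun t ht => (hφd t ht).deriv
  have hint : MeasureTheory.IntegrableOn (deriv φ) (Set.Icc s0 s1) :=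
    ((hcd.congr hderiv).integrableOn_compact isCompact_Icc)
  have habel := sum_mul_eq_sub_sub_integral_mul (S.bb L g) hs00.le hs01
    (fun t ht => (hφd t ht).differentiableAt) hint
  set E : ℝ → ℝ := fun t => S.R L g t - S.rho L * t with hE
  have hEb : ∀ t ∈ Set.Icc s0 s1, |E t| ≤ CF * Real.exp (-2 * (Real.log t / L)) * (S.rho L * t) := by
    intro t ht
    obtain ⟨ht0, ht1⟩ := hlog t ht
    have := S.fund hL hq (u := Real.log t / L) (by rw [le_div_iff₀ hL0]; linarith [ht1.1]) g
    rwa [div_mul_cancel₀ _ hL0.ne', Real.exp_log ht0] at this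
  -- the integral
  have hRint : MeasureTheory.IntegrableOn (fun t => deriv φ t * ∑ k ∈ Finset.Icc 0 ⌊t⌋₊, S.bb L g k)
      (Set.Icc s0 s1) := integrableOn_mul_sum_Icc (S.bb L g) hs00.le hint
  have hRi : IntervalIntegrable (fun t => deriv φ t * ∑ k ∈ Finset.Icc 0 ⌊t⌋₊, S.bb L g k)
      MeasureTheory.volume s0 s1 :=
    (intervalIntegrable_iff_integrableOn_Icc_of_le hs01).2 hRint
  have hti : IntervalIntegrable (fun t => deriv φ t * (S.rho L * t)) MeasureTheory.volume s0 s1 := by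
    refine ContinuousOn.intervalIntegrable ?_
    rw [Set.uIcc_of_le hs01]
    exact (hcd.congr hderiv).mul (by fun_prop)
  have hmain : ∫ t in s0..s1, deriv φ t * (S.rho L * t) =
      S.rho L * (ψ v1 - ψ v0 - ∫ v in v0..v1, ψ v) := by
    have e1 : ∫ t in s0..s1, deriv φ t * (S.rho L * t) =
        ∫ t in s0..s1, S.rho L * (((deriv ψ - ψ) ∘ Real.log) t * t⁻¹) := by
      refine intervalIntegral.integral_congr fun t ht => ?_
      rw [Set.uIcc_of_le hs01] at ht
      have ht0 := (hlog t ht).1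
      simp only [hderiv ht, Function.comp, Pi.sub_apply]
      field_simp
    rw [e1, intervalIntegral.integral_const_mul, intervalIntegral.integral_comp_mul_deriv'' (f' := fun t => t⁻¹)]
    · rw [hs0, hs1, Real.log_exp, Real.log_exp]
      simp only [Pi.sub_apply]
      rw [intervalIntegral.integral_sub (hψc.intervalIntegrable _ _)
        (hψd.continuous.intervalIntegrable _ _),
        intervalIntegral.integral_deriv_eq_sub (fun x _ => hψd x) (hψc.intervalIntegrable _ _)]
    · rw [Set.uIcc_of_le hs01]; exact hlc
    · intro t ht
      rw [min_eq_left hs01, max_eq_right hs01] at ht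
      exact (Real.hasDerivAt_log (hs00.trans ht.1).ne').hasDerivWithinAt
    · rw [Set.uIcc_of_le hs01]
      exact continuousOn_id.inv₀ fun t ht => ne_of_gt (hlog t ht).1
    · exact (hψc.sub hψd.continuous).continuousOn
  have hsplit : ∫ t in s0..s1, deriv φ t * ∑ k ∈ Finset.Icc 0 ⌊t⌋₊, S.bb L g k =
      (∫ t in s0..s1, deriv φ t * E t) + ∫ t in s0..s1, deriv φ t * (S.rho L * t) := by
    rw [← sub_eq_iff_eq_add, ← intervalIntegral.integral_sub hRi hti]
    refine intervalIntegral.integral_congr fun t ht => ?_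
    rw [Set.uIcc_of_le hs01] at ht
    simp only [hE]
    rw [S.R_eq L g (hlog t ht).1.le]; ring
  have hEI : |∫ t in s0..s1, deriv φ t * E t| ≤
      2 * (CF * M * S.rho L) * (L * Real.exp (-(v0 / L))) := by
    have hA : ∀ t ∈ Set.uIcc s0 s1, HasDerivAt (fun t => -(L * Real.exp (-(Real.log t / L))))
        (t⁻¹ * Real.exp (-(Real.log t / L))) t := by
      intro t ht
      rw [Set.uIcc_of_le hs01] at ht
      have ht0 := (hlog t ht).1
      have := ((((Real.hasDerivAt_log ht0.ne').div_const L).neg).exp.const_mul L).neg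
      refine this.congr_deriv ?_
      field_simp
      rfl
    have hci : ContinuousOn (fun t => t⁻¹ * Real.exp (-(Real.log t / L))) (Set.uIcc s0 s1) := by
      rw [Set.uIcc_of_le hs01]
      exact (continuousOn_id.inv₀ fun t ht => ne_of_gt (hlog t ht).1).mul
        (Real.continuous_exp.comp_continuousOn (hlc.div_const L).neg)
    have hFTC := intervalIntegral.integral_eq_sub_of_hasDerivAt hA hci.intervalIntegrable
    have hgi : IntervalIntegrable
        (fun t => 2 * (CF * M * S.rho L) * (t⁻¹ * Real.exp (-(Real.log t / L))))
        MeasureTheory.volume s0 s1 := hci.intervalIntegrable.const_mul _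
    have hle := intervalIntegral.norm_integral_le_of_norm_le (f := fun t => deriv φ t * E t) hs01
      (g := fun t => 2 * (CF * M * S.rho L) * (t⁻¹ * Real.exp (-(Real.log t / L))))
      (Filter.Eventually.of_forall fun t ht => ?_) hgi
    · rw [intervalIntegral.integral_const_mul, hFTC] at hle
      rw [← Real.norm_eq_abs]
      refine hle.trans ?_
      refine mul_le_mul_of_nonneg_left ?_ (by positivity)
      have e0 : Real.log s0 = v0 := Real.log_exp v0
      rw [e0]
      have : 0 ≤ L * Real.exp (-(Real.log s1 / L)) := by positivity
      linarith
    · have ht' : t ∈ Set.Icc s0 s1 := ⟨ht.1.le, ht.2⟩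
      obtain ⟨ht0, ht1⟩ := hlog t ht'
      rw [hderiv ht', Real.norm_eq_abs, abs_mul, abs_div, abs_of_pos (pow_pos ht0 2)]
      have h2 := hb _ ht1
      have h3 := hb' _ ht1
      have h4 : |deriv ψ (Real.log t) - ψ (Real.log t)| ≤ 2 * (M * Real.exp (Real.log t / L)) := by
        refine (abs_sub _ _).trans (by linarith)
      calc _ ≤ 2 * (M * Real.exp (Real.log t / L)) / t ^ 2 *
            (CF * Real.exp (-2 * (Real.log t / L)) * (S.rho L * t)) := by
            refine mul_le_mul ?_ (hEb t ht') (abs_nonneg _) (by positivity)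
            gcongr
        _ = _ := by
            have : Real.exp (-(Real.log t / L)) =
              Real.exp (Real.log t / L) * Real.exp (-2 * (Real.log t / L)) := by
              rw [← Real.exp_add]; congr 1; ring
            rw [this]
            field_simp
  have hbd : ∀ v ∈ Set.Icc v0 v1, |φ (Real.exp v) * E (Real.exp v)| ≤
      CF * M * S.rho L * Real.exp (-(v0 / L)) := by
    intro v hv
    have h3 := hEb (Real.exp v) ⟨Real.exp_le_exp.2 hv.1, Real.exp_le_exp.2 hv.2⟩
    rw [Real.log_exp] at h3
    have hev := Real.exp_pos v
    simp only [hφ]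
    rw [Real.log_exp, abs_mul, abs_div, abs_of_pos hev]
    calc _ ≤ M * Real.exp (v / L) / Real.exp v *
          (CF * Real.exp (-2 * (v / L)) * (S.rho L * Real.exp v)) := by
          refine mul_le_mul ?_ h3 (abs_nonneg _) (by positivity)
          gcongr
          exact hb v hv
      _ = CF * M * S.rho L * Real.exp (-(v / L)) := by
          have : Real.exp (-(v / L)) = Real.exp (v / L) * Real.exp (-2 * (v / L)) := by
            rw [← Real.exp_add]; congr 1; ring
          rw [this]; field_simp
      _ ≤ _ := by
          gcongr
          exact hv.1
  have hb0 := hbd v0 ⟨le_rfl, h1⟩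
  have hb1 := hbd v1 ⟨h1, le_rfl⟩
  have hsum : ∑ n ∈ Finset.Ioc ⌊s0⌋₊ ⌊s1⌋₊, ψ (Real.log n) / n * S.bb L g n =
      φ s1 * S.R L g s1 - φ s0 * S.R L g s0 -
      ∫ t in s0..s1, deriv φ t * ∑ k ∈ Finset.Icc 0 ⌊t⌋₊, S.bb L g k := by
    rw [S.R_eq L g (hs00.trans_le hs01).le, S.R_eq L g hs00.le, intervalIntegral.integral_of_le hs01]
    exact habel
  have hfin : ∑ n ∈ Finset.Ioc ⌊s0⌋₊ ⌊s1⌋₊, ψ (Real.log n) / n * S.bb L g n -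
      S.rho L * ∫ v in v0..v1, ψ v = φ s1 * E s1 - φ s0 * E s0 - ∫ t in s0..s1, deriv φ t * E t := by
    rw [hsum, hsplit, hmain]
    have e1 : φ s1 * (S.rho L * s1) = S.rho L * ψ v1 := by
      simp only [hφ]; rw [hs1, Real.log_exp]; field_simp
    have e0 : φ s0 * (S.rho L * s0) = S.rho L * ψ v0 := by
      simp only [hφ]; rw [hs0, Real.log_exp]; field_simp
    simp only [hE]
    linear_combination e1 - e0
  rw [hfin]
  have e : 0 ≤ CF * M * S.rho L * Real.exp (-(v0 / L)) := by positivity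
  calc _ ≤ |φ s1 * E s1| + |φ s0 * E s0| + |∫ t in s0..s1, deriv φ t * E t| := by
        refine (abs_sub _ _).trans ?_
        gcongr
        exact abs_sub _ _
    _ ≤ CF * M * S.rho L * Real.exp (-(v0 / L)) + CF * M * S.rho L * Real.exp (-(v0 / L)) +
        2 * (CF * M * S.rho L) * (L * Real.exp (-(v0 / L))) := by gcongr
    _ ≤ _ := by nlinarith

end Sys

namespace Sys

open scoped Classical

variable {P G : Type} [AddCommGroup G] [Fintype G]

theorem sum_bb_split (S : Sys P G) {L v : ℝ} (hL : 0 ≤ L) (hv : L ≤ v) (g : G) (f : ℕ → ℝ) :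
    ∑ n ∈ Finset.Ioc 0 ⌊Real.exp v⌋₊, f n * S.bb L g n =
      (if g = 0 then f 1 else 0) + ∑ n ∈ Finset.Ioc ⌊Real.exp L⌋₊ ⌊Real.exp v⌋₊, f n * S.bb L g n := by
  have h1 : 1 ≤ ⌊Real.exp L⌋₊ := Nat.le_floor (by simpa using Real.one_le_exp hL)
  have h2 : ⌊Real.exp L⌋₊ ≤ ⌊Real.exp v⌋₊ := Nat.floor_le_floor (Real.exp_le_exp.2 hv)
  rw [← Finset.sum_Ioc_consecutive _ (Nat.zero_le _) h2]
  congr 1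
  rw [Finset.sum_eq_single 1]
  · rw [bb_one]; split_ifs <;> simp
  · intro n hn hne
    rw [Finset.mem_Ioc] at hn
    rw [S.bb_eq_zero g (by omega) ((Nat.le_floor_iff (Real.exp_pos _).le).1 hn.2), mul_zero]
  · intro h
    exact absurd (Finset.mem_Ioc.2 ⟨one_pos, h1⟩) h

theorem series (S : Sys P G) {L : ℝ} (hL : 300000 ≤ L) (hq : 128 * Real.log S.Q ≤ L) (g : G)
    {ψ Φ : ℝ → ℝ} (hψ : ContDiff ℝ 1 ψ) {M : ℝ} (hM : 0 ≤ M) (h0 : ∀ v, 0 ≤ v → 0 ≤ ψ v)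
    (hb : ∀ v, L ≤ v → |ψ v| ≤ M * Real.exp (v / L))
    (hb' : ∀ v, L ≤ v → |deriv ψ v| ≤ M * Real.exp (v / L))
    (hΦ : ∀ v, HasDerivAt Φ (ψ v) v) (hlim : Filter.Tendsto Φ Filter.atTop (nhds 0)) :
    (Summable fun n : ℕ => ψ (Real.log n) / n * S.bb L g n) ∧
    |∑' n : ℕ, ψ (Real.log n) / n * S.bb L g n - (if g = 0 then ψ 0 else 0) + S.rho L * Φ L| ≤
      4 * CF * M * (S.rho L * L) := by
  have hL0 : 0 < L := by linarith
  have hρ := S.rho_pos L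
  have hCF := CF_pos
  set f : ℕ → ℝ := fun n => ψ (Real.log n) / n * S.bb L g n with hf
  have hf0 : ∀ n, 0 ≤ f n := fun n => by
    have := h0 _ (Real.log_natCast_nonneg n)
    have := S.bb_nonneg L g n
    positivity
  have hpart : ∀ v, L ≤ v → |∑ n ∈ Finset.Ioc 0 ⌊Real.exp v⌋₊, f n - (if g = 0 then ψ 0 else 0) -
      S.rho L * (Φ v - Φ L)| ≤ 4 * CF * M * (S.rho L * L) := by
    intro v hv
    have h1 := S.abel hL hq g hψ le_rfl hv hM (fun w hw => hb w hw.1) (fun w hw => hb' w hw.1)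
    rw [intervalIntegral.integral_eq_sub_of_hasDerivAt (fun w _ => hΦ w)
      (hψ.continuous.intervalIntegrable _ _)] at h1
    have h2 := S.sum_bb_split hL0.le hv g (fun n => ψ (Real.log n) / n)
    simp only [Nat.cast_one, Real.log_one, div_one] at h2
    simp only [hf]
    rw [h2, add_sub_cancel_left]
    refine h1.trans ?_
    have : Real.exp (-(L / L)) ≤ 1 := Real.exp_le_one_iff.2 (by rw [div_self hL0.ne']; norm_num)
    have h3 : 0 ≤ 4 * CF * M := by positivity
    have h4 : 0 ≤ S.rho L * L := by positivity
    calc _ ≤ 4 * CF * M * 1 * (S.rho L * L) := by gcongr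
      _ = _ := by ring
  obtain ⟨V, hV⟩ : ∃ V, ∀ v ≥ V, |Φ v| ≤ 1 := by
    have := hlim.eventually (Metric.ball_mem_nhds (0:ℝ) one_pos)
    obtain ⟨V, hV⟩ := Filter.eventually_atTop.1 this
    exact ⟨V, fun v hv => by simpa using (hV v hv).le⟩
  have hsumm : Summable f := by
    refine summable_of_sum_range_le (c := 4 * CF * M * (S.rho L * L) + |ψ 0| + S.rho L * (1 + |Φ L|))
      hf0 fun N => ?_
    set v := max (max L V) (Real.log (N + 1)) with hv
    have hv1 : L ≤ v := (le_max_left _ _).trans (le_max_left _ _)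
    have hv2 : V ≤ v := (le_max_right _ _).trans (le_max_left _ _)
    have hv3 : N ≤ ⌊Real.exp v⌋₊ := by
      refine Nat.le_floor ?_
      have : (N:ℝ) + 1 ≤ Real.exp v := by
        rw [← Real.log_le_iff_le_exp (by positivity)]
        exact le_max_right _ _
      linarith
    have h1 : ∑ n ∈ Finset.range N, f n ≤ ∑ n ∈ Finset.Ioc 0 ⌊Real.exp v⌋₊, f n := by
      have hz : f 0 = 0 := by simp [hf, bb_zero]
      calc _ ≤ ∑ n ∈ insert 0 (Finset.Ioc 0 ⌊Real.exp v⌋₊), f n := by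
            refine Finset.sum_le_sum_of_subset_of_nonneg (fun n hn => ?_) fun n _ _ => hf0 n
            rw [Finset.mem_range] at hn
            rw [Finset.mem_insert, Finset.mem_Ioc]
            omega
        _ = _ := by rw [Finset.sum_insert (by simp), hz, zero_add]
    have h2 := abs_le.1 (hpart v hv1)
    have h3 := abs_le.1 (hV v hv2)
    have h4 : (if g = 0 then ψ 0 else 0) ≤ |ψ 0| := by
      split_ifs
      · exact le_abs_self _
      · exact abs_nonneg _
    have h5 := neg_abs_le (Φ L)
    have h6 : S.rho L * (Φ v - Φ L) ≤ S.rho L * (1 + |Φ L|) :=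
      mul_le_mul_of_nonneg_left (by linarith) hρ.le
    linarith
  refine ⟨hsumm, ?_⟩
  have ht : Filter.Tendsto (fun v : ℝ => ∑ n ∈ Finset.Ioc 0 ⌊Real.exp v⌋₊, f n) Filter.atTop
      (nhds (∑' n, f n)) := by
    have h1 := hsumm.hasSum.tendsto_sum_nat
    have h2 : Filter.Tendsto (fun v : ℝ => ⌊Real.exp v⌋₊ + 1) Filter.atTop Filter.atTop :=
      (Filter.tendsto_add_atTop_nat 1).comp (tendsto_nat_floor_atTop.comp Real.tendsto_exp_atTop)
    refine (h1.comp h2).congr fun v => ?_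
    have hz : f 0 = 0 := by simp [hf, bb_zero]
    simp only [Function.comp]
    rw [Finset.sum_range_eq_add_Ico _ (by omega), hz, zero_add]
    rfl
  have ht2 := ((ht.sub_const (if g = 0 then ψ 0 else 0)).sub ((hlim.sub_const (Φ L)).const_mul
    (S.rho L))).abs
  rw [show ∑' n, f n - (if g = 0 then ψ 0 else 0) + S.rho L * Φ L =
    ∑' n, f n - (if g = 0 then ψ 0 else 0) - S.rho L * (0 - Φ L) by ring]
  exact le_of_tendsto ht2 (Filter.eventually_atTop.2 ⟨L, hpart⟩)

/-- The Dirichlet series of rough ideals in a class at `1 + σ / L`. -/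
theorem series_F (S : Sys P G) {L : ℝ} (hL : 300000 ≤ L) (hq : 128 * Real.log S.Q ≤ L) (g : G)
    {σ : ℝ} (h0 : 0 < σ) (h1 : σ ≤ 1) :
    (Summable fun n : ℕ => Real.exp (-(σ / L * Real.log n)) / n * S.bb L g n) ∧
    |∑' n : ℕ, Real.exp (-(σ / L * Real.log n)) / n * S.bb L g n - (if g = 0 then 1 else 0) -
      S.rho L * (L / σ * Real.exp (-σ))| ≤ 4 * CF * (S.rho L * L) := by
  have hL0 : 0 < L := by linarith
  have hd : ∀ v, HasDerivAt (fun v => Real.exp (-(σ / L * v))) (-(σ / L) * Real.exp (-(σ / L * v))) v := by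
    intro v
    have := (((hasDerivAt_id v).const_mul (σ / L)).neg).exp
    refine this.congr_deriv ?_
    simp [mul_comm]
  have hσL : σ / L ≤ 1 := by rw [div_le_one hL0]; linarith
  have hexp : ∀ v, L ≤ v → Real.exp (-(σ / L * v)) ≤ 1 := by
    intro v hv
    have hv0 : 0 < v := by linarith
    have : 0 ≤ σ / L * v := by positivity
    exact Real.exp_le_one_iff.2 (by linarith)
  have hexp2 : ∀ v, L ≤ v → 1 ≤ Real.exp (v / L) := by
    intro v hv
    have hv0 : 0 < v := by linarith
    exact Real.one_le_exp (by positivity)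
  have h := S.series hL hq g (ψ := fun v => Real.exp (-(σ / L * v)))
    (Φ := fun v => -(L / σ * Real.exp (-(σ / L * v)))) (by fun_prop) (M := 1) zero_le_one
    (fun v _ => (Real.exp_pos _).le) (fun v hv => ?_) (fun v hv => ?_) (fun v => ?_) ?_
  · refine ⟨h.1, ?_⟩
    have h2 := h.2
    rw [div_mul_cancel₀ _ hL0.ne'] at h2
    simp only [mul_zero, neg_zero, Real.exp_zero, mul_one, mul_neg] at h2
    exact h2
  · rw [abs_of_pos (Real.exp_pos _)]
    linarith [hexp v hv, hexp2 v hv]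
  · rw [(hd v).deriv, abs_mul, abs_neg, abs_of_pos (Real.exp_pos _), abs_of_pos (by positivity)]
    have := hexp v hv
    have := hexp2 v hv
    have := Real.exp_pos (-(σ / L * v))
    nlinarith
  · refine ((hd v).const_mul (L / σ)).neg.congr_deriv ?_
    field_simp
  · have : Filter.Tendsto (fun v : ℝ => Real.exp (-(σ / L * v))) Filter.atTop (nhds 0) := by
      refine Real.tendsto_exp_atBot.comp ?_
      refine Filter.tendsto_neg_atTop_atBot.comp ?_
      exact Filter.tendsto_id.const_mul_atTop (by positivity)
    simpa using (this.const_mul (L / σ)).neg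

/-- The derivative of the Dirichlet series of rough ideals in a class at `1 + σ / L`. -/
theorem series_F' (S : Sys P G) {L : ℝ} (hL : 300000 ≤ L) (hq : 128 * Real.log S.Q ≤ L) (g : G)
    {σ : ℝ} (h0 : 0 < σ) (h1 : σ ≤ 1) :
    (Summable fun n : ℕ => Real.log n * Real.exp (-(σ / L * Real.log n)) / n * S.bb L g n) ∧
    |∑' n : ℕ, Real.log n * Real.exp (-(σ / L * Real.log n)) / n * S.bb L g n -
      S.rho L * (L ^ 2 * ((1 + σ) / σ ^ 2) * Real.exp (-σ))| ≤ 4 * CF * L * (S.rho L * L) := by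
  have hL0 : 0 < L := by linarith
  have hd : ∀ v, HasDerivAt (fun v => Real.exp (-(σ / L * v))) (-(σ / L) * Real.exp (-(σ / L * v))) v := by
    intro v
    have := (((hasDerivAt_id v).const_mul (σ / L)).neg).exp
    refine this.congr_deriv ?_
    simp [mul_comm]
  have hd2 : ∀ v, HasDerivAt (fun v => v * Real.exp (-(σ / L * v)))
      ((1 - σ / L * v) * Real.exp (-(σ / L * v))) v := by
    intro v
    refine ((hasDerivAt_id v).mul (hd v)).congr_deriv ?_
    simp; ring
  have hexp : ∀ v, L ≤ v → Real.exp (-(σ / L * v)) ≤ 1 := by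
    intro v hv
    have hv0 : 0 < v := by linarith
    have : 0 ≤ σ / L * v := by positivity
    exact Real.exp_le_one_iff.2 (by linarith)
  have hexp2 : ∀ v, v / L + 1 ≤ Real.exp (v / L) := fun v => Real.add_one_le_exp _
  have h := S.series hL hq g (ψ := fun v => v * Real.exp (-(σ / L * v)))
    (Φ := fun v => -((L / σ * v + (L / σ) ^ 2) * Real.exp (-(σ / L * v)))) (by fun_prop) (M := L)
    hL0.le
    (fun v hv => by positivity) (fun v hv => ?_) (fun v hv => ?_) (fun v => ?_) ?_
  · refine ⟨h.1, ?_⟩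
    have h2 := h.2
    rw [div_mul_cancel₀ _ hL0.ne'] at h2
    simp only [zero_mul, ite_self, sub_zero, mul_neg] at h2
    rw [← sub_eq_add_neg] at h2
    convert h2 using 5
    field_simp
    ring
  · have hv0 : 0 < v := by linarith
    rw [abs_of_pos (by positivity)]
    have := hexp v hv
    calc v * Real.exp (-(σ / L * v)) ≤ v * 1 := by gcongr
      _ = L * (v / L) := by field_simp
      _ ≤ _ := by gcongr; linarith [hexp2 v]
  · have hv0 : 0 < v := by linarith
    rw [(hd2 v).deriv, abs_mul, abs_of_pos (Real.exp_pos _)]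
    have h3 := hexp v hv
    have h4 := hexp2 v
    have h5 : |1 - σ / L * v| ≤ v / L + 1 := by
      have : 0 ≤ σ / L * v := by positivity
      have : σ / L * v ≤ v / L := by rw [div_mul_eq_mul_div]; gcongr; nlinarith
      rw [abs_le]; constructor <;> linarith
    calc _ ≤ (v / L + 1) * 1 := by gcongr
      _ ≤ 1 * Real.exp (v / L) := by linarith
      _ ≤ _ := by gcongr; linarith
  · have h6 := (((hasDerivAt_id v).const_mul (L / σ)).add_const ((L / σ) ^ 2)).mul (hd v)
    refine h6.neg.congr_deriv ?_
    simp
    field_simp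
    ring
  · have h7 : Filter.Tendsto (fun v : ℝ => σ / L * v) Filter.atTop Filter.atTop :=
      Filter.tendsto_id.const_mul_atTop (by positivity)
    have h8 := (Real.tendsto_pow_mul_exp_neg_atTop_nhds_zero 1).comp h7
    have h9 := (Real.tendsto_pow_mul_exp_neg_atTop_nhds_zero 0).comp h7
    have h10 := ((h8.const_mul ((L / σ) ^ 2)).add (h9.const_mul ((L / σ) ^ 2))).neg
    simp only [mul_zero, add_zero, neg_zero] at h10
    refine h10.congr fun v => ?_
    simp only [Function.comp]
    field_simp

end Sys

/-- `n ^ (-s)` written as `exp (-(s - 1) log n) / n`. -/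
noncomputable def nps (s : ℝ) (n : ℕ) : ℝ := Real.exp (-((s - 1) * Real.log n)) / n

theorem nps_nonneg (s : ℝ) (n : ℕ) : 0 ≤ nps s n := by unfold nps; positivity

theorem term_real (f : ℕ → ℂ) (s : ℝ) (n : ℕ) : LSeries.term f (s:ℂ) n = f n * (nps s n : ℂ) := by
  rcases Nat.eq_zero_or_pos n with rfl | hn
  · simp [nps]
  · have hn' : (0:ℝ) < n := by exact_mod_cast hn
    rw [LSeries.term_of_ne_zero hn.ne', div_eq_mul_inv, ← Complex.ofReal_natCast,
      ← Complex.ofReal_cpow hn'.le, ← Complex.ofReal_inv]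
    congr 2
    rw [nps, Real.rpow_def_of_pos hn', ← Real.exp_neg, div_eq_mul_inv]
    have : ((n:ℝ))⁻¹ = Real.exp (-Real.log n) := by rw [Real.exp_neg, Real.exp_log hn']
    rw [this, ← Real.exp_add]
    congr 1; ring

theorem summable_vonMangoldt_nps {s : ℝ} (hs : 1 < s) :
    Summable fun n => ArithmeticFunction.vonMangoldt n * nps s n := by
  have h := ArithmeticFunction.LSeriesSummable_vonMangoldt (s := (s:ℂ)) (by simpa using hs)
  rw [LSeriesSummable] at h
  have h2 : (LSeries.term (fun n => ((ArithmeticFunction.vonMangoldt n : ℝ) : ℂ)) (s:ℂ)) =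
      fun n => ((ArithmeticFunction.vonMangoldt n * nps s n : ℝ) : ℂ) := by
    funext n
    rw [term_real]; push_cast; rfl
  rw [h2] at h
  exact Complex.summable_ofReal.1 h

namespace Sys

open scoped Classical

variable {P G : Type} [AddCommGroup G] [Fintype G]

/-- rough ideal counts twisted by a character -/
noncomputable def bC (S : Sys P G) (L : ℝ) (ψ : AddChar G ℂ) (n : ℕ) : ℂ :=
  ∑ g, ψ g * (S.bb L g n : ℂ)

/-- von Mangoldt function twisted by a character -/
noncomputable def LC (S : Sys P G) (L : ℝ) (ψ : AddChar G ℂ) (n : ℕ) : ℂ :=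
  ∑ g, ψ g * (S.Lam L g n : ℂ)

theorem bC_one (S : Sys P G) (L : ℝ) (ψ : AddChar G ℂ) : S.bC L ψ 1 = 1 := by
  rw [bC, Finset.sum_eq_single 0]
  · simp [bb_one]
  · intro g _ hg
    simp [bb_one, hg]
  · simp

theorem logMul_bC (S : Sys P G) (L : ℝ) (ψ : AddChar G ℂ) :
    LSeries.logMul (S.bC L ψ) = LSeries.convolution (S.LC L ψ) (S.bC L ψ) := by
  rw [LSeries.convolution_def]
  funext n
  rw [LSeries.logMul]
  rcases eq_or_ne n 0 with rfl | hn
  · simp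
  · have h : ∀ g, Complex.log n * (ψ g * (S.bb L g n : ℂ)) = ∑ x ∈ n.divisorsAntidiagonal, ∑ g',
        (ψ g' * (S.Lam L g' x.1 : ℂ)) * (ψ (g - g') * (S.bb L (g - g') x.2 : ℂ)) := by
      intro g
      have := S.conv L g hn
      have h2 : Complex.log n = ((Real.log n : ℝ) : ℂ) := by
        rw [← Complex.ofReal_natCast, Complex.ofReal_log (Nat.cast_nonneg n)]
      rw [h2, mul_left_comm, ← Complex.ofReal_mul, this]
      push_cast
      rw [Finset.mul_sum]
      refine Finset.sum_congr rfl fun x _ => ?_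
      rw [Finset.mul_sum]
      refine Finset.sum_congr rfl fun g' _ => ?_
      have h3 : ψ g = ψ g' * ψ (g - g') := by rw [← AddChar.map_add_eq_mul]; congr 1; abel
      rw [h3]; ring
    rw [bC, Finset.mul_sum, Finset.sum_congr rfl fun g _ => h g, Finset.sum_comm]
    refine Finset.sum_congr rfl fun x _ => ?_
    rw [Finset.sum_comm, LC, bC, Finset.sum_mul]
    refine Finset.sum_congr rfl fun g' _ => ?_
    rw [← Finset.mul_sum]
    congr 1
    exact Fintype.sum_equiv (Equiv.subRight g') _ _ fun g => rfl

theorem summable_Lam (S : Sys P G) (L : ℝ) (g : G) {s : ℝ} (hs : 1 < s) :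
    Summable fun n => S.Lam L g n * nps s n := by
  refine Summable.of_nonneg_of_le (fun n => mul_nonneg (S.Lam_nonneg L g n) (nps_nonneg s n))
    (fun n => ?_) ((summable_vonMangoldt_nps hs).mul_left 4)
  rw [← mul_assoc]
  exact mul_le_mul_of_nonneg_right (S.Lam_le L g n) (nps_nonneg s n)

theorem hasSum_class {f : G → ℕ → ℝ} (ψ : AddChar G ℂ) {s : ℝ}
    (h : ∀ g, Summable fun n => f g n * nps s n) :
    HasSum (LSeries.term (fun n => ∑ g, ψ g * (f g n : ℂ)) (s:ℂ))
      (∑ g, ψ g * ((∑' n, f g n * nps s n : ℝ) : ℂ)) := by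
  have h1 : ∀ g ∈ Finset.univ, HasSum (fun n => ψ g * ((f g n * nps s n : ℝ) : ℂ))
      (ψ g * ((∑' n, f g n * nps s n : ℝ) : ℂ)) := fun g _ =>
    ((Complex.hasSum_ofReal.2 (h g).hasSum).mul_left _)
  refine (hasSum_sum h1).congr_fun ?_
  intro n
  rw [term_real, Finset.sum_mul]
  refine Finset.sum_congr rfl fun g _ => ?_
  push_cast; ring

theorem LSeries_LC (S : Sys P G) (L : ℝ) (ψ : AddChar G ℂ) {s : ℝ} (hs : 1 < s) :
    LSeriesSummable (S.LC L ψ) s ∧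
    LSeries (S.LC L ψ) s = ∑ g, ψ g * ((∑' n, S.Lam L g n * nps s n : ℝ) : ℂ) := by
  have h := hasSum_class ψ (fun g => S.summable_Lam L g hs)
  exact ⟨h.summable, h.tsum_eq⟩

theorem summable_bb (S : Sys P G) {L : ℝ} (hL : 300000 ≤ L) (hq : 128 * Real.log S.Q ≤ L) (g : G)
    {s : ℝ} (hs : 1 < s) : Summable fun n => S.bb L g n * nps s n := by
  have hL0 : 0 < L := by linarith
  set σ := min 1 ((s - 1) * L)
  have h0 : 0 < σ := lt_min one_pos (mul_pos (by linarith) hL0)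
  refine Summable.of_nonneg_of_le (fun n => mul_nonneg (S.bb_nonneg L g n) (nps_nonneg s n))
    (fun n => ?_) (S.series_F hL hq g h0 (min_le_left _ _)).1
  rw [mul_comm]
  refine mul_le_mul_of_nonneg_right ?_ (S.bb_nonneg L g n)
  rw [nps]
  have h1 : σ / L ≤ s - 1 := by rw [div_le_iff₀ hL0]; exact min_le_right _ _
  have h2 : 0 ≤ Real.log n := Real.log_natCast_nonneg n
  gcongr

theorem LSeries_bC (S : Sys P G) {L : ℝ} (hL : 300000 ≤ L) (hq : 128 * Real.log S.Q ≤ L)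
    (ψ : AddChar G ℂ) {s : ℝ} (hs : 1 < s) :
    LSeriesSummable (S.bC L ψ) s ∧
    LSeries (S.bC L ψ) s = ∑ g, ψ g * ((∑' n, S.bb L g n * nps s n : ℝ) : ℂ) := by
  have h := hasSum_class ψ (fun g => S.summable_bb hL hq g hs)
  exact ⟨h.summable, h.tsum_eq⟩

theorem abscissa_bC (S : Sys P G) {L : ℝ} (hL : 300000 ≤ L) (hq : 128 * Real.log S.Q ≤ L)
    (ψ : AddChar G ℂ) : LSeries.abscissaOfAbsConv (S.bC L ψ) ≤ (1:ℝ) :=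
  LSeries.abscissaOfAbsConv_le_of_forall_lt_LSeriesSummable fun _ hy => (S.LSeries_bC hL hq ψ hy).1

theorem hasDerivAt_bC (S : Sys P G) {L : ℝ} (hL : 300000 ≤ L) (hq : 128 * Real.log S.Q ≤ L)
    (ψ : AddChar G ℂ) {s : ℝ} (hs : 1 < s) :
    HasDerivAt (fun s : ℝ => LSeries (S.bC L ψ) s)
      (-(LSeries (S.LC L ψ) s * LSeries (S.bC L ψ) s)) s := by
  have h1 : LSeries.abscissaOfAbsConv (S.bC L ψ) < ((s:ℂ).re : EReal) := by
    refine lt_of_le_of_lt (S.abscissa_bC hL hq ψ) ?_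
    exact_mod_cast hs
  have h2 := (LSeries_hasDerivAt h1).comp_ofReal
  rw [logMul_bC, LSeries_convolution' (S.LSeries_LC L ψ hs).1 (S.LSeries_bC hL hq ψ hs).1] at h2
  exact h2

theorem re_nonneg (S : Sys P G) (L : ℝ) (ψ : AddChar G ℂ) {s : ℝ} (hs : 1 < s) :
    0 ≤ 3 * (LSeries (S.LC L 0) s).re + 4 * (LSeries (S.LC L ψ) s).re +
      (LSeries (S.LC L (ψ + ψ)) s).re := by
  have h : ∀ χ : AddChar G ℂ, (LSeries (S.LC L χ) s).re =
      ∑ g, (χ g).re * (∑' n, S.Lam L g n * nps s n) := by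
    intro χ
    rw [(S.LSeries_LC L χ hs).2, Complex.re_sum]
    refine Finset.sum_congr rfl fun g _ => ?_
    rw [Complex.re_mul_ofReal]
  rw [h, h, h, Finset.mul_sum, Finset.mul_sum, ← Finset.sum_add_distrib, ← Finset.sum_add_distrib]
  refine Finset.sum_nonneg fun g _ => ?_
  have h0 : 0 ≤ ∑' n, S.Lam L g n * nps s n :=
    tsum_nonneg fun n => mul_nonneg (S.Lam_nonneg L g n) (nps_nonneg s n)
  have h1 : ‖ψ g‖ = 1 := AddChar.norm_apply ψ g
  have h2 : (ψ g).re ^ 2 + (ψ g).im ^ 2 = 1 := by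
    have := Complex.sq_norm (ψ g)
    rw [h1, Complex.normSq_apply] at this
    nlinarith
  have h3 : ((ψ + ψ) g).re = (ψ g).re ^ 2 - (ψ g).im ^ 2 := by
    rw [AddChar.add_apply, Complex.mul_re]; ring
  rw [h3, AddChar.zero_apply, Complex.one_re]
  have : 3 * (1 * ∑' n, S.Lam L g n * nps s n) + 4 * ((ψ g).re * ∑' n, S.Lam L g n * nps s n) +
      ((ψ g).re ^ 2 - (ψ g).im ^ 2) * ∑' n, S.Lam L g n * nps s n =
      2 * (1 + (ψ g).re) ^ 2 * ∑' n, S.Lam L g n * nps s n := by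
    linear_combination (-(∑' n, S.Lam L g n * nps s n)) * h2
  rw [this]
  positivity

theorem one_le_prod (S : Sys P G) {L : ℝ} (hL : 300000 ≤ L) (hq : 128 * Real.log S.Q ≤ L)
    (ψ : AddChar G ℂ) {s : ℝ} (hs : 1 < s) :
    1 ≤ (‖LSeries (S.bC L 0) s‖ ^ 2) ^ 3 * (‖LSeries (S.bC L ψ) s‖ ^ 2) ^ 4 *
      ‖LSeries (S.bC L (ψ + ψ)) s‖ ^ 2 := by
  set H : ℝ → ℝ := fun s => (‖LSeries (S.bC L 0) s‖ ^ 2) ^ 3 * (‖LSeries (S.bC L ψ) s‖ ^ 2) ^ 4 *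
      ‖LSeries (S.bC L (ψ + ψ)) s‖ ^ 2 with hH
  have hn : ∀ (χ : AddChar G ℂ) (s : ℝ), 1 < s → HasDerivAt (fun s : ℝ => ‖LSeries (S.bC L χ) s‖ ^ 2)
      (-2 * (LSeries (S.LC L χ) s).re * ‖LSeries (S.bC L χ) s‖ ^ 2) s := by
    intro χ s hs
    refine (S.hasDerivAt_bC hL hq χ hs).norm_sq.congr_deriv ?_
    rw [Complex.inner, Complex.sq_norm, Complex.normSq_apply]
    simp only [Complex.mul_re, Complex.neg_re, Complex.neg_im, Complex.conj_re, Complex.conj_im,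
      Complex.mul_im]
    ring
  have hd : ∀ s : ℝ, 1 < s → HasDerivAt H (-2 * (3 * (LSeries (S.LC L 0) s).re +
      4 * (LSeries (S.LC L ψ) s).re + (LSeries (S.LC L (ψ + ψ)) s).re) * H s) s := by
    intro s hs
    refine ((((hn 0 s hs).pow 3).mul ((hn ψ s hs).pow 4)).mul (hn (ψ + ψ) s hs)).congr_deriv ?_
    simp only [hH, Pi.pow_apply, Pi.mul_apply]
    push_cast
    ring
  have hanti : AntitoneOn H (Set.Ioi 1) := by
    refine antitoneOn_of_deriv_nonpos (convex_Ioi 1)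
      (fun s hs => (hd s hs).continuousAt.continuousWithinAt) ?_ ?_
    · rw [interior_Ioi]
      exact fun s hs => (hd s hs).differentiableAt.differentiableWithinAt
    · rw [interior_Ioi]
      intro s hs
      rw [(hd s hs).deriv]
      have h1 := S.re_nonneg L ψ hs
      have h2 : 0 ≤ H s := by simp only [hH]; positivity
      nlinarith [mul_nonneg h1 h2]
  have ht : ∀ χ : AddChar G ℂ, Filter.Tendsto (fun s : ℝ => ‖LSeries (S.bC L χ) s‖ ^ 2)
      Filter.atTop (nhds 1) := by
    intro χ
    have h := LSeries.tendsto_atTop (f := S.bC L χ)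
      (lt_of_le_of_lt (S.abscissa_bC hL hq χ) (EReal.coe_lt_top 1))
    rw [bC_one] at h
    simpa using (h.norm.pow 2)
  have hlim : Filter.Tendsto H Filter.atTop (nhds 1) := by
    simpa using (((ht 0).pow 3).mul ((ht ψ).pow 4)).mul (ht (ψ + ψ))
  refine le_of_tendsto hlim (Filter.eventually_atTop.2 ⟨s, fun t ht => ?_⟩)
  exact hanti hs (lt_of_lt_of_le hs ht) ht

end Sys

namespace Sys

open scoped Classical

variable {P G : Type} [AddCommGroup G] [Fintype G]

theorem norm_sum_char_le {χ : AddChar G ℂ} (hχ : χ ≠ 0) (x : G → ℝ) (K : ℝ) :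
    ‖∑ g, χ g * (x g : ℂ)‖ ≤ ∑ g, |x g - K| := by
  have h : ∑ g, χ g * (x g : ℂ) = ∑ g, χ g * ((x g - K : ℝ) : ℂ) := by
    have h0 := AddChar.sum_eq_zero_iff_ne_zero.2 hχ
    push_cast
    simp only [mul_sub, Finset.sum_sub_distrib]
    rw [← Finset.sum_mul, h0, zero_mul, sub_zero]
  rw [h]
  refine (norm_sum_le _ _).trans (Finset.sum_le_sum fun g _ => ?_)
  rw [norm_mul, AddChar.norm_apply, one_mul, Complex.norm_real, Real.norm_eq_abs]

/-- The normalised residue. -/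
noncomputable def A (S : Sys P G) (L : ℝ) : ℝ := Fintype.card G * S.rho L * L

theorem A_pos (S : Sys P G) {L : ℝ} (hL : 0 < L) : 0 < S.A L := by
  have := S.rho_pos L
  have : 0 < Fintype.card G := Fintype.card_pos
  unfold A; positivity

theorem A_le (S : Sys P G) {L : ℝ} (hL : 300000 ≤ L) (hq : 128 * Real.log S.Q ≤ L) : S.A L ≤ 12 := by
  have hQ : 0 < Real.log S.Q := Real.log_pos (by linarith [S.two_le_Q])
  exact S.rho_le (by linarith) (by linarith)

/-- Dirichlet series of rough ideals in a class -/
noncomputable def Fr (S : Sys P G) (L : ℝ) (g : G) (s : ℝ) : ℝ := ∑' n, S.bb L g n * nps s n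

/-- minus the derivative of the Dirichlet series of rough ideals in a class -/
noncomputable def Dr (S : Sys P G) (L : ℝ) (g : G) (s : ℝ) : ℝ :=
  ∑' n : ℕ, (Real.log n * S.bb L g n) * nps s n

theorem Fr_bound (S : Sys P G) {L : ℝ} (hL : 300000 ≤ L) (hq : 128 * Real.log S.Q ≤ L) (g : G)
    {σ : ℝ} (h0 : 0 < σ) (h1 : σ ≤ 1) :
    |S.Fr L g (1 + σ / L) - (if g = 0 then 1 else 0) - S.rho L * (L / σ * Real.exp (-σ))| ≤
      4 * CF * (S.rho L * L) := by
  have h := (S.series_F hL hq g h0 h1).2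
  convert h using 5
  rw [Fr]
  refine tsum_congr fun n => ?_
  rw [nps, add_sub_cancel_left, mul_comm]

theorem Dr_bound (S : Sys P G) {L : ℝ} (hL : 300000 ≤ L) (hq : 128 * Real.log S.Q ≤ L) (g : G)
    {σ : ℝ} (h0 : 0 < σ) (h1 : σ ≤ 1) :
    (Summable fun n : ℕ => (Real.log n * S.bb L g n) * nps (1 + σ / L) n) ∧
    |S.Dr L g (1 + σ / L) - S.rho L * (L ^ 2 * ((1 + σ) / σ ^ 2) * Real.exp (-σ))| ≤
      4 * CF * L * (S.rho L * L) := by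
  have h := S.series_F' hL hq g h0 h1
  have e : ∀ n : ℕ, (Real.log n * S.bb L g n) * nps (1 + σ / L) n =
      Real.log n * Real.exp (-(σ / L * Real.log n)) / n * S.bb L g n := by
    intro n
    rw [nps, add_sub_cancel_left]; ring
  rw [Dr]
  simp only [e]
  exact h

theorem LC_mul_bC (S : Sys P G) {L : ℝ} (hL : 300000 ≤ L) (hq : 128 * Real.log S.Q ≤ L)
    (χ : AddChar G ℂ) {σ : ℝ} (h0 : 0 < σ) (h1 : σ ≤ 1) :
    LSeries (S.LC L χ) (1 + σ / L : ℝ) * LSeries (S.bC L χ) (1 + σ / L : ℝ) =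
      ∑ g, χ g * (S.Dr L g (1 + σ / L) : ℂ) := by
  have hs : 1 < 1 + σ / L := by
    have : 0 < σ / L := by have : 0 < L := by linarith
                           positivity
    linarith
  rw [← LSeries_convolution' (S.LSeries_LC L χ hs).1 (S.LSeries_bC hL hq χ hs).1, ← logMul_bC]
  have h := hasSum_class χ (fun g => (S.Dr_bound hL hq g h0 h1).1)
  have e : LSeries.logMul (S.bC L χ) =
      fun n : ℕ => ∑ g, χ g * ((Real.log n * S.bb L g n : ℝ) : ℂ) := by
    funext n
    rw [LSeries.logMul, bC, Finset.mul_sum]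
    refine Finset.sum_congr rfl fun g _ => ?_
    rw [← Complex.ofReal_natCast, ← Complex.ofReal_log (Nat.cast_nonneg n)]
    push_cast; ring
  rw [e]
  exact h.tsum_eq

/-- constant -/
noncomputable def C1 : ℝ := 25 + 48 * CF

theorem C1_pos : 25 < C1 := by unfold C1; linarith [CF_pos]

theorem card_mul_le (S : Sys P G) {L : ℝ} (hL : 300000 ≤ L) (hq : 128 * Real.log S.Q ≤ L) {c : ℝ}
    (hc : 0 ≤ c) : (Fintype.card G : ℝ) * (4 * CF * c * (S.rho L * L)) ≤ 48 * CF * c := by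
  have h := S.A_le hL hq
  unfold A at h
  have := CF_pos
  calc _ = 4 * CF * c * (Fintype.card G * S.rho L * L) := by ring
    _ ≤ 4 * CF * c * 12 := by gcongr
    _ = _ := by ring

theorem norm_bC_le (S : Sys P G) {L : ℝ} (hL : 300000 ≤ L) (hq : 128 * Real.log S.Q ≤ L)
    {χ : AddChar G ℂ} (hχ : χ ≠ 0) {σ : ℝ} (h0 : 0 < σ) (h1 : σ ≤ 1) :
    ‖LSeries (S.bC L χ) (1 + σ / L : ℝ)‖ ≤ C1 := by
  have hs : 1 < 1 + σ / L := by
    have : 0 < σ / L := by have : 0 < L := by linarith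
                           positivity
    linarith
  rw [(S.LSeries_bC hL hq χ hs).2]
  refine (norm_sum_char_le hχ (fun g => S.Fr L g (1 + σ / L))
    (S.rho L * (L / σ * Real.exp (-σ)))).trans ?_
  have h2 : ∀ g ∈ Finset.univ, |S.Fr L g (1 + σ / L) - S.rho L * (L / σ * Real.exp (-σ))| ≤
      (if g = 0 then 1 else 0) + 4 * CF * (S.rho L * L) := by
    intro g _
    have h := S.Fr_bound hL hq g h0 h1
    rw [abs_le] at h ⊢
    have : (0:ℝ) ≤ if g = 0 then 1 else 0 := by split_ifs <;> norm_num
    constructor <;> linarith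
  refine (Finset.sum_le_sum h2).trans ?_
  rw [Finset.sum_add_distrib, Finset.sum_const, nsmul_eq_mul, Finset.card_univ]
  have := S.card_mul_le hL hq zero_le_one
  simp only [mul_one] at this
  simp only [Finset.sum_ite_eq', Finset.mem_univ, if_true]
  unfold C1
  linarith

theorem norm_LC_mul_bC_le (S : Sys P G) {L : ℝ} (hL : 300000 ≤ L) (hq : 128 * Real.log S.Q ≤ L)
    {χ : AddChar G ℂ} (hχ : χ ≠ 0) {σ : ℝ} (h0 : 0 < σ) (h1 : σ ≤ 1) :
    ‖LSeries (S.LC L χ) (1 + σ / L : ℝ)‖ * ‖LSeries (S.bC L χ) (1 + σ / L : ℝ)‖ ≤ C1 * L := by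
  rw [← norm_mul, S.LC_mul_bC hL hq χ h0 h1]
  refine (norm_sum_char_le hχ _ (S.rho L * (L ^ 2 * ((1 + σ) / σ ^ 2) * Real.exp (-σ)))).trans ?_
  refine (Finset.sum_le_sum fun g _ => (S.Dr_bound hL hq g h0 h1).2).trans ?_
  rw [Finset.sum_const, nsmul_eq_mul, Finset.card_univ]
  have := S.card_mul_le hL hq (c := L) (by linarith)
  unfold C1
  linarith

theorem bC_zero (S : Sys P G) {L : ℝ} (hL : 300000 ≤ L) (hq : 128 * Real.log S.Q ≤ L)
    {σ : ℝ} (h0 : 0 < σ) (h1 : σ ≤ 1) :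
    ∃ x : ℝ, LSeries (S.bC L 0) (1 + σ / L : ℝ) = x ∧ 1 ≤ x ∧ |x - S.A L / σ| ≤ C1 := by
  have hL0 : 0 < L := by linarith
  have hs : 1 < 1 + σ / L := by
    have : 0 < σ / L := by positivity
    linarith
  refine ⟨∑ g, S.Fr L g (1 + σ / L), ?_, ?_, ?_⟩
  · rw [(S.LSeries_bC hL hq 0 hs).2]
    rw [Complex.ofReal_sum]
    refine Finset.sum_congr rfl fun g _ => ?_
    rw [AddChar.zero_apply, one_mul, Fr]
  · have h2 : ∀ g, 0 ≤ S.Fr L g (1 + σ / L) := fun g =>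
      tsum_nonneg fun n => mul_nonneg (S.bb_nonneg L g n) (nps_nonneg _ n)
    refine le_trans ?_ (Finset.single_le_sum (fun g _ => h2 g) (Finset.mem_univ 0))
    refine le_trans ?_ ((S.summable_bb hL hq 0 hs).le_tsum 1 fun n _ =>
      mul_nonneg (S.bb_nonneg L 0 n) (nps_nonneg _ n))
    simp [bb_one, nps]
  · have h2 : ∑ g, S.Fr L g (1 + σ / L) - S.A L / σ * Real.exp (-σ) - 1 =
        ∑ g, (S.Fr L g (1 + σ / L) - (if g = 0 then 1 else 0) -
          S.rho L * (L / σ * Real.exp (-σ))) := by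
      rw [Finset.sum_sub_distrib, Finset.sum_sub_distrib, Finset.sum_const, nsmul_eq_mul,
        Finset.card_univ]
      simp only [Finset.sum_ite_eq', Finset.mem_univ, if_true]
      unfold A; ring
    have h3 : |∑ g, S.Fr L g (1 + σ / L) - S.A L / σ * Real.exp (-σ) - 1| ≤ 48 * CF := by
      rw [h2]
      refine (Finset.abs_sum_le_sum_abs _ _).trans ?_
      refine (Finset.sum_le_sum fun g _ => S.Fr_bound hL hq g h0 h1).trans ?_
      rw [Finset.sum_const, nsmul_eq_mul, Finset.card_univ]
      have := S.card_mul_le hL hq zero_le_one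
      simp only [mul_one] at this
      exact this
    have h4 : |S.A L / σ * Real.exp (-σ) - S.A L / σ| ≤ 12 := by
      have h5 := Real.add_one_le_exp (-σ)
      have h6 : Real.exp (-σ) ≤ 1 := Real.exp_le_one_iff.2 (by linarith)
      have hA := S.A_pos hL0
      have hA2 := S.A_le hL hq
      have h7 : S.A L / σ * (1 - Real.exp (-σ)) ≤ S.A L / σ * σ := by
        gcongr; linarith
      rw [div_mul_cancel₀ _ h0.ne'] at h7
      have h8 : 0 ≤ S.A L / σ * (1 - Real.exp (-σ)) := by
        have : 0 ≤ 1 - Real.exp (-σ) := by linarith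
        positivity
      rw [abs_le]; constructor <;> linarith
    rw [abs_le] at h3 h4 ⊢
    unfold C1
    constructor <;> linarith [h3.1, h3.2, h4.1, h4.2]

/-- The logarithmic derivative at nontrivial characters. -/
theorem norm_LC_le (S : Sys P G) {L : ℝ} (hL : 300000 ≤ L) (hq : 128 * Real.log S.Q ≤ L)
    {χ : AddChar G ℂ} (hχ : χ ≠ 0) (hχ2 : χ + χ ≠ 0) {σ : ℝ} (h0 : 0 < σ) (h1 : σ ≤ 1) :
    ‖LSeries (S.LC L χ) (1 + σ / L : ℝ)‖ ≤ 2 * C1 ^ 2 * L * σ ^ (-(3/4) : ℝ) := by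
  have hL0 : 0 < L := by linarith
  have hs : 1 < 1 + σ / L := by
    have : 0 < σ / L := by positivity
    linarith
  have hC := C1_pos
  have h2 := S.one_le_prod hL hq χ hs
  have h3 := S.norm_bC_le hL hq hχ2 h0 h1
  obtain ⟨x, hx, hx1, hx2⟩ := S.bC_zero hL hq h0 h1
  have hx3 : ‖LSeries (S.bC L 0) (1 + σ / L : ℝ)‖ ≤ 2 * C1 / σ := by
    rw [hx, Complex.norm_real, Real.norm_eq_abs, abs_of_pos (by linarith)]
    rw [le_div_iff₀ h0]
    have h4 := (abs_le.1 hx2).2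
    have h5 : S.A L / σ ≤ 12 / σ := by gcongr; exact S.A_le hL hq
    have h6 : x ≤ 12 / σ + C1 := by linarith
    calc x * σ ≤ (12 / σ + C1) * σ := by gcongr
      _ = 12 + C1 * σ := by field_simp
      _ ≤ _ := by nlinarith
  set f := ‖LSeries (S.bC L χ) (1 + σ / L : ℝ)‖ with hf
  have hf0 : 0 ≤ f := norm_nonneg _
  have h7 : 1 ≤ (2 * C1 / σ) ^ 6 * f ^ 8 * C1 ^ 2 := by
    refine h2.trans ?_
    calc _ = ‖LSeries (S.bC L 0) (1 + σ / L : ℝ)‖ ^ 6 * f ^ 8 *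
          ‖LSeries (S.bC L (χ + χ)) (1 + σ / L : ℝ)‖ ^ 2 := by ring
      _ ≤ _ := by gcongr
  have h8 : σ ^ (3/4 : ℝ) ≤ 2 * C1 * f := by
    refine le_of_pow_le_pow_left₀ (n := 8) (by norm_num) (by positivity) ?_
    have h9 : (σ ^ (3/4 : ℝ)) ^ 8 = σ ^ 6 := by
      rw [← Real.rpow_natCast, ← Real.rpow_mul h0.le, ← Real.rpow_natCast]; norm_num
    rw [h9]
    have h10 : σ ^ 6 ≤ (2 * C1) ^ 6 * f ^ 8 * C1 ^ 2 := by
      have := mul_le_mul_of_nonneg_left h7 (pow_pos h0 6).le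
      rw [mul_one] at this
      refine this.trans (le_of_eq ?_)
      field_simp
    refine h10.trans ?_
    have : 0 ≤ C1 ^ 8 * f ^ 8 := by positivity
    nlinarith
  have h11 := S.norm_LC_mul_bC_le hL hq hχ h0 h1
  have h12 : 0 < σ ^ (3/4 : ℝ) := Real.rpow_pos_of_pos h0 _
  rw [Real.rpow_neg h0.le, ← div_eq_mul_inv, le_div_iff₀ h12]
  calc _ ≤ ‖LSeries (S.LC L χ) (1 + σ / L : ℝ)‖ * (2 * C1 * f) := by gcongr
    _ = 2 * C1 * (‖LSeries (S.LC L χ) (1 + σ / L : ℝ)‖ * f) := by ring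
    _ ≤ 2 * C1 * (C1 * L) := by gcongr
    _ = _ := by ring

/-- The logarithmic derivative at the trivial character. -/
theorem LC_zero (S : Sys P G) {L : ℝ} (hL : 300000 ≤ L) (hq : 128 * Real.log S.Q ≤ L)
    {σ : ℝ} (h0 : 0 < σ) (h1 : σ ≤ 1) :
    |(∑ g, ∑' n, S.Lam L g n * nps (1 + σ / L) n) - L / σ| ≤ 4 * C1 ^ 2 * L / S.A L := by
  have hL0 : 0 < L := by linarith
  have hs : 1 < 1 + σ / L := by
    have : 0 < σ / L := by positivity
    linarith
  have hC := C1_pos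
  have hA := S.A_pos hL0
  have hA2 := S.A_le hL hq
  set p := ∑ g, ∑' n, S.Lam L g n * nps (1 + σ / L) n with hp
  obtain ⟨x, hx, hx1, hx2⟩ := S.bC_zero hL hq h0 h1
  have h2 := S.LC_mul_bC hL hq 0 h0 h1
  rw [hx, (S.LSeries_LC L 0 hs).2] at h2
  simp only [AddChar.zero_apply, one_mul] at h2
  norm_cast at h2
  have h3 : |∑ g, S.Dr L g (1 + σ / L) - S.A L * L * ((1 + σ) / σ ^ 2) * Real.exp (-σ)| ≤
      48 * CF * L := by
    have : ∑ g, S.Dr L g (1 + σ / L) - S.A L * L * ((1 + σ) / σ ^ 2) * Real.exp (-σ) =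
        ∑ g, (S.Dr L g (1 + σ / L) - S.rho L * (L ^ 2 * ((1 + σ) / σ ^ 2) * Real.exp (-σ))) := by
      rw [Finset.sum_sub_distrib, Finset.sum_const, nsmul_eq_mul, Finset.card_univ]
      unfold A; ring
    rw [this]
    refine (Finset.abs_sum_le_sum_abs _ _).trans ?_
    refine (Finset.sum_le_sum fun g _ => (S.Dr_bound hL hq g h0 h1).2).trans ?_
    rw [Finset.sum_const, nsmul_eq_mul, Finset.card_univ]
    exact S.card_mul_le hL hq hL0.le
  have h4 : |S.A L * L * ((1 + σ) / σ ^ 2) * Real.exp (-σ) - S.A L * L / σ ^ 2| ≤ 12 * L := by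
    have h5 := Real.add_one_le_exp (-σ)
    have h6 : (1 + σ) * Real.exp (-σ) ≤ 1 := by
      have := Real.add_one_le_exp σ
      calc _ ≤ Real.exp σ * Real.exp (-σ) := by gcongr; linarith
        _ = 1 := by rw [← Real.exp_add]; simp
    have h7 : 1 - σ ^ 2 ≤ (1 + σ) * Real.exp (-σ) := by nlinarith
    have e : S.A L * L * ((1 + σ) / σ ^ 2) * Real.exp (-σ) - S.A L * L / σ ^ 2 =
      -(S.A L * L / σ ^ 2 * (1 - (1 + σ) * Real.exp (-σ))) := by ring
    rw [e, abs_neg, abs_of_nonneg (mul_nonneg (by positivity) (by linarith))]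
    calc _ ≤ S.A L * L / σ ^ 2 * σ ^ 2 := by gcongr; linarith
      _ = S.A L * L := by field_simp
      _ ≤ _ := by gcongr
  have h5 : |p * x - S.A L * L / σ ^ 2| ≤ C1 * L := by
    rw [h2]
    rw [abs_le] at h3 h4 ⊢
    unfold C1
    constructor <;> linarith [h3.1, h3.2, h4.1, h4.2]
  have h6 : |(p - L / σ) * x| ≤ 2 * C1 * L / σ := by
    have e : (p - L / σ) * x = (p * x - S.A L * L / σ ^ 2) - L / σ * (x - S.A L / σ) := by
      field_simp; ring
    rw [e]
    refine (abs_sub _ _).trans ?_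
    rw [abs_mul, abs_of_pos (by positivity : 0 < L / σ)]
    have h7 : C1 * L ≤ C1 * L / σ := by
      rw [le_div_iff₀ h0]
      have : 0 < C1 * L := by positivity
      nlinarith
    calc _ ≤ C1 * L / σ + L / σ * C1 := by gcongr; linarith
      _ = _ := by ring
  have h7 : S.A L / σ ≤ 2 * C1 * x := by
    have := (abs_le.1 hx2).1
    nlinarith
  rw [abs_mul, abs_of_pos (by linarith : 0 < x)] at h6
  rw [le_div_iff₀ hA]
  have h8 : S.A L ≤ 2 * C1 * x * σ := by rwa [div_le_iff₀ h0] at h7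
  calc |p - L / σ| * S.A L ≤ |p - L / σ| * (2 * C1 * x * σ) := by gcongr
    _ = 2 * C1 * σ * (|p - L / σ| * x) := by ring
    _ ≤ 2 * C1 * σ * (2 * C1 * L / σ) := by gcongr
    _ = _ := by field_simp; ring

end Sys

/-- A smooth bump at `3.75`. -/
noncomputable def wBump : ContDiffBump (3.75 : ℝ) := ⟨0.5, 0.75, by norm_num, by norm_num⟩

/-- The weight: a smooth bump supported in `[3k, 4.5k]`, equal to `1` on `[3.25k, 4.25k]`. -/
noncomputable def wt (k v : ℝ) : ℝ := wBump (v / k)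

theorem wt_nonneg (k v : ℝ) : 0 ≤ wt k v := wBump.nonneg

theorem wt_le_one (k v : ℝ) : wt k v ≤ 1 := wBump.le_one

theorem wt_of_le {k v : ℝ} (hk : 0 < k) (h : v ≤ 3 * k) : wt k v = 0 := by
  refine wBump.zero_of_le_dist ?_
  have : v / k ≤ 3 := by rw [div_le_iff₀ hk]; linarith
  rw [Real.dist_eq, le_abs]
  right
  change (0.75 : ℝ) ≤ _
  linarith

theorem wt_of_ge {k v : ℝ} (hk : 0 < k) (h : 4.5 * k ≤ v) : wt k v = 0 := by
  refine wBump.zero_of_le_dist ?_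
  have : 4.5 ≤ v / k := by rw [le_div_iff₀ hk]; linarith
  rw [Real.dist_eq, le_abs]
  left
  change (0.75 : ℝ) ≤ _
  linarith

theorem wt_eq_one {k v : ℝ} (hk : 0 < k) (h1 : 3.25 * k ≤ v) (h2 : v ≤ 4.25 * k) : wt k v = 1 := by
  refine wBump.one_of_mem_closedBall ?_
  have h3 : 3.25 ≤ v / k := by rw [le_div_iff₀ hk]; linarith
  have h4 : v / k ≤ 4.25 := by rw [div_le_iff₀ hk]; linarith
  rw [mem_closedBall_iff_norm, Real.norm_eq_abs, abs_le]
  change -(0.5 : ℝ) ≤ _ ∧ _ ≤ (0.5:ℝ)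
  constructor <;> linarith

theorem wt_contDiff (k : ℝ) : ContDiff ℝ 1 (wt k) :=
  wBump.contDiff.comp (contDiff_id.div_const k)

theorem exists_wt_deriv : ∃ W1 : ℝ, 0 < W1 ∧ ∀ k, 1 ≤ k → ∀ v, |deriv (wt k) v| ≤ W1 := by
  have h1 : Continuous (deriv wBump) := (wBump.contDiff (n := 1)).continuous_deriv le_rfl
  obtain ⟨C, hC⟩ := h1.bounded_above_of_compact_support wBump.hasCompactSupport.deriv
  refine ⟨max C 1, lt_max_of_lt_right one_pos, fun k hk v => ?_⟩
  have hd : HasDerivAt (wt k) (deriv wBump (v / k) * (1 / k)) v := by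
    have := ((wBump.contDiff (n := 1)).differentiable (by norm_num) (v / k)).hasDerivAt
    exact this.comp v ((hasDerivAt_id v).div_const k)
  rw [hd.deriv, abs_mul, abs_of_pos (by positivity : 0 < 1 / k)]
  have h2 := hC (v / k)
  rw [Real.norm_eq_abs] at h2
  have h3 : 1 / k ≤ 1 := by rw [div_le_one (by linarith)]; exact hk
  calc _ ≤ max C 1 * 1 := by
        gcongr
        exact h2.trans (le_max_left _ _)
    _ = _ := mul_one _

theorem wtq_continuousOn {k : ℝ} (hk : 0 < k) :
    ContinuousOn (fun t => wt k (-Real.log t) / t) (Set.Icc 0 1) := by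
  intro t ht
  refine ContinuousAt.continuousWithinAt ?_
  rcases ht.1.eq_or_lt with h | h
  · have : (fun t => wt k (-Real.log t) / t) =ᶠ[nhds t] fun _ => 0 := by
      rw [← h]
      filter_upwards [Metric.ball_mem_nhds (0:ℝ) (Real.exp_pos (-(4.5 * k)))] with u hu
      rw [mem_ball_zero_iff, Real.norm_eq_abs] at hu
      by_cases hu0 : u = 0
      · simp [hu0]
      · have h1 := Real.log_lt_log (abs_pos.2 hu0) hu
        rw [Real.log_exp, Real.log_abs] at h1
        rw [wt_of_ge hk (by linarith), zero_div]
    exact this.continuousAt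
  · refine ContinuousAt.div ?_ continuousAt_id h.ne'
    exact (wt_contDiff k).continuous.continuousAt.comp (Real.continuousAt_log h.ne').neg

/-- Karamata approximation of the weight. -/
theorem exists_wt_approx {k ε : ℝ} (hk : 0 < k) (hε : 0 < ε) :
    ∃ (n : ℕ) (c : ℕ → ℝ),
      (∀ v, 0 ≤ v → |wt k v - ∑ j ∈ Finset.range n, c j * Real.exp (-((j + 1) * v))| ≤
        ε * Real.exp (-v)) ∧
      k - ε ≤ ∑ j ∈ Finset.range n, c j / (j + 1) := by
  set q : ℝ → ℝ := fun t => wt k (-Real.log t) / t with hq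
  have hqc : ContinuousOn q (Set.Icc 0 1) := wtq_continuousOn hk
  obtain ⟨p, hp⟩ := exists_polynomial_near_of_continuousOn 0 1 q hqc ε hε
  have hpe : ∀ t, p.eval t = ∑ j ∈ Finset.range (p.natDegree + 1), p.coeff j * t ^ j :=
    fun t => Polynomial.eval_eq_sum_range t
  refine ⟨p.natDegree + 1, p.coeff, fun v hv => ?_, ?_⟩
  · have h := hp (Real.exp (-v)) ⟨(Real.exp_pos _).le, Real.exp_le_one_iff.2 (by linarith)⟩
    have h1 : wt k v = Real.exp (-v) * q (Real.exp (-v)) := by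
      simp only [hq, Real.log_exp, neg_neg]
      field_simp
    have h2 : ∑ j ∈ Finset.range (p.natDegree + 1), p.coeff j * Real.exp (-((j + 1) * v)) =
        Real.exp (-v) * p.eval (Real.exp (-v)) := by
      rw [hpe, Finset.mul_sum]
      refine Finset.sum_congr rfl fun j _ => ?_
      rw [← Real.exp_nat_mul, mul_left_comm, ← Real.exp_add]
      congr 2; ring
    rw [h1, h2, ← mul_sub, abs_mul, abs_of_pos (Real.exp_pos _), mul_comm, abs_sub_comm]
    gcongr
  · have hi : IntervalIntegrable q MeasureTheory.volume 0 1 :=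
      (by rw [Set.uIcc_of_le zero_le_one]; exact hqc : ContinuousOn q (Set.uIcc 0 1)).intervalIntegrable
    have h1 : ∫ t in (0:ℝ)..1, p.eval t =
        ∑ j ∈ Finset.range (p.natDegree + 1), p.coeff j / (j + 1) := by
      simp only [hpe]
      rw [intervalIntegral.integral_finsetSum (fun j _ =>
        (Continuous.intervalIntegrable (by fun_prop) _ _))]
      refine Finset.sum_congr rfl fun j _ => ?_
      rw [intervalIntegral.integral_const_mul, integral_pow]
      simp [div_eq_mul_inv]
    rw [← h1]
    have h2 : ∫ t in (0:ℝ)..1, (q t - ε) ≤ ∫ t in (0:ℝ)..1, p.eval t := by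
      refine intervalIntegral.integral_mono_on zero_le_one (hi.sub (by simp))
        (Continuous.intervalIntegrable p.continuous _ _) fun t ht => ?_
      have := (abs_lt.1 (hp t ht)).1
      linarith
    rw [intervalIntegral.integral_sub hi (by simp)] at h2
    simp only [intervalIntegral.integral_const, sub_zero, one_smul] at h2
    have ha : 0 < Real.exp (-(4.25 * k)) := Real.exp_pos _
    have hab : Real.exp (-(4.25 * k)) ≤ Real.exp (-(3.25 * k)) :=
      Real.exp_le_exp.2 (by linarith)
    have hb : Real.exp (-(3.25 * k)) ≤ 1 := Real.exp_le_one_iff.2 (by linarith)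
    have h3 : ∫ t in Real.exp (-(4.25 * k))..Real.exp (-(3.25 * k)), q t ≤ ∫ t in (0:ℝ)..1, q t := by
      refine intervalIntegral.integral_mono_interval ha.le hab hb ?_ hi
      filter_upwards [MeasureTheory.self_mem_ae_restrict measurableSet_Ioc] with t ht
      exact div_nonneg (wt_nonneg _ _) ht.1.le
    have h4 : ∫ t in Real.exp (-(4.25 * k))..Real.exp (-(3.25 * k)), q t = k := by
      have : ∫ t in Real.exp (-(4.25 * k))..Real.exp (-(3.25 * k)), q t =
          ∫ t in Real.exp (-(4.25 * k))..Real.exp (-(3.25 * k)), t⁻¹ := by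
        refine intervalIntegral.integral_congr fun t ht => ?_
        rw [Set.uIcc_of_le hab] at ht
        have ht0 : 0 < t := ha.trans_le ht.1
        have e1 := Real.log_le_log ha ht.1
        have e2 := Real.log_le_log ht0 ht.2
        rw [Real.log_exp] at e1 e2
        simp only [hq]
        rw [wt_eq_one hk (by linarith) (by linarith), one_div]
      rw [this, integral_inv_of_pos ha (Real.exp_pos _), ← Real.exp_sub, Real.log_exp]
      ring
    linarith

section NearConst

open scoped ComplexConjugate

variable {G : Type}

/-- `f` is within `η` of a constant. -/
def NC (f : G → ℝ) (η : ℝ) : Prop := ∃ μ : ℝ, ∀ g, |f g - μ| ≤ η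

theorem NC.add {f f' : G → ℝ} {η η' : ℝ} (h : NC f η) (h' : NC f' η') :
    NC (fun g => f g + f' g) (η + η') := by
  obtain ⟨μ, h⟩ := h
  obtain ⟨μ', h'⟩ := h'
  refine ⟨μ + μ', fun g => ?_⟩
  rw [add_sub_add_comm]
  exact (abs_add_le _ _).trans (add_le_add (h g) (h' g))

theorem NC.sub {f f' : G → ℝ} {η η' : ℝ} (h : NC f η) (h' : NC f' η') :
    NC (fun g => f g - f' g) (η + η') := by
  obtain ⟨μ, h⟩ := h
  obtain ⟨μ', h'⟩ := h'
  refine ⟨μ - μ', fun g => ?_⟩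
  rw [sub_sub_sub_comm]
  exact (abs_sub _ _).trans (add_le_add (h g) (h' g))

theorem NC.mono {f : G → ℝ} {η η' : ℝ} (h : NC f η) (hη : η ≤ η') : NC f η' := by
  obtain ⟨μ, h⟩ := h
  exact ⟨μ, fun g => (h g).trans hη⟩

theorem NC.of_close {f f' : G → ℝ} {η η' : ℝ} (h : NC f η) (h' : ∀ g, |f' g - f g| ≤ η') :
    NC f' (η + η') := by
  obtain ⟨μ, h⟩ := h
  refine ⟨μ, fun g => ?_⟩
  have := abs_add_le (f g - μ) (f' g - f g)
  rw [show f g - μ + (f' g - f g) = f' g - μ by ring] at this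
  exact this.trans (add_le_add (h g) (h' g))

theorem NC.sum {ι : Type*} (s : Finset ι) {f : ι → G → ℝ} {η : ι → ℝ}
    (h : ∀ i ∈ s, NC (f i) (η i)) : NC (fun g => ∑ i ∈ s, f i g) (∑ i ∈ s, η i) := by
  classical
  induction s using Finset.induction_on with
  | empty => exact ⟨0, fun g => by simp⟩
  | insert i s hi ih =>
    simp only [Finset.sum_insert hi]
    exact (h i (Finset.mem_insert_self _ _)).add
      (ih fun j hj => h j (Finset.mem_insert_of_mem hj))

theorem NC.const_mul {f : G → ℝ} {η : ℝ} (h : NC f η) (c : ℝ) :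
    NC (fun g => c * f g) (|c| * η) := by
  obtain ⟨μ, h⟩ := h
  refine ⟨c * μ, fun g => ?_⟩
  rw [← mul_sub, abs_mul]
  exact mul_le_mul_of_nonneg_left (h g) (abs_nonneg c)

theorem NC.shift [AddCommGroup G] {f : G → ℝ} {η : ℝ} (h : NC f η) (a : G) : NC (fun g => f (g - a)) η := by
  obtain ⟨μ, h⟩ := h
  exact ⟨μ, fun g => h _⟩

variable [Fintype G]

theorem NC.conv [AddCommGroup G] {ι : Type*} (s : Finset ι) {f : ι → G → ℝ} {r : ι → G → ℝ} {η : ℝ}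
    (hr : ∀ i ∈ s, ∀ g, 0 ≤ r i g) (h : ∀ i ∈ s, NC (f i) η) :
    NC (fun g => ∑ i ∈ s, ∑ g', r i g' * f i (g - g')) (η * ∑ i ∈ s, ∑ g', r i g') := by
  rw [Finset.mul_sum]
  refine NC.sum s fun i hi => ?_
  rw [Finset.mul_sum]
  refine NC.sum Finset.univ fun g' _ => ?_
  have := ((h i hi).shift g').const_mul (r i g')
  rw [abs_of_nonneg (hr i hi g'), mul_comm] at this
  exact this

/-- A nearly constant function is close to its mean. -/
theorem NC.lower [Nonempty G] {f : G → ℝ} {η T : ℝ} (h : NC f η) (hT : T ≤ ∑ g, f g) (g : G) :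
    T / Fintype.card G - 2 * η ≤ f g := by
  obtain ⟨μ, h⟩ := h
  have hc : 0 < (Fintype.card G : ℝ) := by
    exact_mod_cast Fintype.card_pos
  have h1 : ∑ g, f g ≤ ∑ _g : G, (μ + η) :=
    Finset.sum_le_sum fun g _ => by linarith [(abs_le.1 (h g)).2]
  rw [Finset.sum_const, nsmul_eq_mul, Finset.card_univ] at h1
  have h2 : T / Fintype.card G ≤ μ + η := by
    rw [div_le_iff₀ hc]; linarith
  linarith [(abs_le.1 (h g)).1]

variable [AddCommGroup G]

theorem sum_normSq_char (a : G → ℝ) :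
    ∑ ψ : AddChar G ℂ, ‖∑ g, ψ g * (a g : ℂ)‖ ^ 2 = Fintype.card G * ∑ g, a g ^ 2 := by
  classical
  have h : ∀ ψ : AddChar G ℂ, ((‖∑ g, ψ g * (a g : ℂ)‖ ^ 2 : ℝ) : ℂ) =
      ∑ g, ∑ g', (a g * a g' : ℂ) * ψ (g - g') := by
    intro ψ
    rw [Complex.ofReal_pow, ← Complex.mul_conj', map_sum, Finset.sum_mul_sum]
    refine Finset.sum_congr rfl fun g _ => Finset.sum_congr rfl fun g' _ => ?_
    rw [map_mul, Complex.conj_ofReal, ← AddChar.map_neg_eq_conj, sub_eq_add_neg,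
      AddChar.map_add_eq_mul]
    ring
  have h2 : ((∑ ψ : AddChar G ℂ, ‖∑ g, ψ g * (a g : ℂ)‖ ^ 2 : ℝ) : ℂ) =
      ((Fintype.card G * ∑ g, a g ^ 2 : ℝ) : ℂ) := by
    rw [Complex.ofReal_sum]
    simp only [h]
    rw [Finset.sum_comm]
    push_cast
    rw [Finset.mul_sum]
    refine Finset.sum_congr rfl fun g _ => ?_
    rw [Finset.sum_comm]
    simp only [← Finset.mul_sum, AddChar.sum_apply_eq_ite, sub_eq_zero, mul_ite, mul_zero]
    rw [Finset.sum_ite_eq]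
    simp
    ring
  exact_mod_cast h2

theorem char_inversion (a P : G → ℝ) (g : G) :
    (Fintype.card G : ℂ) * ((∑ g', ∑ g'', a g' * a g'' * P (g - g' - g'') : ℝ) : ℂ) =
      ∑ ψ : AddChar G ℂ, ψ (-g) * (∑ x, ψ x * (P x : ℂ)) * (∑ x, ψ x * (a x : ℂ)) ^ 2 := by
  classical
  have h : ∀ ψ : AddChar G ℂ,
      ψ (-g) * (∑ x, ψ x * (P x : ℂ)) * (∑ x, ψ x * (a x : ℂ)) ^ 2 =
      ∑ g', ∑ g'', ∑ x, (a g' * a g'' * P x : ℂ) * ψ (x - (g - g' - g'')) := by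
    intro ψ
    rw [sq, Finset.sum_mul_sum, Finset.mul_sum]
    refine Finset.sum_congr rfl fun g' _ => ?_
    rw [Finset.mul_sum]
    refine Finset.sum_congr rfl fun g'' _ => ?_
    rw [Finset.mul_sum, Finset.sum_mul]
    refine Finset.sum_congr rfl fun x _ => ?_
    rw [show x - (g - g' - g'') = -g + x + g' + g'' by abel, AddChar.map_add_eq_mul,
      AddChar.map_add_eq_mul, AddChar.map_add_eq_mul]
    ring
  simp only [h]
  conv_rhs => rw [Finset.sum_comm]
  push_cast
  rw [Finset.mul_sum]
  refine Finset.sum_congr rfl fun g' _ => ?_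
  conv_rhs => rw [Finset.sum_comm]
  rw [Finset.mul_sum]
  refine Finset.sum_congr rfl fun g'' _ => ?_
  conv_rhs => rw [Finset.sum_comm]
  simp only [← Finset.mul_sum, AddChar.sum_apply_eq_ite, sub_eq_zero, mul_ite, mul_zero]
  rw [Finset.sum_ite_eq']
  simp
  ring

/-- The bilinear estimate. -/
theorem NC.bilinear (a P : G → ℝ) {M : ℝ} (hM0 : 0 ≤ M)
    (hM : ∀ ψ : AddChar G ℂ, ψ ≠ 0 → ‖∑ x, ψ x * (P x : ℂ)‖ ≤ M) :
    NC (fun g => ∑ g', ∑ g'', a g' * a g'' * P (g - g' - g'')) (M * ∑ g, a g ^ 2) := by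
  classical
  have hc : 0 < (Fintype.card G : ℝ) := by
    have : Nonempty G := ⟨0⟩
    exact_mod_cast Fintype.card_pos
  refine ⟨(∑ x, P x) * (∑ x, a x) ^ 2 / Fintype.card G, fun g => ?_⟩
  set f := ∑ g', ∑ g'', a g' * a g'' * P (g - g' - g'') with hf
  have h := char_inversion a P g
  rw [← hf, ← Finset.add_sum_erase _ _ (Finset.mem_univ (0 : AddChar G ℂ))] at h
  simp only [AddChar.zero_apply, one_mul] at h
  have h1 : ((Fintype.card G * (f - (∑ x, P x) * (∑ x, a x) ^ 2 / Fintype.card G) : ℝ) : ℂ) =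
      ∑ ψ ∈ Finset.univ.erase (0 : AddChar G ℂ),
        ψ (-g) * (∑ x, ψ x * (P x : ℂ)) * (∑ x, ψ x * (a x : ℂ)) ^ 2 := by
    have : (Fintype.card G * (f - (∑ x, P x) * (∑ x, a x) ^ 2 / Fintype.card G) : ℝ) =
      Fintype.card G * f - (∑ x, P x) * (∑ x, a x) ^ 2 := by field_simp
    rw [this, Complex.ofReal_sub, Complex.ofReal_mul, Complex.ofReal_natCast, h]
    push_cast
    ring
  have h2 : Fintype.card G * |f - (∑ x, P x) * (∑ x, a x) ^ 2 / Fintype.card G| ≤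
      M * (Fintype.card G * ∑ g, a g ^ 2) := by
    have e : (Fintype.card G : ℝ) * |f - (∑ x, P x) * (∑ x, a x) ^ 2 / Fintype.card G| =
        |Fintype.card G * (f - (∑ x, P x) * (∑ x, a x) ^ 2 / Fintype.card G)| := by
      rw [abs_mul, abs_of_pos hc]
    rw [e, ← Real.norm_eq_abs, ← Complex.norm_real, h1]
    refine (norm_sum_le _ _).trans ?_
    rw [← sum_normSq_char, Finset.mul_sum]
    refine (Finset.sum_le_sum (g := fun ψ : AddChar G ℂ => M * ‖∑ x, ψ x * (a x : ℂ)‖ ^ 2)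
      fun ψ hψ => ?_).trans
      (Finset.sum_le_sum_of_subset_of_nonneg (Finset.erase_subset _ _)
        fun ψ _ _ => by positivity)
    rw [norm_mul, norm_mul, norm_pow, AddChar.norm_apply, one_mul]
    gcongr
    exact hM ψ (Finset.ne_of_mem_erase hψ)
  refine le_of_mul_le_mul_left ?_ hc
  linarith

end NearConst

theorem sum_Ioc_divisorsAntidiagonal (Z : ℕ) (F : ℕ → ℕ → ℝ) :
    ∑ n ∈ Finset.Ioc 0 Z, ∑ x ∈ n.divisorsAntidiagonal, F x.1 x.2 =
      ∑ m ∈ Finset.Ioc 0 Z, ∑ d ∈ Finset.Ioc 0 Z, if d * m ≤ Z then F d m else 0 := by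
  rw [Finset.sum_comm, ← Finset.sum_product', ← Finset.sum_filter]
  rw [← Finset.sum_fiberwise_of_maps_to (t := Finset.Ioc 0 Z)
    (g := fun x : ℕ × ℕ => x.1 * x.2)]
  · refine Finset.sum_congr rfl fun n hn => ?_
    refine Finset.sum_congr ?_ fun _ _ => rfl
    rw [Finset.mem_Ioc] at hn
    ext ⟨d, m⟩
    simp only [Nat.mem_divisorsAntidiagonal, Finset.mem_filter, Finset.mem_product,
      Finset.mem_Ioc]
    constructor
    · rintro ⟨h1, h2⟩
      have hd : 0 < d := Nat.pos_of_ne_zero fun h => h2 (by rw [← h1, h, zero_mul])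
      have hm : 0 < m := Nat.pos_of_ne_zero fun h => h2 (by rw [← h1, h, mul_zero])
      exact ⟨⟨⟨⟨hd, (Nat.le_mul_of_pos_right d hm).trans (h1 ▸ hn.2)⟩,
        hm, (Nat.le_mul_of_pos_left m hd).trans (h1 ▸ hn.2)⟩, h1 ▸ hn.2⟩, h1⟩
    · rintro ⟨_, h1⟩
      exact ⟨h1, by omega⟩
  · intro x hx
    simp only [Finset.mem_filter, Finset.mem_product, Finset.mem_Ioc] at hx ⊢
    exact ⟨Nat.mul_pos hx.1.1.1 hx.1.2.1, hx.2⟩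

theorem wt_comp_hasDerivAt (k a l v : ℝ) :
    HasDerivAt (fun v => wt k ((v + a) / l)) (deriv (wt k) ((v + a) / l) * (1 / l)) v := by
  have := ((wt_contDiff k).differentiable (by norm_num) ((v + a) / l)).hasDerivAt
  exact HasDerivAt.comp (h₂ := wt k) (h := fun v => (v + a) / l) v this
    (((hasDerivAt_id v).add_const a).div_const l)

theorem wt_comp_contDiff (k a l : ℝ) : ContDiff ℝ 1 (fun v => wt k ((v + a) / l)) :=
  (wt_contDiff k).comp ((contDiff_id.add contDiff_const).div_const l)

namespace Sys

open scoped Classical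

variable {P G : Type} [AddCommGroup G] [Fintype G]

/-- Smoothed prime sums in a class. -/
noncomputable def La (S : Sys P G) (L l k a : ℝ) (g : G) : ℝ :=
  ∑ n ∈ Finset.Ioc 0 ⌊Real.exp (5 * k * l)⌋₊, S.Lam L g n / n * wt k ((Real.log n + a) / l)

/-- Smoothed sums of `log` over rough elements in a class. -/
noncomputable def Tm (S : Sys P G) (l k a : ℝ) (g : G) : ℝ :=
  ∑ n ∈ Finset.Ioc 0 ⌊Real.exp (5 * k * l)⌋₊,
    Real.log n * S.bb l g n / n * wt k ((Real.log n + a) / l)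

theorem Tm_eq (S : Sys P G) {l k a : ℝ} (hl : 0 < l) (hk : 0 < k) (ha : 0 ≤ a) (g : G) :
    S.Tm l k a g = ∑ m ∈ Finset.Ioc 0 ⌊Real.exp (5 * k * l)⌋₊, ∑ g',
      S.bb l g' m / m * S.La l l k (a + Real.log m) (g - g') := by
  set Z := ⌊Real.exp (5 * k * l)⌋₊ with hZ
  have h1 : S.Tm l k a g = ∑ n ∈ Finset.Ioc 0 Z, ∑ x ∈ n.divisorsAntidiagonal,
      ∑ g', S.bb l g' x.2 / x.2 * (S.Lam l (g - g') x.1 / x.1 *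
        wt k ((Real.log x.1 + (a + Real.log x.2)) / l)) := by
    refine Finset.sum_congr rfl fun n hn => ?_
    have hn0 : n ≠ 0 := by have := (Finset.mem_Ioc.1 hn).1; omega
    rw [S.conv l g hn0, Finset.sum_div, Finset.sum_mul]
    refine Finset.sum_congr rfl fun x hx => ?_
    obtain ⟨hx1, -⟩ := Nat.mem_divisorsAntidiagonal.1 hx
    have hx10 : (x.1:ℝ) ≠ 0 := by
      intro h
      have : x.1 = 0 := by exact_mod_cast h
      exact hn0 (by rw [← hx1, this, zero_mul])
    have hx20 : (x.2:ℝ) ≠ 0 := by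
      intro h
      have : x.2 = 0 := by exact_mod_cast h
      exact hn0 (by rw [← hx1, this, mul_zero])
    have hnx : (n:ℝ) = x.1 * x.2 := by rw [← hx1]; push_cast; rfl
    rw [Finset.sum_div, Finset.sum_mul]
    rw [← (Equiv.subLeft g).sum_comp]
    refine Finset.sum_congr rfl fun g' _ => ?_
    simp only [Equiv.subLeft_apply, sub_sub_cancel]
    rw [hnx, Real.log_mul hx10 hx20]
    rw [show Real.log x.1 + Real.log x.2 + a = Real.log x.1 + (a + Real.log x.2) by ring]
    field_simp
  rw [h1, sum_Ioc_divisorsAntidiagonal Z (fun d m => ∑ g', S.bb l g' m / m *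
    (S.Lam l (g - g') d / d * wt k ((Real.log d + (a + Real.log m)) / l)))]
  refine Finset.sum_congr rfl fun m hm => ?_
  have hm0 : (0:ℝ) < m := by exact_mod_cast (Finset.mem_Ioc.1 hm).1
  have h2 : ∀ d ∈ Finset.Ioc 0 Z, (if d * m ≤ Z then ∑ g', S.bb l g' m / m *
      (S.Lam l (g - g') d / d * wt k ((Real.log d + (a + Real.log m)) / l)) else 0) =
      ∑ g', S.bb l g' m / m *
      (S.Lam l (g - g') d / d * wt k ((Real.log d + (a + Real.log m)) / l)) := by
    intro d hd
    split_ifs with h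
    · rfl
    · have hd0 : (0:ℝ) < d := by exact_mod_cast (Finset.mem_Ioc.1 hd).1
      have h3 : Real.exp (5 * k * l) < (d:ℝ) * m := by
        have := Nat.lt_of_floor_lt (not_le.1 h)
        push_cast at this
        exact this
      have h4 : 5 * k * l < Real.log d + Real.log m := by
        rw [← Real.log_mul hd0.ne' hm0.ne', Real.lt_log_iff_exp_lt (by positivity)]
        exact h3
      have h5 : wt k ((Real.log d + (a + Real.log m)) / l) = 0 := by
        refine wt_of_ge hk ?_
        rw [le_div_iff₀ hl]
        nlinarith [mul_pos hk hl]
      simp [h5]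
  rw [Finset.sum_congr rfl h2, Finset.sum_comm]
  refine Finset.sum_congr rfl fun g' _ => ?_
  rw [La, Finset.mul_sum]

/-- constant -/
noncomputable def KX (W1 : ℝ) : ℝ := 4 * CF * (1 + W1) * 12

theorem NC_Tm (S : Sys P G) {l k a W1 : ℝ} (hl : 300000 ≤ l) (hq : 128 * Real.log S.Q ≤ l)
    (hk : 1 ≤ k) (hW : ∀ v, |deriv (wt k) v| ≤ W1) (ha : 0 ≤ a) (hak : a ≤ k * l) :
    NC (S.Tm l k a) (KX W1 * (6 * k * l) * Real.exp (-k) / Fintype.card G) := by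
  have hl0 : 0 < l := by linarith
  have hk0 : 0 < k := by linarith
  have hkl : l ≤ k * l := by nlinarith
  have hW0 : 0 ≤ W1 := (abs_nonneg _).trans (hW 0)
  have hG : 0 < (Fintype.card G : ℝ) := by
    have : Nonempty G := ⟨0⟩
    exact_mod_cast Fintype.card_pos
  set ψ : ℝ → ℝ := fun v => v * wt k ((v + a) / l) with hψ
  refine ⟨S.rho l * ∫ v in (2 * k * l)..(5 * k * l), ψ v, fun g => ?_⟩
  have hd : ∀ v, HasDerivAt ψ (1 * wt k ((v + a) / l) +
      v * (deriv (wt k) ((v + a) / l) * (1 / l))) v := fun v =>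
    (hasDerivAt_id v).mul (wt_comp_hasDerivAt k a l v)
  have hM : 0 ≤ (1 + W1) * (6 * k * l) := by positivity
  have h := S.abel hl hq g (ψ := ψ) (v0 := 2 * k * l) (v1 := 5 * k * l)
    (M := (1 + W1) * (6 * k * l)) (contDiff_id.mul (wt_comp_contDiff k a l))
    (by nlinarith) (by nlinarith) hM ?_ ?_
  · have e : S.Tm l k a g = ∑ n ∈ Finset.Ioc ⌊Real.exp (2 * k * l)⌋₊ ⌊Real.exp (5 * k * l)⌋₊,
        ψ (Real.log n) / n * S.bb l g n := by
      rw [Tm]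
      symm
      refine (Finset.sum_subset (Finset.Ioc_subset_Ioc_left (Nat.zero_le _)) ?_).trans
        (Finset.sum_congr rfl fun n _ => by simp only [hψ]; ring)
      intro n hn hn2
      rw [Finset.mem_Ioc] at hn hn2
      have h1 : n ≤ ⌊Real.exp (2 * k * l)⌋₊ := by
        by_contra h
        exact hn2 ⟨not_le.1 h, hn.2⟩
      have hn0 : (0:ℝ) < n := by exact_mod_cast hn.1
      have h2 : (n:ℝ) ≤ Real.exp (2 * k * l) :=
        (Nat.le_floor_iff (Real.exp_pos _).le).1 h1
      have h3 : Real.log n ≤ 2 * k * l := by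
        rw [Real.log_le_iff_le_exp hn0]; exact h2
      have : wt k ((Real.log n + a) / l) = 0 := by
        refine wt_of_le hk0 ?_
        rw [div_le_iff₀ hl0]; nlinarith
      simp [hψ, this]
    rw [e]
    refine h.trans ?_
    have hρ0 := S.rho_pos l
    have hA := S.A_le hl hq
    unfold A at hA
    have hρ : S.rho l * l ≤ 12 / Fintype.card G := by
      rw [le_div_iff₀ hG]; linarith
    have h2 : Real.exp (-(2 * k * l / l)) ≤ Real.exp (-k) := by
      apply Real.exp_le_exp.2
      rw [mul_div_cancel_right₀ _ hl0.ne']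
      linarith
    have hCF := CF_pos
    calc _ ≤ 4 * CF * ((1 + W1) * (6 * k * l)) * Real.exp (-k) * (12 / Fintype.card G) := by
          gcongr
      _ = _ := by unfold KX; ring
  · intro v hv
    have hv0 : 0 ≤ v := le_trans (by positivity) hv.1
    have h1 : 1 ≤ Real.exp (v / l) := Real.one_le_exp (by positivity)
    simp only [hψ]
    rw [abs_mul, abs_of_nonneg hv0, abs_of_nonneg (wt_nonneg _ _)]
    calc v * wt k ((v + a) / l) ≤ 5 * k * l * 1 :=
          mul_le_mul hv.2 (wt_le_one _ _) (wt_nonneg _ _) (by positivity)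
      _ ≤ (1 + W1) * (6 * k * l) := by nlinarith [mul_pos hk0 hl0]
      _ ≤ _ := le_mul_of_one_le_right hM h1
  · intro v hv
    have hv0 : 0 ≤ v := le_trans (by positivity) hv.1
    have h1 : 1 ≤ Real.exp (v / l) := Real.one_le_exp (by positivity)
    rw [(hd v).deriv]
    refine (abs_add_le _ _).trans ?_
    rw [one_mul, abs_of_nonneg (wt_nonneg _ _), abs_mul, abs_mul, abs_of_nonneg hv0,
      abs_of_pos (by positivity : 0 < 1 / l)]
    have h2 : |deriv (wt k) ((v + a) / l)| * (1 / l) ≤ W1 * 1 := by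
      gcongr
      · exact hW _
      · rw [div_le_one hl0]; linarith
    calc _ ≤ 1 + 5 * k * l * (W1 * 1) := by
          gcongr
          · exact wt_le_one _ _
          · exact hv.2
      _ ≤ (1 + W1) * (6 * k * l) := by nlinarith [mul_nonneg hW0 (mul_pos hk0 hl0).le]
      _ ≤ _ := le_mul_of_one_le_right hM h1

/-- The inner smoothed sums over rough elements. -/
theorem NC_inner (S : Sys P G) {l k b W1 : ℝ} (hl : 300000 ≤ l) (hq : 128 * Real.log S.Q ≤ l)
    (hk : 1 ≤ k) (hW : ∀ v, |deriv (wt k) v| ≤ W1) :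
    NC (fun g => ∑ m ∈ Finset.Ioc ⌊Real.exp (k * l)⌋₊ ⌊Real.exp (5 * k * l)⌋₊,
      S.bb l g m / m * wt k ((Real.log m + b) / l))
      (KX W1 * Real.exp (-k) / Fintype.card G) := by
  have hl0 : 0 < l := by linarith
  have hk0 : 0 < k := by linarith
  have hkl : l ≤ k * l := by nlinarith
  have hW0 : 0 ≤ W1 := (abs_nonneg _).trans (hW 0)
  have hG : 0 < (Fintype.card G : ℝ) := by
    have : Nonempty G := ⟨0⟩
    exact_mod_cast Fintype.card_pos
  set ψ : ℝ → ℝ := fun v => wt k ((v + b) / l) with hψ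
  refine ⟨S.rho l * ∫ v in (k * l)..(5 * k * l), ψ v, fun g => ?_⟩
  have h := S.abel hl hq g (ψ := ψ) (v0 := k * l) (v1 := 5 * k * l)
    (M := 1 + W1) (wt_comp_contDiff k b l)
    (by nlinarith) (by nlinarith) (by positivity) ?_ ?_
  · beta_reduce
    rw [Finset.sum_congr rfl fun n _ => show S.bb l g n / n * wt k ((Real.log n + b) / l) =
      ψ (Real.log n) / n * S.bb l g n by simp only [hψ]; ring]
    refine h.trans ?_
    have hρ0 := S.rho_pos l
    have hA := S.A_le hl hq
    unfold A at hA
    have hρ : S.rho l * l ≤ 12 / Fintype.card G := by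
      rw [le_div_iff₀ hG]; linarith
    have hCF := CF_pos
    rw [mul_div_cancel_right₀ _ hl0.ne']
    calc _ ≤ 4 * CF * (1 + W1) * Real.exp (-k) * (12 / Fintype.card G) := by
          gcongr
      _ = _ := by unfold KX; ring
  · intro v hv
    have h1 : 1 ≤ Real.exp (v / l) := Real.one_le_exp (div_nonneg (le_trans (by positivity) hv.1) hl0.le)
    simp only [hψ]
    rw [abs_of_nonneg (wt_nonneg _ _)]
    have := wt_le_one k ((v + b) / l)
    nlinarith
  · intro v hv
    have h1 : 1 ≤ Real.exp (v / l) := Real.one_le_exp (div_nonneg (le_trans (by positivity) hv.1) hl0.le)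
    rw [(wt_comp_hasDerivAt k b l v).deriv]
    rw [abs_mul, abs_of_pos (by positivity : 0 < 1 / l)]
    have h2 : |deriv (wt k) ((v + b) / l)| * (1 / l) ≤ W1 * 1 := by
      gcongr
      · exact hW _
      · rw [div_le_one hl0]; linarith
    nlinarith

theorem sum_Lam_div_le (S : Sys P G) {l k : ℝ} (hl : 300000 ≤ l) (hk : 1 ≤ k) (L : ℝ) :
    ∑ d ∈ Finset.Ioc 0 ⌊Real.exp (5 * k * l)⌋₊, ∑ g', S.Lam L g' d / d ≤ 24 * k * l := by
  have hkl : l ≤ k * l := by nlinarith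
  have h := sum_vonMangoldt_div_le (X := Real.exp (5 * k * l))
    (Real.one_le_exp (by nlinarith))
  rw [Real.log_exp] at h
  calc _ ≤ ∑ d ∈ Finset.Ioc 0 ⌊Real.exp (5 * k * l)⌋₊, 4 * (ArithmeticFunction.vonMangoldt d / d) := by
        refine Finset.sum_le_sum fun d _ => ?_
        rw [← Finset.sum_div, ← mul_div_assoc]
        gcongr
        exact S.sum_Lam_le L d
    _ ≤ _ := by rw [← Finset.mul_sum]; nlinarith

/-- The near-constant combination. -/
theorem NC_X (S : Sys P G) {l k a W1 : ℝ} (hl : 300000 ≤ l) (hq : 128 * Real.log S.Q ≤ l)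
    (hk : 1 ≤ k) (hW : ∀ v, |deriv (wt k) v| ≤ W1) (ha : 0 ≤ a) (hak : a ≤ k * l) :
    NC (fun g => S.La l l k a g + ∑ m ∈ Finset.Ioc 1 ⌊Real.exp (k * l)⌋₊, ∑ g',
      S.bb l g' m / m * S.La l l k (a + Real.log m) (g - g'))
      (KX W1 * (30 * k * l) * Real.exp (-k) / Fintype.card G) := by
  have hl0 : 0 < l := by linarith
  have hk0 : 0 < k := by linarith
  have hkl : l ≤ k * l := by nlinarith
  have hW0 : 0 ≤ W1 := (abs_nonneg _).trans (hW 0)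
  have hG : 0 < (Fintype.card G : ℝ) := by
    have : Nonempty G := ⟨0⟩
    exact_mod_cast Fintype.card_pos
  set M := ⌊Real.exp (k * l)⌋₊ with hM
  set Z := ⌊Real.exp (5 * k * l)⌋₊ with hZ
  have hM1 : 1 ≤ M := by
    rw [hM, Nat.one_le_floor_iff]; exact Real.one_le_exp (by positivity)
  have hMZ : M ≤ Z := Nat.floor_mono (Real.exp_le_exp.2 (by nlinarith))
  have htail := NC.conv (Finset.Ioc 0 Z) (f := fun d g => ∑ m ∈ Finset.Ioc M Z,
      S.bb l g m / m * wt k ((Real.log m + (Real.log d + a)) / l))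
      (r := fun d g' => S.Lam l g' d / d)
      (η := KX W1 * Real.exp (-k) / Fintype.card G)
      (fun d _ g => div_nonneg (S.Lam_nonneg l g d) (Nat.cast_nonneg _))
      (fun d _ => S.NC_inner hl hq hk hW)
  have h := (S.NC_Tm hl hq hk hW ha hak).sub htail
  have e : (fun g => S.La l l k a g + ∑ m ∈ Finset.Ioc 1 M, ∑ g',
      S.bb l g' m / m * S.La l l k (a + Real.log m) (g - g')) = fun g => S.Tm l k a g -
      ∑ d ∈ Finset.Ioc 0 Z, ∑ g', S.Lam l g' d / d * ∑ m ∈ Finset.Ioc M Z,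
        S.bb l (g - g') m / m * wt k ((Real.log m + (Real.log d + a)) / l) := by
    funext g
    have e1 : ∑ d ∈ Finset.Ioc 0 Z, ∑ g', S.Lam l g' d / d * ∑ m ∈ Finset.Ioc M Z,
        S.bb l (g - g') m / m * wt k ((Real.log m + (Real.log d + a)) / l) =
        ∑ m ∈ Finset.Ioc M Z, ∑ g',
          S.bb l g' m / m * S.La l l k (a + Real.log m) (g - g') := by
      have e2 : ∀ d ∈ Finset.Ioc 0 Z, ∑ g', S.Lam l g' d / d * ∑ m ∈ Finset.Ioc M Z,
          S.bb l (g - g') m / m * wt k ((Real.log m + (Real.log d + a)) / l) =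
          ∑ m ∈ Finset.Ioc M Z, ∑ g', S.bb l g' m / m * (S.Lam l (g - g') d / d *
            wt k ((Real.log d + (a + Real.log m)) / l)) := by
        intro d _
        rw [Finset.sum_comm]
        rw [← (Equiv.subLeft g).sum_comp]
        refine Finset.sum_congr rfl fun g' _ => ?_
        simp only [Equiv.subLeft_apply, sub_sub_cancel]
        rw [Finset.mul_sum]
        refine Finset.sum_congr rfl fun m _ => ?_
        rw [show Real.log m + (Real.log d + a) = Real.log d + (a + Real.log m) by ring]
        ring
      rw [Finset.sum_congr rfl e2, Finset.sum_comm]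
      refine Finset.sum_congr rfl fun m _ => ?_
      rw [Finset.sum_comm]
      refine Finset.sum_congr rfl fun g' _ => ?_
      rw [La, Finset.mul_sum]
    rw [e1, S.Tm_eq hl0 hk0 ha g]
    rw [← Finset.sum_Ioc_consecutive _ (Nat.zero_le M) hMZ, add_sub_cancel_right,
      ← Finset.sum_Ioc_consecutive _ (Nat.zero_le 1) hM1]
    congr 1
    rw [show Finset.Ioc 0 1 = {1} by rfl, Finset.sum_singleton]
    simp [bb_one]
  rw [e]
  refine h.mono ?_
  have hs := S.sum_Lam_div_le hl hk l
  have hK : 0 ≤ KX W1 := by have := CF_pos; unfold KX; positivity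
  calc _ ≤ KX W1 * (6 * k * l) * Real.exp (-k) / Fintype.card G +
      KX W1 * Real.exp (-k) / Fintype.card G * (24 * k * l) := by gcongr
    _ = _ := by ring

end Sys

theorem bilinear_collapse {G : Type} [AddCommGroup G] [Fintype G] (s : Finset ℕ)
    (r : ℕ → G → ℝ) (u : ℕ → ℝ) (F : G → ℝ) (g : G) :
    ∑ m ∈ s, ∑ g', r m g' * ∑ m' ∈ s, ∑ g'', r m' g'' * (u m * u m' * F (g - g' - g'')) =
      ∑ g', ∑ g'', (∑ m ∈ s, r m g' * u m) * (∑ m ∈ s, r m g'' * u m) * F (g - g' - g'') := by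
  rw [Finset.sum_comm]
  refine Finset.sum_congr rfl fun g' _ => ?_
  have : ∀ g'', (∑ m ∈ s, r m g' * u m) * (∑ m ∈ s, r m g'' * u m) * F (g - g' - g'') =
      ∑ m ∈ s, ∑ m' ∈ s, r m g' * (r m' g'' * (u m * u m' * F (g - g' - g''))) := by
    intro g''
    rw [Finset.sum_mul_sum, Finset.sum_mul]
    refine Finset.sum_congr rfl fun m _ => ?_
    rw [Finset.sum_mul]
    exact Finset.sum_congr rfl fun m' _ => by ring
  simp only [this]
  rw [Finset.sum_comm]
  refine Finset.sum_congr rfl fun m _ => ?_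
  rw [Finset.mul_sum, Finset.sum_comm]
  refine Finset.sum_congr rfl fun m' _ => ?_
  rw [Finset.mul_sum]

namespace Sys

open scoped Classical

variable {P G : Type} [AddCommGroup G] [Fintype G]

/-- constant -/
noncomputable def KR (k : ℝ) : ℝ := 12 * (k + 4 * CF)

theorem sum_bb_div_le (S : Sys P G) {l k : ℝ} (hl : 300000 ≤ l) (hq : 128 * Real.log S.Q ≤ l)
    (hk : 1 ≤ k) (g : G) :
    ∑ m ∈ Finset.Ioc 1 ⌊Real.exp (k * l)⌋₊, S.bb l g m / m ≤ KR k / Fintype.card G := by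
  have hl0 : 0 < l := by linarith
  have hk0 : 0 < k := by linarith
  have hkl : l ≤ k * l := by nlinarith
  have hCF := CF_pos
  have hG : 0 < (Fintype.card G : ℝ) := by
    have : Nonempty G := ⟨0⟩
    exact_mod_cast Fintype.card_pos
  have h := S.abel hl hq g (ψ := fun _ => 1) (v0 := l) (v1 := k * l) (M := 1)
    contDiff_const le_rfl hkl zero_le_one ?_ ?_
  · have e : ∑ m ∈ Finset.Ioc 1 ⌊Real.exp (k * l)⌋₊, S.bb l g m / m =
        ∑ n ∈ Finset.Ioc ⌊Real.exp l⌋₊ ⌊Real.exp (k * l)⌋₊, (1:ℝ) / n * S.bb l g n := by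
      symm
      have h1 : 1 ≤ ⌊Real.exp l⌋₊ := by
        rw [Nat.one_le_floor_iff]; exact Real.one_le_exp (by positivity)
      refine (Finset.sum_subset (Finset.Ioc_subset_Ioc_left h1) ?_).trans
        (Finset.sum_congr rfl fun n _ => by ring)
      intro n hn hn2
      rw [Finset.mem_Ioc] at hn hn2
      have h1 : n ≤ ⌊Real.exp l⌋₊ := by
        by_contra h
        exact hn2 ⟨not_le.1 h, hn.2⟩
      rw [S.bb_eq_zero g hn.1 ((Nat.le_floor_iff (Real.exp_pos _).le).1 h1), mul_zero]
    rw [e]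
    have h2 := (abs_le.1 h).2
    rw [intervalIntegral.integral_const, smul_eq_mul, mul_one] at h2
    have hρ0 := S.rho_pos l
    have hA := S.A_le hl hq
    unfold A at hA
    have hρ : S.rho l * l ≤ 12 / Fintype.card G := by
      rw [le_div_iff₀ hG]; linarith
    have h3 : Real.exp (-(l / l)) ≤ 1 := Real.exp_le_one_iff.2 (by rw [div_self hl0.ne']; norm_num)
    have h4 : 4 * CF * 1 * Real.exp (-(l / l)) * (S.rho l * l) ≤ 4 * CF * 1 * 1 * (S.rho l * l) := by
      gcongr
    have h5 : S.rho l * (k * l - l) ≤ k * (S.rho l * l) := by nlinarith [mul_pos hρ0 hl0]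
    calc _ ≤ (k + 4 * CF) * (S.rho l * l) := by linarith
      _ ≤ (k + 4 * CF) * (12 / Fintype.card G) := by gcongr
      _ = _ := by unfold KR; ring
  · intro v hv
    simpa using div_nonneg (hl0.le.trans hv.1) hl0.le
  · intro v hv
    simp [Real.exp_nonneg]

theorem La_expand (S : Sys P G) (l k : ℝ) (s : Finset ℕ) (r : ℕ → G → ℝ) (g : G) :
    S.La l l k 0 g = (S.La l l k 0 g + ∑ m ∈ s, ∑ g', r m g' * S.La l l k (0 + Real.log m) (g - g'))
      - (∑ m ∈ s, ∑ g', r m g' * (S.La l l k (Real.log m) (g - g') +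
          ∑ m' ∈ s, ∑ g'', r m' g'' * S.La l l k (Real.log m + Real.log m') (g - g' - g'')))
      + ∑ m ∈ s, ∑ g', r m g' *
          ∑ m' ∈ s, ∑ g'', r m' g'' * S.La l l k (Real.log m + Real.log m') (g - g' - g'') := by
  simp only [mul_add, Finset.sum_add_distrib, zero_add]
  ring

/-- constant -/
noncomputable def C0 : ℝ := exists_properL_sum.choose

theorem C0_pos : 0 < C0 := exists_properL_sum.choose_spec.1

theorem sum_properL_le (s : Finset ℕ) (Y : ℝ) (h : ∀ n ∈ s, Real.exp Y ≤ n) :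
    ∑ n ∈ s, properL n / n ≤ C0 * Real.exp (-(Y/4)) := exists_properL_sum.choose_spec.2 s Y h

theorem La_level (S : Sys P G) {L l k a : ℝ} (hl : 0 < l) (hL : L ≤ l) (hk : 1 ≤ k)
    (ha : a ≤ 2 * k * l) (g : G) :
    |S.La l l k a g - S.La L l k a g| ≤ 4 * C0 * Real.exp (-(k * l / 4)) := by
  have hk0 : 0 < k := by linarith
  unfold La
  rw [← Finset.sum_sub_distrib]
  set Z := ⌊Real.exp (5 * k * l)⌋₊
  have h1 : ∑ n ∈ Finset.Ioc 0 Z, (S.Lam l g n / n * wt k ((Real.log n + a) / l) -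
      S.Lam L g n / n * wt k ((Real.log n + a) / l)) =
      ∑ n ∈ (Finset.Ioc 0 Z).filter (fun n : ℕ => Real.exp (k * l) < n),
        (S.Lam l g n - S.Lam L g n) / n * wt k ((Real.log n + a) / l) := by
    rw [Finset.sum_filter]
    refine Finset.sum_congr rfl fun n hn => ?_
    split_ifs with h
    · ring
    · have hn0 : (0:ℝ) < n := by exact_mod_cast (Finset.mem_Ioc.1 hn).1
      have h3 : Real.log n ≤ k * l := by
        rw [Real.log_le_iff_le_exp hn0]; exact not_lt.1 h
      have : wt k ((Real.log n + a) / l) = 0 := by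
        refine wt_of_le hk0 ?_
        rw [div_le_iff₀ hl]; linarith
      simp [this]
  rw [h1]
  refine (Finset.abs_sum_le_sum_abs _ _).trans ?_
  calc _ ≤ ∑ n ∈ (Finset.Ioc 0 Z).filter (fun n : ℕ => Real.exp (k * l) < n),
        4 * (properL n / n) := by
        refine Finset.sum_le_sum fun n hn => ?_
        have hn1 := (Finset.mem_filter.1 hn).2
        have h2 : Real.exp l < n := lt_of_le_of_lt (Real.exp_le_exp.2 (by nlinarith)) hn1
        have h3 : Real.exp L < n := lt_of_le_of_lt (Real.exp_le_exp.2 hL) h2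
        rw [abs_mul, abs_div, abs_of_nonneg (wt_nonneg _ _), Nat.abs_cast, ← mul_div_assoc]
        have h5 : 0 ≤ 4 * properL n := by have := properL_nonneg n; positivity
        calc _ ≤ 4 * properL n / n * 1 := by
              gcongr
              · exact wt_nonneg _ _
              · exact S.abs_Lam_sub_le g h2 h3
              · exact wt_le_one _ _
          _ = _ := mul_one _
    _ ≤ _ := by
        rw [← Finset.mul_sum, mul_assoc]
        gcongr
        exact sum_properL_le _ _ fun n hn => (Finset.mem_filter.1 hn).2.le

/-- The prime sum in a class with exponent `s`. -/
noncomputable def Pg (S : Sys P G) (L s : ℝ) (g : G) : ℝ := ∑' n, S.Lam L g n * nps s n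

theorem La_approx (S : Sys P G) {L l k a ε : ℝ} (hl : 0 < l) (hk : 0 < k) (ha : 0 ≤ a)
    (hε : 0 ≤ ε)
    {N : ℕ} {c : ℕ → ℝ}
    (hc : ∀ v, 0 ≤ v → |wt k v - ∑ j ∈ Finset.range N, c j * Real.exp (-((j + 1) * v))| ≤
        ε * Real.exp (-v)) (g : G) :
    |S.La L l k a g - ∑ j ∈ Finset.range N, c j * (Real.exp (-((j + 1) * a / l)) *
      S.Pg L (1 + (j + 1) / l) g)| ≤ ε * S.Pg L (1 + 1 / l) g := by
  have hs : ∀ j : ℕ, Summable fun n => S.Lam L g n * nps (1 + (j + 1) / l) n := fun j =>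
    S.summable_Lam L g (by have : 0 < ((j:ℝ) + 1) / l := by positivity
                           linarith)
  have h1 : HasSum (fun n : ℕ => S.Lam L g n / n * wt k ((Real.log n + a) / l)) (S.La L l k a g) := by
    refine hasSum_sum_of_ne_finset_zero fun n hn => ?_
    by_cases h0 : n = 0
    · simp [h0]
    have hn0 : (0:ℝ) < n := by exact_mod_cast Nat.pos_of_ne_zero h0
    have h2 : ⌊Real.exp (5 * k * l)⌋₊ < n := by
      by_contra h
      exact hn (Finset.mem_Ioc.2 ⟨Nat.pos_of_ne_zero h0, not_lt.1 h⟩)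
    have h3 := Nat.lt_of_floor_lt h2
    have h4 : 5 * k * l < Real.log n := by rwa [Real.lt_log_iff_exp_lt hn0]
    rw [wt_of_ge hk, mul_zero]
    rw [le_div_iff₀ hl]
    nlinarith [mul_pos hk hl]
  have h2 : HasSum (fun n : ℕ => ∑ j ∈ Finset.range N, c j * (Real.exp (-((j + 1) * a / l)) *
      (S.Lam L g n * nps (1 + (j + 1) / l) n)))
      (∑ j ∈ Finset.range N, c j * (Real.exp (-((j + 1) * a / l)) *
      S.Pg L (1 + (j + 1) / l) g)) :=
    hasSum_sum fun j _ => ((hs j).hasSum.mul_left _).mul_left _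
  have h3 := h1.sub h2
  have hs0 := (hs 0).hasSum.mul_left ε
  simp only [CharP.cast_eq_zero, zero_add] at hs0
  rw [← Real.norm_eq_abs, ← h3.tsum_eq]
  refine tsum_of_norm_bounded hs0 fun n => ?_
  by_cases h0 : n = 0
  · simp [h0, nps]
  have hn1 : (1:ℝ) ≤ n := by exact_mod_cast Nat.pos_of_ne_zero h0
  have hlog : 0 ≤ Real.log n := Real.log_nonneg hn1
  have e : S.Lam L g n / n * wt k ((Real.log n + a) / l) -
      ∑ j ∈ Finset.range N, c j * (Real.exp (-((j + 1) * a / l)) *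
        (S.Lam L g n * nps (1 + (j + 1) / l) n)) =
      S.Lam L g n / n * (wt k ((Real.log n + a) / l) - ∑ j ∈ Finset.range N, c j *
        Real.exp (-((j + 1) * ((Real.log n + a) / l)))) := by
    rw [mul_sub, Finset.mul_sum]
    congr 1
    refine Finset.sum_congr rfl fun j _ => ?_
    rw [nps, show -(((j:ℝ) + 1) * ((Real.log n + a) / l)) = -((j + 1) * a / l) +
      -((1 + (j + 1) / l - 1) * Real.log n) by ring, Real.exp_add]
    ring
  have hLn : 0 ≤ S.Lam L g n / n := div_nonneg (S.Lam_nonneg L g n) (Nat.cast_nonneg _)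
  rw [e, Real.norm_eq_abs, abs_mul, abs_of_nonneg hLn]
  calc _ ≤ S.Lam L g n / n * (ε * Real.exp (-((Real.log n + a) / l))) := by
        gcongr
        exact hc _ (by positivity)
    _ ≤ S.Lam L g n / n * (ε * Real.exp (-((1 + 1 / l - 1) * Real.log n))) := by
        gcongr
        rw [add_sub_cancel_left, add_div]
        have : 0 ≤ a / l := by positivity
        rw [one_div, inv_mul_eq_div]; linarith
    _ = _ := by rw [nps]; ring

theorem Pg_nonneg (S : Sys P G) (L s : ℝ) (g : G) : 0 ≤ S.Pg L s g :=
  tsum_nonneg fun n => mul_nonneg (S.Lam_nonneg L g n) (nps_nonneg _ n)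

theorem sum_Pg_le (S : Sys P G) (L : ℝ) {l : ℝ} (hl : 1 ≤ l) :
    ∑ g, S.Pg L (1 + 1 / l) g ≤ 240 * l := by
  have hs : 1 < 1 + 1 / l := by have : 0 < 1 / l := by positivity
                                linarith
  have h1 : HasSum (fun n => ∑ g, S.Lam L g n * nps (1 + 1 / l) n) (∑ g, S.Pg L (1 + 1 / l) g) :=
    hasSum_sum fun g _ => (S.summable_Lam L g hs).hasSum
  rw [← h1.tsum_eq]
  refine Real.tsum_le_of_sum_range_le (fun n => Finset.sum_nonneg fun g _ =>
    mul_nonneg (S.Lam_nonneg L g n) (nps_nonneg _ n)) fun n => ?_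
  have h2 := sum_vonMangoldt_exp_le hl n
  calc _ ≤ ∑ i ∈ Finset.range (n + 1), 4 * (ArithmeticFunction.vonMangoldt i / i *
        Real.exp (-(Real.log i / l))) := by
        refine (Finset.sum_le_sum fun i _ => ?_).trans
          (Finset.sum_le_sum_of_subset_of_nonneg (Finset.range_mono (Nat.le_succ n)) ?_)
        · rw [← Finset.sum_mul, nps, add_sub_cancel_left]
          calc _ ≤ 4 * ArithmeticFunction.vonMangoldt i *
                (Real.exp (-(1 / l * Real.log i)) / i) := by
                gcongr
                exact S.sum_Lam_le L i
            _ = _ := by rw [one_div, inv_mul_eq_div]; ring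
        · intro i _ _
          have := ArithmeticFunction.vonMangoldt_nonneg (n := i)
          positivity
    _ = 4 * ∑ i ∈ Finset.Ioc 0 n, (ArithmeticFunction.vonMangoldt i / i *
        Real.exp (-(Real.log i / l))) := by
        rw [← Finset.mul_sum]
        congr 1
        symm
        refine Finset.sum_subset (fun i hi => ?_) fun i hi hi2 => ?_
        · rw [Finset.mem_Ioc] at hi
          exact Finset.mem_range.2 (by omega)
        · have : i = 0 := by
            rw [Finset.mem_Ioc] at hi2
            have := Finset.mem_range.1 hi
            omega
          simp [this]
    _ ≤ _ := by linarith

end Sys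

section Quad

variable {G : Type} [Fintype G]

/-- A nonnegative quadratic functional. -/
noncomputable def quadF (s : Finset ℕ) (r : ℕ → G → ℝ) (Y : ℕ → ℕ → G → G → ℝ) : ℝ :=
  ∑ m ∈ s, ∑ g', r m g' * ∑ m' ∈ s, ∑ g'', r m' g'' * Y m m' g' g''

theorem quadF_sum (s : Finset ℕ) (r : ℕ → G → ℝ) (N : ℕ) (c : ℕ → ℝ)
    (Y : ℕ → ℕ → ℕ → G → G → ℝ) :
    quadF s r (fun m m' g' g'' => ∑ j ∈ Finset.range N, c j * Y j m m' g' g'') =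
      ∑ j ∈ Finset.range N, c j * quadF s r (Y j) := by
  induction N with
  | zero => simp [quadF]
  | succ N ih =>
    rw [Finset.sum_range_succ, ← ih]
    simp only [quadF, Finset.sum_range_succ, mul_add, Finset.sum_add_distrib, add_right_inj]
    simp only [Finset.mul_sum]
    refine Finset.sum_congr rfl fun m _ => Finset.sum_congr rfl fun g' _ =>
      Finset.sum_congr rfl fun m' _ => Finset.sum_congr rfl fun g'' _ => ?_
    ring

theorem abs_quadF_sub_le (s : Finset ℕ) (r : ℕ → G → ℝ) (hr : ∀ m ∈ s, ∀ g, 0 ≤ r m g)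
    (Y Y' D : ℕ → ℕ → G → G → ℝ)
    (h : ∀ m ∈ s, ∀ m' ∈ s, ∀ g' g'', |Y m m' g' g'' - Y' m m' g' g''| ≤ D m m' g' g'') :
    |quadF s r Y - quadF s r Y'| ≤ quadF s r D := by
  unfold quadF
  rw [← Finset.sum_sub_distrib]
  refine (Finset.abs_sum_le_sum_abs _ _).trans (Finset.sum_le_sum fun m hm => ?_)
  rw [← Finset.sum_sub_distrib]
  refine (Finset.abs_sum_le_sum_abs _ _).trans (Finset.sum_le_sum fun g' _ => ?_)
  rw [← mul_sub, abs_mul, abs_of_nonneg (hr m hm g')]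
  refine mul_le_mul_of_nonneg_left ?_ (hr m hm g')
  rw [← Finset.sum_sub_distrib]
  refine (Finset.abs_sum_le_sum_abs _ _).trans (Finset.sum_le_sum fun m' hm' => ?_)
  rw [← Finset.sum_sub_distrib]
  refine (Finset.abs_sum_le_sum_abs _ _).trans (Finset.sum_le_sum fun g'' _ => ?_)
  rw [← mul_sub, abs_mul, abs_of_nonneg (hr m' hm' g'')]
  exact mul_le_mul_of_nonneg_left (h m hm m' hm' g' g'') (hr m' hm' g'')

variable [AddCommGroup G]

/-- Bound for the quadratic functional at a convolution. -/
theorem quadF_conv_le (s : Finset ℕ) (r : ℕ → G → ℝ) (hr : ∀ m ∈ s, ∀ g, 0 ≤ r m g)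
    {K : ℝ} (hK : 0 ≤ K) (hrK : ∀ g, ∑ m ∈ s, r m g ≤ K / Fintype.card G)
    (E : G → ℝ) (hE : ∀ g, 0 ≤ E g) (g : G) :
    quadF s r (fun _ _ g' g'' => E (g - g' - g'')) ≤ K ^ 2 / Fintype.card G * ∑ g, E g := by
  have hG : 0 < (Fintype.card G : ℝ) := by
    have : Nonempty G := ⟨0⟩
    exact_mod_cast Fintype.card_pos
  have h := bilinear_collapse s r (fun _ => 1) E g
  simp only [one_mul, mul_one] at h
  rw [quadF, h]
  have hS : 0 ≤ ∑ g, E g := Finset.sum_nonneg fun g _ => hE g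
  calc _ ≤ ∑ g', ∑ g'', K / Fintype.card G * (K / Fintype.card G) * E (g - g' - g'') := by
        refine Finset.sum_le_sum fun g' _ => Finset.sum_le_sum fun g'' _ => ?_
        have := Finset.sum_nonneg fun m hm => hr m hm g''
        have := hE (g - g' - g'')
        gcongr
        · exact hrK _
        · exact hrK _
    _ = ∑ _g' : G, K / Fintype.card G * (K / Fintype.card G) * ∑ g, E g := by
        refine Finset.sum_congr rfl fun g' _ => ?_
        rw [← Finset.mul_sum, ← (Equiv.subLeft (g - g')).sum_comp]
        simp
    _ = _ := by
        rw [Finset.sum_const, nsmul_eq_mul, Finset.card_univ]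
        field_simp

end Quad

namespace Sys

open scoped Classical

variable {P G : Type} [AddCommGroup G] [Fintype G]

theorem norm_char_Pg_le (S : Sys P G) {L l : ℝ} (hL : 300000 ≤ L) (hq : 128 * Real.log S.Q ≤ L)
    (hodd : ∀ χ : AddChar G ℂ, χ ≠ 0 → χ + χ ≠ 0) (hl : 0 < l) {N j : ℕ} (hj : j < N)
    (hN : N * L ≤ l) (χ : AddChar G ℂ) (hχ : χ ≠ 0) :
    ‖∑ g, χ g * (S.Pg L (1 + (j + 1) / l) g : ℂ)‖ ≤ 2 * C1 ^ 2 * L * (L / l) ^ (-(3/4) : ℝ) := by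
  have hL0 : 0 < L := by linarith
  have h0 : 0 < (j + 1) * L / l := by positivity
  have h1 : (j + 1) * L / l ≤ 1 := by
    rw [div_le_one hl]
    have : ((j:ℝ) + 1) ≤ N := by exact_mod_cast hj
    nlinarith
  have h := S.norm_LC_le hL hq hχ (hodd χ hχ) h0 h1
  have e : (j + 1) * L / l / L = (j + 1) / l := by field_simp
  have hs : 1 < 1 + ((j:ℝ) + 1) / l := by
    have : 0 < ((j:ℝ) + 1) / l := by positivity
    linarith
  rw [e, (S.LSeries_LC L χ hs).2] at h
  refine h.trans ?_
  have := C1_pos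
  refine mul_le_mul_of_nonneg_left ?_ (by positivity)
  refine Real.rpow_le_rpow_of_nonpos (by positivity) ?_ (by norm_num)
  rw [mul_div_assoc]
  exact le_mul_of_one_le_left (by positivity) (by linarith [(Nat.cast_nonneg j : (0:ℝ) ≤ j)])

theorem NC_La (S : Sys P G) {L l k W1 ε : ℝ} (hL : 300000 ≤ L) (hq : 128 * Real.log S.Q ≤ L)
    (hodd : ∀ χ : AddChar G ℂ, χ ≠ 0 → χ + χ ≠ 0)
    (hLl : L ≤ l) (hk : 1 ≤ k) (hW : ∀ v, |deriv (wt k) v| ≤ W1) (hε : 0 ≤ ε)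
    {N : ℕ} {c : ℕ → ℝ} (hN : N * L ≤ l)
    (hc : ∀ v, 0 ≤ v → |wt k v - ∑ j ∈ Finset.range N, c j * Real.exp (-((j + 1) * v))| ≤
        ε * Real.exp (-v)) :
    NC (S.La l l k 0)
      (KX W1 * (30 * k * l) * Real.exp (-k) / Fintype.card G * (1 + KR k) +
        (KR k) ^ 2 * (4 * C0 * Real.exp (-(k * l / 4))) +
        ε * (KR k) ^ 2 * (240 * l) / Fintype.card G +
        (∑ j ∈ Finset.range N, |c j|) * (2 * C1 ^ 2 * L * (L / l) ^ (-(3/4) : ℝ)) * (KR k) ^ 2 /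
          Fintype.card G) := by
  have hl : 300000 ≤ l := hL.trans hLl
  have hql : 128 * Real.log S.Q ≤ l := hq.trans hLl
  have hl0 : 0 < l := by linarith
  have hL0 : 0 < L := by linarith
  have hk0 : 0 < k := by linarith
  have hCF := CF_pos
  have hC0 := C0_pos
  have hC1 := C1_pos
  have hW0 : 0 ≤ W1 := (abs_nonneg _).trans (hW 0)
  have hG : 0 < (Fintype.card G : ℝ) := by
    have : Nonempty G := ⟨0⟩
    exact_mod_cast Fintype.card_pos
  have hKR : 0 ≤ KR k := by unfold KR; positivity
  have hKX : 0 ≤ KX W1 := by unfold KX; positivity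
  set h := (Fintype.card G : ℝ) with hh
  set s := Finset.Ioc 1 ⌊Real.exp (k * l)⌋₊ with hs
  set r : ℕ → G → ℝ := fun m g => S.bb l g m / m with hrdef
  have hr : ∀ m ∈ s, ∀ g, 0 ≤ r m g := fun m _ g => div_nonneg (S.bb_nonneg l g m) (Nat.cast_nonneg m)
  have hrK : ∀ g, ∑ m ∈ s, r m g ≤ KR k / h := fun g => S.sum_bb_div_le hl hql hk g
  have hrt : ∑ m ∈ s, ∑ g, r m g ≤ KR k := by
    rw [Finset.sum_comm]
    refine (Finset.sum_le_sum fun g _ => hrK g).trans (le_of_eq ?_)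
    rw [Finset.sum_const, nsmul_eq_mul, Finset.card_univ, ← hh]
    field_simp
  have hlog : ∀ m ∈ s, 0 ≤ Real.log m ∧ Real.log m ≤ k * l := by
    intro m hm
    rw [hs, Finset.mem_Ioc] at hm
    have hm1 : (1:ℝ) ≤ m := by exact_mod_cast hm.1.le
    refine ⟨Real.log_nonneg hm1, ?_⟩
    rw [Real.log_le_iff_le_exp (by linarith)]
    exact (Nat.le_floor_iff (Real.exp_pos _).le).1 hm.2
  set E1 := KX W1 * (30 * k * l) * Real.exp (-k) / h with hE1
  have hE10 : 0 ≤ E1 := by positivity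
  have A1 : NC (fun g => S.La l l k 0 g + ∑ m ∈ s, ∑ g', r m g' *
      S.La l l k (0 + Real.log m) (g - g')) E1 :=
    S.NC_X hl hql hk hW le_rfl (by positivity)
  have A2 := NC.conv s (f := fun m g => S.La l l k (Real.log m) g +
      ∑ m' ∈ s, ∑ g'', r m' g'' * S.La l l k (Real.log m + Real.log m') (g - g'')) hr
      (fun m hm => S.NC_X hl hql hk hW (hlog m hm).1 (hlog m hm).2)
  rw [← hE1] at A2
  set D := 2 * C1 ^ 2 * L * (L / l) ^ (-(3/4) : ℝ) with hD
  have hD0 : 0 ≤ D := by positivity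
  set u : ℕ → ℕ → ℝ := fun j m => Real.exp (-((j + 1) * Real.log m / l)) with hu
  have hu1 : ∀ j, ∀ m ∈ s, u j m ≤ 1 := by
    intro j m hm
    refine Real.exp_le_one_iff.2 ?_
    have := (hlog m hm).1
    have : 0 ≤ ((j:ℝ) + 1) * Real.log m / l := by positivity
    linarith
  have A3 : NC (fun g => ∑ j ∈ Finset.range N, c j * quadF s r (fun m m' g' g'' =>
      u j m * u j m' * S.Pg L (1 + (j + 1) / l) (g - g' - g'')))
      (∑ j ∈ Finset.range N, |c j| * (D * ((KR k) ^ 2 / h))) := by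
    refine NC.sum _ fun j hj => NC.const_mul ?_ _
    have hb := NC.bilinear (fun g => ∑ m ∈ s, r m g * u j m) (S.Pg L (1 + (j + 1) / l)) hD0
      (fun χ hχ => S.norm_char_Pg_le hL hq hodd hl0 (Finset.mem_range.1 hj) hN χ hχ)
    have e : (fun g => quadF s r (fun m m' g' g'' =>
        u j m * u j m' * S.Pg L (1 + (j + 1) / l) (g - g' - g''))) = fun g => ∑ g', ∑ g'',
        (∑ m ∈ s, r m g' * u j m) * (∑ m ∈ s, r m g'' * u j m) *
          S.Pg L (1 + (j + 1) / l) (g - g' - g'') := by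
      funext g
      exact bilinear_collapse s r (u j) (S.Pg L (1 + (j + 1) / l)) g
    rw [e]
    refine hb.mono ?_
    refine mul_le_mul_of_nonneg_left ?_ hD0
    have h1 : ∀ g, (∑ m ∈ s, r m g * u j m) ^ 2 ≤ (KR k / h) ^ 2 := by
      intro g
      have h2 : 0 ≤ ∑ m ∈ s, r m g * u j m := Finset.sum_nonneg fun m hm =>
        mul_nonneg (hr m hm g) (Real.exp_pos _).le
      have h3 : ∑ m ∈ s, r m g * u j m ≤ KR k / h :=
        (Finset.sum_le_sum fun m hm => mul_le_of_le_one_right (hr m hm g) (hu1 j m hm)).trans (hrK g)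
      gcongr
    refine (Finset.sum_le_sum fun g _ => h1 g).trans (le_of_eq ?_)
    rw [Finset.sum_const, nsmul_eq_mul, Finset.card_univ, ← hh]
    field_simp
  set δ := 4 * C0 * Real.exp (-(k * l / 4)) with hδ
  have hδ0 : 0 ≤ δ := by positivity
  have A4 : ∀ g, |quadF s r (fun m m' g' g'' => S.La l l k (Real.log m + Real.log m') (g - g' - g'')) -
      ∑ j ∈ Finset.range N, c j * quadF s r (fun m m' g' g'' =>
      u j m * u j m' * S.Pg L (1 + (j + 1) / l) (g - g' - g''))| ≤
      (KR k) ^ 2 * δ + ε * (KR k) ^ 2 * (240 * l) / h := by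
    intro g
    rw [← quadF_sum]
    refine (abs_quadF_sub_le s r hr _ _ (fun _ _ g' g'' => (fun x => δ + ε * S.Pg L (1 + 1 / l) x)
      (g - g' - g'')) ?_).trans ?_
    · intro m hm m' hm' g' g''
      have h1 := S.La_level (L := L) (a := Real.log m + Real.log m') hl0 hLl hk
        (by linarith [(hlog m hm).2, (hlog m' hm').2]) (g - g' - g'')
      have h2 := S.La_approx (L := L) (a := Real.log m + Real.log m') hl0 hk0
        (by linarith [(hlog m hm).1, (hlog m' hm').1]) hε hc (g - g' - g'')
      have h3 : ∀ j : ℕ, Real.exp (-((j + 1) * (Real.log m + Real.log m') / l)) =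
          u j m * u j m' := by
        intro j
        rw [hu, ← Real.exp_add]; congr 1; ring
      simp only [h3] at h2
      have h4 := abs_add_le (S.La l l k (Real.log m + Real.log m') (g - g' - g'') -
        S.La L l k (Real.log m + Real.log m') (g - g' - g''))
        (S.La L l k (Real.log m + Real.log m') (g - g' - g'') - ∑ j ∈ Finset.range N,
          c j * (u j m * u j m' * S.Pg L (1 + (j + 1) / l) (g - g' - g'')))
      rw [sub_add_sub_cancel] at h4
      exact h4.trans (add_le_add h1 h2)
    · have e : quadF s r (fun _ _ g' g'' => (fun x => δ + ε * S.Pg L (1 + 1 / l) x) (g - g' - g'')) =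
          quadF s r (fun _ _ _ _ => δ) +
          ε * quadF s r (fun _ _ g' g'' => S.Pg L (1 + 1 / l) (g - g' - g'')) := by
        have := quadF_sum s r 1 (fun _ => ε) (fun _ _ _ g' g'' => S.Pg L (1 + 1 / l) (g - g' - g''))
        simp only [Finset.range_one, Finset.sum_singleton] at this
        rw [← this]
        simp only [quadF, mul_add, Finset.sum_add_distrib]
      rw [e]
      have h1 : quadF s r (fun _ _ _ _ => δ) ≤ (KR k) ^ 2 * δ := by
        simp only [quadF, ← Finset.sum_mul]
        have h0 : 0 ≤ ∑ m ∈ s, ∑ g, r m g :=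
          Finset.sum_nonneg fun m hm => Finset.sum_nonneg fun g _ => hr m hm g
        calc _ = (∑ m ∈ s, ∑ g, r m g) * (∑ m ∈ s, ∑ g, r m g) * δ := by ring
          _ ≤ KR k * KR k * δ := by gcongr
          _ = _ := by ring
      have h2 := quadF_conv_le s r hr hKR hrK (S.Pg L (1 + 1 / l)) (S.Pg_nonneg L _) g
      have h3 := S.sum_Pg_le L (l := l) (by linarith)
      have h4 : quadF s r (fun _ _ g' g'' => S.Pg L (1 + 1 / l) (g - g' - g'')) ≤
          (KR k) ^ 2 / h * (240 * l) := h2.trans (by gcongr)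
      calc _ ≤ (KR k) ^ 2 * δ + ε * ((KR k) ^ 2 / h * (240 * l)) := by gcongr
        _ = _ := by ring
  have A5 := A3.of_close A4
  have A6 := (A1.sub A2).add A5
  have e : (S.La l l k 0) = fun g => _ := funext fun g => S.La_expand l k s r g
  rw [e]
  refine NC.mono A6 ?_
  rw [← Finset.sum_mul]
  have : E1 * ∑ m ∈ s, ∑ g, r m g ≤ E1 * KR k := by gcongr
  calc _ ≤ E1 + E1 * KR k + ((∑ j ∈ Finset.range N, |c j|) * (D * ((KR k) ^ 2 / h)) +
        ((KR k) ^ 2 * δ + ε * (KR k) ^ 2 * (240 * l) / h)) := by gcongr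
    _ = _ := by ring

end Sys

namespace Sys

open scoped Classical

/-- The window of primes `n` with `3kl ≤ log n ≤ 4.5kl`. -/
noncomputable def window (k l : ℝ) : Finset ℕ :=
  (Finset.Ioc 0 ⌊Real.exp (5 * k * l)⌋₊).filter
    fun n => n.Prime ∧ 3 * k * l ≤ Real.log n ∧ Real.log n ≤ 9 / 2 * k * l

variable {P G : Type} [AddCommGroup G] [Fintype G]

theorem La_le_window (S : Sys P G) {l k : ℝ} (hl : 0 < l) (hk : 1 ≤ k) (g : G) :
    S.La l l k 0 g ≤ (9 / 2 * k * l) * ∑ n ∈ window k l,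
      (((S.primes n).filter fun p => S.N p = n ∧ S.cl p = g).card : ℝ) / n +
      4 * C0 * Real.exp (-(k * l / 4)) := by
  have hk0 : 0 < k := by linarith
  set Z := Finset.Ioc 0 ⌊Real.exp (5 * k * l)⌋₊ with hZ
  set T := Z.filter fun n : ℕ => Real.exp (k * l) < n with hT
  have key : ∀ n ∈ Z, S.Lam l g n / n * wt k ((Real.log n + 0) / l) ≤
      (if n.Prime ∧ 3 * k * l ≤ Real.log n ∧ Real.log n ≤ 9 / 2 * k * l then
        (9 / 2 * k * l) * ((((S.primes n).filter fun p => S.N p = n ∧ S.cl p = g).card : ℝ) / n)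
        else 0) + (if Real.exp (k * l) < n then 4 * (properL n / n) else 0) := by
    intro n hn
    have hn0 : (0:ℝ) < n := by exact_mod_cast (Finset.mem_Ioc.1 hn).1
    have hp := properL_nonneg n
    by_cases hv : 3 * k * l ≤ Real.log n ∧ Real.log n ≤ 9 / 2 * k * l
    · have h1 : Real.exp l < n := by
        rw [← Real.lt_log_iff_exp_lt hn0]; nlinarith
      have h1' : Real.exp (k * l) < n := by
        rw [← Real.lt_log_iff_exp_lt hn0]; nlinarith
      rw [if_pos h1']
      have hw := wt_le_one k ((Real.log n + 0) / l)
      have hL0 := S.Lam_nonneg l g n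
      have h2 : S.Lam l g n / n * wt k ((Real.log n + 0) / l) ≤ S.Lam l g n / n :=
        mul_le_of_le_one_right (by positivity) hw
      refine h2.trans ?_
      by_cases hpr : n.Prime
      · rw [if_pos ⟨hpr, hv⟩, S.Lam_prime g hpr h1]
        have : Real.log n * ((((S.primes n).filter fun p => S.N p = n ∧ S.cl p = g).card : ℝ) / n) ≤
          (9 / 2 * k * l) * ((((S.primes n).filter fun p => S.N p = n ∧ S.cl p = g).card : ℝ) / n) := by
          gcongr
          exact hv.2
        rw [mul_div_assoc]
        have : 0 ≤ 4 * (properL n / n) := by positivity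
        linarith
      · rw [if_neg (fun h => hpr h.1), zero_add, ← mul_div_assoc]
        have : properL n = ArithmeticFunction.vonMangoldt n := by
          unfold properL; rw [if_neg hpr]
        rw [this]
        gcongr
        exact S.Lam_le l g n
    · have : wt k ((Real.log n + 0) / l) = 0 := by
        rw [add_zero]
        rcases not_and_or.1 hv with h | h
        · refine wt_of_le hk0 ?_
          rw [div_le_iff₀ hl]; linarith
        · refine wt_of_ge hk0 ?_
          rw [le_div_iff₀ hl]; linarith
      rw [this, mul_zero, if_neg (fun h => hv h.2), zero_add]
      split_ifs <;> positivity
  refine (Finset.sum_le_sum key).trans ?_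
  rw [Finset.sum_add_distrib, ← Finset.sum_filter, ← Finset.sum_filter, ← Finset.mul_sum,
    ← Finset.mul_sum, mul_assoc 4]
  have := sum_properL_le T (k * l) (fun n hn => (Finset.mem_filter.1 hn).2.le)
  rw [show -(k * l / 4) = -((k * l) / 4) by ring]
  gcongr
  rfl

theorem sum_La_ge (S : Sys P G) {L l k ε : ℝ} (hL : 300000 ≤ L) (hq : 128 * Real.log S.Q ≤ L)
    (hLl : L ≤ l) (hk : 1 ≤ k) (hε : 0 ≤ ε) {N : ℕ} {c : ℕ → ℝ} (hN : N * L ≤ l)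
    (hc : ∀ v, 0 ≤ v → |wt k v - ∑ j ∈ Finset.range N, c j * Real.exp (-((j + 1) * v))| ≤
        ε * Real.exp (-v)) (hc2 : k - ε ≤ ∑ j ∈ Finset.range N, c j / (j + 1)) :
    l * (k - ε) - (∑ j ∈ Finset.range N, |c j|) * (4 * C1 ^ 2 * L / S.A L) - ε * (240 * l) -
      Fintype.card G * (4 * C0 * Real.exp (-(k * l / 4))) ≤ ∑ g, S.La l l k 0 g := by
  have hl0 : 0 < l := by linarith
  have hL0 : 0 < L := by linarith
  have hk0 : 0 < k := by linarith
  have h1 : ∑ g, (∑ j ∈ Finset.range N, c j * S.Pg L (1 + (j + 1) / l) g) -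
      ε * ∑ g, S.Pg L (1 + 1 / l) g - Fintype.card G * (4 * C0 * Real.exp (-(k * l / 4))) ≤
      ∑ g, S.La l l k 0 g := by
    rw [Finset.mul_sum, ← Finset.sum_sub_distrib, sub_le_iff_le_add]
    have : (Fintype.card G : ℝ) * (4 * C0 * Real.exp (-(k * l / 4))) =
        ∑ _g : G, (4 * C0 * Real.exp (-(k * l / 4))) := by
      rw [Finset.sum_const, nsmul_eq_mul, Finset.card_univ]
    rw [this, ← Finset.sum_add_distrib]
    refine Finset.sum_le_sum fun g _ => ?_
    have a1 := abs_le.1 (S.La_level (L := L) (a := 0) hl0 hLl hk (by positivity) g)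
    have a2 := abs_le.1 (S.La_approx (L := L) (a := 0) hl0 hk0 le_rfl hε hc g)
    simp only [mul_zero, zero_div, neg_zero, Real.exp_zero, one_mul] at a2
    linarith [a1.1, a2.1]
  have h2 : l * (k - ε) - (∑ j ∈ Finset.range N, |c j|) * (4 * C1 ^ 2 * L / S.A L) ≤
      ∑ g, (∑ j ∈ Finset.range N, c j * S.Pg L (1 + (j + 1) / l) g) := by
    rw [Finset.sum_comm]
    have : ∀ j ∈ Finset.range N, l * (c j / (j + 1)) - |c j| * (4 * C1 ^ 2 * L / S.A L) ≤
        ∑ g, c j * S.Pg L (1 + (j + 1) / l) g := by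
      intro j hj
      have hj0 : (0:ℝ) < (j:ℝ) + 1 := by positivity
      have b0 : 0 < ((j:ℝ) + 1) * L / l := by positivity
      have b1 : ((j:ℝ) + 1) * L / l ≤ 1 := by
        rw [div_le_one hl0]
        have : ((j:ℝ) + 1) ≤ N := by exact_mod_cast Finset.mem_range.1 hj
        nlinarith
      have b := S.LC_zero hL hq b0 b1
      have e : ((j:ℝ) + 1) * L / l / L = (j + 1) / l := by field_simp
      have e2 : L / (((j:ℝ) + 1) * L / l) = l / (j + 1) := by field_simp
      rw [e, e2] at b
      rw [← Finset.mul_sum]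
      have h3 : |c j * ((∑ g, S.Pg L (1 + (j + 1) / l) g) - l / (j + 1))| ≤
          |c j| * (4 * C1 ^ 2 * L / S.A L) := by
        rw [abs_mul]
        exact mul_le_mul_of_nonneg_left b (abs_nonneg _)
      have h4 := (abs_le.1 h3).1
      have h5 : c j * ((∑ g, S.Pg L (1 + (j + 1) / l) g) - l / (j + 1)) =
        c j * (∑ g, S.Pg L (1 + (j + 1) / l) g) - l * (c j / (j + 1)) := by ring
      linarith
    refine le_trans ?_ (Finset.sum_le_sum this)
    rw [Finset.sum_sub_distrib, ← Finset.mul_sum, Finset.sum_mul]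
    gcongr
  have h3 := S.sum_Pg_le L (l := l) (by linarith)
  have h4 := mul_le_mul_of_nonneg_left h3 hε
  linarith

theorem exists_k : ∃ W1 k : ℝ, (∀ v, |deriv (wt k) v| ≤ W1) ∧ 1 ≤ k ∧
    KX W1 * 30 * Real.exp (-k) * (1 + KR k) ≤ 1 / 100 := by
  obtain ⟨W1, hW1, hW⟩ := exists_wt_deriv
  have t0 := Real.tendsto_pow_mul_exp_neg_atTop_nhds_zero 0
  have t1 := Real.tendsto_pow_mul_exp_neg_atTop_nhds_zero 1
  have t : Filter.Tendsto (fun k => (KX W1 * 30 * (1 + 12 * (4 * CF))) * (k ^ 0 * Real.exp (-k)) +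
      (KX W1 * 30 * 12) * (k ^ 1 * Real.exp (-k))) Filter.atTop (nhds 0) := by
    simpa using (t0.const_mul (KX W1 * 30 * (1 + 12 * (4 * CF)))).add
      (t1.const_mul (KX W1 * 30 * 12))
  have ev := (t.eventually_le_const (show (0:ℝ) < 1 / 100 by norm_num)).and
    (Filter.eventually_ge_atTop (1:ℝ))
  obtain ⟨k, h1, h2⟩ := ev.exists
  refine ⟨W1, k, hW k h2, h2, le_trans (le_of_eq ?_) h1⟩
  unfold KR
  ring

set_option maxHeartbeats 1000000 in
/-- The main theorem for abstract prime systems: every class contains its share of primes. -/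
theorem window_lower_bound : ∃ k : ℝ, 1 ≤ k ∧ ∀ c1 : ℝ, 0 < c1 → ∃ B : ℝ, 1 ≤ B ∧
    ∀ (P G : Type) [AddCommGroup G] [Fintype G] (S : Sys P G),
      (∀ χ : AddChar G ℂ, χ ≠ 0 → χ + χ ≠ 0) → ∀ L l : ℝ, 300000 ≤ L →
      128 * Real.log S.Q ≤ L → B * L ≤ l → c1 ≤ S.A L → ∀ g : G,
      1 / 20 / Fintype.card G ≤ ∑ n ∈ window k l,
        (((S.primes n).filter fun p => S.N p = n ∧ S.cl p = g).card : ℝ) / n := by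
  obtain ⟨W1, k, hW, hk, hkX⟩ := exists_k
  refine ⟨k, hk, fun c1 hc1 => ?_⟩
  have hk0 : 0 < k := by linarith
  have hKR : 0 ≤ KR k := by unfold KR; have := CF_pos; positivity
  have hC0 := C0_pos
  have hC1 := C1_pos
  set ε := 1 / (10 * (241 + 480 * KR k ^ 2)) with hε
  have hε0 : 0 < ε := by positivity
  have hε1 : ε * (241 + 480 * KR k ^ 2) = 1 / 10 := by rw [hε]; field_simp
  obtain ⟨N, c, hc, hc2⟩ := exists_wt_approx hk0 hε0
  set M := ∑ j ∈ Finset.range N, |c j| with hM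
  have hM0 : 0 ≤ M := Finset.sum_nonneg fun _ _ => abs_nonneg _
  have ev1 : ∀ᶠ B : ℝ in Filter.atTop, M * (2 * C1 ^ 2 * B ^ (-(1/4) : ℝ)) * KR k ^ 2 ≤ 1 / 20 := by
    have t := (tendsto_rpow_neg_atTop (show (0:ℝ) < 1/4 by norm_num)).const_mul
      (M * (2 * C1 ^ 2) * KR k ^ 2)
    rw [mul_zero] at t
    filter_upwards [t.eventually_le_const (show (0:ℝ) < 1/20 by norm_num)] with B hB
    refine le_trans (le_of_eq ?_) hB
    ring
  obtain ⟨B, hB1, hB2, hB3, hB4, hB5, hB6⟩ := (ev1.and ((Filter.eventually_ge_atTop (N:ℝ)).and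
    ((Filter.eventually_ge_atTop (632:ℝ)).and ((Filter.eventually_ge_atTop
      (80 * (4 * C0 * (2 + 2 * KR k ^ 2)))).and ((Filter.eventually_ge_atTop
        (10 * (M * (4 * C1 ^ 2 / c1)))).and (Filter.eventually_ge_atTop 1)))))).exists
  refine ⟨B, hB6, ?_⟩
  intro P G _ _ S hodd L l hL hq hBl hcA g
  have hL0 : 0 < L := by linarith
  have hLl : L ≤ l := by nlinarith
  have hl0 : 0 < l := by linarith
  have hN : N * L ≤ l := by nlinarith
  have hne : Nonempty G := ⟨0⟩
  set h := (Fintype.card G : ℝ) with hh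
  have hG : 0 < h := by rw [hh]; exact_mod_cast Fintype.card_pos
  have h1 : 1 ≤ h := by rw [hh]; exact_mod_cast Fintype.card_pos
  -- the exponential term
  have hexp : h * Real.exp (-(k * l / 4)) ≤ 8 / l := by
    have b1 : h ≤ Real.exp (l / 8) := by
      refine S.card_le.trans (Real.exp_le_exp.2 ?_)
      nlinarith
    calc _ ≤ Real.exp (l / 8) * Real.exp (-(k * l / 4)) := by gcongr
      _ = Real.exp (l / 8 - k * l / 4) := by rw [← Real.exp_add]; ring_nf
      _ ≤ Real.exp (-(l / 8)) := Real.exp_le_exp.2 (by nlinarith)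
      _ = (Real.exp (l / 8))⁻¹ := Real.exp_neg _
      _ ≤ (l / 8)⁻¹ := by
          gcongr
          linarith [Real.add_one_le_exp (l / 8)]
      _ = 8 / l := by rw [inv_div]
  have hexp2 : (4 * C0 * (2 + 2 * KR k ^ 2)) * (h * Real.exp (-(k * l / 4))) ≤ l / 10 := by
    calc _ ≤ (4 * C0 * (2 + 2 * KR k ^ 2)) * (8 / l) := by gcongr
      _ ≤ B / 80 * (8 / l) := by gcongr; linarith
      _ = B / 10 / l := by ring
      _ ≤ l / 10 := by
          rw [div_le_iff₀ hl0]
          nlinarith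
  set E := Real.exp (-(k * l / 4)) with hE
  have hE0 : 0 < E := Real.exp_pos _
  have hnc := (S.NC_La hL hq hodd hLl hk hW hε0.le hN hc).lower
    (S.sum_La_ge hL hq hLl hk hε0.le hN hc hc2) g
  rw [← hh, ← hE, ← hM] at hnc
  have hwin := S.La_le_window hl0 hk g
  rw [← hE] at hwin
  set Sw := ∑ n ∈ window k l,
        (((S.primes n).filter fun p => S.N p = n ∧ S.cl p = g).card : ℝ) / n with hSw
  have c2 : M * (4 * C1 ^ 2 * L / S.A L) ≤ l / 10 := by
    calc M * (4 * C1 ^ 2 * L / S.A L) ≤ M * (4 * C1 ^ 2 * L / c1) := by gcongr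
      _ = (10 * (M * (4 * C1 ^ 2 / c1))) * L / 10 := by ring
      _ ≤ B * L / 10 := by gcongr
      _ ≤ l / 10 := by gcongr
  have c3 : M * (2 * C1 ^ 2 * L * (L / l) ^ (-(3/4) : ℝ)) * (KR k) ^ 2 ≤ l / 20 := by
    have d1 : L * (L / l) ^ (-(3/4) : ℝ) = l * (l / L) ^ (-(1/4) : ℝ) := by
      rw [show L / l = (l / L)⁻¹ by rw [inv_div], Real.inv_rpow (by positivity),
        Real.rpow_neg (by positivity), inv_inv,
        show (3/4 : ℝ) = 1 + -(1/4) by norm_num, Real.rpow_add (by positivity), Real.rpow_one]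
      field_simp
    have d2 : (l / L) ^ (-(1/4) : ℝ) ≤ B ^ (-(1/4) : ℝ) := by
      refine Real.rpow_le_rpow_of_nonpos (by linarith) ?_ (by norm_num)
      rw [le_div_iff₀ hL0]; exact hBl
    calc _ = M * (2 * C1 ^ 2 * (L * (L / l) ^ (-(3/4) : ℝ))) * (KR k) ^ 2 := by ring
      _ = M * (2 * C1 ^ 2 * (l / L) ^ (-(1/4) : ℝ)) * (KR k) ^ 2 * l := by rw [d1]; ring
      _ ≤ M * (2 * C1 ^ 2 * B ^ (-(1/4) : ℝ)) * (KR k) ^ 2 * l := by gcongr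
      _ ≤ 1 / 20 * l := by gcongr
      _ = l / 20 := by ring
  have c4 : KX W1 * (30 * k * l) * Real.exp (-k) * (1 + KR k) ≤ k * l / 100 := by
    calc _ = (KX W1 * 30 * Real.exp (-k) * (1 + KR k)) * (k * l) := by ring
      _ ≤ 1 / 100 * (k * l) := by gcongr
      _ = _ := by ring
  -- collect
  have key : k * l / 4 ≤ (9 / 2 * k * l) * Sw * h := by
    have m := mul_le_mul_of_nonneg_right (hnc.trans hwin) hG.le
    have e1 : ((l * (k - ε) - M * (4 * C1 ^ 2 * L / S.A L) - ε * (240 * l) -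
        h * (4 * C0 * E)) / h - 2 * (KX W1 * (30 * k * l) * Real.exp (-k) / h * (1 + KR k) +
        (KR k) ^ 2 * (4 * C0 * E) + ε * (KR k) ^ 2 * (240 * l) / h +
        M * (2 * C1 ^ 2 * L * (L / l) ^ (-(3/4) : ℝ)) * (KR k) ^ 2 / h)) * h =
        l * k - M * (4 * C1 ^ 2 * L / S.A L) - ε * (241 + 480 * KR k ^ 2) * l -
        (4 * C0 * (1 + 2 * KR k ^ 2)) * (h * E) -
        2 * (KX W1 * (30 * k * l) * Real.exp (-k) * (1 + KR k)) -
        2 * (M * (2 * C1 ^ 2 * L * (L / l) ^ (-(3/4) : ℝ)) * (KR k) ^ 2) := by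
      field_simp
      ring
    rw [e1, hε1] at m
    have hkl : l ≤ k * l := by nlinarith
    have e2 : (4 * C0 * (1 + 2 * KR k ^ 2)) * (h * E) + 4 * C0 * E * h =
      (4 * C0 * (2 + 2 * KR k ^ 2)) * (h * E) := by ring
    rw [add_mul] at m
    linarith
  have hkl0 : 0 < k * l := by positivity
  rw [div_le_iff₀ hG]
  by_contra hcon
  push Not at hcon
  have := mul_lt_mul_of_pos_left hcon (show 0 < 9 / 2 * (k * l) by positivity)
  have e3 : 9 / 2 * k * l * Sw * h = 9 / 2 * (k * l) * (Sw * h) := by ring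
  linarith
end Sys

theorem conv_assoc' (f g h : ℕ → ℂ) : LSeries.convolution (LSeries.convolution f g) h = LSeries.convolution f (LSeries.convolution g h) := by
  simp only [LSeries.convolution, ArithmeticFunction.toArithmeticFunction_eq_self, mul_assoc]

theorem conv_comm' (f g : ℕ → ℂ) : LSeries.convolution f g = LSeries.convolution g f := by
  simp only [LSeries.convolution, mul_comm]

theorem conv_add' (f g h : ℕ → ℂ) : LSeries.convolution (f + g) h = LSeries.convolution f h + LSeries.convolution g h := by
  simp only [LSeries.convolution_def]
  funext n
  simp [add_mul, Finset.sum_add_distrib]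

/-- `log` acts as a derivation for Dirichlet convolution. -/
theorem logMul_conv (f g : ℕ → ℂ) :
    LSeries.logMul (LSeries.convolution f g) =
      LSeries.convolution (LSeries.logMul f) g + LSeries.convolution f (LSeries.logMul g) := by
  simp only [LSeries.convolution_def]
  funext n
  simp only [LSeries.logMul, Pi.add_apply]
  rw [Finset.mul_sum, ← Finset.sum_add_distrib]
  refine Finset.sum_congr rfl fun x hx => ?_
  obtain ⟨h1, h2⟩ := Nat.mem_divisorsAntidiagonal.1 hx
  have ha : (x.1 : ℝ) ≠ 0 := by rintro h; apply h2; rw [← h1, Nat.cast_eq_zero.1 h, zero_mul]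
  have hb : (x.2 : ℝ) ≠ 0 := by rintro h; apply h2; rw [← h1, Nat.cast_eq_zero.1 h, mul_zero]
  have h : Complex.log n = Complex.log x.1 + Complex.log x.2 := by
    rw [← h1]
    have := Real.log_mul ha hb
    rw [← Complex.natCast_log, ← Complex.natCast_log, ← Complex.natCast_log]
    push_cast
    rw [this]
    push_cast
    rfl
  rw [h]; ring

theorem logMul_char {N : ℕ} (χ : DirichletCharacter ℂ N) :
    LSeries.logMul (fun n => χ n) =
      LSeries.convolution (fun n => χ n * (ArithmeticFunction.vonMangoldt n : ℂ)) (fun n => χ n) := by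
  have := χ.convolution_twist_vonMangoldt
  have e : (fun n : ℕ => χ n * (ArithmeticFunction.vonMangoldt n : ℂ)) =
      (fun n : ℕ => χ n) * (fun n : ℕ => (ArithmeticFunction.vonMangoldt n : ℂ)) := rfl
  rw [e, this]
  funext n
  simp [LSeries.logMul, mul_comm]

theorem logMul_conv_char {N : ℕ} (χ₁ χ₂ : DirichletCharacter ℂ N) :
    LSeries.logMul (LSeries.convolution (fun n : ℕ => χ₁ n) (fun n : ℕ => χ₂ n)) =
      LSeries.convolution (fun n : ℕ => (χ₁ n + χ₂ n) * (ArithmeticFunction.vonMangoldt n : ℂ))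
        (LSeries.convolution (fun n : ℕ => χ₁ n) (fun n : ℕ => χ₂ n)) := by
  have e : (fun n : ℕ => (χ₁ n + χ₂ n) * (ArithmeticFunction.vonMangoldt n : ℂ)) =
      (fun n : ℕ => χ₁ n * (ArithmeticFunction.vonMangoldt n : ℂ)) +
      (fun n : ℕ => χ₂ n * (ArithmeticFunction.vonMangoldt n : ℂ)) := by
    funext n; simp [add_mul]
  rw [logMul_conv, e, conv_add', logMul_char, logMul_char, conv_assoc']
  congr 1
  rw [← conv_assoc', conv_comm' (fun n : ℕ => χ₁ n), conv_assoc']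

/-- A sequence is determined by its value at `1` and its von Mangoldt function. -/
theorem eq_of_logMul {f g l : ℕ → ℂ} (hl : l 1 = 0) (h1 : f 1 = g 1)
    (hf : LSeries.logMul f = LSeries.convolution l f) (hg : LSeries.logMul g = LSeries.convolution l g) {n : ℕ} (hn : n ≠ 0) :
    f n = g n := by
  induction n using Nat.strong_induction_on with
  | _ n ih =>
    rcases eq_or_ne n 1 with rfl | hn1
    · exact h1
    · have hlog : Complex.log n ≠ 0 := by
        rw [← Complex.natCast_log]
        exact_mod_cast (Real.log_pos (by exact_mod_cast (by omega : 1 < n))).ne'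
      refine mul_left_cancel₀ hlog ?_
      have a := congrFun hf n
      have b := congrFun hg n
      simp only [LSeries.convolution_def, LSeries.logMul] at a b
      rw [a, b]
      refine Finset.sum_congr rfl fun x hx => ?_
      obtain ⟨h1, h2⟩ := Nat.mem_divisorsAntidiagonal.1 hx
      rcases eq_or_ne x.1 1 with h | h
      · rw [h, hl, zero_mul, zero_mul]
      · have hx2 : x.2 ≠ 0 := by rintro h; apply h2; rw [← h1, h, mul_zero]
        have hx1 : x.1 ≠ 0 := by rintro h; apply h2; rw [← h1, h, zero_mul]
        rw [ih x.2 ?_ hx2]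
        rw [← h1]
        have : 2 ≤ x.1 := by omega
        have : 0 < x.2 := by omega
        nlinarith

theorem changeLevel_natCast {R : Type} [CommMonoidWithZero R] {n m : ℕ}
    (χ : DirichletCharacter R n) (h : n ∣ m) {a : ℕ} (ha : a.Coprime m) :
    DirichletCharacter.changeLevel h χ (a : ZMod m) = χ (a : ZMod n) := by
  obtain ⟨u, hu⟩ := (ZMod.isUnit_iff_coprime a m).2 ha
  rw [← hu, DirichletCharacter.changeLevel_eq_cast_of_dvd, hu, ZMod.cast_natCast h]

namespace Sys

open scoped Classical

variable {P G : Type} [AddCommGroup G] [Fintype G]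

/-- The splitting law governed by a quadratic character. -/
def Splits (S : Sys P G) {D : ℕ} (χ : DirichletCharacter ℂ D) : Prop :=
  ∀ l : ℕ, l.Prime → ∃ s : Finset P, (∀ p, p ∈ s ↔ S.below p = l) ∧
    ((χ l = 1 ∧ s.card = 2 ∧ ∀ p ∈ s, S.N p = l) ∨
     (χ l = -1 ∧ s.card = 1 ∧ ∀ p ∈ s, S.N p = l ^ 2) ∨
     (χ l = 0 ∧ s.card = 1 ∧ ∀ p ∈ s, S.N p = l))

/-- Product of the rational primes below the sifting primes. -/
noncomputable def lvl (S : Sys P G) (L : ℝ) : ℕ := ∏ l ∈ (S.lev L).image S.below, l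

theorem lvl_pos (S : Sys P G) (L : ℝ) : 0 < S.lvl L := by
  refine Finset.prod_pos fun l hl => ?_
  obtain ⟨p, -, rfl⟩ := Finset.mem_image.1 hl
  exact (S.prime_below p).pos

theorem prime_dvd_lvl (S : Sys P G) {L : ℝ} {l : ℕ} (hl : l.Prime) :
    l ∣ S.lvl L ↔ ∃ p ∈ S.lev L, S.below p = l := by
  rw [lvl, hl.prime.dvd_finsetProd_iff]
  constructor
  · rintro ⟨q, hq, h⟩
    obtain ⟨p, hp, rfl⟩ := Finset.mem_image.1 hq
    exact ⟨p, hp, ((Nat.prime_dvd_prime_iff_eq hl (S.prime_below p)).1 h).symm⟩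
  · rintro ⟨p, hp, rfl⟩
    exact ⟨_, Finset.mem_image_of_mem _ hp, dvd_rfl⟩

theorem inner_pow_sum {l e m : ℕ} (hl : l.Prime) (he : 0 < e) (hm : 0 < m) (x : ℝ) :
    (∑ j ∈ Finset.Icc 1 (l ^ m), if (l ^ e) ^ j = l ^ m then x else 0) = if e ∣ m then x else 0 := by
  have h : ∀ j, (l ^ e) ^ j = l ^ m ↔ e * j = m := fun j => by
    rw [← pow_mul]; exact Nat.pow_right_inj hl.two_le
  simp only [h]
  split_ifs with hd
  · obtain ⟨j, rfl⟩ := hd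
    have hj : 0 < j := by
      rcases Nat.eq_zero_or_pos j with rfl | h
      · simp at hm
      · exact h
    rw [Finset.sum_eq_single j]
    · simp
    · intro i _ hi
      rw [if_neg]
      exact fun h' => hi (Nat.eq_of_mul_eq_mul_left he h')
    · intro hj'
      exfalso; apply hj'
      rw [Finset.mem_Icc]
      refine ⟨hj, ?_⟩
      have h1 : e * j < l ^ (e * j) := Nat.lt_pow_self hl.one_lt
      nlinarith
  · exact Finset.sum_eq_zero fun j _ => if_neg fun h' => hd ⟨j, h'.symm⟩

theorem sum_Lam_pow (S : Sys P G) (L : ℝ) {l m : ℕ} (hl : l.Prime) (hm : 0 < m) (s : Finset P)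
    (hs : ∀ p, p ∈ s ↔ S.below p = l) {e : ℕ} (he : 0 < e) (hN : ∀ p ∈ s, S.N p = l ^ e) :
    ∑ g, S.Lam L g (l ^ m) = if l ∣ S.lvl L then 0 else
      s.card * (if e ∣ m then e * Real.log l else 0) := by
  rw [sum_Lam_eq]
  have key : ∀ p ∈ s, (∑ j ∈ Finset.Icc 1 (l ^ m), if S.N p ^ j = l ^ m then
      Real.log (S.N p) else 0) = if e ∣ m then e * Real.log l else 0 := by
    intro p hp
    rw [hN p hp, inner_pow_sum hl he hm]
    simp
  have hz : ∀ p, p ∉ s → ∀ j ∈ Finset.Icc 1 (l ^ m), S.N p ^ j ≠ l ^ m := by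
    intro p hp j hj h
    apply hp
    rw [hs]
    have h1 : S.below p ∣ l ^ m := by
      rw [← h]
      refine dvd_pow ?_ (by have := Finset.mem_Icc.1 hj; omega)
      rcases S.N_eq p with h | h <;> rw [h]
      exact dvd_pow_self _ two_ne_zero
    exact (Nat.prime_dvd_prime_iff_eq (S.prime_below p) hl).1
      ((S.prime_below p).dvd_of_dvd_pow h1)
  have hsplit : ∑ p ∈ S.primes (l ^ m) \ S.lev L, (∑ j ∈ Finset.Icc 1 (l ^ m),
      if S.N p ^ j = l ^ m then Real.log (S.N p) else 0) =
      ∑ p ∈ s.filter (fun p => p ∉ S.lev L), if e ∣ m then e * Real.log l else 0 := by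
    refine Finset.sum_congr_of_eq_on_inter ?_ ?_ ?_
    · intro p hp hp'
      rw [Finset.mem_filter, not_and] at hp'
      have : p ∉ s := fun h => hp' h (Finset.mem_sdiff.1 hp).2
      exact Finset.sum_eq_zero fun j hj => if_neg (hz p this j hj)
    · intro p hp hp'
      rw [Finset.mem_filter] at hp
      rw [Finset.mem_sdiff, not_and'] at hp'
      have h1 := hp' hp.2
      rw [mem_primes, hN p hp.1] at h1
      rw [if_neg]
      intro hd
      exact h1 (Nat.pow_le_pow_right hl.pos (Nat.le_of_dvd hm hd))
    · intro p _ hp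
      exact key p (Finset.mem_filter.1 hp).1
  rw [hsplit, Finset.sum_const, nsmul_eq_mul]
  by_cases h1 : l ∣ S.lvl L
  · rw [if_pos h1]
    obtain ⟨p, hp, hb⟩ := (S.prime_dvd_lvl hl).1 h1
    have : s.filter (fun p => p ∉ S.lev L) = ∅ := by
      refine Finset.filter_eq_empty_iff.2 fun q hq hq' => hq' ?_
      rw [mem_lev] at hp ⊢
      rwa [hN q hq, ← hN p ((hs p).2 hb)]
    rw [this]; simp
  · rw [if_neg h1]
    have : s.filter (fun p => p ∉ S.lev L) = s := by
      refine Finset.filter_eq_self.2 fun q hq hq' => h1 ?_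
      exact (S.prime_dvd_lvl hl).2 ⟨q, hq', (hs q).1 hq⟩
    rw [this]

theorem LC_eq (S : Sys P G) {D : ℕ} {χ : DirichletCharacter ℂ D} (hS : S.Splits χ) {L : ℝ}
    (hD : D ∣ S.lvl L) (n : ℕ) :
    S.LC L 0 n = ((1 : DirichletCharacter ℂ (S.lvl L)) n +
      DirichletCharacter.changeLevel hD χ n) * (ArithmeticFunction.vonMangoldt n : ℂ) := by
  have h0 : S.LC L 0 n = ((∑ g, S.Lam L g n : ℝ) : ℂ) := by
    rw [LC, Complex.ofReal_sum]
    simp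
  rw [h0]
  by_cases hn : IsPrimePow n
  · obtain ⟨l, m, hl, hm, rfl⟩ := (isPrimePow_nat_iff n).1 hn
    rw [ArithmeticFunction.vonMangoldt_apply_pow hm.ne', ArithmeticFunction.vonMangoldt_apply_prime hl]
    obtain ⟨s, hs, hcases⟩ := hS l hl
    by_cases hd : l ∣ S.lvl L
    · have hu : ¬ IsUnit (((l ^ m : ℕ) : ZMod (S.lvl L))) := by
        rw [ZMod.isUnit_iff_coprime, Nat.coprime_pow_left_iff hm, hl.coprime_iff_not_dvd]
        exact not_not.2 hd
      rw [MulChar.map_nonunit _ hu, MulChar.map_nonunit _ hu]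
      have : ∑ g, S.Lam L g (l ^ m) = 0 := by
        rcases hcases with ⟨-, -, h⟩ | ⟨-, -, h⟩ | ⟨-, -, h⟩
        · rw [S.sum_Lam_pow L hl hm s hs one_pos (by simpa using h), if_pos hd]
        · rw [S.sum_Lam_pow L hl hm s hs two_pos h, if_pos hd]
        · rw [S.sum_Lam_pow L hl hm s hs one_pos (by simpa using h), if_pos hd]
      rw [this]; simp
    · have hc : (l ^ m).Coprime (S.lvl L) :=
        Nat.Coprime.pow_left _ ((hl.coprime_iff_not_dvd).2 hd)
      rw [MulChar.one_apply ((ZMod.isUnit_iff_coprime _ _).2 hc), changeLevel_natCast _ _ hc,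
        Nat.cast_pow, map_pow]
      rcases hcases with ⟨hχ, hcard, h⟩ | ⟨hχ, hcard, h⟩ | ⟨hχ, hcard, h⟩
      · rw [S.sum_Lam_pow L hl hm s hs one_pos (by simpa using h), if_neg hd, hχ, hcard]
        simp
        norm_num
      · rw [S.sum_Lam_pow L hl hm s hs two_pos h, if_neg hd, hχ, hcard]
        rcases Nat.even_or_odd m with h | h
        · rw [if_pos h.two_dvd, h.neg_one_pow]; push_cast; ring
        · rw [if_neg (by rw [← even_iff_two_dvd]; exact Nat.not_even_iff_odd.2 h), h.neg_one_pow]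
          simp
      · rw [S.sum_Lam_pow L hl hm s hs one_pos (by simpa using h), if_neg hd, hχ, hcard]
        simp [hm.ne']
  · rw [ArithmeticFunction.vonMangoldt_eq_zero_iff.2 hn]
    have : ∑ g, S.Lam L g n = 0 := by
      refine le_antisymm ?_ (Finset.sum_nonneg fun g _ => S.Lam_nonneg L g n)
      refine (S.sum_Lam_le L n).trans ?_
      rw [ArithmeticFunction.vonMangoldt_eq_zero_iff.2 hn, mul_zero]
    rw [this]; simp

theorem bC_eq (S : Sys P G) {D : ℕ} {χ : DirichletCharacter ℂ D} (hS : S.Splits χ) {L : ℝ}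
    (hD : D ∣ S.lvl L) {n : ℕ} (hn : n ≠ 0) :
    S.bC L 0 n = LSeries.convolution (fun n : ℕ => (1 : DirichletCharacter ℂ (S.lvl L)) n)
      (fun n : ℕ => DirichletCharacter.changeLevel hD χ n) n := by
  refine eq_of_logMul (l := S.LC L 0) ?_ ?_ (S.logMul_bC L 0) ?_ hn
  · rw [S.LC_eq hS hD]; simp
  · rw [bC_one]
    simp [LSeries.convolution_def]
  · rw [logMul_conv_char]
    congr 1
    funext n
    exact (S.LC_eq hS hD n).symm

theorem LSeries_bC_eq (S : Sys P G) {D : ℕ} [NeZero D] {χ : DirichletCharacter ℂ D}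
    (hS : S.Splits χ) {L : ℝ} (hD : D ∣ S.lvl L) {s : ℂ} (hs : 1 < s.re) :
    haveI : NeZero (S.lvl L) := ⟨(S.lvl_pos L).ne'⟩
    LSeriesSummable (S.bC L 0) s ∧
    LSeries (S.bC L 0) s = DirichletCharacter.LFunctionTrivChar (S.lvl L) s *
      (DirichletCharacter.changeLevel hD χ).LFunction s := by
  have : NeZero (S.lvl L) := ⟨(S.lvl_pos L).ne'⟩
  have h1 := DirichletCharacter.LSeriesSummable_of_one_lt_re (1 : DirichletCharacter ℂ (S.lvl L)) hs
  have h2 := DirichletCharacter.LSeriesSummable_of_one_lt_re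
    (DirichletCharacter.changeLevel hD χ) hs
  refine ⟨(LSeriesSummable_congr s fun hn => S.bC_eq hS hD hn).2 (h1.convolution h2), ?_⟩
  rw [LSeries_congr (fun hn => S.bC_eq hS hD hn), LSeries_convolution' h1 h2,
    DirichletCharacter.LFunctionTrivChar, DirichletCharacter.LFunction_eq_LSeries _ hs,
    DirichletCharacter.LFunction_eq_LSeries _ hs]

end Sys

section

open MeasureTheory Filter Topology

theorem mellin_tail_eq (E : ℝ → ℝ) (s : ℂ) :
    mellin (fun t => (((Set.Ioi (1 : ℝ)).indicator E t : ℝ) : ℂ)) (-s) =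
      ∫ t in Set.Ioi (1 : ℝ), (E t : ℂ) * (t : ℂ) ^ (-(s + 1)) := by
  rw [mellin]
  have h : ∀ t : ℝ, (t : ℂ) ^ (-s - 1) • (((Set.Ioi (1 : ℝ)).indicator E t : ℝ) : ℂ) =
      (Set.Ioi (1 : ℝ)).indicator (fun t : ℝ => (E t : ℂ) * (t : ℂ) ^ (-(s + 1))) t := by
    intro t
    by_cases ht : t ∈ Set.Ioi (1 : ℝ)
    · rw [Set.indicator_of_mem ht, Set.indicator_of_mem ht, smul_eq_mul, mul_comm, neg_add']
    · rw [Set.indicator_of_notMem ht, Set.indicator_of_notMem ht]; simp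
  simp_rw [h]
  rw [setIntegral_indicator measurableSet_Ioi]
  congr 2
  ext t
  simp only [Set.mem_inter_iff, Set.mem_Ioi]
  constructor
  · exact fun h => h.2
  · exact fun h => ⟨by linarith, h⟩

theorem differentiableAt_tail_integral {E : ℝ → ℝ} (hE : Measurable E) {C θ : ℝ}
    (hC : ∀ t, 1 ≤ t → |E t| ≤ C * t ^ θ) {s : ℂ} (hs : θ < s.re) :
    DifferentiableAt ℂ (fun s : ℂ => ∫ t in Set.Ioi (1 : ℝ), (E t : ℂ) * (t : ℂ) ^ (-(s + 1))) s := by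
  have hEq : (fun s : ℂ => ∫ t in Set.Ioi (1 : ℝ), (E t : ℂ) * (t : ℂ) ^ (-(s + 1))) =
      (mellin (fun t => (((Set.Ioi (1 : ℝ)).indicator E t : ℝ) : ℂ))) ∘ (fun s => -s) := by
    funext s; exact (mellin_tail_eq E s).symm
  rw [hEq]
  refine DifferentiableAt.comp s ?_ differentiableAt_id.neg
  have hbd : ∀ t : ℝ, 1 ≤ t → ‖(((Set.Ioi (1 : ℝ)).indicator E t : ℝ) : ℂ)‖ ≤ C * ‖t ^ (-(-θ))‖ := by
    intro t ht
    rw [neg_neg, Real.norm_of_nonneg (by positivity), Complex.norm_real]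
    exact (norm_indicator_le_norm_self _ _).trans (hC t ht)
  refine mellin_differentiableAt_of_isBigO_rpow (a := -θ) (b := (-s).re - 1) ?_ ?_ ?_ ?_ ?_
  · rw [locallyIntegrableOn_iff isOpen_Ioi.isLocallyClosed]
    intro k hk hkc
    obtain ⟨M, hM⟩ := hkc.isBounded.subset_closedBall 0
    refine Measure.integrableOn_of_bounded (M := max 0 C * (max 1 M) ^ (max 0 θ)) hkc.measure_lt_top.ne ?_ ?_
    · exact (Complex.measurable_ofReal.comp (hE.indicator measurableSet_Ioi)).aestronglyMeasurable
    · refine (ae_restrict_iff' hkc.measurableSet).2 (ae_of_all _ fun t ht => ?_)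
      by_cases h1 : t ∈ Set.Ioi (1 : ℝ)
      · rw [Set.indicator_of_mem h1, Complex.norm_real]
        have h1' : 1 < t := h1
        have htM : t ≤ M := by
          have := hM ht
          simp only [Metric.mem_closedBall, dist_zero_right, Real.norm_eq_abs] at this
          exact (le_abs_self t).trans this
        refine (hC t h1'.le).trans (mul_le_mul (le_max_right _ _) ?_ (by positivity) (le_max_left _ _))
        exact (Real.rpow_le_rpow_of_exponent_le h1'.le (le_max_right _ _)).trans
          (Real.rpow_le_rpow (by linarith) (htM.trans (le_max_right _ _)) (le_max_left _ _))
      · rw [Set.indicator_of_notMem h1]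
        simp only [Complex.ofReal_zero, norm_zero]
        have : 0 ≤ max 1 M := by positivity
        positivity
  · refine Asymptotics.IsBigO.of_bound C ?_
    filter_upwards [eventually_ge_atTop 1] with t ht using hbd t ht
  · simpa using hs
  · refine Asymptotics.IsBigO.of_bound 0 ?_
    have : ∀ᶠ t in 𝓝[>] (0 : ℝ), t < 1 := nhdsWithin_le_nhds (eventually_lt_nhds one_pos)
    filter_upwards [this] with t ht
    rw [Set.indicator_of_notMem (by simpa using ht.le)]
    simp
  · linarith

theorem integrableOn_tail {E : ℝ → ℝ} (hE : Measurable E) {C θ : ℝ}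
    (hC : ∀ t, 1 ≤ t → |E t| ≤ C * t ^ θ) {s : ℂ} (hs : θ < s.re) :
    IntegrableOn (fun t : ℝ => (E t : ℂ) * (t : ℂ) ^ (-(s + 1))) (Set.Ioi 1) := by
  have h1 : IntegrableOn (fun t : ℝ => C * t ^ (θ - s.re - 1)) (Set.Ioi 1) :=
    (integrableOn_Ioi_rpow_of_lt (by linarith) one_pos).const_mul C
  refine h1.mono' ?_ ?_
  · refine AEStronglyMeasurable.mul
      (Complex.measurable_ofReal.comp hE).aestronglyMeasurable ?_
    refine ContinuousOn.aestronglyMeasurable ?_ measurableSet_Ioi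
    intro t ht
    refine ContinuousAt.continuousWithinAt ?_
    refine ContinuousAt.cpow Complex.continuous_ofReal.continuousAt continuousAt_const ?_
    exact Or.inl (by simpa using lt_trans one_pos ht)
  · refine (ae_restrict_iff' measurableSet_Ioi).2 (ae_of_all _ fun t ht => ?_)
    have ht' : (1 : ℝ) < t := ht
    rw [norm_mul, Complex.norm_real, Complex.norm_cpow_eq_rpow_re_of_pos (by linarith)]
    calc _ ≤ (C * t ^ θ) * t ^ (-(s + 1)).re :=
          mul_le_mul_of_nonneg_right (hC t ht'.le) (by positivity)
      _ = _ := by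
          rw [mul_assoc, ← Real.rpow_add (by linarith)]
          congr 2
          simp; ring

/-- Hecke's device: a real continuation without zeros on `[β₀, 1)` controls the residue. -/
theorem hecke_core {b : ℕ → ℝ} (hb : ∀ n, 0 ≤ b n) {κ C θ β₀ : ℝ} (hκ : 0 < κ) (hθ : 0 ≤ θ)
    (hθβ : θ < β₀) (hβ : β₀ < 1)
    (hE : ∀ t, 1 ≤ t → |∑ k ∈ Finset.Icc 1 ⌊t⌋₊, b k - κ * t| ≤ C * t ^ θ)
    {F : ℂ → ℂ} (hF : Differentiable ℂ F)
    (hFL : ∀ s : ℂ, 1 < s.re → F s = (s - 1) * LSeries (fun n => (b n : ℂ)) s)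
    (hF0 : ∀ β : ℝ, β₀ ≤ β → β < 1 → F β ≠ 0) :
    0 ≤ κ + (β₀ - 1) * ∫ t in Set.Ioi (1 : ℝ),
      (∑ k ∈ Finset.Icc 1 ⌊t⌋₊, b k - κ * t) * t ^ (-(β₀ + 1)) := by
  have hC : 0 ≤ C := by
    have := (abs_nonneg _).trans (hE 1 le_rfl)
    simpa using this
  set E : ℝ → ℝ := fun t => ∑ k ∈ Finset.Icc 1 ⌊t⌋₊, b k - κ * t with hEdef
  have hEm : Measurable E := by
    refine Measurable.sub ?_ (by fun_prop)
    exact (measurable_from_nat (f := fun n => ∑ k ∈ Finset.Icc 1 n, b k)).comp Nat.measurable_floor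
  set M : ℂ → ℂ := fun s => ∫ t in Set.Ioi (1 : ℝ), (E t : ℂ) * (t : ℂ) ^ (-(s + 1)) with hM
  have hMd : ∀ s : ℂ, θ < s.re → DifferentiableAt ℂ M s := fun s hs =>
    differentiableAt_tail_integral hEm hE hs
  have hser : ∀ s : ℂ, 1 < s.re → F s = s * κ + s * (s - 1) * M s := by
    intro s hs
    have hs1 : s - 1 ≠ 0 := by
      intro h; rw [sub_eq_zero] at h; rw [h] at hs; simp at hs
    have hO : (fun n : ℕ => ∑ k ∈ Finset.Icc 1 n, b k) =O[atTop] fun n => (n : ℝ) ^ (1 : ℝ) := by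
      refine Asymptotics.IsBigO.of_bound (C + κ) ?_
      filter_upwards [eventually_ge_atTop 1] with n hn
      have h1 : (1 : ℝ) ≤ n := by exact_mod_cast hn
      have h2 := hE n h1
      rw [Nat.floor_natCast] at h2
      have h3 := (abs_le.1 h2).2
      have h4 : (n : ℝ) ^ θ ≤ n := by
        calc (n : ℝ) ^ θ ≤ (n : ℝ) ^ (1 : ℝ) := Real.rpow_le_rpow_of_exponent_le h1 (by linarith)
          _ = n := Real.rpow_one _
      have h5 : C * (n : ℝ) ^ θ ≤ C * n := mul_le_mul_of_nonneg_left h4 hC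
      rw [Real.norm_of_nonneg (Finset.sum_nonneg fun k _ => hb k), Real.rpow_one,
        Real.norm_of_nonneg (by linarith)]
      linarith
    have h := LSeries_eq_mul_integral_of_nonneg b zero_le_one hs hO hb
    rw [hFL s hs, h]
    have hint : ∫ t in Set.Ioi (1 : ℝ), (∑ k ∈ Finset.Icc 1 ⌊t⌋₊, (b k : ℂ)) * (t : ℂ) ^ (-(s + 1)) =
        κ / (s - 1) + M s := by
      have hI1 : ∫ t in Set.Ioi (1 : ℝ), (κ : ℂ) * (t : ℂ) ^ (-s) = κ / (s - 1) := by
        rw [integral_const_mul, integral_Ioi_cpow_of_lt (by simpa using hs) one_pos]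
        simp only [Complex.ofReal_one, Complex.one_cpow]
        rw [neg_div, ← div_neg, neg_add, neg_neg, ← sub_eq_add_neg]
        ring
      have hI2 : IntegrableOn (fun t : ℝ => (κ : ℂ) * (t : ℂ) ^ (-s)) (Set.Ioi 1) :=
        (integrableOn_Ioi_cpow_of_lt (by simpa using hs) one_pos).const_mul _
      rw [← hI1, hM, ← integral_add hI2 (integrableOn_tail hEm hE (by linarith))]
      refine setIntegral_congr_fun measurableSet_Ioi fun t ht => ?_
      have ht0 : (t : ℂ) ≠ 0 := by
        have : (0 : ℝ) < t := lt_trans one_pos ht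
        exact_mod_cast this.ne'
      have e : (t : ℂ) ^ (-s) = t * (t : ℂ) ^ (-(s + 1)) := by
        rw [neg_add', Complex.cpow_sub _ _ ht0, Complex.cpow_one]
        field_simp
      simp only [hEdef]
      push_cast
      rw [e]; ring
    rw [hint]
    field_simp
  have hall : ∀ s : ℂ, θ < s.re → F s = s * κ + s * (s - 1) * M s := by
    have hopen : IsOpen {s : ℂ | θ < s.re} := isOpen_lt continuous_const Complex.continuous_re
    have hcon : IsPreconnected {s : ℂ | θ < s.re} := (convex_halfSpace_re_gt θ).isPreconnected
    have h1 : AnalyticOnNhd ℂ F {s : ℂ | θ < s.re} :=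
      (hF.differentiableOn).analyticOnNhd hopen
    have h2 : AnalyticOnNhd ℂ (fun s => s * κ + s * (s - 1) * M s) {s : ℂ | θ < s.re} := by
      refine DifferentiableOn.analyticOnNhd (fun s hs => ?_) hopen
      have := hMd s hs
      exact DifferentiableAt.differentiableWithinAt (by fun_prop)
    have h3 := h1.eqOn_of_preconnected_of_eventuallyEq h2 hcon (z₀ := 2)
      (by simp; linarith) ?_
    · exact fun s hs => h3 hs
    · have : {s : ℂ | 1 < s.re} ∈ 𝓝 (2 : ℂ) :=
        (isOpen_lt continuous_const Complex.continuous_re).mem_nhds (by simp)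
      filter_upwards [this] with s hs using hser s hs
  set m : ℝ → ℝ := fun β => ∫ t in Set.Ioi (1 : ℝ), E t * t ^ (-(β + 1)) with hm
  have hMm : ∀ β : ℝ, M β = m β := by
    intro β
    rw [hM, hm]
    simp only
    rw [← integral_complex_ofReal]
    refine setIntegral_congr_fun measurableSet_Ioi fun t ht => ?_
    have ht0 : (0 : ℝ) ≤ t := (lt_trans one_pos ht).le
    simp only [Complex.ofReal_mul]
    rw [Complex.ofReal_cpow ht0]
    push_cast
    rfl
  have hFr : ∀ β : ℝ, θ < β → F β = ((β * (κ + (β - 1) * m β) : ℝ) : ℂ) := by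
    intro β h
    rw [hall β (by simpa using h), hMm]
    push_cast; ring
  by_contra hneg
  have hneg' : κ + (β₀ - 1) * m β₀ < 0 := not_le.1 hneg
  have hcont : ContinuousOn (fun β : ℝ => (F β).re) (Set.Icc β₀ 1) :=
    (Complex.continuous_re.comp (hF.continuous.comp Complex.continuous_ofReal)).continuousOn
  have hivt := intermediate_value_Icc hβ.le hcont
  have h0 : (0 : ℝ) ∈ Set.Icc (F β₀).re (F (1 : ℝ)).re := by
    rw [hFr β₀ hθβ, hFr 1 (by linarith), Complex.ofReal_re, Complex.ofReal_re]
    refine ⟨?_, ?_⟩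
    · exact (mul_neg_of_pos_of_neg (by linarith) hneg').le
    · simp; linarith
  obtain ⟨β, hβm, hβ0⟩ := hivt h0
  have hFβ : F β = 0 := by
    have := hFr β (by linarith [hβm.1])
    simp only at hβ0
    rw [this, Complex.ofReal_re] at hβ0
    rw [this, hβ0, Complex.ofReal_zero]
  rcases eq_or_lt_of_le hβm.2 with h | h
  · rw [h, hFr 1 (by linarith)] at hFβ
    have : (1 * (κ + (1 - 1) * m 1) : ℝ) = 0 := by exact_mod_cast hFβ
    linarith
  · exact hF0 β hβm.1 h hFβ

end

section

open MeasureTheory Filter Topology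

theorem exists_riemannZeta_ne_zero : ∃ δ : ℝ, 0 < δ ∧ δ < 1 ∧
    ∀ β : ℝ, 1 - δ ≤ β → β < 1 → riemannZeta β ≠ 0 := by
  have h := eventually_nhdsWithin_iff.1 (riemannZeta_residue_one.eventually_ne one_ne_zero)
  obtain ⟨ε, hε, hb⟩ := Metric.eventually_nhds_iff.1 h
  refine ⟨min (ε / 2) (1 / 2), by positivity, by linarith [min_le_right (ε / 2) (1 / 2 : ℝ)],
    fun β h1 h2 h0 => ?_⟩
  refine hb (y := (β : ℂ)) ?_ ?_ ?_
  · rw [Complex.dist_eq, ← Complex.ofReal_one, ← Complex.ofReal_sub, Complex.norm_real,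
      Real.norm_eq_abs, abs_sub_comm, abs_of_pos (by linarith)]
    linarith [min_le_left (ε / 2) (1 / 2 : ℝ)]
  · simp only [Set.mem_compl_iff, Set.mem_singleton_iff]
    exact_mod_cast h2.ne
  · rw [h0, mul_zero]

theorem euler_factor_ne_zero {N : ℕ} (χ : DirichletCharacter ℂ N) {p : ℕ} (hp : p.Prime) {β : ℝ}
    (hβ : 0 < β) : 1 - χ p * (p : ℂ) ^ (-(β : ℂ)) ≠ 0 := by
  intro h
  have h1 : χ p * (p : ℂ) ^ (-(β : ℂ)) = 1 := (sub_eq_zero.1 h).symm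
  have h2 := congrArg norm h1
  rw [norm_mul, norm_one, Complex.norm_natCast_cpow_of_pos hp.pos] at h2
  have h3 : (p : ℝ) ^ ((-(β : ℂ)).re) < 1 :=
    Real.rpow_lt_one_of_one_lt_of_neg (by exact_mod_cast hp.one_lt) (by simpa using hβ)
  have h4 := χ.norm_le_one (p : ZMod N)
  have h5 : 0 ≤ (p : ℝ) ^ ((-(β : ℂ)).re) := by positivity
  nlinarith [norm_nonneg (χ p)]

theorem LFunction_product_ne_zero {D N : ℕ} [NeZero D] [NeZero N] (hD : D ∣ N)
    {χ : DirichletCharacter ℂ D} (hχ : χ ≠ 1) {β : ℝ} (h0 : 0 < β) (h1 : β < 1)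
    (hz : riemannZeta β ≠ 0) (hL : χ.LFunction β ≠ 0) :
    DirichletCharacter.LFunctionTrivChar₁ N β *
      (DirichletCharacter.changeLevel hD χ).LFunction β ≠ 0 := by
  have hne : (β : ℂ) ≠ 1 := by exact_mod_cast h1.ne
  refine mul_ne_zero ?_ ?_
  · rw [DirichletCharacter.LFunctionTrivChar₁, Function.update_of_ne hne,
      DirichletCharacter.LFunctionTrivChar_eq_mul_riemannZeta hne]
    refine mul_ne_zero (sub_ne_zero.2 hne) (mul_ne_zero (Finset.prod_ne_zero_iff.2 ?_) hz)
    intro p hp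
    have := euler_factor_ne_zero (1 : DirichletCharacter ℂ 1) (Nat.prime_of_mem_primeFactors hp) h0
    rwa [MulChar.one_apply (isUnit_of_subsingleton _), one_mul] at this
  · rw [DirichletCharacter.LFunction_changeLevel hD χ (Or.inl hχ)]
    exact mul_ne_zero hL (Finset.prod_ne_zero_iff.2 fun p hp =>
      euler_factor_ne_zero χ (Nat.prime_of_mem_primeFactors hp) h0)

namespace Sys

variable {P G : Type} [AddCommGroup G] [Fintype G]

theorem dvd_lvl (S : Sys P G) {D : ℕ} (hp : D.Prime) {χ : DirichletCharacter ℂ D}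
    (hS : S.Splits χ) {L : ℝ} (hL : Real.log D ≤ L) : D ∣ S.lvl L := by
  rw [S.prime_dvd_lvl hp]
  obtain ⟨s, hs, h⟩ := hS D hp
  have h0 : χ (D : ZMod D) = 0 := by
    refine MulChar.map_nonunit _ ?_
    rw [ZMod.isUnit_iff_coprime, Nat.coprime_self]
    exact hp.one_lt.ne'
  have h' : s.card = 1 ∧ ∀ p ∈ s, S.N p = D := by
    rcases h with ⟨h, -⟩ | ⟨h, -⟩ | ⟨-, h⟩
    · rw [h0] at h; norm_num at h
    · rw [h0] at h; norm_num at h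
    · exact h
  obtain ⟨p, rfl⟩ := Finset.card_eq_one.1 h'.1
  have hp' : p ∈ ({p} : Finset P) := Finset.mem_singleton_self p
  refine ⟨p, ?_, (hs p).1 hp'⟩
  rw [mem_lev, h'.2 p hp']
  have hD : (0 : ℝ) < D := by exact_mod_cast hp.pos
  exact (Real.log_le_iff_le_exp hD).1 hL

/-- Number of rough elements of norm at most `t`, over all classes. -/
noncomputable def T (S : Sys P G) (L t : ℝ) : ℝ := ∑ k ∈ Finset.Icc 1 ⌊t⌋₊, ∑ g, S.bb L g k

theorem T_eq (S : Sys P G) (L : ℝ) {t : ℝ} (ht : 0 ≤ t) : S.T L t = ∑ g, S.R L g t := by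
  rw [T, Finset.sum_comm]
  refine Finset.sum_congr rfl fun g _ => ?_
  rw [S.R_eq L g ht]
  refine Finset.sum_subset (Finset.Icc_subset_Icc_left zero_le_one) fun k hk hk' => ?_
  have : k = 0 := by
    simp only [Finset.mem_Icc, not_and, not_le] at hk hk'
    by_contra h
    have := hk' (by omega)
    omega
  rw [this, bb_zero]

theorem T_mono (S : Sys P G) (L : ℝ) {t u : ℝ} (h : t ≤ u) : S.T L t ≤ S.T L u :=
  Finset.sum_le_sum_of_subset_of_nonneg
    (Finset.Icc_subset_Icc_right (Nat.floor_le_floor h))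
    fun k _ _ => Finset.sum_nonneg fun g _ => S.bb_nonneg L g k

theorem one_le_T (S : Sys P G) (L : ℝ) {t : ℝ} (h : 1 ≤ t) : 1 ≤ S.T L t := by
  have h1 : S.T L 1 = 1 := by
    rw [T]
    simp only [Nat.floor_one, Finset.Icc_self, Finset.sum_singleton, bb_one]
    classical
    convert Finset.sum_ite_eq' Finset.univ (0 : G) (fun _ => (1 : ℝ)) using 2
    simp
  rw [← h1]
  exact S.T_mono L h

theorem abs_T_sub_le (S : Sys P G) {L : ℝ} (hL : 300000 ≤ L) (hq : 128 * Real.log S.Q ≤ L) {t : ℝ}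
    (ht : Real.exp L ≤ t) :
    |S.T L t - Fintype.card G * S.rho L * t| ≤ CF * (Fintype.card G * S.rho L) * t ^ (1 - 2 / L) := by
  have hL0 : 0 < L := by linarith
  have ht0 : 0 < t := (Real.exp_pos L).trans_le ht
  have hlog : L ≤ Real.log t := (Real.le_log_iff_exp_le ht0).2 ht
  have hu : 1 ≤ Real.log t / L := (one_le_div hL0).2 hlog
  have he : Real.exp (Real.log t / L * L) = t := by
    rw [div_mul_cancel₀ _ hL0.ne', Real.exp_log ht0]
  have hpow : Real.exp (-2 * (Real.log t / L)) * t = t ^ (1 - 2 / L) := by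
    rw [Real.rpow_def_of_pos ht0]
    nth_rewrite 2 [← Real.exp_log ht0]
    rw [← Real.exp_add]
    congr 1
    field_simp
    ring
  rw [S.T_eq L ht0.le]
  have : ∑ g, S.R L g t - Fintype.card G * S.rho L * t = ∑ g : G, (S.R L g t - S.rho L * t) := by
    rw [Finset.sum_sub_distrib, Finset.sum_const, Finset.card_univ, nsmul_eq_mul, mul_assoc]
  rw [this]
  refine (Finset.abs_sum_le_sum_abs _ _).trans ?_
  calc _ ≤ ∑ _g : G, CF * Real.exp (-2 * (Real.log t / L)) * (S.rho L * t) := by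
        refine Finset.sum_le_sum fun g _ => ?_
        have := S.fund hL hq hu g
        rwa [he] at this
    _ = _ := by
        rw [Finset.sum_const, Finset.card_univ, nsmul_eq_mul, ← hpow]; ring

theorem A_lower : ∃ c : ℝ, 0 < c ∧ ∃ L₀ : ℝ, 300000 ≤ L₀ ∧
    ∀ (P G : Type) [AddCommGroup G] [Fintype G] (S : Sys P G) (D : ℕ) [NeZero D] (χ : DirichletCharacter ℂ D)
      (L : ℝ), D.Prime → χ ≠ 1 → S.Splits χ → L₀ ≤ L → 128 * Real.log S.Q ≤ L → Real.log D ≤ L →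
      (∀ β : ℝ, 1 - 1 / L ≤ β → β < 1 → χ.LFunction β ≠ 0) → c ≤ S.A L := by
  obtain ⟨δ, hδ, hδ1, hz⟩ := exists_riemannZeta_ne_zero
  have hCF := CF_pos
  set K : ℝ := Real.exp 2 + 1 + 2 * CF with hK
  have hK0 : 0 < K := by positivity
  refine ⟨1 / (2 * (1 + K)), by positivity, max 300000 (1 / δ), le_max_left _ _, ?_⟩
  intro P G _ _ S D _ χ L hDp hχ hS hL hq hLD hLF
  have hL3 : (300000 : ℝ) ≤ L := (le_max_left _ _).trans hL
  have hL0 : 0 < L := by linarith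
  have hLδ : 1 / L ≤ δ := by
    have := (le_max_right (300000 : ℝ) (1 / δ)).trans hL
    rw [div_le_iff₀ hδ] at this
    rw [div_le_iff₀ hL0]; linarith
  have : NeZero (S.lvl L) := ⟨(S.lvl_pos L).ne'⟩
  have hdvd := S.dvd_lvl hDp hS hLD
  set κ : ℝ := Fintype.card G * S.rho L with hκ
  have hG : (0 : ℝ) < Fintype.card G := by exact_mod_cast Fintype.card_pos
  have hκ0 : 0 < κ := mul_pos hG (S.rho_pos L)
  have hL1 : 1 / L ≤ 1 / 300000 := one_div_le_one_div_of_le (by norm_num) hL3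
  have hL2 : 2 / L = 2 * (1 / L) := by ring
  have hiL : 0 < 1 / L := by positivity
  set β₀ : ℝ := 1 - 1 / L with hβ₀
  have hbig : ∀ t, Real.exp L ≤ t → |S.T L t - κ * t| ≤ CF * κ * t ^ (1 - 2 / L) := fun t ht =>
    S.abs_T_sub_le hL3 hq ht
  have hE : ∀ t, 1 ≤ t → |S.T L t - κ * t| ≤
      (CF * κ + S.T L (Real.exp L) + κ * Real.exp L) * t ^ (1 - 2 / L) := by
    intro t ht
    have hpow : 1 ≤ t ^ (1 - 2 / L) := Real.one_le_rpow ht (by linarith)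
    have hT0 : 0 ≤ S.T L (Real.exp L) :=
      zero_le_one.trans (S.one_le_T L (Real.one_le_exp hL0.le))
    have hx : 0 ≤ κ * Real.exp L := by positivity
    rcases le_total (Real.exp L) t with h | h
    · refine (hbig t h).trans (mul_le_mul_of_nonneg_right ?_ (by linarith))
      linarith
    · have h1 := S.T_mono L h
      have h2 := S.one_le_T L ht
      have h3 : κ * t ≤ κ * Real.exp L := mul_le_mul_of_nonneg_left h hκ0.le
      have h4 : 0 ≤ κ * t := by positivity
      have h5 : 0 ≤ CF * κ := by positivity
      calc |S.T L t - κ * t| ≤ CF * κ + S.T L (Real.exp L) + κ * Real.exp L := by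
            rw [abs_le]; constructor <;> linarith
        _ ≤ _ := le_mul_of_one_le_right (by linarith) hpow
  have hF : Differentiable ℂ fun s => DirichletCharacter.LFunctionTrivChar₁ (S.lvl L) s *
      (DirichletCharacter.changeLevel hdvd χ).LFunction s := by
    refine (DirichletCharacter.differentiable_LFunctionTrivChar₁ _).mul
      (DirichletCharacter.differentiable_LFunction ?_)
    rwa [Ne, DirichletCharacter.changeLevel_eq_one_iff]
  have hbC : (fun n => ((∑ g, S.bb L g n : ℝ) : ℂ)) = S.bC L 0 := by
    funext n
    rw [bC, Complex.ofReal_sum]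
    simp
  have hcore := hecke_core (b := fun n => ∑ g, S.bb L g n) (κ := κ) (θ := 1 - 2 / L) (β₀ := β₀)
    (fun n => Finset.sum_nonneg fun g _ => S.bb_nonneg L g n) hκ0 (by linarith) (by linarith)
    (by linarith) hE hF ?_ ?_
  · set E : ℝ → ℝ := fun t => S.T L t - κ * t with hEdef
    have hlow : ∀ t, 1 < t → t⁻¹ - κ * K * t ^ (1 - 2 / L) ≤ E t := by
      intro t ht
      have ht0 : 0 < t := by linarith
      have hinv : t⁻¹ ≤ 1 := inv_le_one_of_one_le₀ ht.le
      have hp0 : 0 < t ^ (1 - 2 / L) := by positivity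
      have hT1 := S.one_le_T L ht.le
      rcases le_total (Real.exp L) t with h | h
      · have h1 := hbig t h
        have h2 := (abs_le.1 h1)
        have hp1 : t ^ (1 - 2 / L) ≤ t := by
          calc t ^ (1 - 2 / L) ≤ t ^ (1 : ℝ) :=
                Real.rpow_le_rpow_of_exponent_le ht.le (by linarith)
            _ = t := Real.rpow_one t
        have hp2 : 1 ≤ t ^ (1 - 2 / L) := Real.one_le_rpow ht.le (by linarith)
        have h3 : 1 ≤ (1 + CF) * κ * t := by
          have : CF * κ * t ^ (1 - 2 / L) ≤ CF * κ * t := mul_le_mul_of_nonneg_left hp1 (by positivity)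
          linarith [h2.2]
        have h4 : t⁻¹ ≤ (1 + CF) * κ * t ^ (1 - 2 / L) := by
          have h7 : t⁻¹ ≤ (1 + CF) * κ := by
            rw [inv_le_iff_one_le_mul₀ ht0]; exact h3
          exact h7.trans (le_mul_of_one_le_right (by positivity) hp2)
        have h5 : 0 ≤ κ * Real.exp 2 * t ^ (1 - 2 / L) := by positivity
        have h6 := h2.1
        simp only [hEdef, hK]
        nlinarith
      · have h1 : κ * t ≤ κ * Real.exp 2 * t ^ (1 - 2 / L) := by
          rw [mul_assoc κ]
          refine mul_le_mul_of_nonneg_left ?_ hκ0.le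
          have hl : Real.log t ≤ L := (Real.log_le_iff_le_exp ht0).2 h
          rw [Real.rpow_def_of_pos ht0, ← Real.exp_add]
          nth_rewrite 1 [← Real.exp_log ht0]
          refine Real.exp_le_exp.2 ?_
          have : Real.log t * (1 / L) ≤ 1 := by
            rw [mul_one_div]; exact (div_le_one hL0).2 hl
          rw [hL2]; nlinarith
        have h2 : 0 ≤ κ * (1 + 2 * CF) * t ^ (1 - 2 / L) := by positivity
        simp only [hEdef, hK]
        nlinarith
    have hcongr : Set.EqOn (fun t : ℝ => (t⁻¹ - κ * K * t ^ (1 - 2 / L)) * t ^ (-(β₀ + 1)))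
        (fun t : ℝ => t ^ (-(β₀ + 2)) - κ * K * t ^ (-(1 + 1 / L))) (Set.Ioi 1) := by
      intro t ht
      have ht0 : (0 : ℝ) < t := lt_trans one_pos ht
      simp only
      rw [sub_mul, mul_assoc (κ * K), ← Real.rpow_add ht0, ← Real.rpow_neg_one, ← Real.rpow_add ht0]
      congr 3
      · ring
      · rw [hβ₀]; ring
    have hi1 : IntegrableOn (fun t : ℝ => t ^ (-(β₀ + 2))) (Set.Ioi 1) :=
      integrableOn_Ioi_rpow_of_lt (by linarith) one_pos
    have hi2 : IntegrableOn (fun t : ℝ => κ * K * t ^ (-(1 + 1 / L))) (Set.Ioi 1) :=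
      (integrableOn_Ioi_rpow_of_lt (by linarith) one_pos).const_mul _
    have hint1 : ∫ t in Set.Ioi (1 : ℝ), (t⁻¹ - κ * K * t ^ (1 - 2 / L)) * t ^ (-(β₀ + 1)) =
        1 / (β₀ + 1) - κ * K * L := by
      rw [setIntegral_congr_fun measurableSet_Ioi hcongr, integral_sub hi1 hi2, integral_const_mul,
        integral_Ioi_rpow_of_lt (by linarith) one_pos, integral_Ioi_rpow_of_lt (by linarith) one_pos,
        Real.one_rpow, Real.one_rpow]
      have e1 : -(β₀ + 2) + 1 = -(β₀ + 1) := by ring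
      have e2 : -(1 + 1 / L) + 1 = -(1 / L) := by ring
      rw [e1, e2, neg_div_neg_eq, neg_div_neg_eq, one_div_one_div]
    have hint2 : ∫ t in Set.Ioi (1 : ℝ), (t⁻¹ - κ * K * t ^ (1 - 2 / L)) * t ^ (-(β₀ + 1)) ≤
        ∫ t in Set.Ioi (1 : ℝ), E t * t ^ (-(β₀ + 1)) := by
      refine setIntegral_mono_on ?_ ?_ measurableSet_Ioi fun t ht => ?_
      · exact (integrableOn_congr_fun hcongr measurableSet_Ioi).2 (hi1.sub hi2)
      · have hEm : Measurable E := by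
          refine Measurable.sub ?_ (by fun_prop)
          exact (measurable_from_nat (f := fun n => ∑ k ∈ Finset.Icc 1 n, ∑ g, S.bb L g k)).comp
            Nat.measurable_floor
        have h := (integrableOn_tail hEm hE (s := (β₀ : ℂ))
          (by rw [Complex.ofReal_re]; linarith)).re
        refine (integrableOn_congr_fun (fun t ht => ?_) measurableSet_Ioi).1 h
        have ht0 : (0 : ℝ) ≤ t := (lt_trans one_pos ht).le
        have e : (E t : ℂ) * (t : ℂ) ^ (-((β₀ : ℂ) + 1)) = ((E t * t ^ (-(β₀ + 1)) : ℝ) : ℂ) := by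
          rw [Complex.ofReal_mul, Complex.ofReal_cpow ht0]
          push_cast
          rfl
        simp only [e]
        rfl
      · exact mul_le_mul_of_nonneg_right (hlow t ht)
          (Real.rpow_nonneg (lt_trans one_pos ht).le _)
    rw [hint1] at hint2
    have hA : S.A L = κ * L := rfl
    rw [hA]
    have hm : 1 / 2 - κ * K * L ≤ ∫ t in Set.Ioi (1 : ℝ), E t * t ^ (-(β₀ + 1)) := by
      refine le_trans ?_ hint2
      have : 1 / 2 ≤ 1 / (β₀ + 1) := one_div_le_one_div_of_le (by linarith) (by linarith)
      linarith
    set I := ∫ t in Set.Ioi (1 : ℝ), E t * t ^ (-(β₀ + 1)) with hI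
    have hcore' : 0 ≤ κ + (β₀ - 1) * I := hcore
    have hI1 : I ≤ κ * L := by
      have e : κ + (β₀ - 1) * I = (κ * L - I) / L := by
        rw [hβ₀]; field_simp; ring
      rw [e] at hcore'
      have := (div_nonneg_iff.1 hcore')
      rcases this with h | h
      · linarith [h.1]
      · linarith [h.2]
    rw [div_le_iff₀ (by positivity)]
    nlinarith
  · intro s hs
    rw [hbC]
    have h := S.LSeries_bC_eq hS hdvd hs
    have hs1 : s ≠ 1 := by rintro rfl; simp at hs
    rw [h.2, DirichletCharacter.LFunctionTrivChar₁, Function.update_of_ne hs1, mul_assoc]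
  · intro β h1 h2
    exact LFunction_product_ne_zero hdvd hχ (by linarith) h2 (hz β (by linarith) h2) (hLF β h1 h2)

end Sys

end

/-- Coordinates on a ring `ℤ[ω]` with `ω² = ω - m`. -/
structure Quad (O : Type) [CommRing O] (m : ℤ) where
  /-- the generator -/
  ω : O
  sq : ω * ω = ω - m
  /-- first coordinate -/
  u : O → ℤ
  /-- second coordinate -/
  v : O → ℤ
  rep : ∀ x, x = u x + v x * ω
  uniq : ∀ a b : ℤ, (a : O) + b * ω = 0 → a = 0 ∧ b = 0

namespace Quad

variable {O : Type} [CommRing O] {m : ℤ}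

theorem eq_of (q : Quad O m) {a b c d : ℤ} (h : (a : O) + b * q.ω = c + d * q.ω) :
    a = c ∧ b = d := by
  have := q.uniq (a - c) (b - d) (by push_cast; linear_combination h)
  omega

theorem uv_mk (q : Quad O m) (a b : ℤ) : q.u (a + b * q.ω) = a ∧ q.v (a + b * q.ω) = b :=
  q.eq_of (q.rep _).symm

theorem uv_of (q : Quad O m) {x : O} {a b : ℤ} (h : x = a + b * q.ω) : q.u x = a ∧ q.v x = b := by
  rw [h]; exact q.uv_mk a b

theorem uv_add (q : Quad O m) (x y : O) :
    q.u (x + y) = q.u x + q.u y ∧ q.v (x + y) = q.v x + q.v y := by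
  apply q.uv_of
  nth_rewrite 1 [q.rep x, q.rep y]
  push_cast; ring

theorem uv_mul (q : Quad O m) (x y : O) :
    q.u (x * y) = q.u x * q.u y - m * (q.v x * q.v y) ∧
    q.v (x * y) = q.u x * q.v y + q.v x * q.u y + q.v x * q.v y := by
  apply q.uv_of
  nth_rewrite 1 [q.rep x, q.rep y]
  push_cast
  linear_combination (q.v x : O) * q.v y * q.sq

theorem uv_int (q : Quad O m) (a : ℤ) : q.u (a : O) = a ∧ q.v (a : O) = 0 := by
  apply q.uv_of; simp

/-- Conjugation as a function. -/
def cj (q : Quad O m) (x : O) : O := q.u x + q.v x - q.v x * q.ω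

theorem uv_cj (q : Quad O m) (x : O) : q.u (q.cj x) = q.u x + q.v x ∧ q.v (q.cj x) = -q.v x := by
  apply q.uv_of
  rw [cj]; push_cast; ring

theorem cj_cj (q : Quad O m) (x : O) : q.cj (q.cj x) = x := by
  rw [cj, (q.uv_cj x).1, (q.uv_cj x).2]
  nth_rewrite 5 [q.rep x]
  push_cast; ring

theorem cj_add (q : Quad O m) (x y : O) : q.cj (x + y) = q.cj x + q.cj y := by
  rw [cj, cj, cj, (q.uv_add x y).1, (q.uv_add x y).2]
  push_cast; ring

theorem cj_mul (q : Quad O m) (x y : O) : q.cj (x * y) = q.cj x * q.cj y := by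
  rw [cj, cj, cj, (q.uv_mul x y).1, (q.uv_mul x y).2]
  push_cast
  linear_combination (-(q.v x : O) * q.v y) * q.sq

theorem cj_int (q : Quad O m) (a : ℤ) : q.cj (a : O) = a := by
  rw [cj, (q.uv_int a).1, (q.uv_int a).2]
  simp

/-- Conjugation as a ring automorphism. -/
def conj (q : Quad O m) : O ≃+* O where
  toFun := q.cj
  invFun := q.cj
  left_inv := q.cj_cj
  right_inv := q.cj_cj
  map_mul' := q.cj_mul
  map_add' := q.cj_add

/-- The norm form. -/
def nm (q : Quad O m) (x : O) : ℤ := q.u x ^ 2 + q.u x * q.v x + m * q.v x ^ 2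

theorem mul_cj (q : Quad O m) (x : O) : x * q.cj x = (q.nm x : O) := by
  rw [cj, nm]
  nth_rewrite 1 [q.rep x]
  push_cast
  linear_combination (-(q.v x : O) ^ 2) * q.sq

theorem int_inj (q : Quad O m) {a b : ℤ} (h : (a : O) = b) : a = b :=
  (q.eq_of (a := a) (b := 0) (c := b) (d := 0) (by rw [h])).1

theorem charZero (q : Quad O m) : CharZero O :=
  ⟨fun a b h => by
    have := q.int_inj (a := a) (b := b) (by simpa using h)
    exact_mod_cast this⟩

theorem nm_mul (q : Quad O m) (x y : O) : q.nm (x * y) = q.nm x * q.nm y := by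
  apply q.int_inj
  rw [← mul_cj, cj_mul]
  push_cast
  rw [← mul_cj, ← mul_cj]; ring

theorem nm_int (q : Quad O m) (a : ℤ) : q.nm (a : O) = a ^ 2 := by
  rw [nm, (q.uv_int a).1, (q.uv_int a).2]; ring

theorem four_nm (q : Quad O m) (x : O) :
    4 * q.nm x = (2 * q.u x + q.v x) ^ 2 + (4 * m - 1) * q.v x ^ 2 := by
  rw [nm]; ring

theorem nm_nonneg (q : Quad O m) (hm : 0 < m) (x : O) : 0 ≤ q.nm x := by
  have := q.four_nm x
  nlinarith [sq_nonneg (2 * q.u x + q.v x), sq_nonneg (q.v x)]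

theorem nm_eq_zero (q : Quad O m) (hm : 0 < m) {x : O} : q.nm x = 0 ↔ x = 0 := by
  constructor
  · intro h
    have h4 := q.four_nm x
    rw [h] at h4
    have hv : q.v x ^ 2 = 0 := by nlinarith [sq_nonneg (2 * q.u x + q.v x), sq_nonneg (q.v x)]
    have hv' : q.v x = 0 := by simpa using hv
    rw [hv'] at h4
    have hu' : q.u x = 0 := by
      have : q.u x ^ 2 = 0 := by linarith
      simpa using this
    rw [q.rep x, hu', hv']; simp
  · rintro rfl
    have := q.nm_int 0
    simpa using this

/-- The integral basis `1, ω`. -/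
noncomputable def basis (q : Quad O m) : Module.Basis (Fin 2) ℤ O :=
  Module.Basis.ofEquivFun
    { toFun := fun x => ![q.u x, q.v x]
      map_add' := fun x y => by
        rw [(q.uv_add x y).1, (q.uv_add x y).2]; simp
      map_smul' := fun a x => by
        rw [zsmul_eq_mul, (q.uv_mul _ x).1, (q.uv_mul _ x).2, (q.uv_int a).1, (q.uv_int a).2]
        simp
      invFun := fun c => c 0 + c 1 * q.ω
      left_inv := fun x => by simp [← q.rep x]
      right_inv := fun c => by
        beta_reduce
        rw [(q.uv_mk _ _).1, (q.uv_mk _ _).2]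
        ext i; fin_cases i <;> rfl }

theorem basis_repr (q : Quad O m) (x : O) : ⇑(q.basis.repr x) = ![q.u x, q.v x] := by
  rw [← Module.Basis.equivFun_apply, basis, Module.Basis.equivFun_ofEquivFun]
  rfl

theorem basis_zero (q : Quad O m) : q.basis 0 = 1 := by
  have h := q.basis_repr (q.basis 0)
  rw [Module.Basis.repr_self] at h
  have h0 := congrFun h 0
  have h1 := congrFun h 1
  simp at h0 h1
  rw [q.rep (q.basis 0), ← h0, ← h1]
  simp

theorem basis_one (q : Quad O m) : q.basis 1 = q.ω := by
  have h := q.basis_repr (q.basis 1)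
  rw [Module.Basis.repr_self] at h
  have h0 := congrFun h 0
  have h1 := congrFun h 1
  simp at h0 h1
  rw [q.rep (q.basis 1), ← h0, ← h1]
  simp

theorem leftMul (q : Quad O m) (x : O) : Algebra.leftMulMatrix q.basis x =
    !![q.u x, -m * q.v x; q.v x, q.u x + q.v x] := by
  have h1 : q.u 1 = 1 ∧ q.v 1 = 0 := q.uv_of (by simp)
  have hω : q.u q.ω = 0 ∧ q.v q.ω = 1 := q.uv_of (by simp)
  ext i j
  rw [Algebra.leftMulMatrix_eq_repr_mul, basis_repr]
  fin_cases i <;> fin_cases j <;>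
    simp [basis_zero, basis_one, (q.uv_mul x q.ω).1, (q.uv_mul x q.ω).2, hω]

theorem norm_eq (q : Quad O m) (x : O) : Algebra.norm ℤ x = q.nm x := by
  rw [Algebra.norm_eq_matrix_det q.basis, leftMul, Matrix.det_fin_two_of, nm]; ring

theorem trace_eq (q : Quad O m) (x : O) : Algebra.trace ℤ O x = 2 * q.u x + q.v x := by
  rw [Algebra.trace_eq_matrix_trace q.basis, leftMul, Matrix.trace_fin_two_of]; ring

theorem discr_eq (q : Quad O m) : Algebra.discr ℤ q.basis = 1 - 4 * m := by
  have hω : q.u q.ω = 0 ∧ q.v q.ω = 1 := q.uv_of (by simp)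
  have h1 : q.u 1 = 1 ∧ q.v 1 = 0 := q.uv_of (by simp)
  have h2 := q.uv_mul q.ω q.ω
  rw [Algebra.discr_def, Matrix.det_fin_two]
  simp only [Algebra.traceMatrix_apply, Algebra.traceForm_apply, basis_zero, basis_one,
    mul_one, one_mul]
  rw [q.trace_eq, q.trace_eq, q.trace_eq, h2.1, h2.2, h1.1, h1.2, hω.1, hω.2]
  ring

end Quad

namespace Quad

variable {O : Type} [CommRing O] {m : ℤ}

theorem exists_int_gen (V : Ideal ℤ) (hV : ∃ x ∈ V, x ≠ 0) : ∃ f : ℤ, 0 < f ∧ ∀ x, x ∈ V ↔ f ∣ x := by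
  obtain ⟨f, hf⟩ := (IsPrincipalIdealRing.principal V).principal
  have h : ∀ x, x ∈ V ↔ f ∣ x := fun x => by
    rw [hf]; exact Ideal.mem_span_singleton
  refine ⟨|f|, ?_, fun x => by rw [h, abs_dvd]⟩
  obtain ⟨x, hx, hx0⟩ := hV
  rw [abs_pos]
  rintro rfl
  exact hx0 (zero_dvd_iff.1 ((h x).1 hx))

/-- Every nonzero ideal is `f(gℤ + (b+ω)ℤ)`. -/
theorem ideal_form (q : Quad O m) (hm : 0 < m) (J : Ideal O) (hJ : J ≠ ⊥) :
    ∃ f g b : ℤ, 0 < f ∧ 0 < g ∧ g ∣ b ^ 2 + b + m ∧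
      ∀ x, x ∈ J ↔ ∃ s t : ℤ, q.u x = f * (g * s + b * t) ∧ q.v x = f * t := by
  have hω : q.u q.ω = 0 ∧ q.v q.ω = 1 := q.uv_of (by simp)
  obtain ⟨y, hy, hy0⟩ := Submodule.exists_mem_ne_zero_of_ne_bot hJ
  have hn0 : ((q.nm y : ℤ) : O) ∈ J := by rw [← q.mul_cj]; exact J.mul_mem_right _ hy
  have hny : q.nm y ≠ 0 := fun h => hy0 ((q.nm_eq_zero hm).1 h)
  let V : Ideal ℤ :=
    { carrier := {t | ∃ x ∈ J, q.v x = t}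
      add_mem' := by
        rintro _ _ ⟨x, hx, rfl⟩ ⟨y, hy, rfl⟩
        exact ⟨x + y, J.add_mem hx hy, (q.uv_add x y).2⟩
      zero_mem' := ⟨0, J.zero_mem, by simpa using (q.uv_int 0).2⟩
      smul_mem' := by
        rintro a _ ⟨x, hx, rfl⟩
        refine ⟨a * x, J.mul_mem_left _ hx, ?_⟩
        rw [(q.uv_mul _ _).2, (q.uv_int a).1, (q.uv_int a).2]; simp }
  have hVmem : ∀ t, t ∈ V ↔ ∃ x ∈ J, q.v x = t := fun t => Iff.rfl
  have hvω : ∀ x ∈ J, q.u x + q.v x ∈ V := by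
    intro x hx
    refine ⟨x * q.ω, J.mul_mem_right _ hx, ?_⟩
    rw [(q.uv_mul _ _).2, hω.1, hω.2]; ring
  obtain ⟨f, hf0, hf⟩ := exists_int_gen V ⟨q.nm y, by
    have := hvω _ hn0
    rwa [(q.uv_int _).1, (q.uv_int _).2, add_zero] at this, hny⟩
  obtain ⟨n, hn, hnA⟩ := exists_int_gen (J.comap (Int.castRingHom O)) ⟨q.nm y, hn0, hny⟩
  obtain ⟨x0, hx0, hx0v⟩ := (hVmem f).1 ((hf f).2 dvd_rfl)
  obtain ⟨b, hb⟩ : f ∣ q.u x0 := by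
    have := (hf _).1 (hvω x0 hx0)
    rw [hx0v] at this
    exact (dvd_add_left dvd_rfl).1 this
  have hnJ : ((n : ℤ) : O) ∈ J := (hnA n).2 dvd_rfl
  obtain ⟨g, hg⟩ : f ∣ n := by
    have := (hf _).1 (hvω _ hnJ)
    rwa [(q.uv_int _).1, (q.uv_int _).2, add_zero] at this
  have hg0 : 0 < g := by
    by_contra h
    nlinarith
  have hmem : ∀ x, x ∈ J ↔ ∃ s t : ℤ, q.u x = f * (g * s + b * t) ∧ q.v x = f * t := by
    intro x
    constructor
    · intro hx
      obtain ⟨t, ht⟩ := (hf _).1 ((hVmem _).2 ⟨x, hx, rfl⟩)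
      have h1 : ((q.u x - t * (f * b) : ℤ) : O) ∈ J := by
        have h2 : x - t * x0 ∈ J := J.sub_mem hx (J.mul_mem_left _ hx0)
        convert h2 using 1
        have r := q.rep x
        have r0 := q.rep x0
        rw [ht] at r
        rw [hx0v, hb] at r0
        push_cast at r r0 ⊢
        linear_combination -r + t * r0
      obtain ⟨s, hs⟩ := (hnA _).1 h1
      refine ⟨s, t, ?_, ht⟩
      rw [hg] at hs
      linear_combination hs
    · rintro ⟨s, t, h1, h2⟩
      have h3 : (n : O) * s + t * x0 ∈ J :=
        J.add_mem (J.mul_mem_right _ hnJ) (J.mul_mem_left _ hx0)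
      convert h3 using 1
      have r := q.rep x
      have r0 := q.rep x0
      rw [h1, h2] at r
      rw [hx0v, hb] at r0
      rw [hg]
      push_cast at r r0 ⊢
      linear_combination r - t * r0
  refine ⟨f, g, b, hf0, hg0, ?_, hmem⟩
  obtain ⟨s, t, h1, h2⟩ := (hmem _).1 (J.mul_mem_right q.ω hx0)
  rw [(q.uv_mul _ _).1, hω.1, hω.2, hb, hx0v] at h1
  rw [(q.uv_mul _ _).2, hω.1, hω.2, hb, hx0v] at h2
  have ht : t = b + 1 := by
    refine mul_left_cancel₀ hf0.ne' ?_
    linear_combination -h2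
  refine ⟨-s, ?_⟩
  refine mul_left_cancel₀ hf0.ne' ?_
  rw [ht] at h1
  linear_combination -h1

theorem absNorm_form (q : Quad O m) [IsDedekindDomain O] [Module.Free ℤ O] [Module.Finite ℤ O]
    {J : Ideal O} {f g b : ℤ}
    (hf : 0 < f) (hg : 0 < g)
    (h : ∀ x, x ∈ J ↔ ∃ s t : ℤ, q.u x = f * (g * s + b * t) ∧ q.v x = f * t) :
    (Ideal.absNorm J : ℤ) = f ^ 2 * g := by
  choose s t hu hv using fun x : J => (h x).1 x.2
  have hadd : ∀ x y : J, s (x + y) = s x + s y ∧ t (x + y) = t x + t y := by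
    intro x y
    have h1 := hv (x + y)
    have h2 := hu (x + y)
    rw [J.coe_add, (q.uv_add _ _).2, hv, hv] at h1
    rw [J.coe_add, (q.uv_add _ _).1, hu, hu] at h2
    have ht : t (x + y) = t x + t y := mul_left_cancel₀ hf.ne' (by linear_combination -h1)
    refine ⟨mul_left_cancel₀ hg.ne' (mul_left_cancel₀ hf.ne' ?_), ht⟩
    rw [ht] at h2
    linear_combination -h2
  have hmk : ∀ a c : ℤ, ((f * (g * a + b * c) : ℤ) : O) + ((f * c : ℤ) : O) * q.ω ∈ J := by
    intro a c
    rw [h]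
    exact ⟨a, c, (q.uv_mk _ _).1, (q.uv_mk _ _).2⟩
  have hst : ∀ (x : J) (a c : ℤ), q.u (x : O) = f * (g * a + b * c) → q.v (x : O) = f * c →
      s x = a ∧ t x = c := by
    intro x a c h1 h2
    rw [hv] at h2
    rw [hu] at h1
    have ht : t x = c := mul_left_cancel₀ hf.ne' h2
    rw [ht] at h1
    have h3 := mul_left_cancel₀ hf.ne' h1
    exact ⟨mul_left_cancel₀ hg.ne' (by linarith), ht⟩
  let e : J ≃+ (Fin 2 → ℤ) :=
    { toFun := fun x => ![s x, t x]
      map_add' := fun x y => by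
        rw [(hadd x y).1, (hadd x y).2]; simp
      invFun := fun c => ⟨_, hmk (c 0) (c 1)⟩
      left_inv := fun x => by
        apply Subtype.ext
        simp only [Matrix.cons_val_zero, Matrix.cons_val_one]
        rw [← hu, ← hv, ← q.rep]
      right_inv := fun c => by
        beta_reduce
        have := hst ⟨_, hmk (c 0) (c 1)⟩ (c 0) (c 1) (q.uv_mk _ _).1 (q.uv_mk _ _).2
        rw [this.1, this.2]
        ext i; fin_cases i <;> rfl }
  let bJ : Module.Basis (Fin 2) ℤ J := Module.Basis.ofEquivFun e.toIntLinearEquiv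
  have hb : ∀ i, s (bJ i) = (Pi.single i 1 : Fin 2 → ℤ) 0 ∧ t (bJ i) = (Pi.single i 1 : Fin 2 → ℤ) 1 := by
    intro i
    have h1 : e (bJ i) = Pi.single i 1 := by
      have := congrFun (Module.Basis.coe_ofEquivFun e.toIntLinearEquiv) i
      rw [show bJ i = e.toIntLinearEquiv.symm (Pi.single i 1) from this]
      exact e.apply_symm_apply _
    exact ⟨congrFun h1 0, congrFun h1 1⟩
  have hdet := Ideal.natAbs_det_basis_change q.basis J bJ
  have hcalc : q.basis.det ((↑) ∘ bJ) = f ^ 2 * g := by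
    rw [Module.Basis.det_apply, Matrix.det_fin_two]
    simp only [Module.Basis.toMatrix_apply, basis_repr, Function.comp_apply, Matrix.cons_val_zero,
      Matrix.cons_val_one]
    rw [hu, hu, hv, hv, (hb 0).1, (hb 0).2, (hb 1).1, (hb 1).2]
    simp
    ring
  rw [hcalc] at hdet
  rw [← hdet, Int.natAbs_of_nonneg (by positivity)]

end Quad

namespace Quad

variable {O : Type} [CommRing O] {m : ℤ}

/-- A nonzero conjugation-invariant ideal is principal. -/
theorem isPrincipal_of_invariant (q : Quad O m) (hm : 0 < m) (hp : Prime (4 * m - 1))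
    {J : Ideal O} (hJ : J ≠ ⊥) (hinv : ∀ x ∈ J, q.cj x ∈ J) : ∃ d, J = Ideal.span {d} := by
  obtain ⟨f, g, b, hf, hg, hgb, h⟩ := q.ideal_form hm J hJ
  have hg1 : g ∣ 2 * b + 1 := by
    have h1 : (f * b : ℤ) + (f : ℤ) * q.ω ∈ J := by
      refine (h _).2 ⟨0, 1, ?_, ?_⟩
      · rw [(q.uv_mk _ _).1]; ring
      · rw [(q.uv_mk _ _).2]; ring
    obtain ⟨s, t, h2, h3⟩ := (h _).1 (hinv _ h1)
    rw [(q.uv_cj _).1, (q.uv_mk _ _).1, (q.uv_mk _ _).2] at h2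
    rw [(q.uv_cj _).2, (q.uv_mk _ _).2] at h3
    have ht : t = -1 := mul_left_cancel₀ hf.ne' (by linear_combination -h3)
    rw [ht] at h2
    exact ⟨s, mul_left_cancel₀ hf.ne' (by linear_combination h2)⟩
  have hgD : g ∣ 4 * m - 1 := by
    have : 4 * m - 1 = 4 * (b ^ 2 + b + m) - (2 * b + 1) * (2 * b + 1) := by ring
    rw [this]
    exact dvd_sub (hgb.mul_left _) (hg1.mul_left _)
  have hcases : g = 1 ∨ g = 4 * m - 1 := by
    obtain ⟨r, hr⟩ := hgD
    have hr0 : 0 < r := by nlinarith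
    rcases (hp.irreducible.isUnit_or_isUnit hr) with h | h
    · left; rcases Int.isUnit_iff.1 h with h | h <;> omega
    · right
      rcases Int.isUnit_iff.1 h with h | h
      · rw [hr, h, mul_one]
      · omega
  rcases hcases with rfl | hgm
  · refine ⟨(f : O), ?_⟩
    ext x
    rw [h, Ideal.mem_span_singleton]
    constructor
    · rintro ⟨s, t, h1, h2⟩
      refine ⟨((1 * s + b * t : ℤ) : O) + (t : ℤ) * q.ω, ?_⟩
      nth_rewrite 1 [q.rep x]
      rw [h1, h2]; push_cast; ring
    · rintro ⟨y, rfl⟩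
      refine ⟨q.u y - b * q.v y, q.v y, ?_, ?_⟩
      · rw [(q.uv_mul _ _).1, (q.uv_int _).1, (q.uv_int _).2]; ring
      · rw [(q.uv_mul _ _).2, (q.uv_int _).1, (q.uv_int _).2]; ring
  · obtain ⟨k, hk⟩ : (4 * m - 1) ∣ b + 2 * m := by
      obtain ⟨r, hr⟩ := hg1
      rw [hgm] at hr
      refine ⟨2 * m * (r + 1) - (b + 2 * m), ?_⟩
      linear_combination (2 * m) * hr
    have hα := q.uv_mk (-1) 2
    refine ⟨f * (((-1 : ℤ) : O) + ((2 : ℤ) : O) * q.ω), ?_⟩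
    ext x
    rw [h, Ideal.mem_span_singleton]
    constructor
    · rintro ⟨s, t, h1, h2⟩
      refine ⟨((s + k * t : ℤ) : O) + ((t - 2 * (s + k * t) : ℤ) : O) * q.ω, ?_⟩
      nth_rewrite 1 [q.rep x]
      rw [h1, h2, hgm]
      have hk' : (b : O) + 2 * m = (4 * m - 1) * k := by exact_mod_cast congrArg (Int.cast (R := O)) hk
      push_cast
      linear_combination (-2 * (f : O) * (t - 2 * (s + k * t))) * q.sq + (f : O) * t * hk'
    · rintro ⟨y, rfl⟩
      refine ⟨q.u y - k * (2 * q.u y + q.v y), 2 * q.u y + q.v y, ?_, ?_⟩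
      · rw [mul_assoc, (q.uv_mul _ _).1, (q.uv_int _).1, (q.uv_int _).2, (q.uv_mul _ _).1, hα.1, hα.2, hgm]
        linear_combination (-f * (2 * q.u y + q.v y)) * hk
      · rw [mul_assoc, (q.uv_mul _ _).2, (q.uv_int _).1, (q.uv_int _).2, (q.uv_mul _ _).2, hα.1, hα.2]
        ring

variable [IsDedekindDomain O]

theorem isPrincipal_of_sq_eq (q : Quad O m) (hm : 0 < m) (hp : Prime (4 * m - 1))
    {J : Ideal O} (hJ : J ≠ ⊥) {k : ℤ} (hk : J ^ 2 = Ideal.span {(k : O)}) :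
    ∃ d, J = Ideal.span {d} := by
  refine q.isPrincipal_of_invariant hm hp hJ fun x hx => ?_
  have h1 : (J.map q.conj) ^ 2 = J ^ 2 := by
    rw [← Ideal.map_pow, hk, Ideal.map_span, Set.image_singleton]
    congr 2
    exact q.cj_int k
  have h2 : J.map q.conj = J := by
    apply le_antisymm
    · rw [← Ideal.dvd_iff_le, ← UniqueFactorizationMonoid.pow_dvd_pow_iff_dvd (two_ne_zero : (2 : ℕ) ≠ 0), h1]
    · rw [← Ideal.dvd_iff_le, ← UniqueFactorizationMonoid.pow_dvd_pow_iff_dvd (two_ne_zero : (2 : ℕ) ≠ 0), h1]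
  rw [← h2]
  exact Ideal.mem_map_of_mem q.conj hx

theorem class_eq_one_of_sq (q : Quad O m) [Module.Free ℤ O] [Module.Finite ℤ O] (hm : 0 < m)
    (hp : Prime (4 * m - 1)) (C : ClassGroup O) (hC : C ^ 2 = 1) : C = 1 := by
  have := q.charZero
  obtain ⟨⟨I, hI⟩, rfl⟩ := ClassGroup.mk0_surjective C
  have hI0 : I ≠ ⊥ := mem_nonZeroDivisors_iff_ne_zero.1 hI
  rw [← map_pow, ClassGroup.mk0_eq_one_iff] at hC
  obtain ⟨γ, hγ⟩ := hC.principal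
  have hγ' : I ^ 2 = Ideal.span {γ} := hγ
  set n : ℤ := ((Ideal.absNorm I : ℕ) : ℤ) with hn
  have hnγ : q.nm γ = n ^ 2 := by
    have h1 : Ideal.absNorm (I ^ 2) = Ideal.absNorm (Ideal.span {γ}) := by rw [hγ']
    rw [map_pow, Ideal.absNorm_span_singleton, q.norm_eq] at h1
    have h2 : ((q.nm γ).natAbs : ℤ) = q.nm γ := Int.natAbs_of_nonneg (q.nm_nonneg hm γ)
    rw [← h2, ← h1, hn]; push_cast; ring
  rw [ClassGroup.mk0_eq_one_iff]
  by_cases hδ : (n : O) + q.cj γ = 0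
  · have h1 : γ = -(n : O) := by
      have : q.cj γ = ((-n : ℤ) : O) := by push_cast; linear_combination hδ
      rw [← q.cj_cj γ, this, q.cj_int]; push_cast; rfl
    obtain ⟨d, hd⟩ := q.isPrincipal_of_sq_eq hm hp hI0 (k := -n) (by rw [hγ', h1]; push_cast; rfl)
    exact ⟨d, hd⟩
  · set δ := (n : O) + q.cj γ with hδdef
    have hJ0 : Ideal.span {δ} * I ≠ ⊥ := by
      rw [Ne, Ideal.mul_eq_bot, not_or, Ideal.span_singleton_eq_bot]
      exact ⟨hδ, hI0⟩
    have hk : (Ideal.span {δ} * I) ^ 2 = Ideal.span {((n * q.nm δ : ℤ) : O)} := by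
      rw [mul_pow, hγ', Ideal.span_singleton_pow, Ideal.span_singleton_mul_span_singleton]
      congr 2
      have h1 : q.cj δ = n + γ := by rw [hδdef, q.cj_add, q.cj_int, q.cj_cj]
      have h2 := q.mul_cj γ
      rw [hnγ] at h2
      push_cast at h2 ⊢
      rw [← q.mul_cj δ, h1, hδdef]
      linear_combination ((n : O) + q.cj γ) * h2
    obtain ⟨d, hd⟩ := q.isPrincipal_of_sq_eq hm hp hJ0 hk
    have h1 : ClassGroup.mk0 ⟨Ideal.span {δ} * I, mem_nonZeroDivisors_iff_ne_zero.2 hJ0⟩ = 1 :=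
      ClassGroup.mk0_eq_one_iff _ |>.2 ⟨d, hd⟩
    have h2 : ClassGroup.mk0 ⟨Ideal.span {δ}, mem_nonZeroDivisors_iff_ne_zero.2
        (by rwa [Ne, Ideal.zero_eq_bot, Ideal.span_singleton_eq_bot])⟩ = 1 :=
      ClassGroup.mk0_eq_one_iff _ |>.2 ⟨δ, rfl⟩
    have h3 := (ClassGroup.mk0 (R := O)).map_mul ⟨Ideal.span {δ}, mem_nonZeroDivisors_iff_ne_zero.2
        (by rwa [Ne, Ideal.zero_eq_bot, Ideal.span_singleton_eq_bot])⟩ ⟨I, hI⟩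
    rw [h2, one_mul] at h3
    rw [← ClassGroup.mk0_eq_one_iff hI, ← h3]
    exact h1

/-- The class group has odd order, so no nontrivial character is quadratic. -/
theorem addChar_add_self_ne_zero (q : Quad O m) [Module.Free ℤ O] [Module.Finite ℤ O]
    [Fintype (ClassGroup O)] (hm : 0 < m)
    (hp : Prime (4 * m - 1)) (ψ : AddChar (Additive (ClassGroup O)) ℂ) (hψ : ψ ≠ 0) :
    ψ + ψ ≠ 0 := by
  intro h
  apply hψ
  have hinj : Function.Injective (fun g : Additive (ClassGroup O) => g + g) := by
    intro a b hab
    have h1 : (a - b) + (a - b) = 0 := by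
      have : a + a = b + b := hab
      rw [sub_add_sub_comm, this, sub_self]
    have h2 : (Additive.toMul (a - b)) ^ 2 = 1 := by
      rw [pow_two]; exact h1
    exact sub_eq_zero.1 (q.class_eq_one_of_sq hm hp _ h2)
  have hsurj := Finite.surjective_of_injective hinj
  ext g
  obtain ⟨a, rfl⟩ := hsurj g
  simp only
  rw [AddChar.map_add_eq_mul]
  have := DFunLike.congr_fun h a
  simpa using this

end Quad

open Polynomial in
/-- Integers of an imaginary quadratic field have integral trace and norm. -/
theorem exists_trace_norm {K : Type} [Field K] [NumberField K] {D : ℕ} (hD : 0 < D) {α : K}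
    (hα : α ^ 2 = -(D : K)) {r s : ℚ} (hx : IsIntegral ℤ ((r : K) + s * α)) :
    ∃ a n : ℤ, 2 * r = a ∧ r ^ 2 + D * s ^ 2 = n := by
  by_cases hs : s = 0
  · rw [hs, Rat.cast_zero, zero_mul, add_zero] at hx
    have h1 : IsIntegral ℤ r := by
      have := (isIntegral_algebraMap_iff (R := ℤ) (A := ℚ) (B := K) (x := r)
        (algebraMap ℚ K).injective).1 (by simpa using hx)
      exact this
    obtain ⟨a, ha⟩ := IsIntegrallyClosed.isIntegral_iff.1 h1
    refine ⟨2 * a, a ^ 2, ?_, ?_⟩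
    · rw [← ha]; simp
    · rw [← ha, hs]; simp
  obtain ⟨x, hxd⟩ : ∃ x : K, x = (r : K) + s * α := ⟨_, rfl⟩
  rw [← hxd] at hx
  have hirr : x ∉ (algebraMap ℚ K).range := by
    rintro ⟨y, hy⟩
    have hs' : (s : K) ≠ 0 := by exact_mod_cast hs
    have h1 : α = (((y - r) / s : ℚ) : K) := by
      have : (algebraMap ℚ K) y = (y : K) := by simp
      rw [this] at hy
      push_cast
      rw [hy, hxd]; field_simp; ring
    have h2 : ((((y - r) / s) ^ 2 : ℚ) : K) = ((-(D : ℚ) : ℚ) : K) := by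
      push_cast; push_cast at h1; rw [← h1, hα]
    have h3 : ((y - r) / s) ^ 2 = -(D : ℚ) := by exact_mod_cast h2
    have h4 : (0 : ℚ) < D := by exact_mod_cast hD
    nlinarith [sq_nonneg ((y - r) / s)]
  set p : ℚ[X] := X ^ 2 - C (2 * r) * X + C (r ^ 2 + D * s ^ 2) with hp
  have hdeg : p.natDegree = 2 := by rw [hp]; compute_degree!
  have hmon : p.Monic := by rw [hp]; monicity!
  have hroot : aeval x p = 0 := by
    rw [hp, hxd]
    simp
    linear_combination (s : K) ^ 2 * hα
  have hmin : minpoly ℚ x = p := by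
    have hint : IsIntegral ℚ x := ⟨p, hmon, by simpa [aeval_def] using hroot⟩
    have h2 : 2 ≤ (minpoly ℚ x).natDegree := (minpoly.two_le_natDegree_iff hint).2 hirr
    exact (Polynomial.eq_of_monic_of_dvd_of_natDegree_le (minpoly.monic hint) hmon
      (minpoly.dvd _ _ hroot) (by rw [hdeg]; exact h2)).symm
  have hZ := minpoly.isIntegrallyClosed_eq_field_fractions ℚ K hx
  rw [Algebra.algebraMap_self, RingHom.id_apply, hmin] at hZ
  have hc (i : ℕ) : p.coeff i = ((minpoly ℤ x).coeff i : ℚ) := by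
    rw [hZ, coeff_map]; rfl
  have hp1 (a b : ℚ) : (X ^ 2 - C a * X + C b).coeff 1 = -a := by
    rw [coeff_add, coeff_sub, coeff_C_mul, coeff_X_pow, coeff_X_one, coeff_C]; simp
  have hp0 (a b : ℚ) : (X ^ 2 - C a * X + C b).coeff 0 = b := by
    rw [coeff_add, coeff_sub, coeff_C_mul, coeff_X_pow, coeff_X_zero, coeff_C]; simp
  refine ⟨-(minpoly ℤ x).coeff 1, (minpoly ℤ x).coeff 0, ?_, ?_⟩
  · rw [Int.cast_neg, ← hc 1, hp, hp1, neg_neg]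
  · rw [← hc 0, hp, hp0]

theorem rat_of_sq_int {q : ℚ} {n : ℤ} (h : q ^ 2 = n) : ∃ a : ℤ, q = a := by
  have h1 : IsIntegral ℤ q := by
    refine IsIntegral.of_pow (n := 2) (by norm_num) ?_
    rw [h]
    exact isIntegral_algebraMap (R := ℤ) (A := ℚ) (x := n)
  obtain ⟨a, ha⟩ := IsIntegrallyClosed.isIntegral_iff.1 h1
  exact ⟨a, ha.symm⟩

theorem rat_of_prime_mul_sq {D : ℕ} (hD : D.Prime) {w : ℚ} {n : ℤ} (h : D * w ^ 2 = n) :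
    ∃ a : ℤ, w = a := by
  have hD0 : (D : ℚ) ≠ 0 := by exact_mod_cast hD.ne_zero
  obtain ⟨e, he⟩ := rat_of_sq_int (q := D * w) (n := D * n) (by push_cast; rw [← h]; ring)
  have h1 : e ^ 2 = D * n := by
    have : (e : ℚ) ^ 2 = D * n := by rw [← he, ← h]; ring
    exact_mod_cast this
  obtain ⟨k, hk⟩ : (D : ℤ) ∣ e :=
    (Nat.prime_iff_prime_int.1 hD).dvd_of_dvd_pow (n := 2) ⟨n, h1⟩
  refine ⟨k, mul_left_cancel₀ hD0 ?_⟩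
  rw [he, hk]; push_cast; rfl

theorem exists_quad (K : Type) [Field K] [NumberField K] (hK : Module.finrank ℚ K = 2) {D : ℕ}
    (hD : D.Prime) {m : ℤ} (hm : (D : ℤ) = 4 * m - 1) {α : K} (hα : α ^ 2 = -(D : K)) :
    Nonempty (Quad (NumberField.RingOfIntegers K) m) := by
  have hmK : (D : K) = 4 * m - 1 := by exact_mod_cast congrArg (Int.cast (R := K)) hm
  have hli : ∀ a b : ℚ, (a : K) + b * α = 0 → a = 0 ∧ b = 0 := by
    intro a b h
    have h1 : (a : K) ^ 2 + D * b ^ 2 = 0 := by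
      linear_combination (a - b * α : K) * h + (b : K) ^ 2 * hα
    have h2 : a ^ 2 + D * b ^ 2 = 0 := by exact_mod_cast h1
    have h3 : (0 : ℚ) < D := by exact_mod_cast hD.pos
    have hb : b = 0 := by
      by_contra hb
      have : 0 < b ^ 2 := by positivity
      nlinarith [sq_nonneg a, mul_pos h3 this]
    rw [hb] at h2
    exact ⟨by simpa using h2, hb⟩
  have hspan : ∀ x : K, ∃ r s : ℚ, x = r + s * α := by
    have hl : LinearIndependent ℚ ![(1 : K), α] := by
      rw [LinearIndependent.pair_iff]
      intro a b h
      exact hli a b (by simpa [Algebra.smul_def] using h)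
    intro x
    have htop := hl.span_eq_top_of_card_eq_finrank (by simp [hK])
    have : x ∈ Submodule.span ℚ (Set.range ![(1 : K), α]) := by rw [htop]; trivial
    rw [Matrix.range_cons, Matrix.range_cons, Matrix.range_empty, Set.union_empty,
      Set.singleton_union, Submodule.mem_span_pair] at this
    obtain ⟨r, s, h⟩ := this
    exact ⟨r, s, by rw [← h]; simp [Algebra.smul_def]⟩
  have hωint : IsIntegral ℤ ((1 + α) / 2 : K) := by
    have hmon : (Polynomial.X ^ 2 - Polynomial.X + Polynomial.C m : Polynomial ℤ).Monic := by
      monicity!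
    refine ⟨_, hmon, ?_⟩
    rw [Polynomial.eval₂_add, Polynomial.eval₂_sub, Polynomial.eval₂_pow,
      Polynomial.eval₂_X, Polynomial.eval₂_C, eq_intCast]
    linear_combination (1 / 4 : K) * hα - (1 / 4 : K) * hmK
  let ω : NumberField.RingOfIntegers K := ⟨(1 + α) / 2, hωint⟩
  have hrep : ∀ x : NumberField.RingOfIntegers K, ∃ a : ℤ × ℤ, x = a.1 + a.2 * ω := by
    intro x
    obtain ⟨r, s, h⟩ := hspan x
    have hx : IsIntegral ℤ (x : K) := x.isIntegral_coe
    rw [h] at hx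
    obtain ⟨a, n, ha, hn⟩ := exists_trace_norm hD.pos hα hx
    obtain ⟨w, hw⟩ := rat_of_prime_mul_sq hD (w := 2 * s) (n := 4 * n - a ^ 2)
      (by push_cast; rw [← ha, ← hn]; ring)
    have h4 : a ^ 2 + D * w ^ 2 = 4 * n := by
      have : (a : ℚ) ^ 2 + D * w ^ 2 = 4 * n := by rw [← ha, ← hw, ← hn]; ring
      exact_mod_cast this
    have hev : Even (a - w) := by
      rw [hm] at h4
      have h5 : Even ((a - w) * (a + w)) := ⟨2 * n - 2 * m * w ^ 2, by linear_combination h4⟩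
      rcases Int.even_mul.1 h5 with h5 | h5
      · exact h5
      · rw [Int.even_sub]; rwa [Int.even_add] at h5
    obtain ⟨k, hk⟩ := hev
    refine ⟨(k, w), NumberField.RingOfIntegers.ext ?_⟩
    have hr : (r : K) = k + w / 2 := by
      have : r = k + w / 2 := by
        have : (a : ℚ) - w = k + k := by exact_mod_cast hk
        linarith
      rw [this]; push_cast; ring
    have hs : (s : K) = w / 2 := by
      have : s = w / 2 := by linarith
      rw [this]; push_cast; ring
    have hω : ((ω : NumberField.RingOfIntegers K) : K) = (1 + α) / 2 := rfl
    rw [h, hr, hs]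
    simp [hω]
    ring
  choose c hc using hrep
  refine ⟨⟨ω, ?_, fun x => (c x).1, fun x => (c x).2, hc, ?_⟩⟩
  · apply NumberField.RingOfIntegers.ext
    have hω : ((ω : NumberField.RingOfIntegers K) : K) = (1 + α) / 2 := rfl
    simp [hω]
    linear_combination (1 / 4 : K) * hα - (1 / 4 : K) * hmK
  · intro a b h
    have hω : ((ω : NumberField.RingOfIntegers K) : K) = (1 + α) / 2 := rfl
    have h1 := congrArg (fun y : NumberField.RingOfIntegers K => (y : K)) h
    simp [hω] at h1
    obtain ⟨h2, h3⟩ := hli (a + b / 2) (b / 2) (by push_cast; linear_combination h1)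
    have hb : (b : ℚ) = 0 := by linarith
    have ha : (a : ℚ) = 0 := by linarith
    exact ⟨by exact_mod_cast ha, by exact_mod_cast hb⟩

namespace Quad

variable {O : Type} [CommRing O] {m : ℤ}

/-- Reduction modulo a prime ideal of degree one, given by a root of the polynomial of `ω`. -/
def red (q : Quad O m) {l : ℕ} (a : ZMod l) (ha : a ^ 2 - a + m = 0) : O →+* ZMod l where
  toFun x := q.u x + a * q.v x
  map_one' := by
    have := q.uv_int 1
    rw [Int.cast_one] at this
    rw [this.1, this.2]; simp
  map_zero' := by
    have := q.uv_int 0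
    rw [Int.cast_zero] at this
    rw [this.1, this.2]; simp
  map_add' x y := by
    rw [(q.uv_add x y).1, (q.uv_add x y).2]; push_cast; ring
  map_mul' x y := by
    rw [(q.uv_mul x y).1, (q.uv_mul x y).2]; push_cast
    linear_combination (-(q.v x : ZMod l) * q.v y) * ha

theorem red_surjective (q : Quad O m) {l : ℕ} (a : ZMod l) (ha : a ^ 2 - a + m = 0) :
    Function.Surjective (q.red a ha) := fun b => by
  obtain ⟨n, rfl⟩ := ZMod.intCast_surjective b
  exact ⟨n, map_intCast _ n⟩

variable [IsDedekindDomain O] [Module.Free ℤ O] [Module.Finite ℤ O]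

open IsDedekindDomain

/-- The degree one prime attached to a root. -/
noncomputable def rootPrime (q : Quad O m) {l : ℕ} (hl : l.Prime) (a : ZMod l)
    (ha : a ^ 2 - a + m = 0) : HeightOneSpectrum O :=
  haveI := Fact.mk hl
  ⟨RingHom.ker (q.red a ha), RingHom.ker_isPrime _, fun h => by
    have h1 : ((l : ℤ) : O) ∈ RingHom.ker (q.red a ha) := by
      rw [RingHom.mem_ker, map_intCast]; simp
    rw [h, Ideal.mem_bot] at h1
    have := q.int_inj (a := l) (b := 0) (by rw [h1, Int.cast_zero])
    exact hl.ne_zero (by exact_mod_cast this)⟩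

theorem mem_rootPrime (q : Quad O m) {l : ℕ} (hl : l.Prime) (a : ZMod l)
    (ha : a ^ 2 - a + m = 0) (x : O) :
    x ∈ (q.rootPrime hl a ha).asIdeal ↔ (q.u x + a * q.v x : ZMod l) = 0 := Iff.rfl

theorem absNorm_rootPrime (q : Quad O m) {l : ℕ} (hl : l.Prime) (a : ZMod l)
    (ha : a ^ 2 - a + m = 0) : Ideal.absNorm (q.rootPrime hl a ha).asIdeal = l := by
  have e := RingHom.quotientKerEquivOfSurjective (q.red_surjective a ha)
  have h : Ideal.absNorm (q.rootPrime hl a ha).asIdeal = Nat.card (O ⧸ RingHom.ker (q.red a ha)) :=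
    rfl
  rw [h, Nat.card_congr e.toEquiv, Nat.card_zmod]

theorem l_mem_rootPrime (q : Quad O m) {l : ℕ} (hl : l.Prime) (a : ZMod l)
    (ha : a ^ 2 - a + m = 0) : (l : O) ∈ (q.rootPrime hl a ha).asIdeal := by
  change q.red a ha l = 0
  rw [map_natCast]; simp

theorem rootPrime_injective (q : Quad O m) {l : ℕ} (hl : l.Prime) {a b : ZMod l}
    (ha : a ^ 2 - a + m = 0) (hb : b ^ 2 - b + m = 0)
    (h : q.rootPrime hl a ha = q.rootPrime hl b hb) : a = b := by
  obtain ⟨n, rfl⟩ := ZMod.intCast_surjective a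
  have h1 := q.uv_mk (-n) 1
  have h2 : (((-n : ℤ) : O) + (1 : ℤ) * q.ω) ∈ (q.rootPrime hl _ ha).asIdeal := by
    rw [mem_rootPrime, h1.1, h1.2]; push_cast; ring
  rw [h, mem_rootPrime, h1.1, h1.2] at h2
  push_cast at h2
  linear_combination -h2

theorem absNorm_int (q : Quad O m) (n : ℕ) :
    Ideal.absNorm (Ideal.span {(n : O)}) = n ^ 2 := by
  have := q.nm_int n
  rw [Ideal.absNorm_span_singleton, q.norm_eq]
  rw [Int.cast_natCast] at this
  rw [this]
  exact_mod_cast Int.natAbs_natCast (n ^ 2)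

theorem exists_below (p : HeightOneSpectrum O) : ∃ l : ℕ, l.Prime ∧ (l : O) ∈ p.asIdeal := by
  have h0 := Ideal.absNorm_mem p.asIdeal
  have hne : Ideal.absNorm p.asIdeal ≠ 0 := by
    rw [Ne, Ideal.absNorm_eq_zero_iff]; exact p.ne_bot
  by_contra! hcon
  have : ∀ n : ℕ, n ≠ 0 → (n : O) ∉ p.asIdeal := by
    intro n
    induction n using Nat.recOnMul with
    | zero => intro h; exact absurd rfl h
    | one => intro _; rw [Nat.cast_one]; exact (Ideal.ne_top_iff_one _).1 p.isPrime.ne_top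
    | prime r hr => intro _; exact hcon r hr
    | mul a b ha hb =>
      intro h
      rw [Nat.cast_mul, p.isPrime.mul_mem_iff_mem_or_mem, not_or]
      exact ⟨ha (left_ne_zero_of_mul h), hb (right_ne_zero_of_mul h)⟩
  exact this _ hne h0

theorem below_unique (p : HeightOneSpectrum O) {l l' : ℕ} (hl : l.Prime) (hl' : l'.Prime)
    (h : (l : O) ∈ p.asIdeal) (h' : (l' : O) ∈ p.asIdeal) : l = l' := by
  by_contra hne
  have hc : IsCoprime (l : ℤ) l' := Nat.isCoprime_iff_coprime.2 ((Nat.coprime_primes hl hl').2 hne)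
  obtain ⟨a, b, hab⟩ := hc
  apply p.isPrime.ne_top
  rw [Ideal.eq_top_iff_one]
  have : (1 : O) = a * l + b * l' := by exact_mod_cast (congrArg (Int.cast (R := O)) hab).symm
  rw [this]
  exact add_mem (Ideal.mul_mem_left _ _ h) (Ideal.mul_mem_left _ _ h')

theorem absNorm_eq_or (q : Quad O m) (p : HeightOneSpectrum O) {l : ℕ} (hl : l.Prime)
    (h : (l : O) ∈ p.asIdeal) :
    Ideal.absNorm p.asIdeal = l ∨ Ideal.absNorm p.asIdeal = l ^ 2 := by
  have h1 : Ideal.absNorm p.asIdeal ∣ l ^ 2 := by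
    rw [← q.absNorm_int]
    exact Ideal.absNorm_dvd_absNorm_of_le ((Ideal.span_singleton_le_iff_mem _).2 h)
  obtain ⟨k, hk, h2⟩ := (Nat.dvd_prime_pow hl).1 h1
  interval_cases k
  · rw [pow_zero, Ideal.absNorm_eq_one_iff] at h2
    exact absurd h2 p.isPrime.ne_top
  · left; rw [h2, pow_one]
  · right; exact h2

theorem eq_span_of_absNorm (q : Quad O m) (p : HeightOneSpectrum O) {l : ℕ} (hl : l.Prime)
    (h : (l : O) ∈ p.asIdeal) (h2 : Ideal.absNorm p.asIdeal = l ^ 2) :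
    p.asIdeal = Ideal.span {(l : O)} := by
  obtain ⟨J, hJ⟩ := Ideal.dvd_iff_le.2 ((Ideal.span_singleton_le_iff_mem _).2 h)
  have h3 := congrArg Ideal.absNorm hJ
  rw [map_mul, h2, q.absNorm_int] at h3
  have hl0 : 0 < l ^ 2 := pow_pos hl.pos 2
  have h4 : Ideal.absNorm J = 1 := by
    exact Nat.eq_of_mul_eq_mul_left hl0 (by rw [← h3, mul_one])
  rw [Ideal.absNorm_eq_one_iff] at h4
  rw [hJ, h4, Ideal.mul_top]

theorem exists_root (q : Quad O m) (hm : 0 < m) (p : HeightOneSpectrum O) {l : ℕ} (hl : l.Prime)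
    (h2 : Ideal.absNorm p.asIdeal = l) :
    ∃ (a : ZMod l) (ha : a ^ 2 - a + m = 0), p = q.rootPrime hl a ha := by
  obtain ⟨f, g, b, hf, hg, hgb, h⟩ := q.ideal_form hm p.asIdeal p.ne_bot
  have h3 := q.absNorm_form hf hg h
  rw [h2] at h3
  have hf1 : f = 1 := by
    have hlZ : Prime (l : ℤ) := Nat.prime_iff_prime_int.1 hl
    have h4 : IsUnit f ∨ IsUnit (f * g) := by
      apply hlZ.irreducible.isUnit_or_isUnit; rw [h3]; ring
    rcases h4 with h4 | h4
    · rcases Int.isUnit_iff.1 h4 with h | h <;> omega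
    · rcases Int.isUnit_iff.1 (isUnit_of_mul_isUnit_left h4) with h | h <;> omega
  subst hf1
  have hgl : g = l := by rw [h3]; ring
  subst hgl
  have ha : (-(b : ZMod l)) ^ 2 - (-(b : ZMod l)) + m = 0 := by
    have := (ZMod.intCast_zmod_eq_zero_iff_dvd _ l).2 hgb
    push_cast at this
    linear_combination this
  refine ⟨-(b : ZMod l), ha, HeightOneSpectrum.ext ?_⟩
  ext x
  rw [h, mem_rootPrime]
  have : ((q.u x : ZMod l) + -(b : ZMod l) * q.v x) = ((q.u x - b * q.v x : ℤ) : ZMod l) := by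
    push_cast; ring
  rw [this, ZMod.intCast_zmod_eq_zero_iff_dvd]
  constructor
  · rintro ⟨s, t, h5, h6⟩
    exact ⟨s, by rw [h5, h6]; ring⟩
  · rintro ⟨s, hs⟩
    exact ⟨s, q.v x, by linear_combination hs, by ring⟩

theorem isMaximal' (p : HeightOneSpectrum O) : p.asIdeal.IsMaximal :=
  p.isPrime.isMaximal p.ne_bot

/-- Primes above `l` when the polynomial of `ω` has roots modulo `l`. -/
theorem primes_of_roots (q : Quad O m) (hm : 0 < m) {l : ℕ} (hl : l.Prime)
    (R : Finset (ZMod l)) (hR : ∀ a, a ∈ R ↔ a ^ 2 - a + m = 0) (hne : R.Nonempty) :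
    ∃ s : Finset (HeightOneSpectrum O), (∀ p, p ∈ s ↔ (l : O) ∈ p.asIdeal) ∧ s.card = R.card ∧
      ∀ p ∈ s, Ideal.absNorm p.asIdeal = l := by
  classical
  refine ⟨R.attach.image fun a => q.rootPrime hl a.1 ((hR _).1 a.2), fun p => ?_, ?_, ?_⟩
  · rw [Finset.mem_image]
    constructor
    · rintro ⟨a, -, rfl⟩
      exact q.l_mem_rootPrime hl _ _
    · intro hp
      have hN : Ideal.absNorm p.asIdeal = l := by
        rcases q.absNorm_eq_or p hl hp with h | h
        · exact h
        · obtain ⟨a, ha⟩ := hne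
          have h1 := q.eq_span_of_absNorm p hl hp h
          have h2 : p.asIdeal ≤ (q.rootPrime hl a ((hR a).1 ha)).asIdeal := by
            rw [h1, Ideal.span_singleton_le_iff_mem]
            exact q.l_mem_rootPrime hl _ _
          have h3 := (isMaximal' p).eq_of_le (q.rootPrime hl a ((hR a).1 ha)).isPrime.ne_top h2
          rw [h3, q.absNorm_rootPrime]
      obtain ⟨a, ha, h⟩ := q.exists_root hm p hl hN
      exact ⟨⟨a, (hR a).2 ha⟩, Finset.mem_attach _ _, h.symm⟩
  · rw [Finset.card_image_of_injective, Finset.card_attach]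
    intro a b hab
    exact Subtype.ext (q.rootPrime_injective hl _ _ hab)
  · intro p hp
    obtain ⟨a, -, rfl⟩ := Finset.mem_image.1 hp
    exact q.absNorm_rootPrime hl _ _

/-- The prime above `l` when the polynomial of `ω` has no root modulo `l`. -/
theorem primes_of_no_root (q : Quad O m) (hm : 0 < m) {l : ℕ} (hl : l.Prime)
    (hR : ∀ a : ZMod l, a ^ 2 - a + m ≠ 0) :
    ∃ s : Finset (HeightOneSpectrum O), (∀ p, p ∈ s ↔ (l : O) ∈ p.asIdeal) ∧ s.card = 1 ∧
      ∀ p ∈ s, Ideal.absNorm p.asIdeal = l ^ 2 := by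
  have key : ∀ p : HeightOneSpectrum O, (l : O) ∈ p.asIdeal →
      Ideal.absNorm p.asIdeal = l ^ 2 := by
    intro p hp
    rcases q.absNorm_eq_or p hl hp with h | h
    · obtain ⟨a, ha, -⟩ := q.exists_root hm p hl h
      exact absurd ha (hR a)
    · exact h
  have htop : Ideal.span {(l : O)} ≠ ⊤ := by
    intro h
    have := q.absNorm_int l
    rw [h, Ideal.absNorm_top] at this
    have := hl.one_lt
    nlinarith
  obtain ⟨M, hM, hle⟩ := Ideal.exists_le_maximal _ htop
  have hlM : (l : O) ∈ M := (Ideal.span_singleton_le_iff_mem _).1 hle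
  have hl0 : (l : O) ≠ 0 := fun h => hl.ne_zero (by
    have := q.int_inj (a := l) (b := 0) (by simpa using h)
    exact_mod_cast this)
  let p : HeightOneSpectrum O := ⟨M, hM.isPrime, fun h => by
    rw [h, Ideal.mem_bot] at hlM; exact hl0 hlM⟩
  refine ⟨{p}, fun p' => ?_, Finset.card_singleton _, fun p' hp' => ?_⟩
  · rw [Finset.mem_singleton]
    constructor
    · rintro rfl; exact hlM
    · intro h
      apply HeightOneSpectrum.ext
      rw [q.eq_span_of_absNorm p' hl h (key p' h), q.eq_span_of_absNorm p hl hlM (key p hlM)]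
  · rw [Finset.mem_singleton] at hp'
    rw [hp']; exact key p hlM

end Quad

theorem card_roots_odd {l : ℕ} [Fact l.Prime] (hl : l ≠ 2) {D : ℕ} {m : ℤ} (hm : (D : ℤ) = 4 * m - 1) :
    (((Finset.univ.filter fun a : ZMod l => a ^ 2 - a + m = 0).card : ℕ) : ℤ) =
      quadraticChar (ZMod l) (-(D : ZMod l)) + 1 := by
  have hF : ringChar (ZMod l) ≠ 2 := by rwa [ZMod.ringChar_zmod_n]
  have h2 : (2 : ZMod l) ≠ 0 := Ring.two_ne_zero hF
  have hmD : (D : ZMod l) = 4 * m - 1 := by exact_mod_cast congrArg (Int.cast (R := ZMod l)) hm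
  rw [← quadraticChar_card_sqrts hF]
  refine congrArg Nat.cast ?_
  refine Finset.card_bij (fun a _ => 2 * a - 1) ?_ ?_ ?_
  · intro a ha
    rw [Finset.mem_filter] at ha
    rw [Set.mem_toFinset, Set.mem_ofPred_eq]
    linear_combination 4 * ha.2 + hmD
  · intro a _ b _ hab
    have : (2 : ZMod l) * (a - b) = 0 := by linear_combination hab
    exact sub_eq_zero.1 ((mul_eq_zero.1 this).resolve_left h2)
  · intro b hb
    rw [Set.mem_toFinset, Set.mem_ofPred_eq] at hb
    refine ⟨(b + 1) / 2, ?_, by field_simp; ring⟩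
    rw [Finset.mem_filter]
    refine ⟨Finset.mem_univ _, ?_⟩
    field_simp
    linear_combination hb - hmD

theorem zmod_two_root : ∀ a : ZMod 2, a ^ 2 - a + 0 = 0 := by decide

theorem zmod_two_no_root : ∀ a : ZMod 2, ¬a ^ 2 - a + 1 = 0 := by decide

theorem card_roots {D : ℕ} [Fact D.Prime] (hD4 : D % 4 = 3) {m : ℤ} (hm : (D : ℤ) = 4 * m - 1)
    {l : ℕ} [Fact l.Prime] :
    (((Finset.univ.filter fun a : ZMod l => a ^ 2 - a + m = 0).card : ℕ) : ℤ) =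
      quadraticChar (ZMod D) l + 1 := by
  have hD2 : D ≠ 2 := by omega
  have hFD : ringChar (ZMod D) ≠ 2 := by rwa [ZMod.ringChar_zmod_n]
  by_cases hl : l = 2
  · subst hl
    rw [Nat.cast_ofNat (n := 2), quadraticChar_two hFD, ZMod.card, ZMod.χ₈_nat_eq_if_mod_eight]
    have hD2' : D % 2 ≠ 0 := by omega
    rw [if_neg hD2']
    have hM : (m : ZMod 2) = if m % 2 = 0 then 0 else 1 := by
      split_ifs with h
      · rw [ZMod.intCast_zmod_eq_zero_iff_dvd]; exact Int.dvd_of_emod_eq_zero (by exact_mod_cast h)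
      · have : ((m - 1 : ℤ) : ZMod 2) = 0 := by
          rw [ZMod.intCast_zmod_eq_zero_iff_dvd]; exact Int.dvd_of_emod_eq_zero (by push_cast; omega)
        push_cast at this
        exact sub_eq_zero.1 this
    rw [hM]
    by_cases h : m % 2 = 0
    · rw [if_pos h, if_pos (by omega), Finset.filter_true_of_mem (fun a _ => zmod_two_root a),
        Finset.card_univ, ZMod.card]
      norm_num
    · rw [if_neg h, if_neg (by omega), Finset.filter_false_of_mem (fun a _ => zmod_two_no_root a),
        Finset.card_empty]
      norm_num
  · rw [card_roots_odd hl hm]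
    congr 1
    by_cases hlD : l = D
    · subst hlD
      simp
    · rw [quadraticChar_odd_prime hFD hl (by rw [ZMod.ringChar_zmod_n]; exact fun h => hlD h.symm),
        ZMod.card, ZMod.χ₄_nat_three_mod_four hD4]
      congr 1
      push_cast; ring

namespace Quad

variable {O : Type} [CommRing O] {m : ℤ} [IsDedekindDomain O] [Module.Free ℤ O] [Module.Finite ℤ O]

open IsDedekindDomain

/-- The splitting law. -/
theorem splitting (q : Quad O m) {D : ℕ} [Fact D.Prime] (hD4 : D % 4 = 3)
    (hm : (D : ℤ) = 4 * m - 1) {l : ℕ} (hl : l.Prime) :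
    ∃ s : Finset (HeightOneSpectrum O), (∀ p, p ∈ s ↔ (l : O) ∈ p.asIdeal) ∧
      ((quadraticChar (ZMod D) l = 1 ∧ s.card = 2 ∧ ∀ p ∈ s, Ideal.absNorm p.asIdeal = l) ∨
       (quadraticChar (ZMod D) l = -1 ∧ s.card = 1 ∧ ∀ p ∈ s, Ideal.absNorm p.asIdeal = l ^ 2) ∨
       (quadraticChar (ZMod D) l = 0 ∧ s.card = 1 ∧ ∀ p ∈ s, Ideal.absNorm p.asIdeal = l)) := by
  have := Fact.mk hl
  have hm0 : 0 < m := by omega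
  have hR := card_roots hD4 hm (l := l)
  set R := Finset.univ.filter fun a : ZMod l => a ^ 2 - a + m = 0 with hRd
  have hmem : ∀ a, a ∈ R ↔ a ^ 2 - a + m = 0 := fun a => by simp [hRd]
  have htri : quadraticChar (ZMod D) l = 0 ∨ quadraticChar (ZMod D) l = 1 ∨
      quadraticChar (ZMod D) l = -1 := quadraticChar_isQuadratic (ZMod D) l
  rcases htri with h | h | h
  · rw [h] at hR
    have hc : R.card = 1 := by omega
    obtain ⟨s, h1, h2, h3⟩ := q.primes_of_roots hm0 hl R hmem (Finset.card_pos.1 (by omega))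
    exact ⟨s, h1, Or.inr (Or.inr ⟨h, by omega, h3⟩)⟩
  · rw [h] at hR
    have hc : R.card = 2 := by omega
    obtain ⟨s, h1, h2, h3⟩ := q.primes_of_roots hm0 hl R hmem (Finset.card_pos.1 (by omega))
    exact ⟨s, h1, Or.inl ⟨h, by omega, h3⟩⟩
  · rw [h] at hR
    have hc : R.card = 0 := by omega
    obtain ⟨s, h1, h2, h3⟩ := q.primes_of_no_root hm0 hl (fun a ha => by
      have := (hmem a).2 ha
      rw [Finset.card_eq_zero.1 hc] at this
      simp at this)
    exact ⟨s, h1, Or.inr (Or.inl ⟨h, h2, h3⟩)⟩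

end Quad

section

open Finset

theorem card_Icc_sub_le {x y : ℝ} (h : x ≤ y) :
    |((Icc ⌈x⌉ ⌊y⌋).card : ℝ) - (y - x)| ≤ 1 := by
  rw [Int.card_Icc]
  have h1 := Int.ceil_lt_add_one x
  have h2 := Int.le_ceil x
  have h3 := Int.lt_floor_add_one y
  have h4 := Int.floor_le y
  have h5 : (0 : ℤ) ≤ ⌊y⌋ + 1 - ⌈x⌉ := by
    have : (⌈x⌉ : ℝ) < ⌊y⌋ + 1 + 1 := by linarith
    have : ⌈x⌉ < ⌊y⌋ + 1 + 1 := by exact_mod_cast this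
    omega
  have h6 : (((⌊y⌋ + 1 - ⌈x⌉).toNat : ℕ) : ℝ) = ⌊y⌋ + 1 - ⌈x⌉ := by
    have : (((⌊y⌋ + 1 - ⌈x⌉).toNat : ℤ) : ℝ) = ((⌊y⌋ + 1 - ⌈x⌉ : ℤ) : ℝ) := by
      rw [Int.toNat_of_nonneg h5]
    push_cast at this
    exact_mod_cast this
  rw [h6, abs_le]
  constructor <;> linarith

/-- A quarter of the area of the unit disc. -/
noncomputable def quarterArea : ℝ := ∫ v in (0 : ℝ)..1, √(1 - v ^ 2)

theorem continuous_sqrt_one_sub : Continuous fun v : ℝ => √(1 - v ^ 2) := by fun_prop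

theorem quarterArea_le : quarterArea ≤ 1 := by
  have h := intervalIntegral.integral_mono_on (μ := MeasureTheory.volume) zero_le_one
    (continuous_sqrt_one_sub.intervalIntegrable 0 1)
    ((continuous_const (y := (1 : ℝ))).intervalIntegrable (0 : ℝ) 1) (fun v _ => by
      rw [Real.sqrt_le_one]; nlinarith [sq_nonneg v])
  simpa [quarterArea] using h

theorem le_quarterArea : 1 / 2 ≤ quarterArea := by
  have hc : Continuous fun v : ℝ => 1 - v := by fun_prop
  have h := intervalIntegral.integral_mono_on (μ := MeasureTheory.volume) zero_le_one
    (hc.intervalIntegrable 0 1)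
    (continuous_sqrt_one_sub.intervalIntegrable 0 1) (fun v hv => by
      apply Real.le_sqrt_of_sq_le
      nlinarith [hv.1, hv.2])
  refine le_trans (le_of_eq ?_) h
  rw [intervalIntegral.integral_sub intervalIntegrable_const
    intervalIntegral.intervalIntegrable_id, integral_id, intervalIntegral.integral_const]
  norm_num

theorem integral_zero_tail {n : ℝ} (hn : 1 ≤ n) : ∫ v in (0 : ℝ)..n, √(1 - v ^ 2) = quarterArea := by
  rw [quarterArea, ← intervalIntegral.integral_add_adjacent_intervals
    (continuous_sqrt_one_sub.intervalIntegrable 0 1) (continuous_sqrt_one_sub.intervalIntegrable 1 n)]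
  have : ∫ v in (1 : ℝ)..n, √(1 - v ^ 2) = 0 := by
    rw [intervalIntegral.integral_congr (g := fun _ => 0)]
    · simp
    · intro v hv
      rw [Set.uIcc_of_le hn] at hv
      exact Real.sqrt_eq_zero_of_nonpos (by nlinarith [hv.1])
  rw [this, add_zero]

/-- Summing the chord lengths of a disc. -/
theorem sum_chords {R a : ℝ} (hR : 0 ≤ R) (ha : 0 < a) {n : ℕ} (hn : a ≤ n) :
    |(∑ t ∈ Icc (-(n : ℤ)) n, R * √(1 - ((t : ℝ) / a) ^ 2)) - 2 * (R * a * quarterArea)| ≤ R := by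
  set h : ℝ → ℝ := fun t => R * √(1 - (t / a) ^ 2) with hh
  have hanti : AntitoneOn h (Set.Icc ((0 : ℕ) : ℝ) n) := by
    intro s hs t _ hst
    rw [Nat.cast_zero] at hs
    have h1 : s / a ≤ t / a := by gcongr
    have h2 : 0 ≤ s / a := div_nonneg hs.1 ha.le
    simp only [hh]
    gcongr
  have hint : ∫ t in ((0 : ℕ) : ℝ)..n, h t = R * a * quarterArea := by
    simp only [hh, Nat.cast_zero]
    rw [intervalIntegral.integral_const_mul,
      intervalIntegral.integral_comp_div (fun v => √(1 - v ^ 2)) ha.ne', zero_div,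
      integral_zero_tail ((one_le_div ha).2 hn), smul_eq_mul]
    ring
  have h1 := hanti.sum_le_integral_Ico (Nat.zero_le n)
  have h2 := hanti.integral_le_sum_Ico (Nat.zero_le n)
  rw [hint] at h1 h2
  have h0 : h 0 = R := by simp [hh]
  have hsplit : ∑ t ∈ Icc (-(n : ℤ)) n, h t = h 0 + 2 * ∑ i ∈ range n, h ((i + 1 : ℕ) : ℝ) := by
    have heven : ∀ t, h (-t) = h t := fun t => by simp only [hh]; rw [neg_div, neg_sq]
    clear h1 h2 hint hanti hn
    induction n with
    | zero => simp
    | succ k ih =>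
      have e : Icc (-((k + 1 : ℕ) : ℤ)) ((k + 1 : ℕ) : ℤ) =
          insert (-((k + 1 : ℕ) : ℤ)) (insert ((k + 1 : ℕ) : ℤ) (Icc (-(k : ℤ)) k)) := by
        ext z; simp only [mem_insert, mem_Icc]; push_cast; omega
      rw [e, sum_insert (by simp only [mem_insert, mem_Icc]; push_cast; omega),
        sum_insert (by simp only [mem_Icc]; push_cast; omega), ih, sum_range_succ]
      push_cast
      rw [heven]; ring
  have hmono : ∑ i ∈ range n, h (i : ℝ) ≤ h 0 + ∑ i ∈ range n, h ((i + 1 : ℕ) : ℝ) := by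
    have h3 := sum_range_succ (fun i : ℕ => h (i : ℝ)) n
    have h4 := sum_range_succ' (fun i : ℕ => h (i : ℝ)) n
    have : 0 ≤ h n := mul_nonneg hR (Real.sqrt_nonneg _)
    rw [h3] at h4
    rw [Nat.cast_zero] at h4
    linarith
  rw [Nat.Ico_zero_eq_range] at h1 h2
  rw [h0] at hsplit hmono
  change |∑ t ∈ Icc (-(n : ℤ)) n, h t - _| ≤ R
  rw [hsplit, abs_le]
  constructor <;> linarith

/-- Lattice points in an ellipse. -/
theorem lattice_count {g δ R : ℝ} (hg : 0 < g) (hδ : 0 < δ) (hR : 0 < R) (β : ℤ → ℝ) :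
    ∃ S : Finset (ℤ × ℤ),
      (∀ p, p ∈ S ↔ (g * p.1 + β p.2) ^ 2 + δ ^ 2 * (p.2 : ℝ) ^ 2 ≤ R ^ 2) ∧
      |(S.card : ℝ) - 4 * quarterArea * R ^ 2 / (g * δ)| ≤ 2 * R / g + 2 * (R / δ) + 3 := by
  set a := R / δ with had
  have ha : 0 < a := div_pos hR hδ
  set n := ⌈a⌉₊ with hn
  have han : a ≤ n := Nat.le_ceil a
  have hna : (n : ℝ) < a + 1 := Nat.ceil_lt_add_one ha.le
  set w : ℤ → ℝ := fun t => R * √(1 - ((t : ℝ) / a) ^ 2) with hw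
  have hw0 : ∀ t, 0 ≤ w t := fun t => mul_nonneg hR.le (Real.sqrt_nonneg _)
  have haδ : a * δ = R := by rw [had]; field_simp
  have hw2 : ∀ t : ℤ, |(t : ℝ)| ≤ a → w t ^ 2 = R ^ 2 - δ ^ 2 * (t : ℝ) ^ 2 := by
    intro t ht
    have h1 : ((t : ℝ) / a) ^ 2 ≤ 1 := by
      rw [div_pow, div_le_one (by positivity)]
      exact sq_le_sq' (by linarith [neg_abs_le (t : ℝ)]) ((le_abs_self _).trans ht)
    simp only [hw]
    rw [mul_pow, Real.sq_sqrt (by linarith), ← haδ]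
    field_simp
  have hout : ∀ t : ℤ, ¬|(t : ℝ)| ≤ a → w t = 0 ∧ R ^ 2 < δ ^ 2 * (t : ℝ) ^ 2 := by
    intro t ht
    push Not at ht
    have h1 : a ^ 2 < (t : ℝ) ^ 2 := by rw [← sq_abs (t : ℝ)]; gcongr
    constructor
    · simp only [hw]
      rw [Real.sqrt_eq_zero_of_nonpos, mul_zero]
      rw [div_pow, sub_nonpos, one_le_div (by positivity)]
      exact h1.le
    · rw [← haδ, mul_pow, mul_comm]
      gcongr
  let F : ℤ → Finset ℤ := fun t => if |(t : ℝ)| ≤ a then Icc ⌈(-w t - β t) / g⌉ ⌊(w t - β t) / g⌋ else ∅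
  have hFcard : ∀ t, |((F t).card : ℝ) - 2 / g * w t| ≤ 1 := by
    intro t
    by_cases ht : |(t : ℝ)| ≤ a
    · simp only [F, if_pos ht]
      have h1 := card_Icc_sub_le (x := (-w t - β t) / g) (y := (w t - β t) / g)
        (by gcongr; linarith [hw0 t])
      convert h1 using 3
      ring
    · simp only [F, if_neg ht, (hout t ht).1]
      simp
  refine ⟨((Icc (-(n : ℤ)) n).sigma F).image fun x => (x.2, x.1), ?_, ?_⟩
  · rintro ⟨s, t⟩
    rw [mem_image]
    have hmem : s ∈ F t ↔ (g * s + β t) ^ 2 + δ ^ 2 * (t : ℝ) ^ 2 ≤ R ^ 2 := by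
      by_cases ht : |(t : ℝ)| ≤ a
      · simp only [F, if_pos ht]
        rw [mem_Icc, Int.ceil_le, Int.le_floor, div_le_iff₀ hg, le_div_iff₀ hg]
        rw [← le_sub_iff_add_le, ← hw2 t ht, sq_le_sq, abs_of_nonneg (hw0 t), abs_le]
        constructor <;> rintro ⟨h1, h2⟩ <;> constructor <;> linarith
      · simp only [F, if_neg ht]
        constructor
        · intro h; simp at h
        · intro h
          have := (hout t ht).2
          nlinarith [sq_nonneg (g * s + β t)]
    constructor
    · rintro ⟨⟨t', s'⟩, h, h2⟩
      rw [Prod.mk.injEq] at h2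
      obtain ⟨rfl, rfl⟩ := h2
      exact hmem.1 (mem_sigma.1 h).2
    · intro h
      refine ⟨⟨t, s⟩, mem_sigma.2 ⟨?_, hmem.2 h⟩, rfl⟩
      have ht : |(t : ℝ)| ≤ a := by
        by_contra ht
        have := (hout t ht).2
        simp only at h
        nlinarith [sq_nonneg (g * s + β t)]
      have := abs_le.1 (ht.trans han)
      rw [mem_Icc]
      exact ⟨by exact_mod_cast this.1, by exact_mod_cast this.2⟩
  · rw [card_image_of_injective _ (by
      rintro ⟨t, s⟩ ⟨t', s'⟩ h
      simp only [Prod.mk.injEq] at h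
      obtain ⟨rfl, rfl⟩ := h; rfl), card_sigma]
    have h1 := sum_chords hR.le ha han
    have h2 : |∑ t ∈ Icc (-(n : ℤ)) n, (((F t).card : ℝ) - 2 / g * w t)| ≤ 2 * n + 1 := by
      refine (abs_sum_le_sum_abs _ _).trans ((sum_le_sum fun t _ => hFcard t).trans (le_of_eq ?_))
      rw [sum_const, Int.card_Icc, nsmul_eq_mul, mul_one]
      have : ((n : ℤ) + 1 - -(n : ℤ)).toNat = 2 * n + 1 := by omega
      rw [this]; push_cast; ring
    rw [sum_sub_distrib, ← mul_sum] at h2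
    have h3 : |2 / g * ∑ t ∈ Icc (-(n : ℤ)) n, w t - 2 / g * (2 * (R * a * quarterArea))| ≤ 2 / g * R := by
      rw [← mul_sub, abs_mul, abs_of_pos (by positivity : (0 : ℝ) < 2 / g)]
      gcongr
    have h4 : 4 * quarterArea * R ^ 2 / (g * δ) = 2 / g * (2 * (R * a * quarterArea)) := by
      rw [had]; field_simp; ring
    rw [h4]
    push_cast
    have h5 : 2 * R / g = 2 / g * R := by ring
    rw [h5]
    rw [abs_le] at h2 h3 ⊢
    constructor <;> linarith [h2.1, h2.2, h3.1, h3.2]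

end

section

open Finset nonZeroDivisors

namespace Quad

variable {O : Type} [CommRing O] {m : ℤ}

theorem nm_isUnit (q : Quad O m) (hm : 0 < m) (e : Oˣ) : q.nm e = 1 := by
  have h1 : q.nm (e : O) * q.nm ((e⁻¹ : Oˣ) : O) = 1 := by
    rw [← q.nm_mul, Units.mul_inv]
    have := q.nm_int 1
    rw [Int.cast_one] at this
    rw [this, one_pow]
  rcases Int.isUnit_iff.1 (IsUnit.of_mul_eq_one _ h1) with h | h
  · exact h
  · have := q.nm_nonneg hm e; omega

theorem unit_eq (q : Quad O m) (hm : 2 ≤ m) (e : Oˣ) : (e : O) = 1 ∨ (e : O) = -1 := by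
  have h1 := q.nm_isUnit (by omega) e
  have h2 := q.four_nm (e : O)
  rw [h1] at h2
  have hv : q.v (e : O) = 0 := by
    by_contra hv
    have : 1 ≤ q.v (e : O) ^ 2 := by
      have := Int.one_le_abs hv
      rw [← sq_abs]; nlinarith
    nlinarith [sq_nonneg (2 * q.u (e : O) + q.v (e : O))]
  have hu : q.u (e : O) = 1 ∨ q.u (e : O) = -1 := by
    rw [hv] at h2
    have : q.u (e : O) ^ 2 = 1 := by linarith
    exact sq_eq_one_iff.1 this
  rw [q.rep (e : O), hv]
  rcases hu with h | h <;> rw [h] <;> simp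

variable [IsDedekindDomain O] [Module.Free ℤ O] [Module.Finite ℤ O]

theorem span_eq_iff (q : Quad O m) (hm : 2 ≤ m) (x y : O) :
    Ideal.span {x} = Ideal.span {y} ↔ y = x ∨ y = -x := by
  rw [Ideal.span_singleton_eq_span_singleton]
  constructor
  · rintro ⟨e, rfl⟩
    rcases q.unit_eq hm e with h | h <;> rw [h] <;> simp
  · rintro (rfl | rfl)
    · exact Associated.refl _
    · exact (Associated.refl _).neg_right

theorem absNorm_span (q : Quad O m) (hm : 0 < m) (x : O) :
    (Ideal.absNorm (Ideal.span {x}) : ℤ) = q.nm x := by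
  rw [Ideal.absNorm_span_singleton, q.norm_eq, Int.natAbs_of_nonneg (q.nm_nonneg hm x)]

set_option maxHeartbeats 400000 in
/-- Ideals in a class correspond to elements of an ideal in the inverse class, up to sign. -/
theorem class_finset (q : Quad O m) (hm : 2 ≤ m) (C : ClassGroup O) (B : (Ideal O)⁰)
    (hB : ClassGroup.mk0 B = C⁻¹) {f g b : ℤ} (hf : 0 < f) (hg : 0 < g)
    (h : ∀ x, x ∈ (B : Ideal O) ↔ ∃ s t : ℤ, q.u x = f * (g * s + b * t) ∧ q.v x = f * t) (X : ℝ)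
    (S : Finset (ℤ × ℤ)) (hS : ∀ p : ℤ × ℤ, p ∈ S ↔
      (((g * p.1 + b * p.2) ^ 2 + (g * p.1 + b * p.2) * p.2 + m * p.2 ^ 2 : ℤ) : ℝ) ≤ g * X)
    (hS0 : (0, 0) ∈ S) :
    ∃ A : Finset (Ideal O), (∀ I, I ∈ A ↔
      (∃ h0 : I ∈ (Ideal O)⁰, ClassGroup.mk0 ⟨I, h0⟩ = C) ∧ (Ideal.absNorm I : ℝ) ≤ X) ∧
      S.card = 2 * A.card + 1 := by
  classical
  have hm0 : 0 < m := by omega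
  have hB0 : (B : Ideal O) ≠ ⊥ := nonZeroDivisors.coe_ne_zero B
  let x : ℤ × ℤ → O := fun p => ((f * (g * p.1 + b * p.2) : ℤ) : O) + ((f * p.2 : ℤ) : O) * q.ω
  have hxu : ∀ p, q.u (x p) = f * (g * p.1 + b * p.2) ∧ q.v (x p) = f * p.2 := fun p => q.uv_mk _ _
  have hxB : ∀ p, x p ∈ (B : Ideal O) := fun p => (h _).2 ⟨p.1, p.2, hxu p⟩
  have hxinj : ∀ p p', x p = x p' → p = p' := by
    rintro ⟨s, t⟩ ⟨s', t'⟩ he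
    have h1 := hxu (s, t); rw [he, (hxu (s', t')).1, (hxu (s', t')).2] at h1
    have ht : t' = t := mul_left_cancel₀ hf.ne' h1.2
    subst ht
    have h2 : g * s' + b * t' = g * s + b * t' := mul_left_cancel₀ hf.ne' h1.1
    have h3 : s' = s := mul_left_cancel₀ hg.ne' (by linarith)
    rw [h3]
  have hxneg : ∀ p : ℤ × ℤ, x (-p) = -x p := by
    intro p; simp only [x, Prod.fst_neg, Prod.snd_neg]; push_cast; ring
  have hx0 : x (0, 0) = 0 := by simp [x]
  have hnm : ∀ p, q.nm (x p) = f ^ 2 *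
      ((g * p.1 + b * p.2) ^ 2 + (g * p.1 + b * p.2) * p.2 + m * p.2 ^ 2) := by
    intro p; rw [nm, (hxu p).1, (hxu p).2]; ring
  have hBN := q.absNorm_form hf hg h
  have hJ : ∀ p, ∃ J : Ideal O, Ideal.span {x p} = B * J := fun p =>
    Ideal.dvd_iff_le.2 ((Ideal.span_singleton_le_iff_mem _).2 (hxB p))
  choose J hJ using hJ
  have hnorm : ∀ (I : Ideal O) p, Ideal.span {x p} = B * I → (Ideal.absNorm I : ℝ) * g =
      (((g * p.1 + b * p.2) ^ 2 + (g * p.1 + b * p.2) * p.2 + m * p.2 ^ 2 : ℤ) : ℝ) := by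
    intro I p hI
    have h1 := q.absNorm_span hm0 (x p)
    rw [hI, map_mul, Nat.cast_mul, hBN, hnm] at h1
    have h2 : (Ideal.absNorm I : ℤ) * g =
      (g * p.1 + b * p.2) ^ 2 + (g * p.1 + b * p.2) * p.2 + m * p.2 ^ 2 :=
      mul_left_cancel₀ (pow_pos hf 2).ne' (by linear_combination h1)
    exact_mod_cast congrArg (Int.cast (R := ℝ)) h2
  have hgR : (0 : ℝ) < g := by exact_mod_cast hg
  have hSiff : ∀ (I : Ideal O) p, Ideal.span {x p} = B * I → (p ∈ S ↔ (Ideal.absNorm I : ℝ) ≤ X) := by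
    intro I p hI
    rw [hS, ← hnorm I p hI, mul_comm, mul_le_mul_iff_right₀ hgR]
  have hcls : ∀ (I : (Ideal O)⁰) p, Ideal.span {x p} = (B : Ideal O) * I → ClassGroup.mk0 I = C := by
    intro I p hI
    have h1 : ClassGroup.mk0 (B * I) = 1 := (ClassGroup.mk0_eq_one_iff (B * I).2).2 ⟨x p, hI.symm⟩
    rw [map_mul, hB] at h1
    exact (inv_mul_eq_one.1 h1).symm
  refine ⟨(S.erase (0, 0)).image J, fun I => ?_, ?_⟩
  · rw [mem_image]
    constructor
    · rintro ⟨p, hp, rfl⟩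
      rw [mem_erase] at hp
      have hne : J p ≠ 0 := by
        intro h0
        have h1 := hJ p
        rw [h0, mul_zero, Ideal.zero_eq_bot, Ideal.span_singleton_eq_bot, ← hx0] at h1
        exact hp.1 (hxinj _ _ h1)
      have hmem := mem_nonZeroDivisors_iff_ne_zero.2 hne
      exact ⟨⟨hmem, hcls ⟨J p, hmem⟩ p (hJ p)⟩, (hSiff _ p (hJ p)).1 hp.2⟩
    · rintro ⟨⟨h0, hC⟩, hN⟩
      obtain ⟨I', hI'⟩ : ∃ I' : (Ideal O)⁰, I' = ⟨I, h0⟩ := ⟨_, rfl⟩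
      have h1 : ClassGroup.mk0 (B * I') = 1 := by rw [map_mul, hB, hI', hC, inv_mul_cancel]
      obtain ⟨y, hy⟩ := ((ClassGroup.mk0_eq_one_iff (B * I').2).1 h1).principal
      rw [hI'] at hy
      have hy' : (B : Ideal O) * I = Ideal.span {y} := hy
      have hyB : y ∈ (B : Ideal O) := by
        have : y ∈ (B : Ideal O) * I := by rw [hy']; exact Ideal.mem_span_singleton_self y
        exact (Ideal.mul_le_left (I := (B : Ideal O)) (J := I)) this
      obtain ⟨s, t, hu, hv⟩ := (h y).1 hyB
      have hyx : y = x (s, t) := by rw [q.rep y, hu, hv]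
      rw [hyx] at hy'
      refine ⟨(s, t), mem_erase.2 ⟨?_, (hSiff I _ hy'.symm).2 hN⟩, ?_⟩
      · intro h2
        rw [h2] at hy'
        rw [hx0, Ideal.span_singleton_eq_bot.2 rfl, Ideal.mul_eq_bot] at hy'
        rcases hy' with h3 | h3
        · exact hB0 h3
        · exact mem_nonZeroDivisors_iff_ne_zero.1 h0 h3
      · have := hJ (s, t)
        rw [← hy'] at this
        exact (mul_left_cancel₀ hB0 this).symm
  · have h1 := card_eq_sum_card_image J (S.erase (0, 0))
    rw [sum_const_nat (m := 2), card_erase_of_mem hS0] at h1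
    · have : 0 < S.card := card_pos.2 ⟨_, hS0⟩
      omega
    · intro I hI
      obtain ⟨p, hp, rfl⟩ := mem_image.1 hI
      have hp0 := (mem_erase.1 hp).1
      have hpS := (mem_erase.1 hp).2
      rw [card_eq_two]
      refine ⟨p, -p, ?_, ?_⟩
      · intro he
        apply hp0
        have h2 := congrArg Prod.fst he; have h3 := congrArg Prod.snd he
        rw [Prod.fst_neg] at h2; rw [Prod.snd_neg] at h3
        ext
        · simp only; omega
        · simp only; omega
      · ext p'
        rw [mem_filter, mem_insert, mem_singleton, mem_erase]
        have hiff : J p' = J p ↔ p' = p ∨ p' = -p := by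
          have h2 : J p' = J p ↔ Ideal.span {x p'} = Ideal.span {x p} := by
            rw [hJ, hJ]
            exact ⟨fun h => by rw [h], fun h => mul_left_cancel₀ hB0 h⟩
          rw [h2, eq_comm, q.span_eq_iff hm]
          constructor
          · rintro (h | h)
            · exact Or.inl (hxinj _ _ h)
            · rw [← hxneg] at h; exact Or.inr (hxinj _ _ h)
          · rintro (rfl | rfl)
            · exact Or.inl rfl
            · exact Or.inr (hxneg p)
        constructor
        · rintro ⟨-, h2⟩; exact hiff.1 h2
        · intro h2
          have h3 := hiff.2 h2
          have hn0 : -p ≠ (0, 0) := by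
            intro h4; exact hp0 (neg_eq_zero.1 h4)
          have hS' : p' ∈ S := by
            rw [hSiff (J p') p' (hJ p'), h3, ← hSiff (J p) p (hJ p)]; exact hpS
          refine ⟨⟨?_, hS'⟩, h3⟩
          rcases h2 with rfl | rfl
          · exact hp0
          · exact hn0

/-- Ideals of bounded norm in a class. -/
theorem class_count (q : Quad O m) {D : ℕ} (hD : 7 ≤ D) (hm : (D : ℤ) = 4 * m - 1)
    (hmink : ∀ C : ClassGroup O, ∃ B : (Ideal O)⁰, ClassGroup.mk0 B = C ∧ Ideal.absNorm (B : Ideal O) ≤ D)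
    (C : ClassGroup O) {X : ℝ} (hX : 0 ≤ X) :
    ∃ A : Finset (Ideal O), (∀ I, I ∈ A ↔
      (∃ h0 : I ∈ (Ideal O)⁰, ClassGroup.mk0 ⟨I, h0⟩ = C) ∧ (Ideal.absNorm I : ℝ) ≤ X) ∧
      |(A.card : ℝ) - 4 * quarterArea / √D * X| ≤ D * √X := by
  have hDR : (7 : ℝ) ≤ D := by exact_mod_cast hD
  have hsD : 2 ≤ √(D : ℝ) := by apply Real.le_sqrt_of_sq_le; linarith
  have hsDD : √(D : ℝ) * √D = D := Real.mul_self_sqrt (by linarith)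
  rcases lt_or_ge X 1 with hX1 | hX1
  · refine ⟨∅, fun I => ?_, ?_⟩
    · constructor
      · intro h; simp at h
      · rintro ⟨⟨h0, -⟩, hN⟩
        have h1 : (Ideal.absNorm I : ℝ) < 1 := hN.trans_lt hX1
        have h2 : Ideal.absNorm I = 0 := by
          have : Ideal.absNorm I < 1 := by exact_mod_cast h1
          omega
        rw [Ideal.absNorm_eq_zero_iff] at h2
        exact absurd h2 (mem_nonZeroDivisors_iff_ne_zero.1 h0)
    · rw [card_empty, Nat.cast_zero, zero_sub, abs_neg]
      have hq := le_quarterArea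
      rw [abs_of_nonneg (by positivity)]
      have h1 : X ≤ √X := Real.le_sqrt_of_sq_le (by nlinarith)
      have h2 : 4 * quarterArea / √D ≤ D := by
        rw [div_le_iff₀ (by linarith)]
        nlinarith [quarterArea_le]
      gcongr
  obtain ⟨B, hB, hBD⟩ := hmink C⁻¹
  have hB0 : (B : Ideal O) ≠ ⊥ := nonZeroDivisors.coe_ne_zero B
  have hm2 : 2 ≤ m := by omega
  obtain ⟨f, g, b, hf, hg, hgb, h⟩ := q.ideal_form (by omega) B hB0
  have hBN := q.absNorm_form hf hg h
  have hgD : (g : ℝ) ≤ D := by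
    have : g ≤ D := by
      have h1 : f ^ 2 * g ≤ D := by rw [← hBN]; exact_mod_cast hBD
      nlinarith [pow_pos hf 2]
    exact_mod_cast this
  have hgR : (0 : ℝ) < g := by exact_mod_cast hg
  have hg1 : (1 : ℝ) ≤ g := by exact_mod_cast hg
  have hR : 0 < √(g * X) := Real.sqrt_pos.2 (by positivity)
  obtain ⟨S, hS, hcard⟩ := lattice_count hgR (δ := √D / 2) (by linarith) hR
    (fun t => (b + 1 / 2) * t)
  have hmR : (D : ℝ) = 4 * m - 1 := by exact_mod_cast congrArg (Int.cast (R := ℝ)) hm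
  have hR2 : √(g * X) ^ 2 = g * X := Real.sq_sqrt (by positivity)
  have hS' : ∀ p : ℤ × ℤ, p ∈ S ↔
      (((g * p.1 + b * p.2) ^ 2 + (g * p.1 + b * p.2) * p.2 + m * p.2 ^ 2 : ℤ) : ℝ) ≤ g * X := by
    intro p
    rw [hS, hR2, div_pow, Real.sq_sqrt (by linarith), hmR]
    push_cast
    ring_nf
  obtain ⟨A, hA, hc⟩ := q.class_finset hm2 C B hB hf hg h X S hS' ((hS' _).2 (by simp; positivity))
  refine ⟨A, hA, ?_⟩
  rw [hc, hR2] at hcard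
  have hY : 1 ≤ √X := by rw [Real.one_le_sqrt]; exact hX1
  have e1 : 4 * quarterArea * (g * X) / (g * (√D / 2)) = 2 * (4 * quarterArea / √D * X) := by
    field_simp
  have e2 : 2 * √(g * X) / g ≤ 2 * √X := by
    rw [Real.sqrt_mul hgR.le, div_le_iff₀ hgR]
    have : √(g : ℝ) ≤ g := by rw [Real.sqrt_le_left (by positivity)]; nlinarith
    nlinarith
  have e3 : 2 * (√(g * X) / (√D / 2)) ≤ 4 * √X := by
    rw [Real.sqrt_mul hgR.le]
    have h1 : √(g : ℝ) ≤ √D := Real.sqrt_le_sqrt hgD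
    have h2 : √(g : ℝ) * √X / (√D / 2) ≤ 2 * √X := by
      rw [div_le_iff₀ (by linarith)]; nlinarith
    linarith
  rw [e1] at hcard
  push_cast at hcard
  have h9 : 7 * √X ≤ D * √X := by gcongr
  rw [abs_le] at hcard ⊢
  constructor <;> linarith [hcard.1, hcard.2]

end Quad

end

section

open nonZeroDivisors IsDedekindDomain

namespace Quad

variable {O : Type} [CommRing O] [IsDedekindDomain O]

/-- The ideal class of a nonzero prime ideal, written additively. -/
noncomputable def primeClass (p : HeightOneSpectrum O) : Additive (ClassGroup O) :=
  Additive.ofMul (ClassGroup.mk0 ⟨p.asIdeal, mem_nonZeroDivisors_iff_ne_zero.2 p.ne_bot⟩)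

/-- The ideal with a given multiset of prime factors. -/
noncomputable def idealOf (a : Multiset (HeightOneSpectrum O)) : Ideal O :=
  (a.map fun p => p.asIdeal).prod

theorem idealOf_ne_zero (a : Multiset (HeightOneSpectrum O)) : idealOf a ≠ 0 := by
  unfold idealOf
  rw [Ne, Multiset.prod_eq_zero_iff]
  intro h
  obtain ⟨p, -, hp⟩ := Multiset.mem_map.1 h
  exact p.ne_bot hp

theorem idealOf_injective : Function.Injective (idealOf (O := O)) := by
  classical
  have key : ∀ a : Multiset (HeightOneSpectrum O),
      UniqueFactorizationMonoid.normalizedFactors (idealOf a) = a.map fun p => p.asIdeal := by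
    intro a
    refine UniqueFactorizationMonoid.normalizedFactors_prod_of_prime fun I hI => ?_
    obtain ⟨p, -, rfl⟩ := Multiset.mem_map.1 hI
    exact p.prime
  intro a b hab
  have h := (key a).symm.trans ((congrArg _ hab).trans (key b))
  exact Multiset.map_injective (fun p q hpq => HeightOneSpectrum.ext hpq) h

theorem exists_idealOf {I : Ideal O} (hI : I ≠ 0) : ∃ a, idealOf a = I := by
  induction I using UniqueFactorizationMonoid.induction_on_prime with
  | h₁ => exact absurd rfl hI
  | h₂ x hx => exact ⟨0, by rw [idealOf]; simp [Ideal.isUnit_iff.1 hx]⟩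
  | h₃ J p hJ hp ih =>
    obtain ⟨a, ha⟩ := ih hJ
    refine ⟨⟨p, Ideal.isPrime_of_prime hp, hp.ne_zero⟩ ::ₘ a, ?_⟩
    rw [← ha]; simp [idealOf]

theorem mk0_idealOf (a : Multiset (HeightOneSpectrum O)) (h0 : idealOf a ∈ (Ideal O)⁰) :
    Additive.ofMul (ClassGroup.mk0 ⟨idealOf a, h0⟩) = (a.map primeClass).sum := by
  induction a using Multiset.induction with
  | empty =>
    have : (⟨idealOf (0 : Multiset (HeightOneSpectrum O)), h0⟩ : (Ideal O)⁰) = 1 := by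
      apply Subtype.ext; simp [idealOf]
    rw [this]; simp
  | cons p a ih =>
    have h1 : idealOf a ∈ (Ideal O)⁰ := mem_nonZeroDivisors_iff_ne_zero.2 (idealOf_ne_zero a)
    have : (⟨idealOf (p ::ₘ a), h0⟩ : (Ideal O)⁰) =
        ⟨p.asIdeal, mem_nonZeroDivisors_iff_ne_zero.2 p.ne_bot⟩ * ⟨idealOf a, h1⟩ := by
      apply Subtype.ext; simp [idealOf]
    rw [this, map_mul, ofMul_mul, ih h1, Multiset.map_cons, Multiset.sum_cons]
    rfl

theorem absNorm_idealOf [Module.Free ℤ O] [Module.Finite ℤ O] (a : Multiset (HeightOneSpectrum O)) :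
    Ideal.absNorm (idealOf a) = (a.map fun p => Ideal.absNorm p.asIdeal).prod := by
  rw [idealOf, map_multiset_prod, Multiset.map_map]; rfl

variable [Module.Free ℤ O] [Module.Finite ℤ O] {m : ℤ}

/-- The system of prime ideals of an imaginary quadratic order of prime discriminant. -/
noncomputable def sys (q : Quad O m) [Fintype (ClassGroup O)] {D : ℕ} [Fact D.Prime] (hD : 7 ≤ D)
    (hD4 : D % 4 = 3) (hm : (D : ℤ) = 4 * m - 1)
    (hmink : ∀ C : ClassGroup O, ∃ B : (Ideal O)⁰,
      ClassGroup.mk0 B = C ∧ Ideal.absNorm (B : Ideal O) ≤ D) :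
    Sys (HeightOneSpectrum O) (Additive (ClassGroup O)) where
  N p := Ideal.absNorm p.asIdeal
  cl := primeClass
  below p := (exists_below p).choose
  prime_below p := (exists_below p).choose_spec.1
  N_eq p := q.absNorm_eq_or p (exists_below p).choose_spec.1 (exists_below p).choose_spec.2
  fib l s hs := by
    rcases s.eq_empty_or_nonempty with rfl | ⟨p, hp⟩
    · simp
    have hl : l.Prime := hs p hp ▸ (exists_below p).choose_spec.1
    obtain ⟨t, ht, hc⟩ := q.splitting hD4 hm hl
    have h1 : t.card ≤ 2 := by rcases hc with h | h | h <;> omega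
    refine (Finset.card_le_card fun r hr => ?_).trans h1
    rw [ht, ← hs r hr]
    exact (exists_below r).choose_spec.2
  c := 4 * quarterArea / √D
  Q := D
  two_le_Q := by
    have : (7 : ℝ) ≤ D := by exact_mod_cast hD
    linarith
  inv_le_c := by
    have h7 : (7 : ℝ) ≤ D := by exact_mod_cast hD
    have h1 : √(D : ℝ) ≤ D := Real.sqrt_le_iff.2 ⟨by linarith, by nlinarith⟩
    have h0 : 0 < √(D : ℝ) := Real.sqrt_pos.2 (by linarith)
    have := le_quarterArea
    rw [inv_eq_one_div]
    apply div_le_div₀ <;> linarith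
  count g X hX := by
    obtain ⟨A, hA, hc⟩ := q.class_count hD hm hmink g.toMul hX
    convert hc using 4
    rw [← Nat.card_eq_finsetCard]
    refine Nat.card_congr (Equiv.ofBijective (fun a => ⟨idealOf a.1, (hA _).2 ⟨⟨?_, ?_⟩, ?_⟩⟩) ⟨?_, ?_⟩)
    · exact mem_nonZeroDivisors_iff_ne_zero.2 (idealOf_ne_zero _)
    · have h := a.2.2
      rw [← mk0_idealOf _ (mem_nonZeroDivisors_iff_ne_zero.2 (idealOf_ne_zero _))] at h
      exact Additive.ofMul.injective h
    · rw [absNorm_idealOf]; exact a.2.1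
    · intro a b hab
      exact Subtype.ext (idealOf_injective (Subtype.ext_iff.1 hab))
    · rintro ⟨I, hI⟩
      obtain ⟨⟨h0, hC⟩, hN⟩ := (hA I).1 hI
      obtain ⟨a, rfl⟩ := exists_idealOf (mem_nonZeroDivisors_iff_ne_zero.1 h0)
      refine ⟨⟨a, ?_, ?_⟩, rfl⟩
      · rw [absNorm_idealOf] at hN; exact hN
      · rw [← mk0_idealOf a h0, hC]; rfl

theorem sys_splits (q : Quad O m) [Fintype (ClassGroup O)] {D : ℕ} [Fact D.Prime] (hD : 7 ≤ D)
    (hD4 : D % 4 = 3) (hm : (D : ℤ) = 4 * m - 1)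
    (hmink : ∀ C : ClassGroup O, ∃ B : (Ideal O)⁰,
      ClassGroup.mk0 B = C ∧ Ideal.absNorm (B : Ideal O) ≤ D) :
    (q.sys hD hD4 hm hmink).Splits
      ((quadraticChar (ZMod D)).ringHomComp (Int.castRingHom ℂ) : DirichletCharacter ℂ D) := by
  intro l hl
  obtain ⟨s, hs, hc⟩ := q.splitting hD4 hm hl
  refine ⟨s, fun p => ?_, ?_⟩
  · rw [hs]
    constructor
    · intro h
      exact below_unique p (exists_below p).choose_spec.1 hl (exists_below p).choose_spec.2 h
    · rintro rfl
      exact (exists_below p).choose_spec.2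
  · simp only [MulChar.ringHomComp_apply]
    rcases hc with ⟨h, hc⟩ | ⟨h, hc⟩ | ⟨h, hc⟩
    · left; exact ⟨by rw [h]; simp, hc⟩
    · right; left; exact ⟨by rw [h]; simp, hc⟩
    · right; right; exact ⟨by rw [h]; simp, hc⟩

open NumberField in
theorem minkowski (K : Type) [Field K] [NumberField K] (hK : Module.finrank ℚ K = 2)
    (q : Quad (NumberField.RingOfIntegers K) m) {D : ℕ} (hD : 7 ≤ D) (hm : (D : ℤ) = 4 * m - 1)
    (C : ClassGroup (NumberField.RingOfIntegers K)) :
    ∃ B : (Ideal (NumberField.RingOfIntegers K))⁰,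
      ClassGroup.mk0 B = C ∧ Ideal.absNorm (B : Ideal (NumberField.RingOfIntegers K)) ≤ D := by
  obtain ⟨B, hB, hN⟩ := NumberField.exists_ideal_in_class_of_norm_le C
  refine ⟨B, hB, ?_⟩
  have hd : NumberField.discr K = -(D : ℤ) := by
    rw [← NumberField.discr_eq_discr K q.basis, q.discr_eq]; omega
  have hr : NumberField.InfinitePlace.nrComplexPlaces K ≤ 1 := by
    have := NumberField.InfinitePlace.card_add_two_mul_card_eq_rank K
    omega
  rw [hK, hd] at hN
  have h7 : (7 : ℝ) ≤ D := by exact_mod_cast hD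
  have h1 : √(D : ℝ) ≤ D := Real.sqrt_le_iff.2 ⟨by linarith, by nlinarith⟩
  have h2 : (4 / Real.pi) ^ NumberField.InfinitePlace.nrComplexPlaces K ≤ 2 := by
    have h3 : 4 / Real.pi ≤ 2 := by
      rw [div_le_iff₀ Real.pi_pos]; linarith [Real.pi_gt_three]
    have h4 : 0 < 4 / Real.pi := by positivity
    interval_cases h : NumberField.InfinitePlace.nrComplexPlaces K <;> simp <;> linarith
  have h5 : |((-(D : ℤ) : ℤ) : ℝ)| = D := by
    push_cast; rw [abs_neg, abs_of_nonneg (by linarith)]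
  rw [h5] at hN
  have h6 : (Ideal.absNorm (B : Ideal (NumberField.RingOfIntegers K)) : ℝ) ≤ D := by
    refine hN.trans ?_
    norm_num [Nat.factorial]
    calc _ ≤ 2 * (1 / 2 * √(D : ℝ)) := by gcongr
      _ ≤ D := by linarith
  exact_mod_cast h6

end Quad

end

theorem card_le_lambdaC {K : Type} [Field K] [NumberField K] (C : ClassGroup (𝓞 K)) (n : ℕ)
    (s : Finset (IsDedekindDomain.HeightOneSpectrum (𝓞 K)))
    (hs : ∀ p ∈ s, Ideal.absNorm p.asIdeal = n ∧ Quad.primeClass p = Additive.ofMul C) :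
    s.card ≤ lambdaC K C n := by
  rw [lambdaC, ← Nat.card_eq_finsetCard]
  have hmem : ∀ p : s, Ideal.absNorm p.1.asIdeal = n ∧ p.1.asIdeal ≠ 0 ∧
      idealClass K p.1.asIdeal = C := by
    intro p
    obtain ⟨h1, h2⟩ := hs p.1 p.2
    refine ⟨h1, p.1.ne_bot, ?_⟩
    rw [idealClass, dif_pos (mem_nonZeroDivisors_iff_ne_zero.2 p.1.ne_bot)]
    exact Additive.ofMul.injective h2
  rcases s.eq_empty_or_nonempty with rfl | ⟨p₀, hp₀⟩
  · simp
  have hn : 0 < n := by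
    rw [← (hs p₀ hp₀).1]
    exact Nat.pos_of_ne_zero fun h => p₀.ne_bot (Ideal.absNorm_eq_zero_iff.1 h)
  have : Finite {I : Ideal (𝓞 K) // Ideal.absNorm I = n ∧ I ≠ 0 ∧ idealClass K I = C} := by
    refine Set.Finite.subset (Ideal.finite_setOfPred_absNorm_eq n) fun I hI => ?_
    exact hI.1
  refine Nat.card_le_card_of_injective (fun p : s => ⟨p.1.asIdeal, hmem p⟩) fun a b hab => ?_
  exact Subtype.ext (IsDedekindDomain.HeightOneSpectrum.ext (Subtype.ext_iff.1 hab))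

theorem chiD_ne_one {D : ℕ} [Fact D.Prime] (hD : D ≠ 2) : chiD D ≠ 1 := by
  intro h
  obtain ⟨a, ha⟩ := quadraticChar_exists_neg_one (F := ZMod D) (by rwa [ZMod.ringChar_zmod_n])
  have hu : IsUnit a := by
    rw [isUnit_iff_ne_zero]
    rintro rfl
    simp at ha
  have h1 : chiD D a = 1 := by rw [h, MulChar.one_apply hu]
  rw [chiD, MulChar.ringHomComp_apply, ha] at h1
  norm_num at h1

/-- A bounded-below weighted sum over primes from the corresponding finite window. -/
theorem sum_le_tsum_weighted {f : ℝ → ℝ} (hf0 : ∀ u, 0 ≤ f u)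
    (hsupp : Function.support f ⊆ Set.Icc (1 - 3 / 4) 1) (a : ℕ → ℝ) (ha : ∀ n, 0 ≤ a n)
    {x : ℝ} (hx : 1 < x) (s : Finset ℕ)
    (hs : ∀ n ∈ s, n.Prime ∧ 1 ≤ f (Real.log n / Real.log x)) :
    ∑ n ∈ s, a n / n ≤ ∑' p : ℕ, if p.Prime then a p / p * f (Real.log p / Real.log x) else 0 := by
  have hlx := Real.log_pos hx
  have hnn : ∀ p : ℕ, 0 ≤ if p.Prime then a p / p * f (Real.log p / Real.log x) else 0 := by
    intro p
    split_ifs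
    · exact mul_nonneg (div_nonneg (ha p) p.cast_nonneg) (hf0 _)
    · exact le_rfl
  have hsum : Summable fun p : ℕ =>
      if p.Prime then a p / p * f (Real.log p / Real.log x) else 0 := by
    refine summable_of_ne_finset_zero (s := Finset.range (⌊x⌋₊ + 1)) fun p hp => ?_
    split_ifs with hpp
    · rw [Finset.mem_range, not_lt, Nat.succ_le_iff, Nat.floor_lt (by linarith)] at hp
      have : f (Real.log p / Real.log x) = 0 := by
        by_contra hne
        have h := (hsupp hne).2
        rw [div_le_one hlx] at h
        have := Real.log_lt_log (by linarith) hp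
        linarith
      rw [this, mul_zero]
    · rfl
  refine le_trans (Finset.sum_le_sum fun n hn => ?_) (hsum.sum_le_tsum s fun n _ => hnn n)
  rw [if_pos (hs n hn).1]
  exact le_mul_of_one_le_right (div_nonneg (ha n) n.cast_nonneg) (hs n hn).2

theorem nonexceptional_case_lower_bound :
    ∃ c ν L : ℝ, 0 < c ∧ 0 < ν ∧ ν < 1 ∧ 0 < L ∧
    ∀ f : ℝ → ℝ, ContDiff ℝ (⊤ : ℕ∞) f → (∀ u, 0 ≤ f u) →
      Function.support f ⊆ Set.Icc (1 - ν) 1 →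
      (∀ u ∈ Set.Icc (1 - 2 * ν / 3) (1 - ν / 3), 1 ≤ f u) →
    ∃ κ : ℝ, 0 < κ ∧
    ∀ (D : ℕ) [Fact (Nat.Prime D)], 3 < D → D % 4 = 3 →
    ∀ (K : Type) [Field K] [NumberField K], Module.finrank ℚ K = 2 →
      (∃ α : K, α ^ 2 = -(D : K)) →
    ∀ 𝒞 : ClassGroup (𝓞 K), ∀ x : ℝ, (D : ℝ) ^ L ≤ x → HypH c D →
    κ * ν / (NumberField.classNumber K) ≤
      ∑' p : ℕ, if p.Prime then (lambdaC K 𝒞 p : ℝ) / p * f (Real.log p / Real.log x)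
        else 0 := by
  obtain ⟨c₁, hc₁, L₀, hL₀, hA⟩ := Sys.A_lower
  obtain ⟨k, hk, hmain⟩ := Sys.window_lower_bound
  obtain ⟨B, hB, hmain⟩ := hmain c₁ hc₁
  have hkR : (1 : ℝ) ≤ k := by exact_mod_cast hk
  refine ⟨1, 3 / 4, 6 * k * B * L₀, one_pos, by norm_num, by norm_num, by positivity, ?_⟩
  intro f _ hf0 hsupp hf1
  refine ⟨1 / 15, by norm_num, ?_⟩
  intro D _ hD3 hD4 K _ _ hK hα 𝒞 x hx hH
  obtain ⟨α, hα⟩ := hα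
  have hDp : D.Prime := Fact.out
  have hD7 : 7 ≤ D := by omega
  obtain ⟨m, hm⟩ : ∃ m : ℤ, (D : ℤ) = 4 * m - 1 := ⟨(D + 1) / 4, by omega⟩
  obtain ⟨q⟩ := exists_quad K hK hDp hm hα
  let S := q.sys hD7 hD4 hm (Quad.minkowski K hK q hD7 hm)
  have hSQ : S.Q = D := rfl
  have hDR : (7 : ℝ) ≤ D := by exact_mod_cast hD7
  have hlD : 1 ≤ Real.log D := by
    rw [Real.le_log_iff_exp_le (by linarith)]
    linarith [Real.exp_one_lt_d9]
  have hL1 : L₀ ≤ L₀ * Real.log D := le_mul_of_one_le_right (by linarith) hlD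
  have hL2 : 128 * Real.log D ≤ L₀ * Real.log D := by gcongr; linarith
  have hL3 : Real.log D < L₀ * Real.log D := by linarith
  have hzero : ∀ β : ℝ, 1 - 1 / (L₀ * Real.log D) ≤ β → β < 1 → (chiD D).LFunction β ≠ 0 := by
    intro β h1 _ h0
    have h2 := hH β h0 (by simp)
    rw [Complex.ofReal_re] at h2
    have h3 : 1 / (L₀ * Real.log D) < 1 / Real.log D :=
      one_div_lt_one_div_of_lt (by linarith) hL3
    linarith
  have hSA : c₁ ≤ S.A (L₀ * Real.log D) :=
    hA _ _ S D (chiD D) _ hDp (chiD_ne_one (by omega)) (q.sys_splits hD7 hD4 hm _) hL1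
      (by rw [hSQ]; exact hL2) hL3.le hzero
  have hx0 : 0 < (D : ℝ) ^ (6 * k * B * L₀) := Real.rpow_pos_of_pos (by linarith) _
  have hlx : 6 * k * B * L₀ * Real.log D ≤ Real.log x := by
    rw [← Real.log_rpow (by linarith)]
    exact Real.log_le_log hx0 hx
  have hl : B * (L₀ * Real.log D) ≤ Real.log x / (6 * k) := by
    rw [le_div_iff₀ (by positivity)]; linarith
  have hlx0 : 0 < Real.log x := lt_of_lt_of_le (by positivity) hlx
  have hx1 : 1 < x := (Real.log_pos_iff (hx0.le.trans hx)).1 hlx0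
  have hψ : ∀ χ : AddChar (Additive (ClassGroup (𝓞 K))) ℂ, χ ≠ 0 → χ + χ ≠ 0 := by
    intro χ hχ
    refine q.addChar_add_self_ne_zero (by omega) ?_ χ hχ
    rw [← hm]
    exact Nat.prime_iff_prime_int.1 hDp
  have key := hmain _ _ S hψ (L₀ * Real.log D) (Real.log x / (6 * k)) (by linarith)
    (by rw [hSQ]; exact hL2) hl hSA (Additive.ofMul 𝒞)
  have hcard : (NumberField.classNumber K : ℝ) =
      Fintype.card (Additive (ClassGroup (𝓞 K))) := by
    rw [NumberField.classNumber, Fintype.card_congr (Additive.ofMul (α := ClassGroup (𝓞 K)))]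
  rw [hcard]
  have hc0 : (0 : ℝ) < Fintype.card (Additive (ClassGroup (𝓞 K))) := by
    exact_mod_cast Fintype.card_pos
  have e : (1 / 15 * (3 / 4) / Fintype.card (Additive (ClassGroup (𝓞 K))) : ℝ) =
      1 / 20 / Fintype.card (Additive (ClassGroup (𝓞 K))) := by norm_num
  rw [e]
  refine key.trans ?_
  refine le_trans (Finset.sum_le_sum fun n _ => ?_) (sum_le_tsum_weighted hf0 hsupp
    (fun n => (lambdaC K 𝒞 n : ℝ)) (fun n => Nat.cast_nonneg _) hx1
    (Sys.window k (Real.log x / (6 * k))) fun n hn => ?_)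
  · gcongr
    refine card_le_lambdaC 𝒞 n _ fun p hp => ?_
    exact (Finset.mem_filter.1 hp).2
  · rw [Sys.window, Finset.mem_filter] at hn
    obtain ⟨-, hp, h1, h2⟩ := hn
    have hk0 : (k : ℝ) ≠ 0 := by positivity
    have e1 : 3 * k * (Real.log x / (6 * k)) = 1 / 2 * Real.log x := by field_simp; norm_num
    have e2 : 9 / 2 * k * (Real.log x / (6 * k)) = 3 / 4 * Real.log x := by field_simp; norm_num
    rw [e1] at h1
    rw [e2] at h2
    refine ⟨hp, hf1 _ ⟨?_, ?_⟩⟩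
    · rw [le_div_iff₀ hlx0]; linarith
    · rw [div_le_iff₀ hlx0]; linarith
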